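/- For every ε > 0 there exists a constant C > 0 (depending only on ε) with the following property: for every integer N ≥ 1 and every real (quadratic) primitive Dirichlet character χ of conductor N, there exists a real primitive Dirichlet character χ' of some conductor q with q ≤ C · N^{1/2+ε} such that L(1/2, χ·χ') ≠ 0. (This is the self-dual instance of the GL(1) case of Theorem 1; here the root-number hypothesis of Theorem 1 is automatically satisfied, since every real primitive Dirichlet character has root number +1.) -/

import Mathlib

section
open DirichletCharacter

/-- The central value `L(1/2, χ·χ')` of the product Dirichlet character `χ·χ'` modulo `N*q`
(junk value `0` in the degenerate case `N*q = 0`). -/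
noncomputable def twistedCentralValue {N q : ℕ} (χ : DirichletCharacter ℂ N)
    (χ' : DirichletCharacter ℂ q) : ℂ :=
  if h : N * q ≠ 0 then
    haveI : NeZero (N * q) := ⟨h⟩
    DirichletCharacter.LFunction
      ((changeLevel (dvd_mul_right N q) χ) * (changeLevel (dvd_mul_left q N) χ')) (1 / 2)
  else 0

end

namespace QT

open Complex Finset

/-! ### Additive characters and complete residue systems -/

noncomputable def ee (x : ℝ) : ℂ := Complex.exp (2 * Real.pi * Complex.I * x)

lemma ee_add (x y : ℝ) : ee (x + y) = ee x * ee y := by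
  unfold ee; rw [← Complex.exp_add]; congr 1; push_cast; ring

lemma ee_int (k : ℤ) : ee k = 1 := by
  unfold ee
  rw [show (2 * Real.pi * Complex.I * ((k : ℝ) : ℂ)) = k * (2 * Real.pi * Complex.I) by push_cast; ring]
  exact Complex.exp_int_mul_two_pi_mul_I k

lemma ee_zero : ee 0 = 1 := by simpa using ee_int 0

lemma norm_ee (x : ℝ) : ‖ee x‖ = 1 := by
  unfold ee
  rw [show (2 * Real.pi * Complex.I * (x : ℂ)) = ((2 * Real.pi * x : ℝ) : ℂ) * Complex.I by push_cast; ring]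
  exact Complex.norm_exp_ofReal_mul_I _

lemma ee_add_int (x : ℝ) (k : ℤ) : ee (x + k) = ee x := by
  rw [ee_add, ee_int, mul_one]

lemma ee_eq_of_sub {x y : ℝ} (k : ℤ) (h : x = y + k) : ee x = ee y := by
  rw [h, ee_add_int]

lemma ee_period (k : ℤ) (n : ℕ) (hn : 0 < n) (x y : ℤ) (h : (n : ℤ) ∣ x - y) :
    ee (k * x / n) = ee (k * y / n) := by
  obtain ⟨c, hc⟩ := h
  apply ee_eq_of_sub (k * c)
  have : (x : ℝ) = y + n * c := by exact_mod_cast (by linarith : x = y + n * c)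
  rw [this]; push_cast
  field_simp

lemma ee_nat_mul (x : ℝ) (n : ℕ) : ee (n * x) = ee x ^ n := by
  unfold ee; rw [← Complex.exp_nat_mul]; congr 1; push_cast; ring

lemma ee_eq_one_iff (x : ℝ) : ee x = 1 ↔ ∃ k : ℤ, x = k := by
  constructor
  · intro h
    unfold ee at h
    rw [Complex.exp_eq_one_iff] at h
    obtain ⟨k, hk⟩ := h
    refine ⟨k, ?_⟩
    have h2 : (2 * Real.pi * Complex.I : ℂ) ≠ 0 := Complex.two_pi_I_ne_zero
    have : (2 * Real.pi * Complex.I) * ((x : ℂ) - k) = 0 := by linear_combination hk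
    rcases mul_eq_zero.mp this with h | h
    · exact absurd h h2
    · have : (x : ℂ) = ((k : ℝ) : ℂ) := by push_cast; linear_combination h
      exact_mod_cast this
  · rintro ⟨k, rfl⟩; exact ee_int k

lemma sum_ee (n : ℕ) (hn : 0 < n) (k : ℤ) :
    ∑ x ∈ range n, ee (k * x / n) = if (n : ℤ) ∣ k then (n : ℂ) else 0 := by
  have hn' : (n : ℝ) ≠ 0 := by positivity
  have e1 : ∀ x ∈ range n, ee (k * x / n) = ee (k / n) ^ x := by
    intro x _
    rw [← ee_nat_mul]; congr 1; ring
  rw [sum_congr rfl e1]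
  split_ifs with h
  · obtain ⟨c, rfl⟩ := h
    have : ee (((n * c : ℤ) : ℝ) / n) = 1 := by
      rw [ee_eq_one_iff]; refine ⟨c, ?_⟩; push_cast; field_simp
    rw [this]; simp
  · have hne : ee ((k : ℝ) / n) ≠ 1 := by
      intro h1
      rw [ee_eq_one_iff] at h1
      obtain ⟨c, hc⟩ := h1
      apply h
      refine ⟨c, ?_⟩
      rw [div_eq_iff hn'] at hc
      have : (k : ℝ) = ((n * c : ℤ) : ℝ) := by push_cast; linarith
      exact_mod_cast this
    rw [geom_sum_eq hne, ← ee_nat_mul]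
    have : ee (n * (k / n)) = 1 := by
      rw [ee_eq_one_iff]; exact ⟨k, by field_simp⟩
    rw [this]; simp

/-- sums of periodic functions over complete residue systems -/
lemma sum_complete {M : Type*} [AddCommMonoid M] {ι : Type*} (n : ℕ) (hn : 0 < n) (F : ℤ → M)
    (hF : ∀ x y : ℤ, (n : ℤ) ∣ x - y → F x = F y)
    (S : Finset ι) (s : ι → ℤ) (hS : S.card = n)
    (hs : ∀ i ∈ S, ∀ j ∈ S, (n : ℤ) ∣ s i - s j → i = j) :
    ∑ i ∈ S, F (s i) = ∑ x ∈ range n, F x := by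
  have hn0 : (n : ℤ) ≠ 0 := by positivity
  have key : ∀ i, (((s i % n).toNat : ℕ) : ℤ) = s i % n := fun i =>
    Int.toNat_of_nonneg (Int.emod_nonneg _ hn0)
  have hmem : ∀ i ∈ S, (s i % n).toNat ∈ range n := by
    intro i _
    rw [mem_range]
    have := Int.emod_lt_of_pos (s i) (by exact_mod_cast hn : (0 : ℤ) < n)
    have := key i
    omega
  have hinj : ∀ i ∈ S, ∀ j ∈ S, (s i % n).toNat = (s j % n).toNat → i = j := by
    intro i hi j hj h
    apply hs i hi j hj
    have : s i % n = s j % n := by rw [← key i, ← key j, h]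
    exact Int.ModEq.dvd this.symm
  refine sum_bij (fun i _ => (s i % n).toNat) hmem (fun i hi j hj h => hinj i hi j hj h) ?_ ?_
  · intro b hb
    have := surj_on_of_inj_on_of_card_le (s := S) (t := range n) (fun i _ => (s i % n).toNat)
      hmem (fun i j hi hj h => hinj i hi j hj h) (by simp [hS]) b hb
    obtain ⟨a, ha, h⟩ := this
    exact ⟨a, ha, h.symm⟩
  · intro i hi
    apply hF
    rw [key i]
    exact Int.dvd_self_sub_emod

lemma sum_crt {M : Type*} [AddCommMonoid M] (m n : ℕ) (hm : 0 < m) (hn : 0 < n)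
    (hc : Nat.Coprime m n) (F : ℤ → M)
    (hF : ∀ x y : ℤ, ((m * n : ℕ) : ℤ) ∣ x - y → F x = F y) :
    ∑ x ∈ range (m * n), F x = ∑ i ∈ range m, ∑ j ∈ range n, F (i * n + j * m) := by
  rw [← sum_product' (range m) (range n) (fun i j => F ((i : ℤ) * n + j * m))]
  symm
  refine sum_complete (m * n) (by positivity) F hF (range m ×ˢ range n)
    (fun p => (p.1 : ℤ) * n + p.2 * m) (by simp) ?_
  rintro ⟨i, j⟩ hij ⟨i', j'⟩ hij' h
  simp only [mem_product, mem_range] at hij hij'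
  have hcz : IsCoprime (m : ℤ) (n : ℤ) := Nat.isCoprime_iff_coprime.mpr hc
  have h1 : (m : ℤ) ∣ (i : ℤ) - i' := by
    have h2 : (m : ℤ) ∣ ((i : ℤ) * n + j * m) - (i' * n + j' * m) := dvd_trans (by push_cast; exact dvd_mul_right _ _) h
    have h3 : (m : ℤ) ∣ ((i : ℤ) - i') * n := by
      obtain ⟨c, hc⟩ := h2
      exact ⟨c - (j - j'), by linear_combination hc⟩
    exact hcz.dvd_of_dvd_mul_right h3
  have h2 : (n : ℤ) ∣ (j : ℤ) - j' := by
    have h2 : (n : ℤ) ∣ ((i : ℤ) * n + j * m) - (i' * n + j' * m) := dvd_trans (by push_cast; exact dvd_mul_left _ _) h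
    have h3 : (n : ℤ) ∣ ((j : ℤ) - j') * m := by
      obtain ⟨c, hc⟩ := h2
      exact ⟨c - (i - i'), by linear_combination hc⟩
    exact hcz.symm.dvd_of_dvd_mul_right h3
  have e1 : i = i' := by
    have := Int.eq_zero_of_abs_lt_dvd h1 (by rw [abs_lt]; constructor <;> omega)
    omega
  have e2 : j = j' := by
    have := Int.eq_zero_of_abs_lt_dvd h2 (by rw [abs_lt]; constructor <;> omega)
    omega
  rw [e1, e2]

/-- `x = y + q z`, `y mod q`, `z mod r`. -/
lemma sum_split {M : Type*} [AddCommMonoid M] (q r : ℕ) (hq : 0 < q) (hr : 0 < r) (F : ℤ → M)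
    (hF : ∀ x y : ℤ, ((q * r : ℕ) : ℤ) ∣ x - y → F x = F y) :
    ∑ x ∈ range (q * r), F x = ∑ y ∈ range q, ∑ z ∈ range r, F (y + q * z) := by
  rw [← sum_product' (range q) (range r) (fun i j => F ((i : ℤ) + q * j))]
  symm
  refine sum_complete (q * r) (by positivity) F hF (range q ×ˢ range r)
    (fun p => (p.1 : ℤ) + q * p.2) (by simp) ?_
  rintro ⟨i, j⟩ hij ⟨i', j'⟩ hij' h
  simp only [mem_product, mem_range] at hij hij'
  have h1 : (q : ℤ) ∣ (i : ℤ) - i' := by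
    have h2 : (q : ℤ) ∣ ((i : ℤ) + q * j) - (i' + q * j') := dvd_trans (by push_cast; exact dvd_mul_right _ _) h
    obtain ⟨c, hc⟩ := h2
    exact ⟨c - (j - j'), by linear_combination hc⟩
  have e1 : i = i' := by
    have := Int.eq_zero_of_abs_lt_dvd h1 (by rw [abs_lt]; constructor <;> omega)
    omega
  subst e1
  have h2 : (r : ℤ) ∣ (j : ℤ) - j' := by
    have : ((q : ℤ) * r) ∣ q * ((j : ℤ) - j') := by
      obtain ⟨c, hc⟩ := h
      push_cast at hc
      exact ⟨c, by linear_combination hc⟩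
    exact Int.dvd_of_mul_dvd_mul_left (by positivity) this
  have e2 : j = j' := by
    have := Int.eq_zero_of_abs_lt_dvd h2 (by rw [abs_lt]; constructor <;> omega)
    omega
  rw [e2]

lemma sum_unit {M : Type*} [AddCommMonoid M] (n : ℕ) (hn : 0 < n) (u v : ℤ) (hu : IsCoprime u (n : ℤ)) (F : ℤ → M)
    (hF : ∀ x y : ℤ, (n : ℤ) ∣ x - y → F x = F y) :
    ∑ x ∈ range n, F (u * x + v) = ∑ x ∈ range n, F x := by
  refine sum_complete n hn F hF (range n) (fun x => u * (x : ℤ) + v) (by simp) ?_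
  intro i hi j hj h
  rw [mem_range] at hi hj
  have h1 : (n : ℤ) ∣ (i : ℤ) - j := by
    have : (n : ℤ) ∣ u * ((i : ℤ) - j) := by convert h using 1; ring
    exact hu.symm.dvd_of_dvd_mul_left this
  have := Int.eq_zero_of_abs_lt_dvd h1 (by rw [abs_lt]; constructor <;> omega)
  omega

end QT

namespace QT

open Finset NumberTheorySymbols

/-! ### The arithmetic function `b(x,n)` -/

def sqd (n : ℕ) : Finset ℕ := (range (n + 1)).filter (fun g => g ^ 2 ∣ n)

lemma mem_sqd {n : ℕ} (hn : 0 < n) {g : ℕ} : g ∈ sqd n ↔ g ^ 2 ∣ n := by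
  simp only [sqd, mem_filter, mem_range, and_iff_right_iff_imp]
  intro h
  have := Nat.le_of_dvd hn h
  nlinarith

lemma sqd_pos {n : ℕ} (hn : 0 < n) {g : ℕ} (hg : g ∈ sqd n) : 0 < g := by
  rw [mem_sqd hn] at hg
  rcases Nat.eq_zero_or_pos g with rfl | h
  · simp at hg; omega
  · exact h

def bb (x : ℤ) (n : ℕ) : ℤ :=
  ∑ g ∈ sqd n, if ((g : ℤ) ^ 2 ∣ x) then (g : ℤ) * J(x / (g : ℤ) ^ 2 | n / g ^ 2) else 0

lemma bb_one (x : ℤ) : bb x 1 = 1 := by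
  have : sqd 1 = {1} := by decide
  simp [bb, this]

lemma bb_period {n : ℕ} (hn : 0 < n) {x y : ℤ} (h : (n : ℤ) ∣ x - y) : bb x n = bb y n := by
  unfold bb
  apply sum_congr rfl
  intro g hg
  have hg0 := sqd_pos hn hg
  rw [mem_sqd hn] at hg
  obtain ⟨m, hm⟩ := hg
  have hgz : (g : ℤ) ^ 2 ≠ 0 := by positivity
  obtain ⟨c, hc⟩ := h
  have hx : x = y + (g : ℤ) ^ 2 * (m * c) := by
    have : (n : ℤ) = (g : ℤ) ^ 2 * m := by exact_mod_cast hm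
    rw [this] at hc; linarith
  have h1 : ((g : ℤ) ^ 2 ∣ x) ↔ ((g : ℤ) ^ 2 ∣ y) := by
    rw [hx]; exact (Int.dvd_add_left (dvd_mul_right _ _))
  by_cases h2 : (g : ℤ) ^ 2 ∣ y
  · rw [if_pos h2, if_pos (h1.mpr h2)]
    congr 1
    obtain ⟨z, rfl⟩ := h2
    have e1 : x / (g : ℤ) ^ 2 = z + m * c := by
      rw [hx, ← mul_add, Int.mul_ediv_cancel_left _ hgz]
    have e2 : n / g ^ 2 = m := by
      rw [hm, Nat.mul_div_cancel_left _ (by positivity)]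
    rw [e1, e2, Int.mul_ediv_cancel_left _ hgz]
    apply jacobiSym.mod_left'
    simp
  · rw [if_neg h2, if_neg (fun h => h2 (h1.mp h))]

lemma jac_sq_mul {a : ℤ} {g m : ℕ} (hg : 0 < g) (hm : 0 < m) (h : a.gcd (g ^ 2 * m : ℕ) = 1) :
    J(a | g ^ 2 * m) = J(a | m) := by
  rw [jacobiSym.mul_right' _ (by positivity) (by positivity), jacobiSym.pow_right,
    jacobiSym.sq_one, one_mul]
  have hc : IsCoprime a ((g ^ 2 * m : ℕ) : ℤ) := Int.isCoprime_iff_gcd_eq_one.mpr h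
  rw [← Int.isCoprime_iff_gcd_eq_one]
  push_cast at hc
  have := hc.of_mul_right_left
  exact (IsCoprime.pow_right_iff (by norm_num : 0 < 2)).mp this

lemma bb_unit {n : ℕ} (hn : 0 < n) (u x : ℤ) (hu : IsCoprime u (n : ℤ)) :
    bb (u * x) n = J(u | n) * bb x n := by
  unfold bb
  rw [mul_sum]
  apply sum_congr rfl
  intro g hg
  have hg0 := sqd_pos hn hg
  rw [mem_sqd hn] at hg
  obtain ⟨m, hm⟩ := hg
  have hm0 : 0 < m := by
    rcases Nat.eq_zero_or_pos m with rfl | h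
    · simp at hm; omega
    · exact h
  have hgz : (g : ℤ) ^ 2 ≠ 0 := by positivity
  have hcg : IsCoprime ((g : ℤ) ^ 2) u := by
    have : (n : ℤ) = (g : ℤ) ^ 2 * m := by exact_mod_cast hm
    rw [this] at hu
    exact hu.of_mul_right_left.symm
  have h1 : ((g : ℤ) ^ 2 ∣ u * x) ↔ ((g : ℤ) ^ 2 ∣ x) :=
    ⟨fun h => hcg.dvd_of_dvd_mul_left h, fun h => h.mul_left _⟩
  by_cases h2 : (g : ℤ) ^ 2 ∣ x
  · rw [if_pos h2, if_pos (h1.mpr h2)]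
    obtain ⟨z, rfl⟩ := h2
    have e2 : n / g ^ 2 = m := by
      rw [hm, Nat.mul_div_cancel_left _ (by positivity)]
    rw [e2, Int.mul_ediv_cancel_left _ hgz, show u * ((g : ℤ) ^ 2 * z) = (g : ℤ) ^ 2 * (u * z) by ring,
      Int.mul_ediv_cancel_left _ hgz, jacobiSym.mul_left]
    have : J(u | n) = J(u | m) := by
      rw [hm]; apply jac_sq_mul hg0 hm0
      rw [← hm]; exact Int.isCoprime_iff_gcd_eq_one.mp hu
    rw [this]; ring
  · rw [if_neg h2, if_neg (fun h => h2 (h1.mp h))]; simp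

lemma odd_sq_mod8 {g : ℕ} (hg : Odd g) : g ^ 2 % 8 = 1 := by
  have h1 : g % 8 = 1 ∨ g % 8 = 3 ∨ g % 8 = 5 ∨ g % 8 = 7 := by
    have := Nat.odd_iff.mp hg; omega
  rw [Nat.pow_mod]
  rcases h1 with h | h | h | h <;> rw [h]

lemma sq_mul_mod8 {g m : ℕ} (hg : Odd g) : (g ^ 2 * m) % 8 = m % 8 := by
  rw [Nat.mul_mod, odd_sq_mod8 hg, one_mul, Nat.mod_mod]

lemma odd_of_sq_dvd {g n : ℕ} (hn : Odd n) (h : g ^ 2 ∣ n) : Odd g := by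
  have : Odd (g ^ 2) := Odd.of_dvd_nat hn h
  exact (Nat.odd_pow_iff (by norm_num)).mp this

/-- quadratic reciprocity for `bb` -/
lemma bb_recip {Q n : ℕ} (hQ : Odd Q) (hn : Odd n) :
    bb Q n = (-1) ^ (Q / 2 * (n / 2)) * bb n Q := by
  have hQ0 : 0 < Q := hQ.pos
  have hn0 : 0 < n := hn.pos
  unfold bb
  rw [mul_sum, ← sum_filter, ]
  have hr : ∑ g ∈ sqd Q, (-1 : ℤ) ^ (Q / 2 * (n / 2)) *
      (if ((g : ℤ) ^ 2 ∣ (n : ℤ)) then (g : ℤ) * J((n : ℤ) / (g : ℤ) ^ 2 | Q / g ^ 2) else 0) =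
      ∑ g ∈ (sqd Q).filter (fun g : ℕ => (g : ℤ) ^ 2 ∣ (n : ℤ)), (-1 : ℤ) ^ (Q / 2 * (n / 2)) *
        ((g : ℤ) * J((n : ℤ) / (g : ℤ) ^ 2 | Q / g ^ 2)) := by
    rw [sum_filter]; apply sum_congr rfl; intro g _; split_ifs <;> simp
  rw [hr]
  have hset : (sqd n).filter (fun g : ℕ => (g : ℤ) ^ 2 ∣ (Q : ℤ)) =
      (sqd Q).filter (fun g : ℕ => (g : ℤ) ^ 2 ∣ (n : ℤ)) := by
    ext g
    simp only [mem_filter, mem_sqd hn0, mem_sqd hQ0]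
    norm_cast
    tauto
  rw [hset]
  apply sum_congr rfl
  intro g hg
  simp only [mem_filter, mem_sqd hQ0] at hg
  obtain ⟨h1, h2⟩ := hg
  have h2 : g ^ 2 ∣ n := by exact_mod_cast h2
  have hgo : Odd g := odd_of_sq_dvd hn h2
  obtain ⟨q, rfl⟩ := h1
  obtain ⟨m, rfl⟩ := h2
  have hg0 : 0 < g := hgo.pos
  have e1 : ((g ^ 2 * q : ℕ) : ℤ) / (g : ℤ) ^ 2 = (q : ℤ) := by
    push_cast; rw [Int.mul_ediv_cancel_left _ (by positivity)]
  have e2 : ((g ^ 2 * m : ℕ) : ℤ) / (g : ℤ) ^ 2 = (m : ℤ) := by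
    push_cast; rw [Int.mul_ediv_cancel_left _ (by positivity)]
  rw [e1, e2, Nat.mul_div_cancel_left _ (by positivity), Nat.mul_div_cancel_left _ (by positivity)]
  have hq : Odd q := (Nat.odd_mul.mp hQ).2
  have hm : Odd m := (Nat.odd_mul.mp hn).2
  rw [jacobiSym.quadratic_reciprocity hq hm]
  have e3 : (-1 : ℤ) ^ (g ^ 2 * q / 2 * (g ^ 2 * m / 2)) = (-1) ^ (q / 2 * (m / 2)) := by
    rw [pow_mul, pow_mul]
    have f : ∀ k : ℕ, (-1 : ℤ) ^ (g ^ 2 * k / 2) = (-1) ^ (k / 2) := by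
      intro k
      apply neg_one_pow_congr
      have := sq_mul_mod8 (m := k) hgo
      simp only [Nat.even_iff]; omega
    rw [f q]
    rcases neg_one_pow_eq_or ℤ (q / 2) with h | h
    · rw [h]; simp
    · rw [h]; exact f m
  rw [e3]; ring

lemma bb_recip_one {Q n : ℕ} (hQ : Q % 4 = 1) (hn : Odd n) : bb Q n = bb n Q := by
  rw [bb_recip (Nat.odd_iff.mpr (by omega)) hn, Even.neg_one_pow, one_mul]
  apply Even.mul_right
  rw [Nat.even_iff]; omega

lemma bb_zero_sq {s : ℕ} (hs : 0 < s) : bb 0 (s ^ 2) = s := by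
  have h0 : 0 < s ^ 2 := by positivity
  unfold bb
  rw [sum_eq_single s]
  · rw [if_pos (dvd_zero _), Nat.div_self h0]; simp
  · intro g hg hne
    rw [mem_sqd h0] at hg
    rw [if_pos (dvd_zero _), Int.zero_ediv, jacobiSym.zero_left, mul_zero]
    obtain ⟨m, hm⟩ := hg
    have hg0 : 0 < g := by
      rcases Nat.eq_zero_or_pos g with rfl | h
      · simp at hm; omega
      · exact h
    rw [hm, Nat.mul_div_cancel_left _ (by positivity)]
    by_contra hcon
    have : m = 0 ∨ m = 1 := by omega
    rcases this with rfl | rfl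
    · simp at hm; omega
    · apply hne
      have : s ^ 2 = g ^ 2 := by linarith
      exact (Nat.pow_left_injective (by norm_num : (2:ℕ) ≠ 0) this).symm
  · intro h; exact absurd ((mem_sqd h0).mpr dvd_rfl) h

lemma bb_zero_nonsq {n : ℕ} (hn : 0 < n) (h : ¬ IsSquare n) : bb 0 n = 0 := by
  unfold bb
  apply sum_eq_zero
  intro g hg
  have hg0 := sqd_pos hn hg
  rw [mem_sqd hn] at hg
  obtain ⟨m, hm⟩ := hg
  rw [if_pos (dvd_zero _), Int.zero_ediv, jacobiSym.zero_left, mul_zero]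
  rw [hm, Nat.mul_div_cancel_left _ (by positivity)]
  by_contra hcon
  have : m = 0 ∨ m = 1 := by omega
  rcases this with rfl | rfl
  · simp at hm; omega
  · exact h ⟨g, by rw [hm]; ring⟩

lemma abs_jac_le (a : ℤ) (n : ℕ) : |J(a | n)| ≤ 1 := by
  rcases jacobiSym.trichotomy a n with h | h | h <;> rw [h] <;> simp

lemma bb_abs_le {n : ℕ} (hn : 0 < n) (x : ℤ) : |bb x n| ≤ n := by
  unfold bb
  refine (abs_sum_le_sum_abs _ _).trans ?_
  have h1 : ∀ g ∈ sqd n, |(if ((g : ℤ) ^ 2 ∣ x) then (g : ℤ) * J(x / (g : ℤ) ^ 2 | n / g ^ 2) else 0)|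
      ≤ (g : ℤ) := by
    intro g _
    split_ifs
    · rw [abs_mul, Nat.abs_cast]
      have := abs_jac_le (x / (g : ℤ) ^ 2) (n / g ^ 2)
      nlinarith [Nat.cast_nonneg (α := ℤ) g]
    · simp
  refine (sum_le_sum h1).trans ?_
  have h2 : sqd n ⊆ range (Nat.sqrt n + 1) := by
    intro g hg
    rw [mem_sqd hn] at hg
    have := Nat.le_of_dvd hn hg
    rw [mem_range, Nat.lt_succ_iff, Nat.le_sqrt]; nlinarith
  have h3 : ∑ g ∈ sqd n, g ≤ ∑ g ∈ range (Nat.sqrt n + 1), g :=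
    sum_le_sum_of_subset h2
  have h4 := Finset.sum_range_id_mul_two (Nat.sqrt n + 1)
  have h5 := Nat.sqrt_le n
  have h6 : 0 < Nat.sqrt n := Nat.sqrt_pos.mpr hn
  have : ∑ g ∈ sqd n, g ≤ n := by
    simp only [Nat.add_sub_cancel] at h4
    nlinarith
  have h7 : (∑ g ∈ sqd n, (g : ℤ)) = ((∑ g ∈ sqd n, g : ℕ) : ℤ) := by push_cast; rfl
  rw [h7]
  exact_mod_cast this

/-- multiplicativity -/
lemma bb_mul {m n : ℕ} (hm : 0 < m) (hn : 0 < n) (hc : Nat.Coprime m n) (x : ℤ) :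
    bb x (m * n) = bb x m * bb x n := by
  have hmn : 0 < m * n := by positivity
  unfold bb
  rw [sum_mul_sum, ← sum_product']
  symm
  refine sum_bij (fun p _ => p.1 * p.2) ?_ ?_ ?_ ?_
  · rintro ⟨g, h⟩ hp
    simp only [mem_product, mem_sqd hm, mem_sqd hn] at hp
    rw [mem_sqd hmn, mul_pow]
    exact mul_dvd_mul hp.1 hp.2
  · rintro ⟨g, h⟩ hp ⟨g', h'⟩ hp' heq
    simp only [mem_product, mem_sqd hm, mem_sqd hn] at hp hp' heq
    have c : ∀ {a b : ℕ}, a ^ 2 ∣ m → b ^ 2 ∣ n → Nat.Coprime a b := fun ha hb =>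
      Nat.Coprime.coprime_dvd_left ((dvd_pow_self _ two_ne_zero).trans ha)
        (Nat.Coprime.coprime_dvd_right ((dvd_pow_self _ two_ne_zero).trans hb) hc)
    have hp' := hp'
    have e1 : g = g' := by
      apply Nat.dvd_antisymm
      · exact (c hp.1 hp'.2).dvd_of_dvd_mul_right (heq ▸ dvd_mul_right g h)
      · exact (c hp'.1 hp.2).dvd_of_dvd_mul_right (heq ▸ dvd_mul_right g' h')
    have e2 : h = h' := by
      apply Nat.dvd_antisymm
      · exact (c hp'.1 hp.2).symm.dvd_of_dvd_mul_left (heq ▸ dvd_mul_left h g)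
      · exact (c hp.1 hp'.2).symm.dvd_of_dvd_mul_left (heq ▸ dvd_mul_left h' g')
    rw [e1, e2]
  · intro g hg
    rw [mem_sqd hmn] at hg
    obtain ⟨a, b, ha, hb, hab⟩ := Nat.dvd_mul.mp hg
    have hcab : Nat.Coprime a b := Nat.Coprime.coprime_dvd_left ha (Nat.Coprime.coprime_dvd_right hb hc)
    have ha' := exists_eq_pow_of_mul_eq_pow (k := 2) (c := g) (Nat.isUnit_iff.mpr hcab) (by linarith)
    have hb' := exists_eq_pow_of_mul_eq_pow (k := 2) (c := g) (Nat.isUnit_iff.mpr hcab.symm) (by linarith)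
    obtain ⟨a1, rfl⟩ := ha'
    obtain ⟨b1, rfl⟩ := hb'
    refine ⟨(a1, b1), ?_, ?_⟩
    · simp only [mem_product, mem_sqd hm, mem_sqd hn]; exact ⟨ha, hb⟩
    · rw [← mul_pow] at hab
      exact (Nat.pow_left_injective (by norm_num : (2:ℕ) ≠ 0) hab)
  · rintro ⟨g, h⟩ hp
    simp only [mem_product] at hp
    have hg0 := sqd_pos hm hp.1
    have hh0 := sqd_pos hn hp.2
    simp only [mem_sqd hm, mem_sqd hn] at hp
    have hcg : IsCoprime ((g : ℤ) ^ 2) ((h : ℤ) ^ 2) := by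
      have := Nat.isCoprime_iff_coprime.mpr (Nat.Coprime.coprime_dvd_left hp.1 (Nat.Coprime.coprime_dvd_right hp.2 hc))
      exact_mod_cast this
    have hiff : (((g * h : ℕ) : ℤ) ^ 2 ∣ x) ↔ ((g : ℤ) ^ 2 ∣ x) ∧ ((h : ℤ) ^ 2 ∣ x) := by
      push_cast
      rw [mul_pow]
      exact ⟨fun H => ⟨(dvd_mul_right _ _).trans H, (dvd_mul_left _ _).trans H⟩, fun H => hcg.mul_dvd H.1 H.2⟩
    by_cases H : ((g : ℤ) ^ 2 ∣ x) ∧ ((h : ℤ) ^ 2 ∣ x)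
    · simp only
      rw [if_pos H.1, if_pos H.2, if_pos (hiff.mpr H)]
      obtain ⟨z, hz⟩ := hiff.mpr H
      obtain ⟨m1, hm1⟩ := hp.1
      obtain ⟨n1, hn1⟩ := hp.2
      have hm10 : m1 ≠ 0 := by rintro rfl; simp at hm1; omega
      have hn10 : n1 ≠ 0 := by rintro rfl; simp at hn1; omega
      push_cast at hz
      have q1 : x / (g : ℤ) ^ 2 = (h : ℤ) ^ 2 * z := by
        rw [hz, mul_pow, mul_assoc, Int.mul_ediv_cancel_left _ (by positivity)]
      have q2 : x / (h : ℤ) ^ 2 = (g : ℤ) ^ 2 * z := by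
        rw [hz, mul_pow, mul_comm ((g : ℤ) ^ 2), mul_assoc, Int.mul_ediv_cancel_left _ (by positivity)]
      have q3 : x / (((g * h : ℕ) : ℤ)) ^ 2 = z := by
        push_cast
        rw [hz, Int.mul_ediv_cancel_left _ (by positivity)]
      have r1 : m / g ^ 2 = m1 := by rw [hm1, Nat.mul_div_cancel_left _ (by positivity)]
      have r2 : n / h ^ 2 = n1 := by rw [hn1, Nat.mul_div_cancel_left _ (by positivity)]
      have r3 : m * n / (g * h) ^ 2 = m1 * n1 := by
        rw [hm1, hn1, show g ^ 2 * m1 * (h ^ 2 * n1) = (g * h) ^ 2 * (m1 * n1) by ring,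
          Nat.mul_div_cancel_left _ (by positivity)]
      rw [q1, q2, q3, r1, r2, r3, jacobiSym.mul_right' _ hm10 hn10, jacobiSym.mul_left,
        jacobiSym.mul_left]
      have s1 : J((h : ℤ) ^ 2 | m1) = 1 := by
        apply jacobiSym.sq_one'
        rw [Int.gcd_natCast_natCast]
        exact (Nat.Coprime.coprime_dvd_left (hm1 ▸ dvd_mul_left m1 _ : m1 ∣ m)
          (Nat.Coprime.coprime_dvd_right ((dvd_pow_self h two_ne_zero).trans hp.2) hc)).symm
      have s2 : J((g : ℤ) ^ 2 | n1) = 1 := by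
        apply jacobiSym.sq_one'
        rw [Int.gcd_natCast_natCast]
        exact (Nat.Coprime.coprime_dvd_left ((dvd_pow_self g two_ne_zero).trans hp.1)
          (Nat.Coprime.coprime_dvd_right (hn1 ▸ dvd_mul_left n1 _ : n1 ∣ n) hc))
      rw [s1, s2]; push_cast; ring
    · simp only
      rw [if_neg (fun h => H (hiff.mp h))]
      by_cases H1 : ((g : ℤ) ^ 2 ∣ x)
      · rw [if_neg (fun h => H ⟨H1, h⟩), mul_zero]
      · rw [if_neg H1, zero_mul]

/-- recursion at prime powers -/
lemma bb_prime_pow {p : ℕ} (hp : p.Prime) (e : ℕ) (x : ℤ) :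
    bb x (p ^ (e + 2)) = J(x | p ^ (e + 2)) +
      (if (p : ℤ) ^ 2 ∣ x then (p : ℤ) * bb (x / (p : ℤ) ^ 2) (p ^ e) else 0) := by
  have hp0 := hp.pos
  have h1 : 0 < p ^ (e + 2) := by positivity
  have h2 : 0 < p ^ e := by positivity
  have hset : sqd (p ^ (e + 2)) = insert 1 ((sqd (p ^ e)).image (fun g => p * g)) := by
    ext g
    simp only [mem_sqd h1, mem_insert, mem_image, mem_sqd h2]
    constructor
    · intro h
      by_cases hpg : p ∣ g
      · obtain ⟨g', rfl⟩ := hpg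
        right
        refine ⟨g', ?_, rfl⟩
        rw [mul_pow, pow_add, mul_comm (p ^ e)] at h
        exact Nat.dvd_of_mul_dvd_mul_left (by positivity) h
      · left
        have : Nat.Coprime g (p ^ (e + 2)) := Nat.Coprime.pow_right _ ((Nat.Prime.coprime_iff_not_dvd hp).mpr hpg).symm
        have h3 : g ∣ p ^ (e + 2) := (dvd_pow_self g two_ne_zero).trans h
        exact Nat.Coprime.eq_one_of_dvd this h3
    · rintro (rfl | ⟨g', hg', rfl⟩)
      · simp
      · rw [mul_pow, pow_add, mul_comm (p ^ e)]
        exact Nat.mul_dvd_mul_left _ hg'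
  unfold bb
  rw [hset, sum_insert, sum_image (fun a _ b _ h => Nat.eq_of_mul_eq_mul_left hp0 h)]
  · congr 1
    · simp
    · split_ifs with hx
      · rw [mul_sum]
        apply sum_congr rfl
        intro g hg
        have hg0 := sqd_pos h2 hg
        obtain ⟨z, rfl⟩ := hx
        rw [Int.mul_ediv_cancel_left _ (by positivity)]
        have : (((p * g : ℕ) : ℤ) ^ 2 ∣ (p : ℤ) ^ 2 * z) ↔ ((g : ℤ) ^ 2 ∣ z) := by
          push_cast; rw [mul_pow]
          exact mul_dvd_mul_iff_left (by positivity)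
        by_cases hz : (g : ℤ) ^ 2 ∣ z
        · rw [if_pos hz, if_pos (this.mpr hz)]
          have a1 : (p : ℤ) ^ 2 * z / ((p * g : ℕ) : ℤ) ^ 2 = z / (g : ℤ) ^ 2 := by
            push_cast; rw [mul_pow, Int.mul_ediv_mul_of_pos _ _ (by positivity)]
          have a2 : p ^ (e + 2) / (p * g) ^ 2 = p ^ e / g ^ 2 := by
            rw [pow_add, mul_comm (p ^ e), mul_pow, Nat.mul_div_mul_left _ _ (by positivity)]
          rw [a1, a2]; push_cast; ring
        · rw [if_neg hz, if_neg (fun h => hz (this.mp h)), mul_zero]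
      · apply sum_eq_zero
        intro g _
        rw [if_neg]
        intro h
        apply hx
        push_cast at h
        rw [mul_pow] at h
        exact (dvd_mul_right _ _).trans h
  · simp only [mem_image, not_exists, not_and]
    intro g _ h
    have : p ∣ 1 := ⟨g, h.symm⟩
    exact hp.one_lt.ne' (Nat.dvd_one.mp this)

end QT

namespace QT

open Finset NumberTheorySymbols Filter Topology

lemma summable_gauss {R : ℝ} (hR : 0 < R) : Summable fun k : ℤ => Real.exp (-R * (k : ℝ) ^ 2) := by
  have h1 : Summable fun n : ℕ => Real.exp (-R * (n : ℝ) ^ 2) := by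
    have h := Real.summable_exp_nat_mul_iff.mpr (neg_lt_zero.mpr hR)
    refine Summable.of_nonneg_of_le (fun n => (Real.exp_pos _).le) (fun n => ?_) h
    apply Real.exp_le_exp.mpr
    have h2 : (n : ℝ) ≤ (n : ℝ) ^ 2 := by exact_mod_cast Nat.le_self_pow two_ne_zero n
    nlinarith
  apply Summable.of_nat_of_neg
  · simpa using h1
  · simpa using h1

lemma summable_gauss_c {w : ℂ} (hw : 0 < w.re) {c : ℤ → ℂ} {B : ℝ} (hc : ∀ k, ‖c k‖ ≤ B) :
    Summable fun k : ℤ => c k * Complex.exp (-w * (k : ℂ) ^ 2) := by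
  refine Summable.of_norm_bounded (g := fun k : ℤ => B * Real.exp (-w.re * (k : ℝ) ^ 2))
    ((summable_gauss hw).mul_left _) ?_
  intro k
  rw [norm_mul, Complex.norm_exp]
  have : (-w * (k : ℂ) ^ 2).re = -w.re * (k : ℝ) ^ 2 := by
    rw [show (-w * (k : ℂ) ^ 2) = (((k : ℝ) ^ 2 : ℝ) : ℂ) * (-w) by push_cast; ring, Complex.re_ofReal_mul]
    simp; ring
  rw [this]
  exact mul_le_mul_of_nonneg_right (hc k) (Real.exp_pos _).le

lemma tsum_residue {E : Type*} [NormedAddCommGroup E] [CompleteSpace E] (q : ℕ) (hq : 0 < q)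
    (F : ℤ → E) (hF : Summable F) :
    ∑' x : ℤ, F x = ∑ r ∈ range q, ∑' j : ℤ, F (r + q * j) := by
  have : NeZero q := ⟨hq.ne'⟩
  have h1 : Summable (F ∘ (Int.divModEquiv q).symm) := (Equiv.summable_iff _).mpr hF
  rw [← (Int.divModEquiv q).symm.tsum_eq F]
  have h2 : ∑' c : ℤ × Fin q, F ((Int.divModEquiv q).symm c) =
      ∑' c : Fin q × ℤ, F ((Int.divModEquiv q).symm (c.2, c.1)) :=
    ((Equiv.prodComm (Fin q) ℤ).tsum_eq (fun c => F ((Int.divModEquiv q).symm c))).symm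
  rw [h2]
  have h3 : Summable (fun c : Fin q × ℤ => F ((Int.divModEquiv q).symm (c.2, c.1))) :=
    (Equiv.prodComm (Fin q) ℤ).summable_iff.mpr h1
  rw [h3.tsum_prod, tsum_fintype, ← Fin.sum_univ_eq_sum_range (fun r : ℕ => ∑' j : ℤ, F (r + q * j))]
  apply sum_congr rfl
  intro r _
  apply tsum_congr
  intro j
  congr 1
  rw [Int.divModEquiv_symm_apply]
  ring

lemma tendsto_theta {w : ℝ → ℂ} (hw : Tendsto (fun η => (w η).re) (𝓝[>] 0) atTop)
    {c : ℤ → ℂ} (hc : ∀ k, ‖c k‖ ≤ 1) :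
    Tendsto (fun η => ∑' k : ℤ, c k * Complex.exp (-(w η) * (k : ℂ) ^ 2)) (𝓝[>] 0) (𝓝 (c 0)) := by
  have h0 : c 0 = ∑' k : ℤ, if k = 0 then c 0 else 0 := by rw [tsum_ite_eq]
  rw [h0]
  have hn : ∀ (η : ℝ) (k : ℤ), ‖c k * Complex.exp (-(w η) * (k : ℂ) ^ 2)‖ ≤ Real.exp (-(w η).re * (k : ℝ) ^ 2) := by
    intro η k
    rw [norm_mul, Complex.norm_exp]
    have : (-(w η) * (k : ℂ) ^ 2).re = -(w η).re * (k : ℝ) ^ 2 := by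
      rw [show (-(w η) * (k : ℂ) ^ 2) = (((k : ℝ) ^ 2 : ℝ) : ℂ) * (-(w η)) by push_cast; ring, Complex.re_ofReal_mul]
      simp; ring
    rw [this]
    exact mul_le_of_le_one_left (Real.exp_pos _).le (hc k)
  refine tendsto_tsum_of_dominated_convergence (bound := fun k : ℤ => Real.exp (-1 * (k : ℝ) ^ 2))
    (summable_gauss one_pos) ?_ ?_
  · intro k
    by_cases hk : k = 0
    · subst hk; simp
    · rw [if_neg hk]
      rw [tendsto_zero_iff_norm_tendsto_zero]
      refine squeeze_zero (fun _ => norm_nonneg _) (fun η => hn η k) ?_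
      apply Real.tendsto_exp_atBot.comp
      have : (0 : ℝ) < (k : ℝ) ^ 2 := by positivity
      exact (tendsto_neg_atTop_atBot.comp hw).atBot_mul_const this
  · filter_upwards [hw.eventually_ge_atTop 1] with η hη k
    refine (hn η k).trans (Real.exp_le_exp.mpr ?_)
    nlinarith [sq_nonneg (k : ℝ)]

lemma gauss_residue {q : ℕ} (hq : 0 < q) (r : ℤ) {z : ℂ} (hz : 0 < z.re) :
    ∑' j : ℤ, Complex.exp (-Real.pi * z * ((r : ℂ) + q * j) ^ 2) =
      1 / (z * q ^ 2) ^ (1 / 2 : ℂ) * ∑' k : ℤ, ee (k * r / q) * Complex.exp (-(Real.pi / (z * q ^ 2)) * (k : ℂ) ^ 2) := by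
  have hq' : (q : ℂ) ≠ 0 := by exact_mod_cast hq.ne'
  have hz0 : z ≠ 0 := by rintro rfl; simp at hz
  have ha : 0 < (z * q ^ 2 : ℂ).re := by
    rw [show (z * q ^ 2 : ℂ) = (((q : ℝ) ^ 2 : ℝ) : ℂ) * z by push_cast; ring, Complex.re_ofReal_mul]
    positivity
  have h := Complex.tsum_exp_neg_quadratic ha (-z * r * q)
  have e1 : ∀ j : ℤ, Complex.exp (-Real.pi * z * ((r : ℂ) + q * j) ^ 2) =
      Complex.exp (-Real.pi * z * r ^ 2) * Complex.exp (-Real.pi * (z * q ^ 2) * j ^ 2 + 2 * Real.pi * (-z * r * q) * j) := by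
    intro j; rw [← Complex.exp_add]; congr 1; ring
  have e2 : ∀ k : ℤ, ee (k * r / q) * Complex.exp (-(Real.pi / (z * q ^ 2)) * (k : ℂ) ^ 2) =
      Complex.exp (-Real.pi * z * r ^ 2) * Complex.exp (-Real.pi / (z * q ^ 2) * (k + Complex.I * (-z * r * q)) ^ 2) := by
    intro k; unfold ee; rw [← Complex.exp_add, ← Complex.exp_add]; congr 1
    push_cast
    field_simp
    ring_nf
    rw [Complex.I_sq]
    ring
  simp_rw [e1, e2, tsum_mul_left, h]
  ring

noncomputable def eps (n : ℕ) : ℂ := if n % 4 = 1 then 1 else Complex.I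

lemma cpow_half_real_mul {r : ℝ} (hr : 0 < r) {x : ℂ} (hx : x ≠ 0) :
    ((r : ℂ) * x) ^ (1 / 2 : ℂ) = (r : ℂ) ^ (1 / 2 : ℂ) * x ^ (1 / 2 : ℂ) := by
  have hr' : (r : ℂ) ≠ 0 := by exact_mod_cast hr.ne'
  rw [Complex.cpow_def_of_ne_zero (mul_ne_zero hr' hx), Complex.cpow_def_of_ne_zero hr',
    Complex.cpow_def_of_ne_zero hx, Complex.log_ofReal_mul hr hx, ← Complex.exp_add,
    Complex.ofReal_log hr.le]
  congr 1; ring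

lemma tsum_exp_twist {q : ℕ} (hq : 0 < q) {z : ℂ} (hz : 0 < z.re) (c : ℤ → ℂ) (B : ℝ)
    (hB : ∀ x, ‖c x‖ ≤ B) (hc : ∀ r j : ℤ, c (r + q * j) = c r) :
    ∑' x : ℤ, c x * Complex.exp (-Real.pi * z * (x : ℂ) ^ 2) =
      1 / (z * q ^ 2) ^ (1 / 2 : ℂ) * ∑ r ∈ range q, c r *
       ∑' k : ℤ, ee (k * r / q) * Complex.exp (-(Real.pi / (z * q ^ 2)) * (k : ℂ) ^ 2) := by
  rw [tsum_residue q hq, mul_sum]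
  · apply sum_congr rfl
    intro r _
    have : ∀ j : ℤ, c (r + q * j) * Complex.exp (-Real.pi * z * ((r + q * j : ℤ) : ℂ) ^ 2) =
        c r * Complex.exp (-Real.pi * z * (((r : ℤ) : ℂ) + q * j) ^ 2) := by
      intro j; rw [hc]; push_cast; rfl
    simp_rw [this]
    rw [tsum_mul_left, gauss_residue hq r hz]
    push_cast
    ring
  · have hw : 0 < (Real.pi * z).re := by
      rw [Complex.re_ofReal_mul]; positivity
    have := summable_gauss_c hw hB
    refine this.congr ?_
    intro x; congr 2; ring

noncomputable def ga (p : ℕ) (η : ℝ) : ℂ := η - 2 * Complex.I / p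
noncomputable def gu (p : ℕ) (η : ℝ) : ℂ := 1 / (1 + Complex.I * η * p / 2)
noncomputable def gz (p : ℕ) (η : ℝ) : ℂ := (η * p ^ 2 / 4 : ℝ) * gu p η

lemma gden (p : ℕ) (η : ℝ) : (1 + Complex.I * η * p / 2 : ℂ) ≠ 0 := by
  intro h
  have := congrArg Complex.re h
  simp at this

lemma ga_re (p : ℕ) (η : ℝ) : (ga p η).re = η := by
  unfold ga
  rw [show (2 * Complex.I / p : ℂ) = ((2 / p : ℝ) : ℂ) * Complex.I by push_cast; ring]
  simp

lemma ga_eq {p : ℕ} (hp : 0 < p) (η : ℝ) :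
    ga p η = (-2 * Complex.I / p) * (1 + Complex.I * η * p / 2) := by
  have hpC : (p : ℂ) ≠ 0 := by exact_mod_cast hp.ne'
  unfold ga
  have h : (-2 * Complex.I / p) * (1 + Complex.I * η * p / 2) = -(2 * Complex.I / p) - Complex.I ^ 2 * η * (p / p) := by ring
  rw [h, Complex.I_sq, div_self hpC]; ring

lemma ga_ne {p : ℕ} (hp : 0 < p) (η : ℝ) : ga p η ≠ 0 := by
  have hpC : (p : ℂ) ≠ 0 := by exact_mod_cast hp.ne'
  rw [ga_eq hp]; apply mul_ne_zero _ (gden p η); simp [hpC]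

lemma ga_inv {p : ℕ} (hp : 0 < p) (η : ℝ) : 1 / ga p η = gz p η + Complex.I * p / 2 := by
  have hpC : (p : ℂ) ≠ 0 := by exact_mod_cast hp.ne'
  rw [div_eq_iff (ga_ne hp η), ga_eq hp, gz, gu]
  have hD := gden p η
  generalize hDD : (1 + Complex.I * η * p / 2 : ℂ) = D at *
  have h : ((η * p ^ 2 / 4 : ℝ) * (1 / D) + Complex.I * p / 2) * (-2 * Complex.I / p * D) =
     -(η * p * Complex.I / 2) * (D / D) * (p / p) - Complex.I ^ 2 * D * (p / p) := by push_cast; ring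
  rw [h, div_self hD, div_self hpC, Complex.I_sq, ← hDD]; ring

lemma gz_re {p : ℕ} (hp : 0 < p) {η : ℝ} (hη : 0 < η) : 0 < (gz p η).re := by
  have hpR : (0 : ℝ) < p := by exact_mod_cast hp
  unfold gz gu
  rw [Complex.re_ofReal_mul]
  apply mul_pos (by positivity)
  rw [one_div, Complex.inv_re]
  apply div_pos
  · simp
  · exact Complex.normSq_pos.mpr (gden p η)

lemma gauss_id {p : ℕ} (hp : Odd p) {η : ℝ} (hη : 0 < η) :
      ∑ r ∈ range p, ee ((r : ℝ) ^ 2 / p) *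
        (∑' k : ℤ, ee (k * r / p) * Complex.exp (-(Real.pi / ((η : ℂ) * p ^ 2)) * (k : ℂ) ^ 2)) =
      1 / (ga p η) ^ (1 / 2 : ℂ) * (1 / (gu p η) ^ (1 / 2 : ℂ)) *
        ∑ r ∈ range 2, ee (-(p : ℝ) * (r : ℝ) ^ 2 / 4) *
          (∑' k : ℤ, ee (k * r / 2) * Complex.exp (-(Real.pi / (gz p η * 4)) * (k : ℂ) ^ 2)) := by
  have hp0 : 0 < p := hp.pos
  have hpR : (0 : ℝ) < p := by exact_mod_cast hp0
  have hpC : (p : ℂ) ≠ 0 := by exact_mod_cast hp0.ne'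
  have h1 := Complex.tsum_exp_neg_mul_int_sq (a := ga p η) (by rw [ga_re]; exact hη)
  have hL : ∀ n : ℤ, Complex.exp (-Real.pi * ga p η * (n : ℂ) ^ 2) =
      ee ((n : ℝ) ^ 2 / p) * Complex.exp (-Real.pi * (η : ℂ) * (n : ℂ) ^ 2) := by
    intro n; unfold ee ga; rw [← Complex.exp_add]; congr 1; push_cast; ring
  have hR : ∀ n : ℤ, Complex.exp (-Real.pi / ga p η * (n : ℂ) ^ 2) =
      ee (-(p : ℝ) * (n : ℝ) ^ 2 / 4) * Complex.exp (-Real.pi * (gz p η) * (n : ℂ) ^ 2) := by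
    intro n
    rw [show (-Real.pi / ga p η : ℂ) = -Real.pi * (1 / ga p η) by ring, ga_inv hp0]
    unfold ee; rw [← Complex.exp_add]; congr 1; push_cast; ring
  simp_rw [hL, hR] at h1
  have t1 := tsum_exp_twist hp0 (z := (η : ℂ)) (by simpa using hη) (fun n : ℤ => ee ((n : ℝ) ^ 2 / p)) 1
    (fun x => (norm_ee _).le) (by
      intro r j
      apply ee_eq_of_sub (2 * r * j + p * j ^ 2)
      push_cast; field_simp; ring)
  have t2 := tsum_exp_twist (q := 2) two_pos (gz_re hp0 hη) (fun n : ℤ => ee (-(p : ℝ) * (n : ℝ) ^ 2 / 4)) 1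
    (fun x => (norm_ee _).le) (by
      intro r j
      apply ee_eq_of_sub (-(p * (r * j + j ^ 2)))
      push_cast; ring)
  have t3 : ((2 : ℕ) : ℂ) ^ 2 = 4 := by norm_num
  have t4 : ((2 : ℕ) : ℝ) = 2 := by norm_num
  rw [t1, t2, t3, t4] at h1
  have e1 : ((η : ℂ) * p ^ 2) ^ (1 / 2 : ℂ) ≠ 0 := by
    rw [Ne, Complex.cpow_eq_zero_iff]
    have : (η : ℂ) ≠ 0 := by exact_mod_cast hη.ne'
    simp [this, hpC]
  have e2 : (gz p η * 4) ^ (1 / 2 : ℂ) = ((η : ℂ) * p ^ 2) ^ (1 / 2 : ℂ) * (gu p η) ^ (1 / 2 : ℂ) := by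
    have : gz p η * 4 = ((η * p ^ 2 : ℝ) : ℂ) * gu p η := by
      unfold gz; push_cast; ring
    rw [this, cpow_half_real_mul (by positivity)]
    · push_cast; rfl
    · unfold gu; exact one_div_ne_zero (gden p η)
  rw [e2] at h1
  have h2 := congrArg (fun t => ((η : ℂ) * p ^ 2) ^ (1 / 2 : ℂ) * t) h1
  beta_reduce at h2
  rw [← mul_assoc, mul_one_div_cancel e1, one_mul] at h2
  have c1 : ∀ r : ℕ, ((r : ℤ) : ℝ) = (r : ℝ) := fun r => by simp
  try simp only [c1] at h2
  rw [h2]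
  generalize ((η : ℂ) * p ^ 2) ^ (1 / 2 : ℂ) = E at *
  generalize (ga p η) ^ (1 / 2 : ℂ) = A
  generalize (gu p η) ^ (1 / 2 : ℂ) = U
  rw [show 1 / (E * U) = (1 / E) * (1 / U) by rw [one_div_mul_one_div]]
  generalize (1 : ℂ) / U = U'
  generalize (1 : ℂ) / A = A'
  generalize (∑ r ∈ range 2, ee (-(p : ℝ) * (r : ℝ) ^ 2 / 4) *
          (∑' k : ℤ, ee (k * r / 2) * Complex.exp (-(Real.pi / (gz p η * 4)) * (k : ℂ) ^ 2))) = S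
  calc E * (A' * (1 / E * U' * S)) = (E * (1 / E)) * (A' * U' * S) := by ring
    _ = _ := by rw [mul_one_div_cancel e1, one_mul]

lemma hinvT : Tendsto (fun η : ℝ => η⁻¹) (𝓝[>] 0) atTop := tendsto_inv_nhdsGT_zero

lemma gauss_L1 {p : ℕ} (hp : 0 < p) : Tendsto (fun η : ℝ => ∑ r ∈ range p, ee ((r : ℝ) ^ 2 / p) *
        (∑' k : ℤ, ee (k * r / p) * Complex.exp (-(Real.pi / ((η : ℂ) * p ^ 2)) * (k : ℂ) ^ 2)))
      (𝓝[>] 0) (𝓝 (∑ r ∈ range p, ee ((r : ℝ) ^ 2 / p))) := by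
  have hpR : (0 : ℝ) < p := by exact_mod_cast hp
  apply tendsto_finsetSum
  intro r _
  have : Tendsto (fun η : ℝ => (∑' k : ℤ, ee (k * r / p) * Complex.exp (-(Real.pi / ((η : ℂ) * p ^ 2)) * (k : ℂ) ^ 2)))
      (𝓝[>] 0) (𝓝 1) := by
    have := tendsto_theta (w := fun η => (Real.pi / ((η : ℂ) * p ^ 2))) (c := fun k => ee (k * r / p)) ?_
      (fun k => (norm_ee _).le)
    · simpa [ee_zero] using this
    · have : ∀ η : ℝ, (Real.pi / ((η : ℂ) * p ^ 2)).re = η⁻¹ * (Real.pi / p ^ 2) := by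
        intro η
        rw [show (Real.pi / ((η : ℂ) * p ^ 2) : ℂ) = ((η⁻¹ * (Real.pi / p ^ 2) : ℝ) : ℂ) by
          push_cast; rw [div_mul_eq_div_div_swap]; ring]
        exact Complex.ofReal_re _
      simp_rw [this]
      exact hinvT.atTop_mul_const (by positivity)
  simpa using this.const_mul (ee ((r : ℝ) ^ 2 / p))

lemma gauss_re {p : ℕ} (hp : 0 < p) (η : ℝ) : (Real.pi / (gz p η * 4)).re = η⁻¹ * (Real.pi / p ^ 2) := by
  have hpC : (p : ℂ) ≠ 0 := by exact_mod_cast hp.ne'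
  by_cases hη : η = 0
  · simp [gz, hη]
  have hη' : (η : ℂ) ≠ 0 := by exact_mod_cast hη
  have key : (Real.pi / (gz p η * 4) : ℂ) = ((η⁻¹ * (Real.pi / p ^ 2) : ℝ) : ℂ) +
      ((Real.pi / (2 * p) : ℝ) : ℂ) * Complex.I := by
    have hD := gden p η
    have : gz p η * 4 = (η * p ^ 2) / (1 + Complex.I * η * p / 2) := by
      unfold gz gu; push_cast; ring
    rw [this, div_div_eq_mul_div]
    push_cast
    rw [div_eq_iff (by positivity)]
    calc Real.pi * (1 + Complex.I * η * p / 2) = Real.pi * 1 * 1 + Real.pi * Complex.I * η * p / 2 * 1 := by ring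
      _ = Real.pi * ((η : ℂ)⁻¹ * η) * ((p : ℂ)^2 / p ^ 2) + Real.pi * Complex.I * η * p / 2 * (p / p : ℂ) := by
        rw [inv_mul_cancel₀ hη', div_self hpC, div_self (pow_ne_zero 2 hpC)]
      _ = _ := by ring
  rw [key, Complex.add_re, Complex.ofReal_re, Complex.re_ofReal_mul, Complex.I_re, mul_zero, add_zero]

lemma gauss_L2 {p : ℕ} (hp : 0 < p) : Tendsto (fun η : ℝ => ∑ r ∈ range 2, ee (-(p : ℝ) * (r : ℝ) ^ 2 / 4) *
          (∑' k : ℤ, ee (k * r / 2) * Complex.exp (-(Real.pi / (gz p η * 4)) * (k : ℂ) ^ 2)))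
      (𝓝[>] 0) (𝓝 (∑ r ∈ range 2, ee (-(p : ℝ) * (r : ℝ) ^ 2 / 4))) := by
  have hpR : (0 : ℝ) < p := by exact_mod_cast hp
  have hpC : (p : ℂ) ≠ 0 := by exact_mod_cast hp.ne'
  apply tendsto_finsetSum
  intro r _
  have : Tendsto (fun η : ℝ => (∑' k : ℤ, ee (k * r / 2) * Complex.exp (-(Real.pi / (gz p η * 4)) * (k : ℂ) ^ 2)))
      (𝓝[>] 0) (𝓝 1) := by
    have := tendsto_theta (w := fun η => (Real.pi / (gz p η * 4))) (c := fun k => ee (k * r / 2)) ?_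
      (fun k => (norm_ee _).le)
    · have h0 : ee (((0 : ℤ) : ℝ) * r / 2) = 1 := by
        rw [Int.cast_zero, zero_mul, zero_div, ee_zero]
      rw [h0] at this
      exact this
    · have := gauss_re hp
      rw [show (fun η => (Real.pi / (gz p η * 4) : ℂ).re) = fun η => η⁻¹ * (Real.pi / (p : ℝ) ^ 2) from funext this]
      exact hinvT.atTop_mul_const (by positivity)
  have h2 := this.const_mul (ee (-(p : ℝ) * (r : ℝ) ^ 2 / 4))
  rw [mul_one] at h2
  exact h2

lemma cpow_half_cont (w : ℂ) (hw : w ∈ Complex.slitPlane) : ContinuousAt (fun x : ℂ => x ^ (1 / 2 : ℂ)) w :=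
    continuousAt_id.cpow continuousAt_const hw

lemma gauss_L3 {p : ℕ} (hp : 0 < p) : Tendsto (fun η : ℝ => (ga p η) ^ (1 / 2 : ℂ)) (𝓝[>] 0) (𝓝 ((-2 * Complex.I / p) ^ (1 / 2 : ℂ))) := by
  have hc : ContinuousAt (ga p) 0 := by unfold ga; fun_prop
  have : Tendsto (ga p) (𝓝[>] 0) (𝓝 (-2 * Complex.I / p)) := by
    have := hc.tendsto.mono_left (nhdsWithin_le_nhds (s := Set.Ioi (0:ℝ)))
    convert this using 2; simp only [ga]; push_cast; ring
  refine Tendsto.comp (cpow_half_cont _ ?_) this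
  right
  rw [show (-2 * Complex.I / p : ℂ) = ((-2 / p : ℝ) : ℂ) * Complex.I by push_cast; ring]
  rw [Complex.im_ofReal_mul, Complex.I_im, mul_one]
  have hpR : (0 : ℝ) < p := by exact_mod_cast hp
  exact div_ne_zero (by norm_num) hpR.ne'

lemma gauss_L4 (p : ℕ) : Tendsto (fun η : ℝ => (gu p η) ^ (1 / 2 : ℂ)) (𝓝[>] 0) (𝓝 1) := by
  have hc : ContinuousAt (gu p) 0 := by
    unfold gu
    refine ContinuousAt.div (f := fun _ : ℝ => (1 : ℂ)) (g := fun η : ℝ => 1 + Complex.I * η * p / 2) continuousAt_const (by fun_prop) (gden p 0)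
  have : Tendsto (gu p) (𝓝[>] 0) (𝓝 1) := by
    have := hc.tendsto.mono_left (nhdsWithin_le_nhds (s := Set.Ioi (0:ℝ)))
    convert this using 2; simp [gu]
  have := Tendsto.comp (cpow_half_cont 1 (by simp)) this
  beta_reduce at this
  rw [Complex.one_cpow] at this
  exact this

lemma gauss_val {p : ℕ} (hp : 0 < p) : ((-2 * Complex.I / p) ^ (1 / 2 : ℂ) : ℂ) = (1 - Complex.I) / (Real.sqrt p : ℂ) := by
  have hpR : (0 : ℝ) < p := by exact_mod_cast hp
  have hs : ((Real.sqrt p : ℝ) : ℂ) ^ 2 = p := by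
    rw [← Complex.ofReal_pow, Real.sq_sqrt hpR.le]; simp
  have : (-2 * Complex.I / p : ℂ) = ((1 - Complex.I) / (Real.sqrt p : ℂ)) ^ 2 := by
    rw [div_pow, hs]; congr 1; ring_nf; rw [Complex.I_sq]; ring
  rw [this, one_div]
  apply Complex.sq_cpow_two_inv
  rw [Complex.div_ofReal_re]
  simp only [Complex.sub_re, Complex.one_re, Complex.I_re, sub_zero]
  positivity

lemma ee_quarter : ee (1 / 4) = Complex.I := by
  unfold ee
  rw [show (2 * Real.pi * Complex.I * ((1 / 4 : ℝ) : ℂ)) = Real.pi / 2 * Complex.I by push_cast; ring]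
  exact Complex.exp_pi_div_two_mul_I

lemma ee_neg_quarter : ee (-1 / 4) = -Complex.I := by
  unfold ee
  rw [show (2 * Real.pi * Complex.I * ((-1 / 4 : ℝ) : ℂ)) = -(Real.pi / 2) * Complex.I by push_cast; ring]
  rw [Complex.exp_mul_I]
  simp [Complex.cos_neg, Complex.sin_neg]

lemma gauss_v {p : ℕ} (hp : Odd p) : ee (-(p : ℝ) * ((1 : ℕ) : ℝ) ^ 2 / 4) = if p % 4 = 1 then -Complex.I else Complex.I := by
  have ho := Nat.odd_iff.mp hp
  split_ifs with h
  · rw [← ee_neg_quarter]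
    obtain ⟨k, hk⟩ : ∃ k, p = 4 * k + 1 := ⟨p / 4, by omega⟩
    apply ee_eq_of_sub (-k)
    rw [hk]; push_cast; ring
  · rw [← ee_quarter]
    obtain ⟨k, hk⟩ : ∃ k, p = 4 * k + 3 := ⟨p / 4, by omega⟩
    apply ee_eq_of_sub (-k - 1)
    rw [hk]; push_cast; ring

lemma gauss_sum_sq {p : ℕ} (hp : Odd p) :
    ∑ r ∈ range p, ee ((r : ℝ) ^ 2 / p) = eps p * Real.sqrt p := by
  have hp0 : 0 < p := hp.pos
  have hpR : (0 : ℝ) < p := by exact_mod_cast hp0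
  have hs0 : ((Real.sqrt p : ℝ) : ℂ) ≠ 0 := by
    exact_mod_cast (Real.sqrt_pos.mpr hpR).ne'
  have h1I : (1 - Complex.I) ≠ 0 := by
    intro h; have := congrArg Complex.re h; simp at this
  have L5 := ((tendsto_const_nhds (x := (1 : ℂ))).div (gauss_L3 hp0) (by rw [gauss_val hp0]; exact div_ne_zero h1I hs0)).mul
    ((tendsto_const_nhds (x := (1 : ℂ))).div (gauss_L4 p) one_ne_zero) |>.mul (gauss_L2 hp0)
  have heq : ∑ r ∈ range p, ee ((r : ℝ) ^ 2 / p) =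
      1 / (-2 * Complex.I / p) ^ (1 / 2 : ℂ) * (1 / 1) * ∑ r ∈ range 2, ee (-(p : ℝ) * (r : ℝ) ^ 2 / 4) := by
    refine tendsto_nhds_unique (gauss_L1 hp0) (L5.congr' ?_)
    filter_upwards [self_mem_nhdsWithin] with η hη
    exact (gauss_id hp hη).symm
  rw [heq, gauss_val hp0, sum_range_succ, sum_range_one, gauss_v hp]
  have e0 : ee (-(p : ℝ) * ((0 : ℕ) : ℝ) ^ 2 / 4) = 1 := by
    rw [← ee_zero]; congr 1; simp
  rw [e0]
  unfold eps
  have hI2 := Complex.I_sq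
  split_ifs with h
  · rw [one_div_div, one_div_one, mul_one, div_mul_eq_mul_div, div_eq_iff h1I]; ring
  · rw [one_div_div, one_div_one, mul_one, div_mul_eq_mul_div, div_eq_iff h1I]
    linear_combination (-(Real.sqrt p : ℂ)) * -hI2

end QT

namespace QT

open Finset NumberTheorySymbols

lemma eps_mul {m n : ℕ} (hm : Odd m) (hn : Odd n) (hc : Nat.Coprime m n) :
    ((J(n | m) : ℤ) : ℂ) * ((J(m | n) : ℤ) : ℂ) * (eps m * eps n) = eps (m * n) := by
  have h1 : J(m | n) = (-1) ^ (m / 2 * (n / 2)) * J(n | m) := jacobiSym.quadratic_reciprocity hm hn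
  have h2 : J(n | m) ^ 2 = 1 := jacobiSym.sq_one (by
    rw [Int.gcd_natCast_natCast]; exact hc.symm)
  have h2' : ((J(n | m) : ℤ) : ℂ) ^ 2 = 1 := by exact_mod_cast h2
  have h3 : ((J(n | m) : ℤ) : ℂ) * ((J(m | n) : ℤ) : ℂ) = (-1) ^ (m / 2 * (n / 2)) := by
    rw [h1]; push_cast; linear_combination ((-1) ^ (m / 2 * (n / 2))) * h2'
  rw [h3]
  have hI := Complex.I_mul_I
  have hm2 := Nat.odd_iff.mp hm
  have hn2 := Nat.odd_iff.mp hn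
  unfold eps
  have hmn : (m * n) % 4 = ((m % 4) * (n % 4)) % 4 := Nat.mul_mod m n 4
  have hm4 : m % 4 = 1 ∨ m % 4 = 3 := by omega
  have hn4 : n % 4 = 1 ∨ n % 4 = 3 := by omega
  rcases hm4 with a | a <;> rcases hn4 with b | b <;> rw [hmn, a, b] <;> norm_num
  · exact Even.neg_one_pow (Even.mul_right (by rw [Nat.even_iff]; omega) _)
  · rw [Even.neg_one_pow (Even.mul_right (by rw [Nat.even_iff]; omega) _)]
  · rw [Even.neg_one_pow (Even.mul_left (by rw [Nat.even_iff]; omega) _)]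
  · rw [Odd.neg_one_pow (Odd.mul (by rw [Nat.odd_iff]; omega) (by rw [Nat.odd_iff]; omega))]; norm_num

/-- finite Fourier transform -/
noncomputable def ft (a : ℤ → ℤ) (n : ℕ) (k : ℤ) : ℂ := ∑ x ∈ range n, (a x : ℂ) * ee (k * x / n)

lemma ft_term_period {a : ℤ → ℤ} {n : ℕ} (hn : 0 < n) (ha : ∀ x y : ℤ, (n : ℤ) ∣ x - y → a x = a y) (k : ℤ) :
    ∀ x y : ℤ, (n : ℤ) ∣ x - y → (a x : ℂ) * ee (k * x / n) = (a y : ℂ) * ee (k * y / n) := by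
  intro x y h
  rw [ha x y h, ee_period k n hn x y h]

lemma ft_crt (N : ℤ) {m n : ℕ} (hm : 0 < m) (hn : 0 < n) (hc : Nat.Coprime m n) (k : ℤ) :
    ft (fun x => bb (N * x) (m * n)) (m * n) k =
      ((J(n | m) : ℤ) : ℂ) * ((J(m | n) : ℤ) : ℂ) *
       (ft (fun x => bb (N * x) m) m k * ft (fun x => bb (N * x) n) n k) := by
  have hm' : (m : ℝ) ≠ 0 := by positivity
  have hn' : (n : ℝ) ≠ 0 := by positivity
  unfold ft
  have hmn : 0 < m * n := by positivity
  have := sum_crt m n hm hn hc (fun x : ℤ => (bb (N * x) (m * n) : ℂ) * ee (k * x / (m * n : ℕ)))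
    (ft_term_period (a := fun x => bb (N * x) (m * n)) hmn
    (fun x y h => bb_period hmn (by rw [← mul_sub]; exact Dvd.dvd.mul_left h N)) k)
  simp only [Int.cast_natCast] at this
  refine this.trans ?_
  rw [sum_mul_sum, mul_sum]
  apply sum_congr rfl
  intro i _
  rw [mul_sum]
  apply sum_congr rfl
  intro j _
  rw [bb_mul hm hn hc]
  have e1 : bb (N * ((i : ℤ) * n + j * m)) m = J(n | m) * bb (N * i) m := by
    rw [← bb_unit hm (n : ℤ) (N * i) (Nat.isCoprime_iff_coprime.mpr hc.symm)]
    apply bb_period hm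
    exact ⟨N * j, by ring⟩
  have e2 : bb (N * ((i : ℤ) * n + j * m)) n = J(m | n) * bb (N * j) n := by
    rw [← bb_unit hn (m : ℤ) (N * j) (Nat.isCoprime_iff_coprime.mpr hc)]
    apply bb_period hn
    exact ⟨N * i, by ring⟩
  have e3 : ee (k * (((i : ℤ) * n + j * m : ℤ) : ℝ) / ((m * n : ℕ) : ℝ)) = ee (k * i / m) * ee (k * j / n) := by
    rw [← ee_add]; congr 1; push_cast; field_simp
  rw [e1, e2, e3]; push_cast; ring

lemma sum_zmod {p : ℕ} [NeZero p] {M : Type*} [AddCommMonoid M] (G : ZMod p → M) :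
    ∑ x ∈ range p, G (x : ZMod p) = ∑ x : ZMod p, G x := by
  refine sum_bij' (fun x _ => (x : ZMod p)) (fun z _ => z.val) ?_ ?_ ?_ ?_ ?_
  · simp
  · intro z _; simpa using ZMod.val_lt z
  · intro x hx; exact ZMod.val_cast_of_lt (by simpa using hx)
  · intro z _; exact ZMod.natCast_zmod_val z
  · simp

lemma gauss_jac {p : ℕ} (hp : p.Prime) (hp2 : Odd p) :
    ∑ x ∈ range p, ((J((x : ℤ) | p) : ℤ) : ℂ) * ee ((x : ℝ) / p) = eps p * Real.sqrt p := by
  have : Fact p.Prime := ⟨hp⟩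
  have hp0 := hp.pos
  have hp2' : p ≠ 2 := by rintro rfl; exact absurd hp2 (by decide)
  have hp1 : 1 < p := hp.one_lt
  rw [← gauss_sum_sq hp2]
  set F : ZMod p → ℂ := fun z => ee ((z.val : ℝ) / p) with hF
  have hFi : ∀ x : ℕ, F (x : ZMod p) = ee ((x : ℝ) / p) := by
    intro x
    have hv : (x : ZMod p).val = x % p := ZMod.val_natCast p x
    have h' : (x : ℝ) = ((x % p : ℕ) : ℝ) + p * ((x / p : ℕ) : ℝ) := by exact_mod_cast (Nat.mod_add_div x p).symm
    have hpR : (p : ℝ) ≠ 0 := by positivity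
    simp only [hF]
    rw [hv]
    apply ee_eq_of_sub (-((x / p : ℕ) : ℤ))
    rw [Int.cast_neg, Int.cast_natCast, div_eq_iff hpR, add_mul, div_mul_cancel₀ _ hpR]
    linarith
  have h1 : ∑ r ∈ range p, ee ((r : ℝ) ^ 2 / p) = ∑ y : ZMod p, F (y ^ 2) := by
    rw [← sum_zmod (fun y => F (y ^ 2))]
    apply sum_congr rfl
    intro r _
    have := hFi (r ^ 2)
    push_cast at this
    rw [this]
  have h2 : ∑ y : ZMod p, F (y ^ 2) = ∑ x : ZMod p, ((quadraticChar (ZMod p) x : ℤ) + 1 : ℂ) * F x := by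
    rw [← sum_fiberwise_of_maps_to (s := univ) (t := univ) (g := fun y : ZMod p => y ^ 2) (by simp)]
    apply sum_congr rfl
    intro x _
    have hc := quadraticChar_card_sqrts (F := ZMod p) (by rw [ZMod.ringChar_zmod_n]; exact hp2') x
    have : ∀ i ∈ (univ.filter fun y : ZMod p => y ^ 2 = x), F (i ^ 2) = F x := by
      intro i hi; rw [(mem_filter.mp hi).2]
    rw [sum_congr rfl this, sum_const, nsmul_eq_mul]
    congr 1
    have hs : (univ.filter fun y : ZMod p => y ^ 2 = x) = {y : ZMod p | y ^ 2 = x}.toFinset := by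
      ext; simp
    rw [hs]
    exact_mod_cast hc
  rw [h1, h2]
  simp_rw [add_mul, one_mul]
  rw [sum_add_distrib]
  have h3 : ∑ x : ZMod p, F x = 0 := by
    rw [← sum_zmod F]
    simp_rw [hFi]
    have := sum_ee p hp0 1
    rw [if_neg] at this
    · simpa using this
    · intro h; have := Int.le_of_dvd one_pos h; omega
  rw [h3, add_zero, ← sum_zmod (fun x => ((quadraticChar (ZMod p) x : ℤ) : ℂ) * F x)]
  apply sum_congr rfl
  intro x _
  rw [hFi]
  congr 2
  rw [← jacobiSym.legendreSym.to_jacobiSym, legendreSym]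
  simp

lemma jac_period {p : ℕ} {x y : ℤ} (h : (p : ℤ) ∣ x - y) : J(x | p) = J(y | p) := by
  apply jacobiSym.mod_left'
  exact Int.ModEq.symm (Int.modEq_iff_dvd.mpr h)

lemma jac_zero_of_dvd {p : ℕ} (hp : p.Prime) {x : ℤ} (h : (p : ℤ) ∣ x) : J(x | p) = 0 := by
  rw [jac_period (y := 0) (by simpa using h), jacobiSym.zero_left hp.one_lt]

lemma gauss_jac_k {p : ℕ} (hp : p.Prime) (hp2 : Odd p) (k : ℤ) :
    ∑ x ∈ range p, ((J((x : ℤ) | p) : ℤ) : ℂ) * ee (k * x / p) = eps p * Real.sqrt p * ((J(k | p) : ℤ) : ℂ) := by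
  have hp0 := hp.pos
  have hp1 : 1 < p := hp.one_lt
  have base := gauss_jac hp hp2
  by_cases hk : (p : ℤ) ∣ k
  · have h0 : J(k | p) = 0 := jac_zero_of_dvd hp hk
    rw [h0]
    have e : ∀ x ∈ range p, ((J((x : ℤ) | p) : ℤ) : ℂ) * ee (k * x / p) = ((J((x : ℤ) | p) : ℤ) : ℂ) := by
      intro x _
      obtain ⟨c, rfl⟩ := hk
      rw [show ((p * c : ℤ) : ℝ) * x / p = ((c * x : ℤ) : ℝ) by push_cast; field_simp, ee_int, mul_one]
    rw [sum_congr rfl e]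
    -- sum of the character vanishes
    have : Fact p.Prime := ⟨hp⟩
    have hp2' : p ≠ 2 := by rintro rfl; exact absurd hp2 (by decide)
    have := quadraticChar_sum_zero (F := ZMod p) (by rw [ZMod.ringChar_zmod_n]; exact hp2')
    rw [← sum_zmod] at this
    rw [Int.cast_zero, mul_zero]
    have h' : ∑ x ∈ range p, J((x : ℤ) | p) = 0 := by
      rw [← this]
      apply sum_congr rfl
      intro x _
      rw [← jacobiSym.legendreSym.to_jacobiSym, legendreSym]; simp
    exact_mod_cast h'
  · have hcop : IsCoprime k (p : ℤ) :=
      ((Nat.prime_iff_prime_int.mp hp).coprime_iff_not_dvd.mpr hk).symm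
    have h1 := sum_unit p hp0 k 0 hcop (fun x : ℤ => ((J(x | p) : ℤ) : ℂ) * ee (x / p)) (by
      intro x y h
      have := ee_period 1 p hp0 x y h
      rw [jac_period h]; simp only [Int.cast_one, one_mul] at this; rw [this])
    simp only [Int.cast_natCast] at h1
    rw [base] at h1
    have hk2 : ((J(k | p) : ℤ) : ℂ) * ((J(k | p) : ℤ) : ℂ) = 1 := by
      have : J(k | p) ^ 2 = 1 := jacobiSym.sq_one (Int.isCoprime_iff_gcd_eq_one.mp hcop)
      rw [← sq]; exact_mod_cast this
    rw [← h1, sum_mul]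
    apply sum_congr rfl
    intro x _
    rw [add_zero, jacobiSym.mul_left]; push_cast
    linear_combination (-((J((x : ℤ) | p) : ℤ) : ℂ) * ee (k * x / p)) * hk2

end QT

namespace QT

open Finset NumberTheorySymbols

lemma jac_pow_add_two {p : ℕ} (x : ℤ) (e : ℕ) (he : 0 < e) : J(x | p ^ (e + 2)) = J(x | p ^ e) := by
  rw [jacobiSym.pow_right, jacobiSym.pow_right]
  rcases jacobiSym.trichotomy x p with h | h | h <;> rw [h]
  · rw [zero_pow (by omega), zero_pow (by omega)]
  · simp
  · rw [pow_add]; simp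

lemma delta_step {p : ℕ} (hp : p.Prime) (e : ℕ) (k : ℤ) :
    bb k (p ^ (e + 2 + 2)) - bb k (p ^ (e + 2)) =
      if (p : ℤ) ^ 2 ∣ k then (p : ℤ) * (bb (k / (p : ℤ) ^ 2) (p ^ (e + 2)) - bb (k / (p : ℤ) ^ 2) (p ^ e)) else 0 := by
  rw [bb_prime_pow hp (e + 2) k, bb_prime_pow hp e k, jac_pow_add_two k (e + 2) (by omega)]
  split_ifs <;> ring

lemma jac_prime_sq {p : ℕ} (hp : p.Prime) (x : ℤ) (i : ℕ) : J(x | p ^ (2 * i + 2)) = if (p : ℤ) ∣ x then 0 else 1 := by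
  rw [jacobiSym.pow_right]
  split_ifs with h
  · rw [jac_zero_of_dvd hp h, zero_pow (by omega)]
  · have hcop : IsCoprime x (p : ℤ) :=
      ((Nat.prime_iff_prime_int.mp hp).coprime_iff_not_dvd.mpr h).symm
    have : J(x | p) ^ 2 = 1 := jacobiSym.sq_one (Int.isCoprime_iff_gcd_eq_one.mp hcop)
    rw [show 2 * i + 2 = 2 * (i + 1) by ring, pow_mul, this, one_pow]

lemma jac_prime_odd {p : ℕ} (x : ℤ) (i : ℕ) : J(x | p ^ (2 * i + 1)) = J(x | p) := by
  induction i with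
  | zero => simp
  | succ i ih => rw [show 2 * (i + 1) + 1 = (2 * i + 1) + 2 by ring, jac_pow_add_two _ _ (by omega), ih]

lemma dvd_div_sq {p : ℕ} (hp : 0 < p) (k : ℤ) (h : (p : ℤ) ^ 2 ∣ k) (j : ℕ) :
    (p : ℤ) ^ (j + 2) ∣ k ↔ (p : ℤ) ^ j ∣ k / (p : ℤ) ^ 2 := by
  obtain ⟨c, rfl⟩ := h
  have hp' : (p : ℤ) ^ 2 ≠ 0 := by positivity
  rw [Int.mul_ediv_cancel_left _ hp', show j + 2 = 2 + j by ring, pow_add]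
  exact mul_dvd_mul_iff_left hp'

lemma delta_even {p : ℕ} (hp : p.Prime) (i : ℕ) (k : ℤ) :
    bb k (p ^ (2 * i + 2)) - bb k (p ^ (2 * i)) =
      (p : ℤ) ^ i * ((if (p : ℤ) ^ (2 * i + 2) ∣ k then (p : ℤ) else 0) - if (p : ℤ) ^ (2 * i + 1) ∣ k then 1 else 0) := by
  induction i generalizing k with
  | zero =>
    rw [bb_prime_pow hp, jac_prime_sq hp k 0]
    simp only [Nat.mul_zero, pow_zero, bb_one, zero_add, pow_one]
    by_cases h1 : (p : ℤ) ∣ k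
    · by_cases h2 : (p : ℤ) ^ 2 ∣ k <;> simp [h1, h2]
    · have h2 : ¬ (p : ℤ) ^ 2 ∣ k := fun h => h1 ((dvd_pow_self _ two_ne_zero).trans h)
      simp [h1, h2]
  | succ i ih =>
    have := delta_step hp (2 * i) k
    rw [show 2 * (i + 1) + 2 = 2 * i + 2 + 2 by ring, show 2 * (i + 1) + 1 = 2 * i + 1 + 2 by ring,
      show 2 * (i + 1) = 2 * i + 2 by ring, this]
    by_cases h : (p : ℤ) ^ 2 ∣ k
    · simp only [h, if_true, dvd_div_sq hp.pos k h]
      rw [ih]; ring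
    · have h1 : ¬ (p : ℤ) ^ (2 * i + 2 + 2) ∣ k := fun h' => h ((pow_dvd_pow _ (by omega)).trans h')
      have h2 : ¬ (p : ℤ) ^ (2 * i + 1 + 2) ∣ k := fun h' => h ((pow_dvd_pow _ (by omega)).trans h')
      simp [h, h1, h2]

lemma sqd_squarefree {n : ℕ} (hn : Squarefree n) : sqd n = {1} := by
  have hn0 : 0 < n := Nat.pos_of_ne_zero hn.ne_zero
  ext g
  rw [mem_sqd hn0, mem_singleton]
  constructor
  · intro h
    exact (Nat.isUnit_iff.mp (hn g (by rw [← sq]; exact h)))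
  · rintro rfl; simp

lemma bb_squarefree {n : ℕ} (hn : Squarefree n) (x : ℤ) : bb x n = J(x | n) := by
  simp [bb, sqd_squarefree hn]

lemma delta_odd {p : ℕ} (hp : p.Prime) (i : ℕ) (k : ℤ) :
    bb k (p ^ (2 * i + 1 + 2)) - bb k (p ^ (2 * i + 1)) =
      if (p : ℤ) ^ (2 * i + 2) ∣ k then (p : ℤ) ^ (i + 1) * J(k / (p : ℤ) ^ (2 * i + 2) | p) else 0 := by
  have bp : ∀ x, bb x p = J(x | p) := by
    exact bb_squarefree hp.prime.squarefree
  induction i generalizing k with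
  | zero =>
    rw [bb_prime_pow hp, jac_pow_add_two _ _ (by omega)]
    simp only [Nat.mul_zero, zero_add, pow_one, bp]
    ring
  | succ i ih =>
    have := delta_step hp (2 * i + 1) k
    rw [show 2 * (i + 1) + 1 = 2 * i + 1 + 2 by ring, this,
      show 2 * (i + 1) + 2 = 2 * i + 2 + 2 by ring]
    by_cases h : (p : ℤ) ^ 2 ∣ k
    · rw [if_pos h, ih]
      simp only [dvd_div_sq hp.pos k h]
      rw [pow_add (p : ℤ) (2 * i + 2) 2, mul_comm ((p : ℤ) ^ (2 * i + 2)), ← Int.ediv_ediv_of_nonneg (by positivity)]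
      split_ifs <;> ring
    · rw [if_neg h, if_neg]
      exact fun h' => h ((pow_dvd_pow _ (by omega)).trans h')

lemma eps_sq_mul {m n : ℕ} (hm : Odd m) : eps (m ^ 2 * n) = eps n := by
  unfold eps
  have : (m ^ 2 * n) % 4 = n % 4 := by have := sq_mul_mod8 (m := n) hm; omega
  rw [this]

lemma sqrt_pow_succ2 (p e : ℕ) : Real.sqrt ((p ^ (e + 2) : ℕ) : ℝ) = p * Real.sqrt ((p ^ e : ℕ) : ℝ) := by
  push_cast
  rw [pow_add, mul_comm, Real.sqrt_mul (by positivity), Real.sqrt_sq (by positivity)]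

lemma sqrt_pow_even (p i : ℕ) : Real.sqrt ((p ^ (2 * i) : ℕ) : ℝ) = p ^ i := by
  push_cast
  rw [mul_comm, pow_mul, Real.sqrt_sq (by positivity)]

lemma ft_jac_aux {p : ℕ} (hp : p.Prime) (e : ℕ) (k : ℤ) :
    ft (fun x => J(x | p ^ (e + 2))) (p ^ (e + 2)) k =
      if (p : ℤ) ^ (e + 1) ∣ k then (p : ℂ) ^ (e + 1) *
        ∑ y ∈ range p, ((J((y : ℤ) | p ^ (e + 2)) : ℤ) : ℂ) * ee (((k / (p : ℤ) ^ (e + 1) : ℤ) : ℝ) * y / p) else 0 := by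
  have hp0 := hp.pos
  have hpR : (p : ℝ) ≠ 0 := by positivity
  have hsplit : p ^ (e + 2) = p * p ^ (e + 1) := by ring
  have hper : ∀ x y : ℤ, (p : ℤ) ∣ x - y → J(x | p ^ (e + 2)) = J(y | p ^ (e + 2)) := by
    intro x y h
    rw [jacobiSym.pow_right, jacobiSym.pow_right, jac_period h]
  unfold ft
  have h1 := sum_split p (p ^ (e + 1)) hp0 (by positivity)
    (fun x : ℤ => ((J(x | p ^ (e + 2)) : ℤ) : ℂ) * ee (k * x / (p ^ (e + 2) : ℕ))) (by
      intro x y h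
      rw [← hsplit] at h
      exact ft_term_period (a := fun x => J(x | p ^ (e + 2))) (by positivity)
        (fun x y h => hper x y ((dvd_pow_self (p : ℤ) (show e + 2 ≠ 0 by omega)).trans (by push_cast at h; exact h))) k x y h)
  rw [← hsplit] at h1
  simp only [Int.cast_natCast] at h1
  rw [h1]
  have e1 : ∀ y z : ℕ, ((J((y : ℤ) + p * z | p ^ (e + 2)) : ℤ) : ℂ) * ee (k * (((y : ℤ) + p * z : ℤ) : ℝ) / (p ^ (e + 2) : ℕ))
      = ((J((y : ℤ) | p ^ (e + 2)) : ℤ) : ℂ) * ee (k * y / (p ^ (e + 2) : ℕ)) * ee (k * z / (p ^ (e + 1) : ℕ)) := by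
    intro y z
    rw [hper _ y ⟨z, by ring⟩, mul_assoc, ← ee_add]
    congr 2
    push_cast
    field_simp
    ring
  simp_rw [e1, ← mul_sum]
  rw [sum_ee _ (by positivity)]
  push_cast
  split_ifs with h
  · rw [← sum_mul, mul_comm]
    congr 1
    apply sum_congr rfl
    intro y _
    obtain ⟨c, hc⟩ := h
    congr 2
    rw [hc, Int.mul_ediv_cancel_left _ (by positivity)]
    push_cast
    field_simp
    ring
  · simp

lemma ft_jac_pow {p : ℕ} (hp : p.Prime) (hp2 : Odd p) (e : ℕ) (k : ℤ) :
    ft (fun x => J(x | p ^ (e + 2))) (p ^ (e + 2)) k =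
      eps (p ^ (e + 2)) * Real.sqrt ((p ^ (e + 2) : ℕ) : ℝ) * ((bb k (p ^ (e + 2)) - bb k (p ^ e) : ℤ) : ℂ) := by
  have hp0 := hp.pos
  rw [ft_jac_aux hp]
  rcases Nat.even_or_odd' e with ⟨i, rfl | rfl⟩
  · rw [delta_even hp]
    have he : eps (p ^ (2 * i + 2)) = 1 := by
      rw [show p ^ (2 * i + 2) = (p ^ (i + 1)) ^ 2 * 1 by ring, eps_sq_mul hp2.pow]; simp [eps]
    rw [he, show 2 * i + 2 = 2 * (i + 1) by ring, sqrt_pow_even]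
    by_cases h : (p : ℤ) ^ (2 * i + 1) ∣ k
    · simp only [h, if_true]
      obtain ⟨c, hc⟩ := h
      have hc' : k / (p : ℤ) ^ (2 * i + 1) = c := by
        rw [hc, Int.mul_ediv_cancel_left _ (by positivity)]
      have hd : (p : ℤ) ^ (2 * (i + 1)) ∣ k ↔ (p : ℤ) ∣ c := by
        rw [hc, show 2 * (i + 1) = 2 * i + 1 + 1 by ring, pow_succ (p : ℤ) (2 * i + 1)]
        exact mul_dvd_mul_iff_left (by positivity)
      rw [hc']
      have hsum : ∑ y ∈ range p, ((J((y : ℤ) | p ^ (2 * (i + 1))) : ℤ) : ℂ) * ee ((c : ℝ) * y / p) =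
          (if (p : ℤ) ∣ c then (p : ℂ) else 0) - 1 := by
        rw [← sum_ee p hp0 c]
        obtain ⟨q, rfl⟩ : ∃ q, p = q + 1 := ⟨p - 1, by omega⟩
        rw [sum_range_succ', sum_range_succ' (fun x => ee ((c : ℝ) * x / _))]
        have z1 : J(((0 : ℕ) : ℤ) | (q + 1) ^ (2 * (i + 1))) = 0 := by
          rw [show 2 * (i + 1) = 2 * i + 2 by ring, jac_prime_sq hp]; simp
        rw [z1]
        simp only [Nat.cast_zero, Int.cast_zero, mul_zero, zero_div, ee_zero]
        rw [add_sub_cancel_right, zero_mul, add_zero]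
        apply sum_congr rfl
        intro y hy
        have : J(((y + 1 : ℕ) : ℤ) | (q + 1) ^ (2 * (i + 1))) = 1 := by
          rw [show 2 * (i + 1) = 2 * i + 2 by ring, jac_prime_sq hp, if_neg]
          intro h
          have h2 := Nat.le_of_dvd (by omega) (Int.natCast_dvd_natCast.mp h)
          have := mem_range.mp hy
          omega
        rw [this]; simp
      rw [hsum]
      simp only [hd]
      split_ifs <;> push_cast <;> ring
    · have h' : ¬ (p : ℤ) ^ (2 * (i + 1)) ∣ k := fun h' => h ((pow_dvd_pow _ (by omega)).trans h')
      simp [h, h']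
  · rw [delta_odd hp]
    have he : eps (p ^ (2 * i + 1 + 2)) = eps p := by
      rw [show p ^ (2 * i + 1 + 2) = (p ^ (i + 1)) ^ 2 * p by ring, eps_sq_mul hp2.pow]
    rw [he]
    simp only [show 2 * i + 1 + 1 = 2 * i + 2 by ring]
    split_ifs with h
    · have : ∀ y ∈ range p, ((J((y : ℤ) | p ^ (2 * i + 1 + 2)) : ℤ) : ℂ) * ee (((k / (p : ℤ) ^ (2 * i + 2) : ℤ) : ℝ) * y / p) =
        ((J((y : ℤ) | p) : ℤ) : ℂ) * ee (((k / (p : ℤ) ^ (2 * i + 2) : ℤ) : ℝ) * y / p) := by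
        intro y _
        rw [show 2 * i + 1 + 2 = 2 * (i + 1) + 1 by ring, jac_prime_odd]
      rw [sum_congr rfl this, gauss_jac_k hp hp2]
      have hs : Real.sqrt ((p ^ (2 * i + 1 + 2) : ℕ) : ℝ) = p ^ (i + 1) * Real.sqrt p := by
        push_cast
        rw [show (p : ℝ) ^ (2 * i + 1 + 2) = (p ^ (i + 1)) ^ 2 * p by ring, Real.sqrt_mul (by positivity),
          Real.sqrt_sq (by positivity)]
      rw [hs]
      push_cast
      ring
    · simp

/-- multiples of `q` in a sum over `range (q * r)` -/
lemma sum_dvd {q r : ℕ} (hq : 0 < q) (F : ℤ → ℂ) :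
    ∑ x ∈ range (q * r), (if (q : ℤ) ∣ x then F ((x : ℤ) / q) else 0) = ∑ y ∈ range r, F y := by
  rw [← sum_filter]
  symm
  refine sum_bij' (fun y _ => q * y) (fun x _ => x / q) ?_ ?_ ?_ ?_ ?_
  · intro y hy
    simp only [mem_filter, mem_range] at hy ⊢
    exact ⟨Nat.mul_lt_mul_of_pos_left hy hq, by push_cast; exact dvd_mul_right _ _⟩
  · intro x hx
    simp only [mem_filter, mem_range] at hx ⊢
    exact Nat.div_lt_of_lt_mul hx.1
  · intro y _
    exact Nat.mul_div_cancel_left _ hq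
  · intro x hx
    simp only [mem_filter, mem_range] at hx
    exact Nat.mul_div_cancel' (Int.natCast_dvd_natCast.mp hx.2)
  · intro y _
    congr 1
    push_cast
    rw [Int.mul_ediv_cancel_left _ (by positivity)]

lemma ft_pow {p : ℕ} (hp : p.Prime) (hp2 : Odd p) : ∀ (e : ℕ) (k : ℤ),
    ft (fun x => bb x (p ^ e)) (p ^ e) k =
      eps (p ^ e) * Real.sqrt ((p ^ e : ℕ) : ℝ) * ((bb k (p ^ e) : ℤ) : ℂ)
  | 0, k => by simp [ft, bb_one, ee_zero, eps]
  | 1, k => by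
    have hb : ∀ x, bb x p = J(x | p) := bb_squarefree hp.prime.squarefree
    simp only [ft, pow_one, hb]
    exact gauss_jac_k hp hp2 k
  | (e + 2), k => by
    have ih := ft_pow hp hp2 e k
    have hp0 := hp.pos
    have hpR : (p : ℝ) ≠ 0 := by positivity
    have hJ := ft_jac_pow hp hp2 e k
    have e1 : ft (fun x => bb x (p ^ (e + 2))) (p ^ (e + 2)) k =
        ft (fun x => J(x | p ^ (e + 2))) (p ^ (e + 2)) k + p * ft (fun x => bb x (p ^ e)) (p ^ e) k := by
      unfold ft
      have h := sum_dvd (q := p ^ 2) (r := p ^ e) (by positivity) (fun y => (p : ℂ) * ((bb y (p ^ e) : ℂ) * ee (k * y / (p ^ e : ℕ))))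
      rw [mul_sum]
      simp only [Int.cast_natCast] at h ⊢
      rw [← h, show p ^ 2 * p ^ e = p ^ (e + 2) by ring, ← sum_add_distrib]
      apply sum_congr rfl
      intro x _
      rw [bb_prime_pow hp]
      push_cast
      split_ifs with hd
      · obtain ⟨c, hc⟩ := hd
        rw [hc, Int.mul_ediv_cancel_left _ (by positivity)]
        have : ee ((k : ℝ) * x / (p : ℝ) ^ (e + 2)) = ee (k * c / p ^ e) := by
          congr 1
          have : (x : ℝ) = p ^ 2 * c := by exact_mod_cast hc
          rw [this]; field_simp
          ring
        rw [this]; ring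
      · simp
    rw [e1, hJ, ih]
    have he : eps (p ^ (e + 2)) = eps (p ^ e) := by
      rw [show p ^ (e + 2) = p ^ 2 * p ^ e by ring, eps_sq_mul hp2]
    rw [he, sqrt_pow_succ2]
    push_cast
    ring

end QT

namespace QT

open Finset NumberTheorySymbols

lemma bb_p_mul {p : ℕ} (hp : p.Prime) (e : ℕ) (x : ℤ) :
    bb (p * x) (p ^ (e + 2)) = if (p : ℤ) ∣ x then (p : ℤ) * bb (x / p) (p ^ e) else 0 := by
  have hp0 : (p : ℤ) ≠ 0 := by exact_mod_cast hp.pos.ne'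
  rw [bb_prime_pow hp, jacobiSym.pow_right, jac_zero_of_dvd hp (dvd_mul_right _ _), zero_pow (by omega), zero_add]
  have hd : (p : ℤ) ^ 2 ∣ p * x ↔ (p : ℤ) ∣ x := by
    rw [sq]; exact mul_dvd_mul_iff_left hp0
  simp only [hd]
  split_ifs with h
  · obtain ⟨c, rfl⟩ := h
    rw [← mul_assoc, ← sq, Int.mul_ediv_cancel_left _ (pow_ne_zero 2 hp0), Int.mul_ediv_cancel_left _ hp0]
  · rfl

lemma ft_pow_p {p : ℕ} (hp : p.Prime) (hp2 : Odd p) (e : ℕ) (k : ℤ) :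
    ft (fun x => bb (p * x) (p ^ e)) (p ^ e) k =
      eps (p ^ e) * Real.sqrt ((p ^ e : ℕ) : ℝ) * ((bb (p * k) (p ^ e) : ℤ) : ℂ) := by
  have hp0 := hp.pos
  have hpR : (p : ℝ) ≠ 0 := by positivity
  match e with
  | 0 => simp [ft, bb_one, ee_zero, eps]
  | 1 =>
    have : ∀ x : ℤ, bb (p * x) (p ^ 1) = 0 := by
      intro x; rw [pow_one, bb_squarefree hp.prime.squarefree, jac_zero_of_dvd hp (dvd_mul_right _ _)]
    simp only [ft, this]; simp
  | e + 2 =>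
    have ih := ft_pow hp hp2 e
    have e1 : ft (fun x => bb (p * x) (p ^ (e + 2))) (p ^ (e + 2)) k =
        ∑ y ∈ range (p ^ (e + 1)), (p : ℂ) * ((bb y (p ^ e) : ℂ) * ee (k * y / (p ^ (e + 1) : ℕ))) := by
      unfold ft
      have h := sum_dvd (q := p) (r := p ^ (e + 1)) hp0 (fun y => (p : ℂ) * ((bb y (p ^ e) : ℂ) * ee (k * y / (p ^ (e + 1) : ℕ))))
      simp only [Int.cast_natCast] at h ⊢
      rw [← h, show p * p ^ (e + 1) = p ^ (e + 2) by ring]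
      apply sum_congr rfl
      intro x _
      rw [bb_p_mul hp]
      split_ifs with hd
      · obtain ⟨c, hc⟩ := hd
        rw [hc, Int.mul_ediv_cancel_left _ (by positivity)]
        have : ee ((k : ℝ) * x / ((p ^ (e + 2) : ℕ) : ℝ)) = ee (k * c / (p ^ (e + 1) : ℕ)) := by
          congr 1
          have : (x : ℝ) = p * c := by exact_mod_cast hc
          rw [this]; push_cast; field_simp; ring
        rw [this]; push_cast; ring
      · simp
    have h2 := sum_split (p ^ e) p (by positivity) hp0
      (fun y : ℤ => (p : ℂ) * ((bb y (p ^ e) : ℂ) * ee (k * y / (p ^ (e + 1) : ℕ)))) (by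
        intro x y h
        rw [show p ^ e * p = p ^ (e + 1) by ring] at h
        rw [ee_period k _ (by positivity) x y h, bb_period (by positivity) (x := x) (y := y)]
        refine Dvd.dvd.trans ?_ h
        push_cast
        exact pow_dvd_pow _ (by omega))
    rw [show p ^ e * p = p ^ (e + 1) by ring] at h2
    simp only [Int.cast_natCast] at h2
    have h3 : ∀ y z : ℕ, (p : ℂ) * ((bb ((y : ℤ) + (p ^ e : ℕ) * z) (p ^ e) : ℂ) * ee (k * (((y : ℤ) + (p ^ e : ℕ) * z : ℤ) : ℝ) / (p ^ (e + 1) : ℕ)))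
      = (p : ℂ) * (bb (y : ℤ) (p ^ e) : ℂ) * ee (k * y / (p ^ (e + 1) : ℕ)) * ee (k * z / p) := by
      intro y z
      rw [bb_period (by positivity) (x := (y : ℤ) + (p ^ e : ℕ) * z) (y := y) ⟨z, by ring⟩, mul_assoc, mul_assoc, ← ee_add]
      congr 3
      push_cast
      field_simp
      ring
    rw [e1, h2]
    simp_rw [h3, ← mul_sum]
    rw [sum_ee p hp0, bb_p_mul hp]
    split_ifs with h
    · obtain ⟨c, rfl⟩ := h
      rw [Int.mul_ediv_cancel_left _ (by positivity)]
      have := ih c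
      unfold ft at this
      have e4 : ∀ y : ℕ, ee (((p * c : ℤ) : ℝ) * y / (p ^ (e + 1) : ℕ)) = ee (c * y / (p ^ e : ℕ)) := by
        intro y; congr 1; push_cast; field_simp; ring
      have e5 : ∀ y : ℕ, (p : ℂ) * (bb (y : ℤ) (p ^ e) : ℂ) * ee (((p * c : ℤ) : ℝ) * y / (p ^ (e + 1) : ℕ)) * p
         = (p : ℂ) ^ 2 * ((bb (y : ℤ) (p ^ e) : ℂ) * ee (c * y / (p ^ e : ℕ))) := by
        intro y; rw [e4]; ring
      simp only [Int.cast_natCast] at this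
      simp_rw [e5, ← mul_sum]
      rw [this]
      have he : eps (p ^ (e + 2)) = eps (p ^ e) := by
        rw [show p ^ (e + 2) = p ^ 2 * p ^ e by ring, eps_sq_mul hp2]
      rw [he, sqrt_pow_succ2]
      push_cast
      ring
    · simp

lemma ft_unit {n : ℕ} (hn : 0 < n) (u : ℤ) (hu : IsCoprime u (n : ℤ)) (M : ℤ)
    (h : ∀ k, ft (fun x => bb (M * x) n) n k = eps n * Real.sqrt n * ((bb (M * k) n : ℤ) : ℂ)) (k : ℤ) :
    ft (fun x => bb (u * M * x) n) n k = eps n * Real.sqrt n * ((bb (u * M * k) n : ℤ) : ℂ) := by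
  have h1 : ∀ x, bb (u * M * x) n = J(u | n) * bb (M * x) n := by
    intro x; rw [mul_assoc, bb_unit hn u _ hu]
  have h2 := h k
  unfold ft at h2 ⊢
  simp only [h1]
  push_cast
  simp_rw [mul_assoc ((J(u | n) : ℤ) : ℂ)]
  rw [← mul_sum, h2]
  ring

theorem ft_main {N : ℕ} (hN : Squarefree N) (n : ℕ) (hn : Odd n) : ∀ k : ℤ,
    ft (fun x => bb (N * x) n) n k = eps n * Real.sqrt n * ((bb (N * k) n : ℤ) : ℂ) := by
  induction n using Nat.recOnPosPrimePosCoprime with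
  | zero => exact absurd hn (by decide)
  | one => intro k; simp [ft, bb_one, ee_zero, eps]
  | prime_pow p e hp he =>
    have hp2 : Odd p := Odd.of_dvd_nat hn (dvd_pow_self p (by omega))
    by_cases hd : p ∣ N
    · obtain ⟨M, rfl⟩ := hd
      have hc : Nat.Coprime p M := Nat.coprime_of_squarefree_mul hN
      intro k
      have := ft_unit (n := p ^ e) (by have := hp.pos; positivity) (M : ℤ)
        (Nat.isCoprime_iff_coprime.mpr (Nat.Coprime.pow_right e hc.symm)) p (ft_pow_p hp hp2 e) k
      rw [mul_comm (M : ℤ)] at this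
      push_cast at this ⊢
      exact this
    · have hc : Nat.Coprime p N := (Nat.Prime.coprime_iff_not_dvd hp).mpr hd
      intro k
      have := ft_unit (n := p ^ e) (by have := hp.pos; positivity) (N : ℤ)
        (Nat.isCoprime_iff_coprime.mpr (Nat.Coprime.pow_right e hc.symm)) 1 (by simpa using ft_pow hp hp2 e) k
      simpa using this
  | coprime a b ha hb hc iha ihb =>
    intro k
    have hao : Odd a := Odd.of_dvd_nat hn (dvd_mul_right _ _)
    have hbo : Odd b := Odd.of_dvd_nat hn (dvd_mul_left _ _)
    rw [ft_crt N (by omega) (by omega) hc, iha hao, ihb hbo, ← eps_mul hao hbo hc, bb_mul (by omega) (by omega) hc]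
    push_cast
    rw [Real.sqrt_mul (by positivity)]
    push_cast
    ring

end QT

namespace QT
open Finset NumberTheorySymbols Filter Topology FourierTransform

/-- functions good enough for Poisson summation -/
def Nice (f : ℝ → ℂ) : Prop := Continuous f ∧ ∃ B : ℝ, (∀ x, ‖f x‖ ≤ B / (1 + x ^ 2)) ∧
  ∀ ξ, ‖𝓕 f ξ‖ ≤ B / (1 + ξ ^ 2)

lemma summable_inv_sq_int (c : ℝ) (hc : 0 < c) : Summable (fun k : ℤ => 1 / (1 + (c * k) ^ 2)) := by
  have h : Summable (fun k : ℤ => 1 / ((k : ℝ)) ^ 2) := by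
    exact Real.summable_one_div_int_pow.mpr (by norm_num)
  have h2 := h.mul_left (1 / c ^ 2)
  refine Summable.of_norm_bounded_eventually h2 ?_
  rw [Filter.eventually_cofinite]
  refine Set.Finite.subset (Set.finite_singleton (0 : ℤ)) ?_
  intro k hk
  by_contra h0
  apply hk
  have h0 : (k : ℝ) ≠ 0 := by exact_mod_cast h0
  have : 0 < (k : ℝ) ^ 2 := by positivity
  rw [Real.norm_of_nonneg (by positivity), one_div_mul_one_div]
  apply one_div_le_one_div_of_le (by positivity)
  nlinarith [mul_pow c (k : ℝ) 2]

lemma Nice.summable {f : ℝ → ℂ} (hf : Nice f) : Summable (fun k : ℤ => f k) := by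
  obtain ⟨_, B, hB, _⟩ := hf
  refine Summable.of_norm_bounded (g := fun k : ℤ => B * (1 / (1 + (1 * (k : ℝ)) ^ 2)))
    ((summable_inv_sq_int 1 one_pos).mul_left B) ?_
  intro k
  refine (hB k).trans (le_of_eq ?_)
  rw [one_mul]; ring

lemma Nice.summable_ft {f : ℝ → ℂ} (hf : Nice f) (q : ℝ) (hq : 0 < q) :
    Summable (fun k : ℤ => 𝓕 f (k / q)) := by
  obtain ⟨_, B, _, hB⟩ := hf
  refine Summable.of_norm_bounded (g := fun k : ℤ => B * (1 / (1 + (q⁻¹ * (k : ℝ)) ^ 2)))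
    ((summable_inv_sq_int q⁻¹ (by positivity)).mul_left B) ?_
  intro k
  refine (hB _).trans (le_of_eq ?_)
  rw [div_eq_inv_mul (k : ℝ)]; ring

lemma fourier_scale (f : ℝ → ℂ) (q : ℝ) (hq : 0 < q) (ξ : ℝ) :
    𝓕 (fun x => f (q * x)) ξ = (1 / q : ℂ) * 𝓕 f (ξ / q) := by
  rw [Real.fourier_real_eq, Real.fourier_real_eq]
  have := MeasureTheory.Measure.integral_comp_mul_left
    (fun v : ℝ => (Real.fourierChar (-(v * (ξ / q)))) • f v) q
  rw [abs_of_pos (inv_pos.mpr hq)] at this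
  rw [show (1 / q : ℂ) * ∫ (v : ℝ), Real.fourierChar (-(v * (ξ / q))) • f v =
    q⁻¹ • ∫ (v : ℝ), Real.fourierChar (-(v * (ξ / q))) • f v by
      rw [Complex.real_smul]; push_cast; rw [one_div], ← this]
  congr 1
  ext x
  rw [show q * x * (ξ / q) = x * ξ by field_simp]

lemma poisson_res {f : ℝ → ℂ} (hf : Nice f) (q : ℕ) (hq : 0 < q) (r : ℝ) :
    ∑' j : ℤ, f (r + q * j) = (1 / q : ℂ) * ∑' k : ℤ, ee (k * r / q) * 𝓕 f (k / q) := by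
  have hq' : (0 : ℝ) < q := by exact_mod_cast hq
  have hq1 : (1 : ℝ) ≤ q := by exact_mod_cast hq
  have hs := hf.summable_ft q hq'
  obtain ⟨hc, B, hB, hB2⟩ := hf
  have h := Real.tsum_eq_tsum_fourier_of_rpow_decay_of_summable (f := fun x => f (q * x))
    (by fun_prop) (b := 2) (by norm_num) ?_ ?_ (r / q)
  · have e1 : ∀ n : ℤ, f (q * (r / q + n)) = f (r + q * n) := by
      intro n; congr 1; field_simp
    simp_rw [e1] at h
    rw [h, ← tsum_mul_left]
    congr 1
    ext k
    have := fourier_scale f q hq' k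
    push_cast at this
    rw [this, fourier_coe_apply]
    unfold ee
    rw [mul_assoc, mul_comm (Complex.exp _)]
    congr 3
    push_cast
    rw [div_one]
    ring
  · have hB0 : 0 ≤ B := by
      have := (norm_nonneg _).trans (hB 0)
      simpa using this
    refine Asymptotics.IsBigO.of_bound B ?_
    have : ∀ᶠ x : ℝ in cocompact ℝ, x ≠ 0 := by
      have := (isCompact_singleton (x := (0 : ℝ))).compl_mem_cocompact
      filter_upwards [this] with x hx using hx
    filter_upwards [this] with x hx
    refine (hB _).trans ?_
    have h2 : |x| ^ (-2 : ℝ) = 1 / x ^ 2 := by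
      rw [Real.rpow_neg (abs_nonneg _), one_div]
      congr 1
      rw [show (2 : ℝ) = ((2 : ℕ) : ℝ) by norm_num, Real.rpow_natCast, sq_abs]
    rw [h2, Real.norm_of_nonneg (by positivity), ← mul_one_div]
    have : 0 < x ^ 2 := by positivity
    gcongr
    have : (1 : ℝ) ≤ (q : ℝ) ^ 2 := one_le_pow₀ hq1
    nlinarith [mul_pow (q : ℝ) x 2]
  · have := hs.mul_left (1 / q : ℂ)
    refine this.congr ?_
    intro k
    have := fourier_scale f q hq' k
    push_cast at this
    rw [this]

lemma summable_mul_bounded {ι : Type*} {a f : ι → ℂ} (hf : Summable f) (B : ℝ) (hB : ∀ i, ‖a i‖ ≤ B) :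
    Summable (fun i => a i * f i) := by
  refine Summable.of_norm_bounded (g := fun i => B * ‖f i‖) (hf.norm.mul_left B) ?_
  intro i
  rw [norm_mul]
  gcongr
  exact hB i

lemma periodic_bounded (a : ℤ → ℂ) (q : ℕ) (hq : 0 < q)
    (ha : ∀ x y : ℤ, (q : ℤ) ∣ x - y → a x = a y) : ∃ B : ℝ, ∀ x, ‖a x‖ ≤ B := by
  refine ⟨∑ r ∈ range q, ‖a r‖, fun x => ?_⟩
  have h1 : a x = a (x % q).toNat := by
    apply ha
    rw [Int.toNat_of_nonneg (Int.emod_nonneg _ (by positivity))]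
    exact Int.dvd_self_sub_emod
  rw [h1]
  refine single_le_sum (f := fun r : ℕ => ‖a r‖) (fun _ _ => norm_nonneg _) ?_
  have := Int.emod_lt_of_pos x (show (0 : ℤ) < q by positivity)
  have := Int.emod_nonneg x (show (q : ℤ) ≠ 0 by positivity)
  simp; omega

lemma poisson_per {f : ℝ → ℂ} (hf : Nice f) (a : ℤ → ℂ) (q : ℕ) (hq : 0 < q)
    (ha : ∀ x y : ℤ, (q : ℤ) ∣ x - y → a x = a y) :
    ∑' d : ℤ, a d * f d =
      (1 / q : ℂ) * ∑' k : ℤ, (∑ x ∈ range q, a x * ee (k * x / q)) * 𝓕 f (k / q) := by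
  obtain ⟨B, hB⟩ := periodic_bounded a q hq ha
  rw [tsum_residue q hq _ (summable_mul_bounded hf.summable B hB)]
  have h1 : ∀ r ∈ range q, ∑' j : ℤ, a (r + q * j) * f ((r + q * j : ℤ) : ℝ) =
      (1 / q : ℂ) * ∑' k : ℤ, a r * ee (k * r / q) * 𝓕 f (k / q) := by
    intro r _
    have h2 : ∀ j : ℤ, a (r + q * j) * f ((r + q * j : ℤ) : ℝ) = a r * f ((r : ℝ) + q * j) := by
      intro j
      rw [ha (r + q * j) r (by simp)]; push_cast; rfl
    simp_rw [h2, tsum_mul_left, poisson_res hf q hq r, mul_assoc, tsum_mul_left]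
    ring
  rw [sum_congr rfl h1, ← mul_sum]
  congr 1
  rw [← Summable.tsum_finsetSum]
  · congr 1; ext k; rw [sum_mul]
  · intro r _
    refine summable_mul_bounded (hf.summable_ft q (by positivity)) B ?_
    intro k; rw [norm_mul, norm_ee, mul_one]; exact hB r

lemma ft8 (a : ℤ → ℤ) (c : ℤ → ℂ) (n : ℕ) (hn : Odd n) (σ : ℤ)
    (ha : ∀ x y : ℤ, (n : ℤ) ∣ x - y → a x = a y)
    (hc : ∀ x y : ℤ, (8 : ℤ) ∣ x - y → c x = c y)
    (hσ : ∀ x, a (8 * x) = σ * a x) (k : ℤ) :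
    ∑ x ∈ range (n * 8), (c x * a x) * ee (k * x / (n * 8 : ℕ)) =
      (∑ j ∈ range 8, c (n * j) * ee (k * j / 8)) * (σ * ft a n k) := by
  have hn0 : 0 < n := hn.pos
  have hco : Nat.Coprime n 8 := by
    have : Nat.Coprime n (2 ^ 3) := Nat.Coprime.pow_right 3 (Nat.coprime_two_right.mpr hn)
    simpa using this
  have := sum_crt n 8 hn0 (by norm_num) hco (fun x : ℤ => (c x * a x) * ee (k * x / (n * 8 : ℕ))) (by
    intro x y h
    have h1 : (8 : ℤ) ∣ x - y := dvd_trans ⟨n, by push_cast; ring⟩ h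
    have h2 : (n : ℤ) ∣ x - y := dvd_trans ⟨8, by push_cast; ring⟩ h
    rw [hc x y h1, ha x y h2, ee_period k (n * 8) (by positivity) x y h])
  simp only [Int.cast_natCast] at this
  rw [this, sum_comm, sum_mul]
  apply sum_congr rfl
  intro j _
  unfold ft
  rw [mul_sum, mul_sum]
  apply sum_congr rfl
  intro i _
  rw [hc (i * (8 : ℕ) + j * n) (n * j) (by push_cast; exact ⟨i, by ring⟩),
    ha (i * (8 : ℕ) + j * n) (8 * i) (by push_cast; exact ⟨j, by ring⟩), hσ]
  have : ((k : ℝ) * (((i : ℤ) * (8 : ℕ) + j * n : ℤ) : ℝ) / (n * 8 : ℕ)) = k * j / 8 + k * i / n := by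
    have : (n : ℝ) ≠ 0 := by positivity
    push_cast; field_simp; ring
  rw [this, ee_add]
  push_cast
  ring

lemma poisson8 {f : ℝ → ℂ} (hf : Nice f) (a : ℤ → ℤ) (c : ℤ → ℂ) (n : ℕ) (hn : Odd n) (σ : ℤ)
    (ha : ∀ x y : ℤ, (n : ℤ) ∣ x - y → a x = a y)
    (hc : ∀ x y : ℤ, (8 : ℤ) ∣ x - y → c x = c y)
    (hσ : ∀ x, a (8 * x) = σ * a x) :
    ∑' d : ℤ, (c d * a d) * f d =
      (1 / (n * 8) : ℂ) * ∑' k : ℤ, (∑ j ∈ range 8, c (n * j) * ee (k * j / 8)) * (σ * ft a n k)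
        * 𝓕 f (k / (n * 8)) := by
  have hn0 : 0 < n := hn.pos
  have := poisson_per hf (fun d => c d * a d) (n * 8) (by positivity) (by
    intro x y h
    have h1 : (8 : ℤ) ∣ x - y := dvd_trans ⟨n, by push_cast; ring⟩ h
    have h2 : (n : ℤ) ∣ x - y := dvd_trans ⟨8, by push_cast; ring⟩ h
    rw [hc x y h1, ha x y h2])
  rw [this]
  simp_rw [ft8 a c n hn σ ha hc hσ]
  push_cast
  rfl

end QT

namespace QT
open Finset Filter Topology MeasureTheory
open scoped ContDiff

/-- test functions supported in `[1/4, 3/4]` -/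
def TF (φ : ℝ → ℝ) : Prop := ContDiff ℝ ∞ φ ∧ ∀ u, u ∉ Set.Icc (1/4 : ℝ) (3/4) → φ u = 0

lemma TF.add {φ ψ : ℝ → ℝ} (h : TF φ) (h' : TF ψ) : TF (fun u => φ u + ψ u) :=
  ⟨h.1.add h'.1, fun u hu => by simp [h.2 u hu, h'.2 u hu]⟩

lemma TF.smul {φ : ℝ → ℝ} (h : TF φ) (c : ℝ) : TF (fun u => c * φ u) :=
  ⟨contDiff_const.mul h.1, fun u hu => by simp [h.2 u hu]⟩

lemma TF.mul_id {φ : ℝ → ℝ} (h : TF φ) : TF (fun u => u * φ u) :=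
  ⟨contDiff_id.mul h.1, fun u hu => by simp [h.2 u hu]⟩

lemma TF.deriv_zero {φ : ℝ → ℝ} (h : TF φ) {u : ℝ} (hu : u ∉ Set.Icc (1/4 : ℝ) (3/4)) : deriv φ u = 0 := by
  have : φ =ᶠ[𝓝 u] fun _ => 0 := by
    filter_upwards [isClosed_Icc.isOpen_compl.mem_nhds hu] with v hv using h.2 v hv
  rw [this.deriv_eq]; simp

lemma TF.deriv {φ : ℝ → ℝ} (h : TF φ) : TF (deriv φ) := by
  refine ⟨?_, fun u hu => h.deriv_zero hu⟩
  have := h.1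
  rw [show (∞ : WithTop ℕ∞) = ∞ + 1 by rfl, contDiff_succ_iff_deriv] at this
  exact this.2.2

lemma TF.inv {φ : ℝ → ℝ} (h : TF φ) : TF (fun u => φ u * u⁻¹) := by
  refine ⟨?_, fun u hu => by simp [h.2 u hu]⟩
  rw [contDiff_iff_contDiffAt]
  intro u
  by_cases hu : u = 0
  · have : (fun u => φ u * u⁻¹) =ᶠ[𝓝 u] fun _ => 0 := by
      have hu' : u ∉ Set.Icc (1/4 : ℝ) (3/4) := by rw [hu]; norm_num
      filter_upwards [isClosed_Icc.isOpen_compl.mem_nhds hu'] with v hv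
      simp [h.2 v hv]
    exact contDiffAt_const.congr_of_eventuallyEq this
  · exact h.1.contDiffAt.mul (contDiffAt_inv ℝ hu)

/-- the oscillating integral -/
noncomputable def II (φ : ℝ → ℝ) (P q : ℝ) : ℂ :=
  ∫ u : ℝ, ((φ u * Real.exp (-P / u) : ℝ) : ℂ) * ee (-(q * u))

lemma continuous_ee : Continuous ee := by unfold ee; fun_prop

lemma TF.continuous_core {φ : ℝ → ℝ} (h : TF φ) (P : ℝ) : Continuous (fun u => φ u * Real.exp (-P / u)) := by
  rw [continuous_iff_continuousAt]
  intro u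
  by_cases hu : u = 0
  · have : (fun u => φ u * Real.exp (-P / u)) =ᶠ[𝓝 u] fun _ => 0 := by
      have hu' : u ∉ Set.Icc (1/4 : ℝ) (3/4) := by rw [hu]; norm_num
      filter_upwards [isClosed_Icc.isOpen_compl.mem_nhds hu'] with v hv
      simp [h.2 v hv]
    exact continuousAt_const.congr this.symm
  · have := h.1.continuous
    fun_prop (disch := assumption)

lemma TF.continuous_integrand {φ : ℝ → ℝ} (h : TF φ) (P q : ℝ) :
    Continuous (fun u : ℝ => ((φ u * Real.exp (-P / u) : ℝ) : ℂ) * ee (-(q * u))) := by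
  have := h.continuous_core P
  have := continuous_ee
  fun_prop

lemma TF.compact_supp {φ : ℝ → ℝ} (_h : TF φ) {F : ℝ → ℂ} (hF : ∀ u, u ∉ Set.Icc (1/4 : ℝ) (3/4) → F u = 0) :
    HasCompactSupport F := HasCompactSupport.intro isCompact_Icc hF

lemma TF.integrable_integrand {φ : ℝ → ℝ} (h : TF φ) (P q : ℝ) :
    Integrable (fun u : ℝ => ((φ u * Real.exp (-P / u) : ℝ) : ℂ) * ee (-(q * u))) :=
  (h.continuous_integrand P q).integrable_of_hasCompactSupport
    (h.compact_supp (fun u hu => by simp [h.2 u hu]))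

lemma II_add {φ ψ : ℝ → ℝ} (h : TF φ) (h' : TF ψ) (P q : ℝ) :
    II (fun u => φ u + ψ u) P q = II φ P q + II ψ P q := by
  unfold II
  rw [← integral_add (h.integrable_integrand P q) (h'.integrable_integrand P q)]
  congr 1; ext u; push_cast; ring

lemma II_smul (φ : ℝ → ℝ) (c P q : ℝ) : II (fun u => c * φ u) P q = c * II φ P q := by
  unfold II
  rw [← integral_const_mul]
  congr 1; ext u; push_cast; ring

lemma hasDerivAt_ee (c x : ℝ) : HasDerivAt (fun u : ℝ => ee (c * u)) (2 * Real.pi * Complex.I * c * ee (c * x)) x := by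
  unfold ee
  have h1 : HasDerivAt (fun u : ℝ => (2 * Real.pi * Complex.I * ((c * u : ℝ) : ℂ))) (2 * Real.pi * Complex.I * c) x := by
    have : HasDerivAt (fun u : ℝ => c * u) c x := by simpa using (hasDerivAt_id x).const_mul c
    exact this.ofReal_comp.const_mul _
  have := h1.cexp
  rwa [mul_comm (Complex.exp _)] at this

lemma II_ibp {φ : ℝ → ℝ} (h : TF φ) (P q : ℝ) :
    2 * Real.pi * Complex.I * q * II φ P q =
      II (deriv φ) P q + P * II (fun u => φ u * u⁻¹ * u⁻¹) P q := by
  have hi : Integrable (fun u : ℝ => ((deriv φ u * Real.exp (-P / u) : ℝ) : ℂ) * ee (-(q * u)) +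
      P * (((φ u * u⁻¹ * u⁻¹ * Real.exp (-P / u) : ℝ) : ℂ) * ee (-(q * u)))) :=
    (h.deriv.integrable_integrand P q).add ((h.inv.inv.integrable_integrand P q).const_mul _)
  have hd : ∀ u : ℝ, HasDerivAt (fun u : ℝ => ((φ u * Real.exp (-P / u) : ℝ) : ℂ) * ee (-(q * u)))
     ((((deriv φ u * Real.exp (-P / u) : ℝ) : ℂ) * ee (-(q * u)) +
      P * (((φ u * u⁻¹ * u⁻¹ * Real.exp (-P / u) : ℝ) : ℂ) * ee (-(q * u)))) -
       2 * Real.pi * Complex.I * q * (((φ u * Real.exp (-P / u) : ℝ) : ℂ) * ee (-(q * u)))) u := by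
    intro u
    by_cases hu : u = 0
    · have hu' : u ∉ Set.Icc (1/4 : ℝ) (3/4) := by rw [hu]; norm_num
      have : (fun u : ℝ => ((φ u * Real.exp (-P / u) : ℝ) : ℂ) * ee (-(q * u))) =ᶠ[𝓝 u] fun _ => 0 := by
        filter_upwards [isClosed_Icc.isOpen_compl.mem_nhds hu'] with v hv
        simp [h.2 v hv]
      rw [h.2 u hu', h.deriv_zero hu']
      simp only [zero_mul, Complex.ofReal_zero, mul_zero, add_zero, sub_zero]
      exact (hasDerivAt_const u (0:ℂ)).congr_of_eventuallyEq this
    · have h1 : HasDerivAt φ (deriv φ u) u := (h.1.differentiable (by simp)).differentiableAt.hasDerivAt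
      have h2 : HasDerivAt (fun u : ℝ => Real.exp (-P / u)) (Real.exp (-P / u) * (P * u⁻¹ * u⁻¹)) u := by
        have := ((hasDerivAt_inv hu).const_mul (-P)).exp
        simp only [← div_eq_mul_inv] at this
        convert this using 1
        field_simp
      have h3 := (h1.mul h2).ofReal_comp.mul (hasDerivAt_ee (-q) u)
      simp only [neg_mul] at h3
      refine HasDerivAt.congr_deriv h3 ?_
      simp only [Pi.mul_apply]
      push_cast
      ring
  have h0 := integral_eq_zero_of_hasDerivAt_of_integrable hd
    (hi.sub ((h.integrable_integrand P q).const_mul _)) (h.integrable_integrand P q)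
  rw [integral_sub hi ((h.integrable_integrand P q).const_mul _), integral_const_mul,
    integral_add (h.deriv.integrable_integrand P q) ((h.inv.inv.integrable_integrand P q).const_mul _),
    integral_const_mul] at h0
  unfold II
  linear_combination -h0

lemma II_bound0 {φ : ℝ → ℝ} (h : TF φ) : ∃ C : ℝ, 0 ≤ C ∧ ∀ P q : ℝ, 0 ≤ P →
    ‖II φ P q‖ ≤ C * Real.exp (-(4 / 3 * P)) := by
  have hi : Integrable (fun u => |φ u|) :=
    (h.1.continuous.abs).integrable_of_hasCompactSupport
      (HasCompactSupport.intro (isCompact_Icc (a := (1/4 : ℝ)) (b := 3/4)) (fun u hu => by simp [h.2 u hu]))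
  refine ⟨∫ u, |φ u|, integral_nonneg (fun _ => abs_nonneg _), fun P q hP => ?_⟩
  unfold II
  rw [← integral_mul_const]
  refine norm_integral_le_of_norm_le (hi.mul_const _) (ae_of_all _ fun u => ?_)
  rw [norm_mul, norm_ee, mul_one, Complex.norm_real, norm_mul, Real.norm_eq_abs, Real.norm_eq_abs,
    abs_of_pos (Real.exp_pos _)]
  by_cases hu : u ∈ Set.Icc (1/4 : ℝ) (3/4)
  · gcongr
    have : 0 < u := by linarith [hu.1]
    rw [neg_div, neg_le_neg_iff, le_div_iff₀ this]
    nlinarith [hu.2]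
  · simp [h.2 u hu]

lemma II_bound1 (A : ℕ) : ∀ {φ : ℝ → ℝ} (_ : TF φ), ∃ C : ℝ, 0 ≤ C ∧ ∀ P q : ℝ, 0 ≤ P →
    |q| ^ A * ‖II φ P q‖ ≤ C * (1 + P) ^ A * Real.exp (-(4 / 3 * P)) := by
  induction A with
  | zero => intro φ h; simpa using II_bound0 h
  | succ A ih =>
    intro φ h
    obtain ⟨C1, h1, hC1⟩ := ih h.deriv
    obtain ⟨C2, h2, hC2⟩ := ih h.inv.inv
    refine ⟨C1 + C2, by positivity, fun P q hP => ?_⟩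
    have e1 : |q| * ‖II φ P q‖ ≤ ‖II (deriv φ) P q‖ + P * ‖II (fun u => φ u * u⁻¹ * u⁻¹) P q‖ := by
      have := congrArg norm (II_ibp h P q)
      rw [norm_mul, norm_mul, norm_mul, norm_mul] at this
      simp only [Complex.norm_ofNat, Complex.norm_real, Complex.norm_I, mul_one, Real.norm_eq_abs,
        abs_of_pos Real.pi_pos] at this
      have h3 := norm_add_le (II (deriv φ) P q) (P * II (fun u => φ u * u⁻¹ * u⁻¹) P q)
      rw [norm_mul (P : ℂ), Complex.norm_real, Real.norm_of_nonneg hP] at h3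
      have : |q| * ‖II φ P q‖ ≤ 2 * Real.pi * |q| * ‖II φ P q‖ := by
        have : (1 : ℝ) ≤ 2 * Real.pi := by linarith [Real.pi_gt_three]
        rw [mul_assoc (2 * Real.pi)]
        nlinarith [mul_nonneg (abs_nonneg q) (norm_nonneg (II φ P q))]
      linarith
    calc |q| ^ (A + 1) * ‖II φ P q‖ = |q| ^ A * (|q| * ‖II φ P q‖) := by ring
      _ ≤ |q| ^ A * (‖II (deriv φ) P q‖ + P * ‖II (fun u => φ u * u⁻¹ * u⁻¹) P q‖) := by gcongr
      _ = |q| ^ A * ‖II (deriv φ) P q‖ + P * (|q| ^ A * ‖II (fun u => φ u * u⁻¹ * u⁻¹) P q‖) := by ring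
      _ ≤ C1 * (1 + P) ^ A * Real.exp (-(4 / 3 * P)) + P * (C2 * (1 + P) ^ A * Real.exp (-(4 / 3 * P))) := by
          exact add_le_add (hC1 P q hP) (mul_le_mul_of_nonneg_left (hC2 P q hP) hP)
      _ ≤ (1 + P) * (C1 * (1 + P) ^ A * Real.exp (-(4 / 3 * P))) + (1 + P) * (C2 * (1 + P) ^ A * Real.exp (-(4 / 3 * P))) := by
          have : 0 ≤ C1 * (1 + P) ^ A * Real.exp (-(4 / 3 * P)) := by positivity
          have : 0 ≤ C2 * (1 + P) ^ A * Real.exp (-(4 / 3 * P)) := by positivity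
          nlinarith
      _ = _ := by ring

lemma pow_exp_bound (B : ℕ) : ∃ C : ℝ, 0 ≤ C ∧ ∀ P : ℝ, 0 ≤ P → (1 + P) ^ B * Real.exp (-(1 / 3 * P)) ≤ C := by
  refine ⟨3 ^ B * B.factorial * Real.exp (1 / 3), by positivity, fun P hP => ?_⟩
  have h := Real.pow_div_factorial_le_exp (x := (1 + P) / 3) (by positivity) B
  rw [div_le_iff₀ (by positivity), div_pow, div_le_iff₀ (by positivity)] at h
  calc (1 + P) ^ B * Real.exp (-(1 / 3 * P)) ≤ Real.exp ((1 + P) / 3) * B.factorial * 3 ^ B * Real.exp (-(1 / 3 * P)) := by gcongr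
    _ = 3 ^ B * B.factorial * (Real.exp ((1 + P) / 3) * Real.exp (-(1 / 3 * P))) := by ring
    _ = _ := by rw [← Real.exp_add]; ring_nf

lemma II_bound {φ : ℝ → ℝ} (h : TF φ) (A B : ℕ) : ∃ C : ℝ, 0 ≤ C ∧ ∀ P q : ℝ, 0 ≤ P →
    (1 + |q|) ^ A * ((1 + P) ^ B * ‖II φ P q‖) ≤ C * Real.exp (-P) := by
  obtain ⟨C0, h0, hC0⟩ := II_bound0 h
  obtain ⟨C1, h1, hC1⟩ := II_bound1 A h
  obtain ⟨C2, h2, hC2⟩ := pow_exp_bound (A + B)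
  refine ⟨2 ^ A * (C0 + C1) * C2, by positivity, fun P q hP => ?_⟩
  have e1 : (1 + |q|) ^ A ≤ 2 ^ A * (1 + |q| ^ A) := by
    rcases le_total (|q|) 1 with hq | hq
    · calc (1 + |q|) ^ A ≤ 2 ^ A := by gcongr; linarith
        _ ≤ _ := le_mul_of_one_le_right (by positivity) (by linarith [pow_nonneg (abs_nonneg q) A])
    · calc (1 + |q|) ^ A ≤ (2 * |q|) ^ A := by gcongr; linarith
        _ = 2 ^ A * |q| ^ A := by rw [mul_pow]
        _ ≤ _ := by gcongr; linarith
  have e2 : (1 + |q| ^ A) * ‖II φ P q‖ ≤ (C0 + C1) * (1 + P) ^ A * Real.exp (-(4 / 3 * P)) := by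
    have := hC0 P q hP
    have := hC1 P q hP
    have h3 : (1 : ℝ) ≤ (1 + P) ^ A := one_le_pow₀ (by linarith)
    have : C0 * Real.exp (-(4 / 3 * P)) ≤ C0 * (1 + P) ^ A * Real.exp (-(4 / 3 * P)) := by
      gcongr; exact le_mul_of_one_le_right h0 h3
    nlinarith
  calc (1 + |q|) ^ A * ((1 + P) ^ B * ‖II φ P q‖)
      ≤ 2 ^ A * (1 + |q| ^ A) * ((1 + P) ^ B * ‖II φ P q‖) := by gcongr
    _ = 2 ^ A * (1 + P) ^ B * ((1 + |q| ^ A) * ‖II φ P q‖) := by ring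
    _ ≤ 2 ^ A * (1 + P) ^ B * ((C0 + C1) * (1 + P) ^ A * Real.exp (-(4 / 3 * P))) := by gcongr
    _ = 2 ^ A * (C0 + C1) * ((1 + P) ^ (A + B) * Real.exp (-(1 / 3 * P))) * Real.exp (-P) := by
        rw [show -(4 / 3 * P) = -(1 / 3 * P) + -P by ring, Real.exp_add]; ring
    _ ≤ _ := by gcongr; exact hC2 P hP

end QT

namespace QT
open Finset Filter Topology MeasureTheory
open scoped ContDiff

lemma II_hasDeriv {φ : ℝ → ℝ} (h : TF φ) (α β x : ℝ) (hα : 0 ≤ α) (hx : 0 < x) :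
    HasDerivAt (fun x => II φ (α * x ^ 2) (β / x))
      ((1 / x : ℂ) * (II (fun u => φ u + u * deriv φ u) (α * x ^ 2) (β / x) -
        (α * x ^ 2 : ℝ) * II (fun u => φ u * u⁻¹) (α * x ^ 2) (β / x))) x := by
  set F' : ℝ → ℝ → ℂ := fun x u => (-(2 * α * x) : ℝ) * (((φ u * u⁻¹ * Real.exp (-(α * x ^ 2) / u) : ℝ) : ℂ) * ee (-((β / x) * u)))
    + (2 * Real.pi * Complex.I * (β / x ^ 2 : ℝ)) * (((u * φ u * Real.exp (-(α * x ^ 2) / u) : ℝ) : ℂ) * ee (-((β / x) * u))) with hF'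
  have hs : Set.Ioo (x / 2) (2 * x) ∈ 𝓝 x := Ioo_mem_nhds (by linarith) (by linarith)
  have key := hasDerivAt_integral_of_dominated_loc_of_deriv_le (μ := volume) (x₀ := x)
    (F := fun x u => ((φ u * Real.exp (-(α * x ^ 2) / u) : ℝ) : ℂ) * ee (-((β / x) * u)))
    (bound := fun u => 4 * α * x * |φ u * u⁻¹| + 8 * Real.pi * |β| / x ^ 2 * |u * φ u|) (F' := F') hs
    (Eventually.of_forall fun y => (h.continuous_integrand _ _).aestronglyMeasurable)
    (h.integrable_integrand _ _) ?_ ?_ ?_ ?_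
  · refine HasDerivAt.congr_deriv key.2 ?_
    rw [hF']
    simp only
    rw [integral_add ((h.inv.integrable_integrand _ _).const_mul _) ((h.mul_id.integrable_integrand _ _).const_mul _),
      integral_const_mul, integral_const_mul]
    have e := II_ibp h.mul_id (α * x ^ 2) (β / x)
    have e1 : (fun u => u * φ u * u⁻¹ * u⁻¹) = (fun u => φ u * u⁻¹) := by
      ext u
      by_cases hu : u = 0
      · simp [hu]
      · field_simp
    have e2 : deriv (fun u => u * φ u) = fun u => φ u + u * deriv φ u := by
      ext u
      have h1 : HasDerivAt φ (deriv φ u) u := (h.1.differentiable (by simp)).differentiableAt.hasDerivAt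
      have := ((hasDerivAt_id u).mul h1).deriv
      simp only [id, one_mul] at this
      exact this
    rw [e1, e2] at e
    unfold II at e ⊢
    have hx' : (x : ℂ) ≠ 0 := by exact_mod_cast hx.ne'
    have e3 : ∀ z w : ℂ, (2 * Real.pi * Complex.I * (β / x ^ 2 : ℝ)) * z = (1 / x : ℂ) * (2 * Real.pi * Complex.I * (β / x : ℝ) * z) := by
      intro z _; push_cast; field_simp
    rw [e3 _ 0, e]
    push_cast
    field_simp
    ring
  · have := h.inv.continuous_integrand (α * x ^ 2) (β / x)
    have := h.mul_id.continuous_integrand (α * x ^ 2) (β / x)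
    exact Continuous.aestronglyMeasurable (by rw [hF']; fun_prop)
  · refine ae_of_all _ fun u y hy => ?_
    have hy0 : 0 < y := by linarith [hy.1]
    by_cases hu : u ∈ Set.Icc (1/4 : ℝ) (3/4)
    · have hu0 : 0 < u := by linarith [hu.1]
      have hexp : Real.exp (-(α * y ^ 2) / u) ≤ 1 := by
        rw [Real.exp_le_one_iff, neg_div]
        have : 0 ≤ α * y ^ 2 / u := by positivity
        linarith
      have hexp0 := (Real.exp_pos (-(α * y ^ 2) / u)).le
      rw [hF']
      refine (norm_add_le _ _).trans (add_le_add ?_ ?_)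
      · rw [norm_mul, norm_mul, norm_ee, mul_one, Complex.norm_real, Complex.norm_real, norm_mul (φ u * u⁻¹),
          norm_neg, Real.norm_of_nonneg (show 0 ≤ 2 * α * y by positivity), Real.norm_of_nonneg hexp0, Real.norm_eq_abs]
        have : 2 * α * y ≤ 4 * α * x := by nlinarith [hy.2]
        calc 2 * α * y * (|φ u * u⁻¹| * Real.exp (-(α * y ^ 2) / u)) ≤ 4 * α * x * (|φ u * u⁻¹| * 1) := by gcongr
          _ = _ := by ring
      · rw [norm_mul, norm_mul, norm_mul, norm_mul, norm_mul, norm_ee, Complex.norm_real, Complex.norm_real, Complex.norm_real,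
          norm_mul (u * φ u), Real.norm_of_nonneg hexp0, Complex.norm_I, Real.norm_of_nonneg Real.pi_pos.le, Real.norm_eq_abs, Real.norm_eq_abs,
          abs_div, abs_of_pos (show 0 < y ^ 2 by positivity), Complex.norm_ofNat]
        have h3 : |β| / y ^ 2 ≤ 4 * |β| / x ^ 2 := by
          rw [div_le_div_iff₀ (by positivity) (by positivity)]
          have : x ^ 2 ≤ 4 * y ^ 2 := by nlinarith [hy.1]
          nlinarith [abs_nonneg β]
        calc _ = 2 * Real.pi * (|β| / y ^ 2) * (|u * φ u| * Real.exp (-(α * y ^ 2) / u)) := by ring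
          _ ≤ 2 * Real.pi * (4 * |β| / x ^ 2) * (|u * φ u| * 1) := by gcongr
          _ = _ := by ring
    · rw [hF']; simp [h.2 u hu]
  · have i1 : Integrable (fun u => |φ u * u⁻¹|) :=
      (h.inv.1.continuous.abs).integrable_of_hasCompactSupport
      (HasCompactSupport.intro (isCompact_Icc (a := (1/4 : ℝ)) (b := 3/4)) (fun u hu => by simp [h.2 u hu]))
    have i2 : Integrable (fun u => |u * φ u|) :=
      (h.mul_id.1.continuous.abs).integrable_of_hasCompactSupport
      (HasCompactSupport.intro (isCompact_Icc (a := (1/4 : ℝ)) (b := 3/4)) (fun u hu => by simp [h.2 u hu]))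
    exact (i1.const_mul _).add (i2.const_mul _)
  · refine ae_of_all _ fun u y hy => ?_
    have hy0 : 0 < y := by linarith [hy.1]
    have d1 : HasDerivAt (fun y : ℝ => φ u * Real.exp (-(α * y ^ 2) / u)) (φ u * (Real.exp (-(α * y ^ 2) / u) * (-(2 * α * y) * u⁻¹))) y := by
      have := (((hasDerivAt_pow 2 y).const_mul α).neg.div_const u).exp.const_mul (φ u)
      refine this.congr_deriv ?_
      simp only [Pi.neg_apply, div_eq_mul_inv, Nat.cast_ofNat, Nat.add_one_sub_one, pow_one]
      ring
    have d2 : HasDerivAt (fun y : ℝ => ee (-((β / y) * u))) (2 * Real.pi * Complex.I * (β / y ^ 2 : ℝ) * u * ee (-((β / y) * u))) y := by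
      unfold ee
      have h1 : HasDerivAt (fun y : ℝ => (2 * Real.pi * Complex.I * ((-((β / y) * u) : ℝ) : ℂ))) (2 * Real.pi * Complex.I * ((β / y ^ 2 * u : ℝ) : ℂ)) y := by
        have : HasDerivAt (fun y : ℝ => -((β / y) * u)) (β / y ^ 2 * u) y := by
          have := (((hasDerivAt_inv hy0.ne').const_mul β).mul_const u).neg
          refine this.congr_deriv ?_
          field_simp
        exact this.ofReal_comp.const_mul _
      refine h1.cexp.congr_deriv ?_
      push_cast
      ring
    refine (d1.ofReal_comp.mul d2).congr_deriv ?_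
    rw [hF']
    push_cast
    ring

/-- building block functions -/
noncomputable def EE (φ : ℝ → ℝ) (α β : ℝ) (j s : ℕ) (x : ℝ) : ℂ :=
  if 0 < x then ((x ^ (-(1/2 : ℝ) - s) * (α * x ^ 2) ^ j : ℝ) : ℂ) * II φ (α * x ^ 2) (β / x) else 0

lemma EE_nonpos (φ : ℝ → ℝ) (α β : ℝ) (j s : ℕ) {x : ℝ} (hx : x ≤ 0) : EE φ α β j s x = 0 := by
  unfold EE; rw [if_neg (by linarith)]

lemma EE_bound {φ : ℝ → ℝ} (h : TF φ) (A j s : ℕ) : ∃ C : ℝ, 0 ≤ C ∧ ∀ α β x : ℝ, 0 ≤ α → 0 < x →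
    ‖EE φ α β j s x‖ ≤ C * (x ^ (-(1/2 : ℝ) - s) * ((1 + |β| / x) ^ A)⁻¹ * Real.exp (-(α * x ^ 2))) := by
  obtain ⟨C, hC, hb⟩ := II_bound h A j
  refine ⟨C, hC, fun α β x hα hx => ?_⟩
  have h1 := hb (α * x ^ 2) (β / x) (by positivity)
  rw [abs_div, abs_of_pos hx] at h1
  unfold EE
  rw [if_pos hx, norm_mul, Complex.norm_real, norm_mul, Real.norm_of_nonneg (Real.rpow_nonneg hx.le _),
    Real.norm_of_nonneg (by positivity)]
  have h2 : 0 < 1 + |β| / x := by positivity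
  have h3 : (α * x ^ 2) ^ j * ‖II φ (α * x ^ 2) (β / x)‖ ≤ C * (((1 + |β| / x) ^ A)⁻¹ * Real.exp (-(α * x ^ 2))) := by
    calc (α * x ^ 2) ^ j * ‖II φ (α * x ^ 2) (β / x)‖ ≤ (1 + α * x ^ 2) ^ j * ‖II φ (α * x ^ 2) (β / x)‖ := by
          gcongr; linarith
      _ = ((1 + |β| / x) ^ A)⁻¹ * ((1 + |β| / x) ^ A * ((1 + α * x ^ 2) ^ j * ‖II φ (α * x ^ 2) (β / x)‖)) := by
          field_simp
      _ ≤ ((1 + |β| / x) ^ A)⁻¹ * (C * Real.exp (-(α * x ^ 2))) := by gcongr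
      _ = _ := by ring
  calc x ^ (-(1/2 : ℝ) - s) * (α * x ^ 2) ^ j * ‖II φ (α * x ^ 2) (β / x)‖
      = x ^ (-(1/2 : ℝ) - s) * ((α * x ^ 2) ^ j * ‖II φ (α * x ^ 2) (β / x)‖) := by ring
    _ ≤ x ^ (-(1/2 : ℝ) - s) * (C * (((1 + |β| / x) ^ A)⁻¹ * Real.exp (-(α * x ^ 2)))) := by gcongr
    _ = _ := by ring

lemma EE_hasDeriv_pos {φ : ℝ → ℝ} (h : TF φ) (α β : ℝ) (j s : ℕ) (x : ℝ) (hα : 0 ≤ α) (hx : 0 < x) :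
    HasDerivAt (EE φ α β j s)
      (EE (fun u => (2 * j + 1 / 2 - s) * φ u + u * deriv φ u) α β j (s + 1) x -
        EE (fun u => φ u * u⁻¹) α β (j + 1) (s + 1) x) x := by
  have d1 : HasDerivAt (fun x : ℝ => x ^ (-(1/2 : ℝ) - s) * (α * x ^ 2) ^ j)
      ((-(1/2 : ℝ) - s + 2 * j) * (x ^ (-(1/2 : ℝ) - (s + 1 : ℕ)) * (α * x ^ 2) ^ j)) x := by
    have e1 : HasDerivAt (fun x : ℝ => x ^ (-(1/2 : ℝ) - s)) ((-(1/2 : ℝ) - s) * x ^ (-(1/2 : ℝ) - s - 1)) x :=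
      Real.hasDerivAt_rpow_const (Or.inl hx.ne')
    have e2 : HasDerivAt (fun x : ℝ => (α * x ^ 2) ^ j) (2 * j * (α * x ^ 2) ^ j * x⁻¹) x := by
      have := ((hasDerivAt_pow 2 x).const_mul α).pow j
      refine this.congr_deriv ?_
      rcases j with _ | j
      · simp
      · simp only [Nat.add_sub_cancel, Nat.cast_ofNat]
        push_cast
        field_simp
        ring
    have e3 : x ^ (-(1/2 : ℝ) - (s + 1 : ℕ)) = x ^ (-(1/2 : ℝ) - s) * x⁻¹ := by
      rw [← Real.rpow_neg_one x, ← Real.rpow_add hx]; congr 1; push_cast; ring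
    have e4 : x ^ (-(1/2 : ℝ) - s - 1) = x ^ (-(1/2 : ℝ) - s) * x⁻¹ := by
      rw [← Real.rpow_neg_one x, ← Real.rpow_add hx]; congr 1
    refine (e1.mul e2).congr_deriv ?_
    rw [e3, e4]
    ring
  have d2 := II_hasDeriv h α β x hα hx
  have d3 := d1.ofReal_comp.mul d2
  have e3 : x ^ (-(1/2 : ℝ) - (s + 1 : ℕ)) = x ^ (-(1/2 : ℝ) - s) * x⁻¹ := by
    rw [← Real.rpow_neg_one x, ← Real.rpow_add hx]; congr 1; push_cast; ring
  have hev : EE φ α β j s =ᶠ[𝓝 x] ((fun y : ℝ => ((y ^ (-(1 / 2) - (s:ℝ)) * (α * y ^ 2) ^ j : ℝ) : ℂ)) *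
      fun x => II φ (α * x ^ 2) (β / x)) := by
    filter_upwards [lt_mem_nhds hx] with y hy
    unfold EE; rw [if_pos hy]; rfl
  have d4 := d3.congr_of_eventuallyEq hev
  refine d4.congr_deriv ?_
  unfold EE
  rw [if_pos hx, if_pos hx, e3]
  have f1 : TF (fun u => u * deriv φ u) := h.deriv.mul_id
  rw [II_add h f1, II_add (h.smul _) f1, II_smul]
  have hx' : (x : ℂ) ≠ 0 := by exact_mod_cast hx.ne'
  push_cast
  field_simp
  ring

/-- extension by zero -/
lemma hasDerivAt_ext (F F' : ℝ → ℂ) (hF : ∀ x ≤ 0, F x = 0) (hF' : ∀ x ≤ 0, F' x = 0)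
    (hd : ∀ x > 0, HasDerivAt F (F' x) x) (C : ℝ) (hC : ∀ x > 0, ‖F x‖ ≤ C * x ^ 2) :
    ∀ x, HasDerivAt F (F' x) x := by
  intro x
  rcases lt_trichotomy x 0 with hx | hx | hx
  · rw [hF' x hx.le]
    refine (hasDerivAt_const x (0 : ℂ)).congr_of_eventuallyEq ?_
    filter_upwards [gt_mem_nhds hx] with y hy using hF y (le_of_lt hy)
  · subst hx
    rw [hF' 0 le_rfl, hasDerivAt_iff_isLittleO_nhds_zero]
    simp only [zero_add, hF 0 le_rfl, sub_zero, smul_zero]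
    have : F =O[𝓝 0] fun h : ℝ => h ^ 2 := by
      refine Asymptotics.IsBigO.of_bound |C| (Eventually.of_forall fun y => ?_)
      rcases le_or_gt y 0 with hy | hy
      · rw [hF y hy, norm_zero]; positivity
      · refine (hC y hy).trans ?_
        rw [Real.norm_of_nonneg (by positivity)]
        gcongr; exact le_abs_self C
    refine this.trans_isLittleO ?_
    have := Asymptotics.isLittleO_pow_pow (𝕜 := ℝ) (m := 1) (n := 2) (by norm_num)
    simpa using this
  · exact hd x hx

lemma continuous_ext (F : ℝ → ℂ) (hF : ∀ x ≤ 0, F x = 0)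
    (hd : ∀ x > 0, ContinuousAt F x) (C : ℝ) (hC : ∀ x > 0, ‖F x‖ ≤ C * x) :
    Continuous F := by
  rw [continuous_iff_continuousAt]
  intro x
  rcases lt_trichotomy x 0 with hx | hx | hx
  · refine continuousAt_const (y := (0:ℂ)) |>.congr ?_
    filter_upwards [gt_mem_nhds hx] with y hy using (hF y (le_of_lt hy)).symm
  · subst hx
    unfold ContinuousAt
    rw [hF 0 le_rfl]
    refine squeeze_zero_norm (a := fun y => |C| * |y|) (fun y => ?_) ?_
    · rcases le_or_gt y 0 with hy | hy
      · rw [hF y hy, norm_zero]; positivity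
      · refine (hC y hy).trans ?_
        rw [abs_of_pos hy]; gcongr; exact le_abs_self C
    · have : Continuous (fun y : ℝ => |C| * |y|) := by fun_prop
      have := this.tendsto 0
      simpa using this
  · exact hd x hx

end QT

namespace QT
open Finset Filter Topology MeasureTheory FourierTransform
open scoped ContDiff

lemma inv_pow_le_rpow (y a : ℝ) (A : ℕ) (hy : 0 < y) (ha : 0 ≤ a) (haA : a ≤ A) :
    ((1 + y) ^ A)⁻¹ ≤ y ^ (-a) := by
  rw [Real.rpow_neg hy.le]
  apply inv_anti₀ (by positivity)
  calc y ^ a ≤ (1 + y) ^ a := by gcongr; linarith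
    _ ≤ (1 + y) ^ (A : ℝ) := by gcongr; linarith
    _ = _ := Real.rpow_natCast _ _

lemma EE_pow {φ : ℝ → ℝ} (h : TF φ) (j s : ℕ) (t α β : ℝ) (hα : 0 < α) (hβ : β ≠ 0) (ht : 0 ≤ t) :
    ∃ C : ℝ, 0 ≤ C ∧ ∀ x > 0, ‖EE φ α β j s x‖ ≤ C * x ^ t * Real.exp (-(α * x ^ 2)) := by
  obtain ⟨A, hA⟩ := exists_nat_ge (1 / 2 + s + t)
  obtain ⟨C, hC, hb⟩ := EE_bound h A j s
  have hβ' : 0 < |β| := abs_pos.mpr hβ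
  refine ⟨C * |β| ^ (-(1 / 2 + s + t)), by positivity, fun x hx => ?_⟩
  refine (hb α β x hα.le hx).trans ?_
  have h1 := inv_pow_le_rpow (|β| / x) (1 / 2 + s + t) A (by positivity) (by positivity) hA
  calc C * (x ^ (-(1/2 : ℝ) - s) * ((1 + |β| / x) ^ A)⁻¹ * Real.exp (-(α * x ^ 2)))
      ≤ C * (x ^ (-(1/2 : ℝ) - s) * (|β| / x) ^ (-(1 / 2 + s + t)) * Real.exp (-(α * x ^ 2))) := by gcongr
    _ = _ := by
      rw [Real.div_rpow hβ'.le hx.le, Real.rpow_neg hx.le, div_inv_eq_mul]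
      have : x ^ (-(1/2 : ℝ) - s) * x ^ (1 / 2 + (s : ℝ) + t) = x ^ t := by
        rw [← Real.rpow_add hx]; congr 1; ring
      rw [← this]; ring

lemma EE_hasDeriv {φ : ℝ → ℝ} (h : TF φ) (α β : ℝ) (j s : ℕ) (hα : 0 < α) (hβ : β ≠ 0) (x : ℝ) :
    HasDerivAt (EE φ α β j s)
      (EE (fun u => (2 * j + 1 / 2 - s) * φ u + u * deriv φ u) α β j (s + 1) x -
        EE (fun u => φ u * u⁻¹) α β (j + 1) (s + 1) x) x := by
  obtain ⟨C, hC, hb⟩ := EE_pow h j s 2 α β hα hβ (by norm_num)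
  refine hasDerivAt_ext _ (fun x => EE (fun u => (2 * j + 1 / 2 - s) * φ u + u * deriv φ u) α β j (s + 1) x -
        EE (fun u => φ u * u⁻¹) α β (j + 1) (s + 1) x) (fun x hx => EE_nonpos _ _ _ _ _ hx)
    (fun x hx => by simp only [EE_nonpos _ _ _ _ _ hx, sub_zero])
    (fun x hx => EE_hasDeriv_pos h α β j s x hα.le hx) C (fun x hx => ?_) x
  refine (hb x hx).trans ?_
  rw [show (x : ℝ) ^ (2 : ℝ) = x ^ 2 by exact_mod_cast Real.rpow_natCast x 2]
  refine mul_le_of_le_one_right (by positivity) ?_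
  rw [Real.exp_le_one_iff]
  have : 0 ≤ α * x ^ 2 := by positivity
  linarith

lemma EE_continuous {φ : ℝ → ℝ} (h : TF φ) (α β : ℝ) (j s : ℕ) (hα : 0 < α) (hβ : β ≠ 0) :
    Continuous (EE φ α β j s) :=
  continuous_iff_continuousAt.mpr fun x => (EE_hasDeriv h α β j s hα hβ x).continuousAt

lemma EE_decay {φ : ℝ → ℝ} (h : TF φ) (α β : ℝ) (j s : ℕ) (hα : 0 < α) (hβ : β ≠ 0) :
    ∃ B : ℝ, 0 ≤ B ∧ ∀ x, ‖EE φ α β j s x‖ ≤ B / (1 + x ^ 2) := by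
  obtain ⟨C, hC, hb⟩ := EE_pow h j s 0 α β hα hβ le_rfl
  refine ⟨C * (1 + 1 / α), by positivity, fun x => ?_⟩
  rcases le_or_gt x 0 with hx | hx
  · rw [EE_nonpos _ _ _ _ _ hx, norm_zero]; positivity
  · refine (hb x hx).trans ?_
    rw [Real.rpow_zero, mul_one, mul_div_assoc]
    gcongr
    rw [Real.exp_neg, ← one_div, div_le_div_iff₀ (Real.exp_pos _) (by positivity)]
    have h1 := Real.add_one_le_exp (α * x ^ 2)
    have h2 : (1 + 1 / α) * (α * x ^ 2 + 1) ≤ (1 + 1 / α) * Real.exp (α * x ^ 2) := by gcongr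
    have h3 : (1 + 1 / α) * (α * x ^ 2 + 1) = 1 + x ^ 2 + (α * x ^ 2 + 1 / α) := by field_simp; ring
    have : 0 ≤ α * x ^ 2 + 1 / α := by positivity
    linarith

lemma integrable_of_decay {F : ℝ → ℂ} (hF : Continuous F) (B : ℝ) (hB : ∀ x, ‖F x‖ ≤ B / (1 + x ^ 2)) :
    Integrable F := by
  refine Integrable.mono' (g := fun x => B * (1 + x ^ 2)⁻¹) (integrable_inv_one_add_sq.const_mul B)
    hF.aestronglyMeasurable (ae_of_all _ fun x => ?_)
  rw [← div_eq_mul_inv]; exact hB x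

lemma EE_integrable {φ : ℝ → ℝ} (h : TF φ) (α β : ℝ) (j s : ℕ) (hα : 0 < α) (hβ : β ≠ 0) :
    Integrable (EE φ α β j s) := by
  obtain ⟨B, _, hB⟩ := EE_decay h α β j s hα hβ
  exact integrable_of_decay (EE_continuous h α β j s hα hβ) B hB

lemma fourier_second {g g1 g2 : ℝ → ℂ} (h1 : ∀ x, HasDerivAt g (g1 x) x) (h2 : ∀ x, HasDerivAt g1 (g2 x) x)
    (i0 : Integrable g) (i1 : Integrable g1) (i2 : Integrable g2) (c ξ : ℝ) :
    𝓕 g ξ = (1 / (1 + c ^ 2 * ξ ^ 2) : ℝ) * 𝓕 (fun x => g x - (c ^ 2 / (4 * Real.pi ^ 2) : ℝ) * g2 x) ξ := by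
  have e1 : deriv g = g1 := funext fun x => (h1 x).deriv
  have e2 : deriv g1 = g2 := funext fun x => (h2 x).deriv
  have f1 := congrFun (Real.fourier_deriv i0 (fun x => (h1 x).differentiableAt) (e1 ▸ i1)) ξ
  have f2 := congrFun (Real.fourier_deriv i1 (fun x => (h2 x).differentiableAt) (e2 ▸ i2)) ξ
  rw [e1] at f1
  rw [e2, f1] at f2
  have hsub : 𝓕 (fun x => g x - (c ^ 2 / (4 * Real.pi ^ 2) : ℝ) * g2 x) ξ = 𝓕 g ξ - (c ^ 2 / (4 * Real.pi ^ 2) : ℝ) * 𝓕 g2 ξ := by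
    rw [Real.fourier_real_eq_integral_exp_smul, Real.fourier_real_eq_integral_exp_smul, Real.fourier_real_eq_integral_exp_smul,
      ← integral_const_mul, ← integral_sub]
    · congr 1; ext v; simp only [smul_eq_mul]; ring
    · have := (Real.fourierIntegral_convergent_iff ξ).2 i0
      refine this.congr (ae_of_all _ fun v => ?_)
      simp only [Circle.smul_def, Real.fourierChar_apply]
      congr 2
      simp; ring
    · have := ((Real.fourierIntegral_convergent_iff ξ).2 i2).const_mul ((c ^ 2 / (4 * Real.pi ^ 2) : ℝ) : ℂ)
      refine this.congr (ae_of_all _ fun v => ?_)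
      simp only [Circle.smul_def, Real.fourierChar_apply]
      congr 3
      simp; ring
  rw [hsub, f2]
  have hpi : (Real.pi : ℂ) ≠ 0 := by exact_mod_cast Real.pi_ne_zero
  have hne : ((1 + c ^ 2 * ξ ^ 2 : ℝ) : ℂ) ≠ 0 := by
    exact_mod_cast (by positivity : (1 + c ^ 2 * ξ ^ 2 : ℝ) ≠ 0)
  push_cast at hne ⊢
  simp only [smul_eq_mul]
  field_simp
  ring_nf
  simp only [Complex.I_sq]
  ring

lemma norm_fourier_le (F : ℝ → ℂ) (ξ : ℝ) : ‖𝓕 F ξ‖ ≤ ∫ x, ‖F x‖ := by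
  rw [Real.fourier_real_eq]
  refine (norm_integral_le_integral_norm _).trans (le_of_eq ?_)
  congr 1; ext v; rw [Circle.norm_smul]

lemma fourier_ee (F : ℝ → ℂ) (ξ : ℝ) : 𝓕 F ξ = ∫ v, F v * ee (-(ξ * v)) := by
  rw [Real.fourier_real_eq_integral_exp_smul]
  congr 1; ext v
  rw [smul_eq_mul, mul_comm]
  unfold ee
  congr 2
  push_cast; ring

theorem W_main {φ : ℝ → ℝ} (h : TF φ) (A : ℕ) : ∃ C : ℝ, 0 ≤ C ∧ ∀ α β X : ℝ, 0 < α → β ≠ 0 → 0 < X → X ≤ 8 * |β| →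
    ∃ D : ℝ → ℂ, Continuous D ∧ Integrable D ∧ (∀ x ≤ 0, D x = 0) ∧
      (∀ x > 0, ‖D x‖ ≤ C * (x ^ (-(1/2 : ℝ)) * ((1 + |β| / x) ^ A)⁻¹ * Real.exp (-(α * x ^ 2)))) ∧
      ∀ ξ, 𝓕 (EE φ α β 0 0) ξ = (1 / (1 + X ^ 2 * ξ ^ 2) : ℝ) * ∫ v, D v * ee (-(ξ * v)) := by
  set φ1 : ℝ → ℝ := fun u => (2 * (0 : ℕ) + 1 / 2 - (0 : ℕ)) * φ u + u * deriv φ u with hφ1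
  have h1 : TF φ1 := (h.smul _).add h.deriv.mul_id
  set φ2 : ℝ → ℝ := fun u => φ u * u⁻¹ with hφ2
  have h2 : TF φ2 := h.inv
  set φ11 : ℝ → ℝ := fun u => (2 * (0 : ℕ) + 1 / 2 - (1 : ℕ)) * φ1 u + u * deriv φ1 u with hφ11
  have h11 : TF φ11 := (h1.smul _).add h1.deriv.mul_id
  set φ12 : ℝ → ℝ := fun u => φ1 u * u⁻¹ with hφ12
  have h12 : TF φ12 := h1.inv
  set φ21 : ℝ → ℝ := fun u => (2 * (1 : ℕ) + 1 / 2 - (1 : ℕ)) * φ2 u + u * deriv φ2 u with hφ21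
  have h21 : TF φ21 := (h2.smul _).add h2.deriv.mul_id
  set φ22 : ℝ → ℝ := fun u => φ2 u * u⁻¹ with hφ22
  have h22 : TF φ22 := h2.inv
  obtain ⟨C0, p0, b0⟩ := EE_bound h A 0 0
  obtain ⟨C1, p1, b1⟩ := EE_bound h11 (A + 2) 0 2
  obtain ⟨C2, p2, b2⟩ := EE_bound h12 (A + 2) 1 2
  obtain ⟨C3, p3, b3⟩ := EE_bound h21 (A + 2) 1 2
  obtain ⟨C4, p4, b4⟩ := EE_bound h22 (A + 2) 2 2
  refine ⟨C0 + 64 * (C1 + C2 + C3 + C4), by positivity, fun α β X hα hβ hX hXβ => ?_⟩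
  set g1 : ℝ → ℂ := fun x => EE φ1 α β 0 1 x - EE φ2 α β 1 1 x with hg1
  set g2 : ℝ → ℂ := fun x => (EE φ11 α β 0 2 x - EE φ12 α β 1 2 x) - (EE φ21 α β 1 2 x - EE φ22 α β 2 2 x) with hg2
  have d1 : ∀ x, HasDerivAt (EE φ α β 0 0) (g1 x) x := fun x => EE_hasDeriv h α β 0 0 hα hβ x
  have d2 : ∀ x, HasDerivAt g1 (g2 x) x := fun x =>
    (EE_hasDeriv h1 α β 0 1 hα hβ x).sub (EE_hasDeriv h2 α β 1 1 hα hβ x)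
  have i0 := EE_integrable h α β 0 0 hα hβ
  have i1 : Integrable g1 := (EE_integrable h1 α β 0 1 hα hβ).sub (EE_integrable h2 α β 1 1 hα hβ)
  have i2 : Integrable g2 := ((EE_integrable h11 α β 0 2 hα hβ).sub (EE_integrable h12 α β 1 2 hα hβ)).sub
    ((EE_integrable h21 α β 1 2 hα hβ).sub (EE_integrable h22 α β 2 2 hα hβ))
  have c2 : Continuous g2 := ((EE_continuous h11 α β 0 2 hα hβ).sub (EE_continuous h12 α β 1 2 hα hβ)).sub
    ((EE_continuous h21 α β 1 2 hα hβ).sub (EE_continuous h22 α β 2 2 hα hβ))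
  have c0 := EE_continuous h α β 0 0 hα hβ
  refine ⟨fun x => EE φ α β 0 0 x - (X ^ 2 / (4 * Real.pi ^ 2) : ℝ) * g2 x, c0.sub (continuous_const.mul c2),
    i0.sub (i2.const_mul _), ?_, ?_, ?_⟩
  · intro x hx; simp only [hg2, EE_nonpos _ _ _ _ _ hx]; simp
  · intro x hx
    have hβ' : 0 < |β| := abs_pos.mpr hβ
    set Y := 1 + |β| / x with hY
    have hY0 : 0 < Y := by positivity
    set e := Real.exp (-(α * x ^ 2)) with he
    have he0 : 0 < e := Real.exp_pos _
    have hpow : x ^ (-(1/2 : ℝ) - (2 : ℕ)) = x ^ (-(1/2 : ℝ)) * (x ^ 2)⁻¹ := by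
      rw [← Real.rpow_natCast x 2, ← Real.rpow_neg hx.le, ← Real.rpow_add hx]; rfl
    have hXY : X ^ 2 / (4 * Real.pi ^ 2) * (x ^ 2)⁻¹ ≤ 64 * Y ^ 2 := by
      have q1 : X ^ 2 / (4 * Real.pi ^ 2) ≤ X ^ 2 := by
        apply div_le_self (by positivity)
        nlinarith [Real.pi_gt_three]
      have q2 : X / x ≤ 8 * Y := by
        rw [hY, div_le_iff₀ hx]
        have : |β| / x * x = |β| := by field_simp
        nlinarith
      calc X ^ 2 / (4 * Real.pi ^ 2) * (x ^ 2)⁻¹ ≤ X ^ 2 * (x ^ 2)⁻¹ := by gcongr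
        _ = (X / x) ^ 2 := by field_simp
        _ ≤ (8 * Y) ^ 2 := by gcongr
        _ = _ := by ring
    have hg2b : ‖g2 x‖ ≤ (C1 + C2 + C3 + C4) * (x ^ (-(1/2 : ℝ)) * (x ^ 2)⁻¹ * (Y ^ (A + 2))⁻¹ * e) := by
      have q1 := b1 α β x hα.le hx
      have q2 := b2 α β x hα.le hx
      have q3 := b3 α β x hα.le hx
      have q4 := b4 α β x hα.le hx
      rw [hpow] at q1 q2 q3 q4
      calc ‖g2 x‖ ≤ (‖EE φ11 α β 0 2 x‖ + ‖EE φ12 α β 1 2 x‖) + (‖EE φ21 α β 1 2 x‖ + ‖EE φ22 α β 2 2 x‖) :=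
            (norm_sub_le _ _).trans (add_le_add (norm_sub_le _ _) (norm_sub_le _ _))
        _ ≤ _ := by linarith
    have q0 := b0 α β x hα.le hx
    rw [Nat.cast_zero, sub_zero] at q0
    refine (norm_sub_le _ _).trans ?_
    rw [norm_mul, Complex.norm_real, Real.norm_of_nonneg (by positivity), add_mul]
    refine add_le_add q0 ?_
    calc X ^ 2 / (4 * Real.pi ^ 2) * ‖g2 x‖ ≤ X ^ 2 / (4 * Real.pi ^ 2) * ((C1 + C2 + C3 + C4) * (x ^ (-(1/2 : ℝ)) * (x ^ 2)⁻¹ * (Y ^ (A + 2))⁻¹ * e)) := by gcongr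
      _ = (X ^ 2 / (4 * Real.pi ^ 2) * (x ^ 2)⁻¹) * ((C1 + C2 + C3 + C4) * (x ^ (-(1/2 : ℝ)) * (Y ^ (A + 2))⁻¹ * e)) := by ring
      _ ≤ (64 * Y ^ 2) * ((C1 + C2 + C3 + C4) * (x ^ (-(1/2 : ℝ)) * (Y ^ (A + 2))⁻¹ * e)) := by gcongr
      _ = _ := by rw [pow_add]; field_simp
  · intro ξ
    rw [fourier_second d1 d2 i0 i1 i2 X ξ, fourier_ee]

lemma EE_nice {φ : ℝ → ℝ} (h : TF φ) (α β : ℝ) (hα : 0 < α) (hβ : β ≠ 0) : Nice (EE φ α β 0 0) := by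
  obtain ⟨C, hC, hW⟩ := W_main h 0
  have hβ' : 0 < |β| := abs_pos.mpr hβ
  set X := 8 * |β| with hX
  have hX0 : 0 < X := by positivity
  obtain ⟨D, hD, hDi, _, _, hF⟩ := hW α β X hα hβ hX0 le_rfl
  obtain ⟨B, hB0, hB⟩ := EE_decay h α β 0 0 hα hβ
  have hI : 0 ≤ ∫ x, ‖D x‖ := integral_nonneg fun _ => norm_nonneg _
  refine ⟨EE_continuous h α β 0 0 hα hβ, B + (1 + 1 / X ^ 2) * ∫ x, ‖D x‖, fun x => ?_, fun ξ => ?_⟩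
  · refine (hB x).trans ?_
    gcongr
    have : 0 ≤ (1 + 1 / X ^ 2) * ∫ x, ‖D x‖ := by positivity
    linarith
  · rw [hF ξ, ← fourier_ee, norm_mul, Complex.norm_real, Real.norm_of_nonneg (by positivity)]
    have h1 := norm_fourier_le D ξ
    have h2 : 1 / (1 + X ^ 2 * ξ ^ 2) ≤ (1 + 1 / X ^ 2) / (1 + ξ ^ 2) := by
      rw [div_le_div_iff₀ (by positivity) (by positivity)]
      have : (1 + 1 / X ^ 2) * (1 + X ^ 2 * ξ ^ 2) = 1 + ξ ^ 2 + (X ^ 2 * ξ ^ 2 + 1 / X ^ 2) := by field_simp; ring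
      rw [this]
      have : 0 ≤ X ^ 2 * ξ ^ 2 + 1 / X ^ 2 := by positivity
      linarith
    calc 1 / (1 + X ^ 2 * ξ ^ 2) * ‖𝓕 D ξ‖ ≤ (1 + 1 / X ^ 2) / (1 + ξ ^ 2) * ∫ x, ‖D x‖ := by gcongr
      _ = ((1 + 1 / X ^ 2) * ∫ x, ‖D x‖) / (1 + ξ ^ 2) := by ring
      _ ≤ _ := by gcongr; linarith

end QT

namespace QT
open Finset Filter Topology MeasureTheory FourierTransform NumberTheorySymbols

lemma core_fourier (φ : ℝ → ℝ) (P q : ℝ) :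
    𝓕 (fun u : ℝ => ((φ u * Real.exp (-P / u) : ℝ) : ℂ)) q = II φ P q := by
  rw [fourier_ee]; rfl

lemma fn_fourier (φ : ℝ → ℝ) (X R ξ : ℝ) (hX : 0 < X) :
    𝓕 (fun y : ℝ => ((φ (y / X) * Real.exp (-R / y) : ℝ) : ℂ)) ξ = X * II φ (R / X) (ξ * X) := by
  have := fourier_scale (fun u : ℝ => ((φ u * Real.exp (-(R / X) / u) : ℝ) : ℂ)) X⁻¹ (by positivity) ξ
  rw [core_fourier] at this
  have e : (fun x : ℝ => ((φ (X⁻¹ * x) * Real.exp (-(R / X) / (X⁻¹ * x)) : ℝ) : ℂ)) =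
      fun y : ℝ => ((φ (y / X) * Real.exp (-R / y) : ℝ) : ℂ) := by
    ext y
    rw [show X⁻¹ * y = y / X by ring, show -(R / X) / (y / X) = -R / y by field_simp]
  rw [e] at this
  rw [this]
  push_cast
  rw [one_div, inv_inv, div_inv_eq_mul]

lemma fn_nice {φ : ℝ → ℝ} (h : TF φ) (X R : ℝ) (hX : 0 < X) (hR : 0 ≤ R) :
    Nice (fun y : ℝ => ((φ (y / X) * Real.exp (-R / y) : ℝ) : ℂ)) := by
  have hc : Continuous (fun y : ℝ => ((φ (y / X) * Real.exp (-R / y) : ℝ) : ℂ)) := by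
    have := h.continuous_core (R / X)
    have h2 : Continuous (fun y : ℝ => φ (y / X) * Real.exp (-(R / X) / (y / X))) :=
      this.comp (continuous_id.div_const X)
    have e : (fun y : ℝ => φ (y / X) * Real.exp (-(R / X) / (y / X))) = fun y : ℝ => φ (y / X) * Real.exp (-R / y) := by
      ext y; rw [show -(R / X) / (y / X) = -R / y by field_simp]
    rw [e] at h2
    exact Complex.continuous_ofReal.comp h2
  have hcs : HasCompactSupport (fun y : ℝ => (1 + y ^ 2) * ‖((φ (y / X) * Real.exp (-R / y) : ℝ) : ℂ)‖) := by
    refine HasCompactSupport.intro (isCompact_Icc (a := X / 4) (b := 3 / 4 * X)) fun y hy => ?_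
    rw [h.2]; · simp
    intro hh
    apply hy
    rw [Set.mem_Icc, le_div_iff₀ hX, div_le_iff₀ hX] at hh
    constructor <;> linarith [hh.1, hh.2]
  obtain ⟨B, hB⟩ := hcs.exists_bound_of_continuous (by fun_prop)
  obtain ⟨C, hC, hC2⟩ := II_bound h 2 0
  have hB0 : 0 ≤ B := (norm_nonneg _).trans (hB 0)
  refine ⟨hc, B + X * C * (1 + 1 / X ^ 2), fun y => ?_, fun ξ => ?_⟩
  · rw [le_div_iff₀ (by positivity), mul_comm]
    have := hB y
    rw [Real.norm_of_nonneg (by positivity)] at this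
    have : 0 ≤ X * C * (1 + 1 / X ^ 2) := by positivity
    linarith
  · rw [fn_fourier φ X R ξ hX, norm_mul, Complex.norm_real, Real.norm_of_nonneg hX.le, le_div_iff₀ (by positivity)]
    have h1 := hC2 (R / X) (ξ * X) (by positivity)
    rw [pow_zero, one_mul] at h1
    have h2 : C * Real.exp (-(R / X)) ≤ C := by
      refine mul_le_of_le_one_right hC ?_
      rw [Real.exp_le_one_iff]
      have : 0 ≤ R / X := by positivity
      linarith
    have h3 : (1 + ξ ^ 2) ≤ (1 + 1 / X ^ 2) * (1 + |ξ * X|) ^ 2 := by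
      have e1 : (1 + |ξ * X|) ^ 2 ≥ 1 + ξ ^ 2 * X ^ 2 := by nlinarith [abs_nonneg (ξ * X), sq_abs (ξ * X)]
      have e2 : (1 + 1 / X ^ 2) * (1 + ξ ^ 2 * X ^ 2) = 1 + ξ ^ 2 + (ξ ^ 2 * X ^ 2 + 1 / X ^ 2) := by field_simp; ring
      have e3 : 0 ≤ ξ ^ 2 * X ^ 2 + 1 / X ^ 2 := by positivity
      calc 1 + ξ ^ 2 ≤ (1 + 1 / X ^ 2) * (1 + ξ ^ 2 * X ^ 2) := by linarith
        _ ≤ _ := by gcongr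
    calc X * ‖II φ (R / X) (ξ * X)‖ * (1 + ξ ^ 2) ≤ X * ‖II φ (R / X) (ξ * X)‖ * ((1 + 1 / X ^ 2) * (1 + |ξ * X|) ^ 2) := by gcongr
      _ = X * (1 + 1 / X ^ 2) * ((1 + |ξ * X|) ^ 2 * ‖II φ (R / X) (ξ * X)‖) := by ring
      _ ≤ X * (1 + 1 / X ^ 2) * C := by gcongr; linarith
      _ ≤ _ := by linarith

/-- exponential test function -/
noncomputable def xf (c : ℝ) (x : ℝ) : ℂ := ((Real.exp (-(2 * Real.pi * c * |x|)) : ℝ) : ℂ)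

lemma fourier_xf (c ξ : ℝ) (hc : 0 < c) :
    𝓕 (xf c) ξ = ((1 / (Real.pi * c) * (1 / (1 + (ξ / c) ^ 2)) : ℝ) : ℂ) := by
  rw [fourier_ee]
  set a : ℂ := -(2 * Real.pi * c) - 2 * Real.pi * Complex.I * ξ with ha
  set b : ℂ := 2 * Real.pi * c - 2 * Real.pi * Complex.I * ξ with hb
  have hpc : 0 < 2 * Real.pi * c := by positivity
  have hare : a.re < 0 := by
    rw [ha]; simp; linarith [hpc]
  have hbre : 0 < b.re := by
    rw [hb]; simp; positivity
  have e1 : ∀ x ∈ Set.Ioi (0 : ℝ), xf c x * ee (-(ξ * x)) = Complex.exp (a * x) := by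
    intro x hx
    unfold xf ee
    rw [abs_of_pos hx, Complex.ofReal_exp, ← Complex.exp_add]
    congr 1; rw [ha]; push_cast; ring
  have e2 : ∀ x ∈ Set.Iic (0 : ℝ), xf c x * ee (-(ξ * x)) = Complex.exp (b * x) := by
    intro x hx
    unfold xf ee
    rw [abs_of_nonpos hx, Complex.ofReal_exp, ← Complex.exp_add]
    congr 1; rw [hb]; push_cast; ring
  have i1 : IntegrableOn (fun x : ℝ => xf c x * ee (-(ξ * x))) (Set.Ioi 0) :=
    (integrableOn_exp_mul_complex_Ioi hare 0).congr_fun (fun x hx => (e1 x hx).symm) measurableSet_Ioi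
  have i2 : IntegrableOn (fun x : ℝ => xf c x * ee (-(ξ * x))) (Set.Iic 0) :=
    (integrableOn_exp_mul_complex_Iic hbre 0).congr_fun (fun x hx => (e2 x hx).symm) measurableSet_Iic
  rw [← intervalIntegral.integral_Iic_add_Ioi i2 i1, setIntegral_congr_fun measurableSet_Ioi e1,
    setIntegral_congr_fun measurableSet_Iic e2, integral_exp_mul_complex_Ioi hare, integral_exp_mul_complex_Iic hbre]
  simp only [Complex.ofReal_zero, mul_zero, Complex.exp_zero]
  have ha0 : a ≠ 0 := fun h => by rw [h] at hare; simp at hare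
  have hb0 : b ≠ 0 := fun h => by rw [h] at hbre; simp at hbre
  have hpi : (Real.pi : ℂ) ≠ 0 := by exact_mod_cast Real.pi_ne_zero
  have hc0 : (c : ℂ) ≠ 0 := by exact_mod_cast hc.ne'
  have hne : ((c ^ 2 + ξ ^ 2 : ℝ) : ℂ) ≠ 0 := by
    exact_mod_cast (by positivity : (c ^ 2 + ξ ^ 2 : ℝ) ≠ 0)
  have hne2 : ((1 + (ξ / c) ^ 2 : ℝ) : ℂ) ≠ 0 := by
    exact_mod_cast (by positivity : (1 + (ξ / c) ^ 2 : ℝ) ≠ 0)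
  have hab : a * b = -4 * Real.pi ^ 2 * (c ^ 2 + ξ ^ 2) := by
    rw [ha, hb]; ring_nf; rw [Complex.I_sq]; ring
  have : 1 / b + -1 / a = (a - b) / (a * b) := by field_simp; ring
  rw [this, hab, show a - b = -4 * Real.pi * c by rw [ha, hb]; ring]
  push_cast at hne hne2 ⊢
  have h3 : (1 : ℂ) + (ξ / c) ^ 2 = (c ^ 2 + ξ ^ 2) / c ^ 2 := by field_simp
  rw [h3]
  field_simp

lemma tsum_exp_nat (y : ℝ) (hy : 0 < y) : Summable (fun d : ℕ => Real.exp (-(y * (d + 1)))) ∧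
    ∑' d : ℕ, Real.exp (-(y * (d + 1))) ≤ 1 / y := by
  have e : ∀ d : ℕ, Real.exp (-(y * (d + 1))) = Real.exp (-y) * Real.exp (-y) ^ d := by
    intro d; rw [← Real.exp_nat_mul, ← Real.exp_add]; congr 1; ring
  have h1 : Real.exp (-y) < 1 := by rw [Real.exp_lt_one_iff]; linarith
  simp_rw [e]
  refine ⟨(summable_geometric_of_lt_one (Real.exp_pos _).le h1).mul_left _, ?_⟩
  rw [tsum_mul_left, tsum_geometric_of_lt_one (Real.exp_pos _).le h1, ← div_eq_mul_inv,
    div_le_div_iff₀ (by linarith) hy, Real.exp_neg]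
  have h2 := Real.add_one_le_exp y
  have h3 := Real.exp_pos y
  have h4 : (Real.exp y)⁻¹ * Real.exp y = 1 := by field_simp
  have h5 : 0 < (Real.exp y)⁻¹ := by positivity
  nlinarith

lemma hasSum_xf (c : ℝ) (hc : 0 < c) : Summable (fun d : ℤ => Real.exp (-(2 * Real.pi * c * |(d : ℝ)|))) ∧
    ∑' d : ℤ, Real.exp (-(2 * Real.pi * c * |(d : ℝ)|)) ≤ 1 + 1 / (Real.pi * c) ∧
    ∑' d : ℤ, (if d = 0 then 0 else Real.exp (-(2 * Real.pi * c * |(d : ℝ)|))) ≤ 1 / (Real.pi * c) := by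
  obtain ⟨hs, hb⟩ := tsum_exp_nat (2 * Real.pi * c) (by positivity)
  have key : HasSum (fun d : ℤ => Real.exp (-(2 * Real.pi * c * |(d : ℝ)|)))
      (∑' d : ℕ, Real.exp (-(2 * Real.pi * c * (d + 1))) + Real.exp (-(2 * Real.pi * c * |((0 : ℤ) : ℝ)|)) + ∑' d : ℕ, Real.exp (-(2 * Real.pi * c * (d + 1)))) := by
    refine HasSum.of_add_one_of_neg_add_one (f := fun d : ℤ => Real.exp (-(2 * Real.pi * c * |(d : ℝ)|))) ?_ ?_
    · refine hs.hasSum.congr_fun ?_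
      intro d; push_cast; rw [abs_of_nonneg (by positivity)]
    · refine hs.hasSum.congr_fun ?_
      intro d; push_cast; rw [abs_of_nonpos (by have : (0:ℝ) ≤ d := by positivity
                                                linarith)]; congr 3; ring
  have h2 : 1 / (2 * Real.pi * c) + 1 / (2 * Real.pi * c) = 1 / (Real.pi * c) := by
    have := Real.pi_ne_zero; field_simp; norm_num
  have h3 : ∑' d : ℤ, Real.exp (-(2 * Real.pi * c * |(d : ℝ)|)) ≤ 1 + 1 / (Real.pi * c) := by
    rw [key.tsum_eq]; simp only [Int.cast_zero, abs_zero, mul_zero, neg_zero, Real.exp_zero]; linarith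
  refine ⟨key.summable, h3, ?_⟩
  have h4 := key.summable.tsum_eq_add_tsum_ite (0 : ℤ)
  simp only [Int.cast_zero, abs_zero, mul_zero, neg_zero, Real.exp_zero] at h4
  linarith

/-- Lorentzian weight -/
noncomputable def om (M : ℝ) (k : ℤ) : ℝ := 1 / (1 + ((k : ℝ) / M) ^ 2)

lemma om_nonneg (M : ℝ) (k : ℤ) : 0 ≤ om M k := by unfold om; positivity

lemma om_summable (M : ℝ) (hM : 0 < M) : Summable (om M) := by
  refine (summable_inv_sq_int M⁻¹ (by positivity)).congr ?_
  intro k; unfold om; rw [div_eq_inv_mul (k : ℝ)]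

lemma xf_nice (c : ℝ) (hc : 0 < c) : Nice (xf c) := by
  refine ⟨by unfold xf; fun_prop, (1 + 1 / c ^ 2) + 1 / (Real.pi * c) * (1 + c ^ 2), fun x => ?_, fun ξ => ?_⟩
  · have hb : 0 ≤ 1 / (Real.pi * c) * (1 + c ^ 2) := by positivity
    unfold xf
    rw [Complex.norm_real, Real.norm_of_nonneg (Real.exp_pos _).le, Real.exp_neg, ← one_div,
      div_le_div_iff₀ (Real.exp_pos _) (by positivity)]
    have h1 := Real.quadratic_le_exp_of_nonneg (x := 2 * Real.pi * c * |x|) (by positivity)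
    have h2 : (2 * Real.pi * c * |x|) ^ 2 / 2 ≥ c ^ 2 * x ^ 2 := by
      rw [mul_pow, mul_pow, sq_abs]
      have : (1 : ℝ) ≤ (2 * Real.pi) ^ 2 / 2 := by nlinarith [Real.pi_gt_three]
      have h0 : 0 ≤ c ^ 2 * x ^ 2 := by positivity
      nlinarith
    have h3 : 1 + c ^ 2 * x ^ 2 ≤ Real.exp (2 * Real.pi * c * |x|) := by
      have : 0 ≤ 2 * Real.pi * c * |x| := by positivity
      linarith
    have h4 : (1 + 1 / c ^ 2) * (1 + c ^ 2 * x ^ 2) = 1 + x ^ 2 + (c ^ 2 * x ^ 2 + 1 / c ^ 2) := by field_simp; ring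
    have h5 : 0 ≤ c ^ 2 * x ^ 2 + 1 / c ^ 2 := by positivity
    have h6 : (1 + 1 / c ^ 2) * (1 + c ^ 2 * x ^ 2) ≤ ((1 + 1 / c ^ 2) + 1 / (Real.pi * c) * (1 + c ^ 2)) * Real.exp (2 * Real.pi * c * |x|) := by
      exact mul_le_mul (le_add_of_nonneg_right (by positivity)) h3 (by positivity) (by positivity)
    linarith
  · rw [fourier_xf c ξ hc, Complex.norm_real, Real.norm_of_nonneg (by positivity)]
    have h1 : 1 / (1 + (ξ / c) ^ 2) ≤ (1 + c ^ 2) / (1 + ξ ^ 2) := by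
      rw [div_le_div_iff₀ (by positivity) (by positivity)]
      have : (1 + c ^ 2) * (1 + (ξ / c) ^ 2) = 1 + ξ ^ 2 + (c ^ 2 + (ξ / c) ^ 2) := by field_simp; ring
      have : 0 ≤ c ^ 2 + (ξ / c) ^ 2 := by positivity
      linarith
    have h2 : 1 / (Real.pi * c) * (1 / (1 + (ξ / c) ^ 2)) ≤ 1 / (Real.pi * c) * ((1 + c ^ 2) / (1 + ξ ^ 2)) := by gcongr
    refine h2.trans ?_
    rw [← mul_div_assoc]
    gcongr
    have : 0 ≤ 1 + 1 / c ^ 2 := by positivity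
    linarith

lemma om_tsum_le (M : ℝ) (hM : 0 < M) : ∑' k : ℤ, om M k ≤ Real.pi * M + 1 := by
  have h := poisson_per (xf_nice M hM) (fun _ => 1) 1 one_pos (fun _ _ _ => rfl)
  simp only [range_one, sum_singleton, one_mul, Nat.cast_zero, Nat.cast_one, mul_zero, div_one, ee_zero, fourier_xf M _ hM, Int.cast_natCast, zero_div] at h
  unfold xf at h
  rw [← Complex.ofReal_tsum, ← Complex.ofReal_tsum] at h
  have h' : ∑' d : ℤ, Real.exp (-(2 * Real.pi * M * |(d : ℝ)|)) = ∑' k : ℤ, 1 / (Real.pi * M) * (1 / (1 + ((k : ℝ) / M) ^ 2)) := by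
    exact_mod_cast h
  rw [tsum_mul_left] at h'
  have hb := (hasSum_xf M hM).2.1
  rw [h'] at hb
  change 1 / (Real.pi * M) * ∑' k : ℤ, om M k ≤ _ at hb
  have hpM : 0 < Real.pi * M := by positivity
  have := mul_le_mul_of_nonneg_left hb hpM.le
  have e1 : Real.pi * M * (1 / (Real.pi * M) * ∑' k : ℤ, om M k) = ∑' k : ℤ, om M k := by field_simp
  have e2 : Real.pi * M * (1 + 1 / (Real.pi * M)) = Real.pi * M + 1 := by field_simp
  linarith

lemma om_tsum_ne (M : ℝ) (hM : 0 < M) : ∑' k : ℤ, (if k = 0 then 0 else om M k) ≤ Real.pi * M := by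
  have h4 := (om_summable M hM).tsum_eq_add_tsum_ite (0 : ℤ)
  have : om M 0 = 1 := by simp [om]
  have := om_tsum_le M hM
  linarith

lemma om_char_bound (a : ℤ → ℤ) (Q : ℕ) (hQ : 0 < Q) (γ : ℂ) (hγ : ‖γ‖ = Real.sqrt Q)
    (ha : ∀ x y : ℤ, (Q : ℤ) ∣ x - y → a x = a y) (hft : ∀ k, ft a Q k = γ * a k)
    (h0 : a 0 = 0) (h1 : ∀ x, |a x| ≤ 1) (M : ℝ) (hM : 0 < M) :
    |∑' k : ℤ, (a k : ℝ) * om M k| ≤ Real.sqrt Q := by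
  have hQ' : (0 : ℝ) < Q := by exact_mod_cast hQ
  set c : ℝ := M / Q with hc
  have hc0 : 0 < c := by positivity
  have h := poisson_per (xf_nice c hc0) (fun x => (a x : ℂ)) Q hQ (fun x y hxy => by simp only [ha x y hxy])
  have e1 : ∀ k : ℤ, (∑ x ∈ range Q, (a x : ℂ) * ee (k * x / Q)) * 𝓕 (xf c) (k / Q) =
      γ * (1 / (Real.pi * c) : ℝ) * (((a k : ℝ) * om M k : ℝ) : ℂ) := by
    intro k
    have := hft k
    unfold ft at this
    rw [this, fourier_xf c _ hc0]
    unfold om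
    rw [show (k : ℝ) / Q / c = k / M by rw [hc]; field_simp]
    push_cast; ring
  simp_rw [e1, tsum_mul_left] at h
  rw [← Complex.ofReal_tsum] at h
  have h2 : ‖∑' d : ℤ, (a d : ℂ) * xf c d‖ ≤ 1 / (Real.pi * c) := by
    refine le_trans ?_ (hasSum_xf c hc0).2.2
    refine tsum_of_norm_bounded (Summable.hasSum ?_) ?_
    · exact Summable.of_nonneg_of_le (fun d => by split_ifs <;> positivity)
        (fun d => by split_ifs; exacts [by positivity, le_rfl]) (hasSum_xf c hc0).1
    · intro d
      split_ifs with hd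
      · rw [hd, h0]; simp
      · unfold xf
        rw [norm_mul, Complex.norm_real, Real.norm_of_nonneg (Real.exp_pos _).le]
        refine mul_le_of_le_one_left (Real.exp_pos _).le ?_
        rw [Complex.norm_intCast]
        exact_mod_cast h1 d
  rw [h, norm_mul, norm_mul, norm_mul, hγ, Complex.norm_real, Complex.norm_real, Real.norm_of_nonneg (show 0 ≤ 1 / (Real.pi * c) by positivity),
    norm_div, norm_one, Complex.norm_natCast, Real.norm_eq_abs] at h2
  have hs : 0 < Real.sqrt Q := Real.sqrt_pos.mpr hQ'
  have hpc : 0 < 1 / (Real.pi * c) := by positivity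
  have h3 : 1 / (Q : ℝ) * (Real.sqrt Q * (1 / (Real.pi * c)) * |∑' k : ℤ, (a k : ℝ) * om M k|) =
     (1 / (Real.pi * c)) * (|∑' k : ℤ, (a k : ℝ) * om M k| / Real.sqrt Q) := by
    nth_rewrite 1 [← Real.mul_self_sqrt hQ'.le]
    field_simp
  rw [h3] at h2
  have h4 := le_of_mul_le_mul_left (h2.trans (mul_one _).symm.le) hpc
  rwa [div_le_one hs] at h4

end QT

namespace QT
open Finset Filter Topology MeasureTheory NumberTheorySymbols

lemma om_scale (M : ℝ) (p : ℕ) (hp : 0 < p) (k : ℤ) : om M (p * k) = om (M / p) k := by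
  unfold om
  have : (p : ℝ) ≠ 0 := by positivity
  congr 3
  push_cast
  rw [div_div_eq_mul_div, mul_comm]

lemma om_mul_summable (M : ℝ) (hM : 0 < M) (a : ℤ → ℝ) (h1 : ∀ x, |a x| ≤ 1) :
    Summable (fun k => a k * om M k) := by
  refine Summable.of_norm_bounded (om_summable M hM) (fun k => ?_)
  rw [Real.norm_eq_abs, abs_mul, abs_of_nonneg (om_nonneg M k)]
  exact mul_le_of_le_one_left (om_nonneg M k) (h1 k)

lemma tsum_multiples (p : ℕ) (hp : 0 < p) (g : ℤ → ℝ) :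
    ∑' k : ℤ, (if (p : ℤ) ∣ k then g k else 0) = ∑' k : ℤ, g (p * k) := by
  have hinj : Function.Injective (fun k : ℤ => (p : ℤ) * k) :=
    fun a b h => mul_left_cancel₀ (by exact_mod_cast hp.ne') h
  rw [← hinj.tsum_eq (f := fun k : ℤ => if (p : ℤ) ∣ k then g k else 0)]
  · refine tsum_congr fun k => ?_
    simp
  · intro k hk
    simp only [Function.mem_support, ne_eq, ite_eq_right_iff, Classical.not_imp] at hk
    obtain ⟨c, hc⟩ := hk.1
    exact ⟨c, hc.symm⟩

open Classical in
lemma sieve_cop (Q : ℕ) (hQ : Squarefree Q) (hQo : Odd Q) (hQ1 : 1 < Q) (f : ℕ) :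
    f ≠ 0 → ∀ M : ℝ, 0 < M →
      |∑' k : ℤ, (if IsCoprime k (f : ℤ) then (J(k | Q) : ℝ) else 0) * om M k| ≤ f * Real.sqrt Q := by
  have hb : ∀ (f : ℕ) (k : ℤ), |(if IsCoprime k (f : ℤ) then (J(k | Q) : ℝ) else 0)| ≤ 1 := by
    intro f k
    split_ifs
    · exact_mod_cast abs_jac_le k Q
    · simp
  induction f using induction_on_primes with
  | zero => intro h; exact absurd rfl h
  | one =>
    intro _ M hM
    simp only [Nat.cast_one, isCoprime_one_right, if_true, one_mul]
    have hft := ft_main (N := 1) squarefree_one Q hQo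
    have hε : ‖eps Q‖ = 1 := by unfold eps; split_ifs <;> simp
    refine om_char_bound (fun k => J(k | Q)) Q (by omega) (eps Q * Real.sqrt Q) ?_ ?_ ?_ ?_ ?_ M hM
    · rw [norm_mul, hε, one_mul, Complex.norm_real, Real.norm_of_nonneg (Real.sqrt_nonneg _)]
    · intro x y h
      rw [← bb_squarefree hQ, ← bb_squarefree hQ, bb_period (by omega) h]
    · intro k
      have := hft k
      simp only [Nat.cast_one, one_mul, bb_squarefree hQ] at this
      exact this
    · show J((0 : ℤ) | Q) = 0
      rw [jacobiSym.zero_left hQ1]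
    · intro x; exact abs_jac_le x Q
  | prime_mul p a hp ih =>
    intro hpa M hM
    have ha : a ≠ 0 := fun h => hpa (by simp [h])
    have hp0 := hp.pos
    have hpM : 0 < M / p := by positivity
    set A : ℤ → ℝ := fun k => if IsCoprime k (a : ℤ) then (J(k | Q) : ℝ) else 0 with hA
    have e0 : ∀ k : ℤ, (if IsCoprime k ((p * a : ℕ) : ℤ) then (J(k | Q) : ℝ) else 0) * om M k =
        A k * om M k - (if (p : ℤ) ∣ k then A k * om M k else 0) := by
      intro k
      have h1 : IsCoprime k (p : ℤ) ↔ ¬ (p : ℤ) ∣ k := by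
        rw [isCoprime_comm]
        exact (Nat.prime_iff_prime_int.mp hp).irreducible.coprime_iff_not_dvd
      have h3 : IsCoprime k ((p * a : ℕ) : ℤ) ↔ ¬ (p : ℤ) ∣ k ∧ IsCoprime k (a : ℤ) := by
        push_cast
        rw [IsCoprime.mul_right_iff, h1]
      simp only [h3]
      by_cases h2 : (p : ℤ) ∣ k
      · simp [h2]
      · simp [h2, hA]
    have s1 := om_mul_summable M hM A (hb a)
    have s2 : Summable (fun k : ℤ => if (p : ℤ) ∣ k then A k * om M k else 0) := by
      have := om_mul_summable M hM (fun k => if (p : ℤ) ∣ k then A k else 0) (fun x => by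
        split_ifs
        · exact hb a x
        · simp)
      refine this.congr fun k => ?_
      split_ifs <;> simp
    simp_rw [e0]
    rw [s1.tsum_sub s2, tsum_multiples p hp0]
    have e1 : ∀ k : ℤ, A (p * k) * om M (p * k) = A p * (A k * om (M / p) k) := by
      intro k
      rw [om_scale M p hp0]
      simp only [hA, IsCoprime.mul_left_iff, jacobiSym.mul_left]
      by_cases h1 : IsCoprime (p : ℤ) (a : ℤ) <;> by_cases h2 : IsCoprime k (a : ℤ) <;> simp [h1, h2]
      ring
    simp_rw [e1, tsum_mul_left]
    have i1 := ih ha M hM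
    have i2 := ih ha (M / p) hpM
    have i3 : |A p| ≤ 1 := hb a p
    have hp2 : (2 : ℝ) ≤ p := by exact_mod_cast hp.two_le
    have i4 : |A p * ∑' k : ℤ, A k * om (M / p) k| ≤ a * Real.sqrt Q := by
      rw [abs_mul]
      exact (mul_le_of_le_one_left (abs_nonneg _) i3).trans i2
    have i5 : 0 ≤ (a : ℝ) * Real.sqrt Q := by positivity
    push_cast
    calc _ ≤ |∑' k : ℤ, A k * om M k| + |A p * ∑' k : ℤ, A k * om (M / p) k| := abs_sub _ _
      _ ≤ 2 * (a * Real.sqrt Q) := by linarith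
      _ ≤ p * (a * Real.sqrt Q) := by gcongr
      _ = _ := by ring

lemma sieve_char (Q : ℕ) (hQo : Odd Q) (hQ : ¬ IsSquare Q) (M : ℝ) (hM : 0 < M) :
    |∑' k : ℤ, (J(k | Q) : ℝ) * om M k| ≤ Real.sqrt Q := by
  classical
  obtain ⟨q, f, h, hq⟩ := Nat.sq_mul_squarefree Q
  have hf : f ≠ 0 := by
    rintro rfl
    simp at h
    rw [← h] at hQo; simp at hQo
  have hqo : Odd q := by rw [← h, Nat.odd_mul] at hQo; exact hQo.2
  have hq1 : 1 < q := by
    have : q ≠ 0 := hq.ne_zero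
    have : q ≠ 1 := by
      rintro rfl
      exact hQ ⟨f, by rw [← h]; ring⟩
    omega
  have hh := sieve_cop q hq hqo hq1 f hf M hM
  have e : Real.sqrt Q = f * Real.sqrt q := by
    rw [← h]; push_cast
    rw [Real.sqrt_mul (by positivity), Real.sqrt_sq (by positivity)]
  rw [e]
  refine le_of_eq_of_le ?_ hh
  congr 1
  refine tsum_congr fun k => ?_
  congr 1
  have : NeZero f := ⟨hf⟩
  have : NeZero q := ⟨hq.ne_zero⟩
  rw [← h, jacobiSym.mul_right, jacobiSym.pow_right]
  split_ifs with h1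
  · rw [jacobiSym.sq_one (Int.isCoprime_iff_gcd_eq_one.mp h1), one_mul]
  · have : J(k | f) = 0 := by
      rw [jacobiSym.eq_zero_iff_not_coprime]
      exact fun h2 => h1 (Int.isCoprime_iff_gcd_eq_one.mpr h2)
    rw [this]; simp

/-- zeta-type constant -/
noncomputable def ZZ (δ : ℝ) : ℝ := ∑' n : ℕ, (n : ℝ) ^ (-(1 + δ))

lemma ZZ_summable {δ : ℝ} (hδ : 0 < δ) : Summable (fun n : ℕ => (n : ℝ) ^ (-(1 + δ))) :=
  Real.summable_nat_rpow.mpr (by linarith)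

lemma ZZ_sum_le {δ : ℝ} (hδ : 0 < δ) (S : Finset ℕ) : ∑ n ∈ S, (n : ℝ) ^ (-(1 + δ)) ≤ ZZ δ :=
  (ZZ_summable hδ).sum_le_tsum S (fun n _ => by positivity)

lemma ZZ_nonneg (δ : ℝ) : 0 ≤ ZZ δ := tsum_nonneg fun n => by positivity

lemma square_param (x y : ℕ) (hx : 0 < x) (h : IsSquare (x * y)) :
    ∃ t : ℕ × ℕ × ℕ, x = t.1 * t.2.1 ^ 2 ∧ y = t.1 * t.2.2 ^ 2 := by
  obtain ⟨s, hs⟩ := h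
  have hg : 0 < Nat.gcd x y := Nat.gcd_pos_of_pos_left _ hx
  obtain ⟨a, b, hab, ha, hb⟩ := Nat.exists_coprime x y
  set g := Nat.gcd x y with hgd
  have h1 : g ∣ s := by
    have : g ^ 2 ∣ s ^ 2 := ⟨a * b, by rw [sq s, ← hs]; nth_rewrite 1 [ha]; nth_rewrite 1 [hb]; ring⟩
    exact (Nat.pow_dvd_pow_iff (by norm_num)).mp this
  obtain ⟨r, hr⟩ := h1
  have h2 : a * b = r ^ 2 := by
    have : g ^ 2 * (a * b) = g ^ 2 * r ^ 2 := by
      calc g ^ 2 * (a * b) = (a * g) * (b * g) := by ring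
        _ = x * y := by rw [← ha, ← hb]
        _ = _ := by rw [hs, hr]; ring
    exact Nat.eq_of_mul_eq_mul_left (by positivity) this
  obtain ⟨c, hc⟩ := exists_associated_pow_of_mul_eq_pow (Nat.isUnit_iff.mpr hab) h2
  obtain ⟨d, hd⟩ := exists_associated_pow_of_mul_eq_pow (Nat.isUnit_iff.mpr (Nat.Coprime.symm hab)) ((mul_comm b a).trans h2)
  rw [associated_iff_eq] at hc hd
  exact ⟨(g, c, d), by rw [hc, mul_comm]; exact ha, by rw [hd, mul_comm]; exact hb⟩

lemma diag_sum {δ : ℝ} (hδ : 0 < δ) (S : Finset ℕ) (hS : ∀ κ ∈ S, 0 < κ) :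
    ∑ p ∈ (S ×ˢ S).filter (fun p => IsSquare (p.1 * p.2)),
      (p.1 : ℝ) ^ (-(1/2 + δ)) * (p.2 : ℝ) ^ (-(1/2 + δ)) ≤ ZZ δ ^ 3 := by
  classical
  have hx : ∀ p : ℕ × ℕ, ∃ t : ℕ × ℕ × ℕ, p ∈ (S ×ˢ S).filter (fun p => IsSquare (p.1 * p.2)) →
      p.1 = t.1 * t.2.1 ^ 2 ∧ p.2 = t.1 * t.2.2 ^ 2 := by
    intro p
    by_cases hp : p ∈ (S ×ˢ S).filter (fun p => IsSquare (p.1 * p.2))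
    · rw [mem_filter, mem_product] at hp
      obtain ⟨t, ht⟩ := square_param p.1 p.2 (hS _ hp.1.1) hp.2
      exact ⟨t, fun _ => ht⟩
    · exact ⟨0, fun h => absurd h hp⟩
  choose t ht using hx
  set P := (S ×ˢ S).filter (fun p => IsSquare (p.1 * p.2)) with hP
  have hinj : Set.InjOn t P := by
    intro p hp p' hp' h
    have h1 := ht p hp
    have h2 := ht p' hp'
    rw [h] at h1
    exact Prod.ext (h1.1.trans h2.1.symm) (h1.2.trans h2.2.symm)
  set G : ℕ → ℝ := fun n => (n : ℝ) ^ (-(1 + δ)) with hG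
  have hG0 : ∀ n, 0 ≤ G n := fun n => by positivity
  have hterm : ∀ p ∈ P, (p.1 : ℝ) ^ (-(1/2 + δ)) * (p.2 : ℝ) ^ (-(1/2 + δ)) ≤
      G (t p).1 * (G (t p).2.1 * G (t p).2.2) := by
    intro p hp
    obtain ⟨h1, h2⟩ := ht p hp
    have hp' := hp
    rw [hP, mem_filter, mem_product] at hp'
    have p1 := hS _ hp'.1.1
    have p2 := hS _ hp'.1.2
    generalize t p = T at h1 h2
    obtain ⟨q, a, b⟩ := T
    simp only at h1 h2 ⊢
    have q0 : 0 < q := by rw [h1] at p1; exact Nat.pos_of_mul_pos_right p1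
    have a0 : 0 < a := Nat.pos_of_ne_zero (by rintro rfl; simp at h1; omega)
    have b0 : 0 < b := Nat.pos_of_ne_zero (by rintro rfl; simp at h2; omega)
    have hqab : (1 : ℝ) ≤ q * (a * b) := by
      have : 1 ≤ q * (a * b) := Nat.succ_le_of_lt (by positivity)
      exact_mod_cast this
    rw [← Real.mul_rpow (by positivity) (by positivity)]
    simp only [hG]
    rw [← Real.mul_rpow (by positivity) (by positivity), ← Real.mul_rpow (by positivity) (by positivity), h1, h2]
    have e1 : (((q * a ^ 2 : ℕ) : ℝ) * ((q * b ^ 2 : ℕ) : ℝ)) = ((q : ℝ) * (a * b)) ^ (2 : ℝ) := by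
      rw [Real.rpow_two]; push_cast; ring
    rw [e1, ← Real.rpow_mul (by positivity)]
    exact Real.rpow_le_rpow_of_exponent_le hqab (by linarith)
  calc _ ≤ ∑ p ∈ P, G (t p).1 * (G (t p).2.1 * G (t p).2.2) := sum_le_sum hterm
    _ = ∑ x ∈ P.image t, G x.1 * (G x.2.1 * G x.2.2) := by
        rw [sum_image hinj]
    _ ≤ ∑ x ∈ ((P.image t).image (fun x => x.1)) ×ˢ (((P.image t).image (fun x => x.2.1)) ×ˢ ((P.image t).image (fun x => x.2.2))), G x.1 * (G x.2.1 * G x.2.2) := by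
        refine sum_le_sum_of_subset_of_nonneg ?_ (fun x _ _ => mul_nonneg (hG0 _) (mul_nonneg (hG0 _) (hG0 _)))
        intro x hx
        rw [mem_product, mem_product]
        exact ⟨mem_image_of_mem _ hx, mem_image_of_mem (fun x : ℕ × ℕ × ℕ => x.2.1) hx, mem_image_of_mem (fun x : ℕ × ℕ × ℕ => x.2.2) hx⟩
    _ = (∑ n ∈ ((P.image t).image (fun x => x.1)), G n) * ((∑ n ∈ ((P.image t).image (fun x => x.2.1)), G n) * (∑ n ∈ ((P.image t).image (fun x => x.2.2)), G n)) := by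
        rw [sum_mul_sum, ← sum_product', sum_mul_sum, ← sum_product']
    _ ≤ ZZ δ * (ZZ δ * ZZ δ) := by
        have h0 := ZZ_nonneg δ
        have hs : ∀ T : Finset ℕ, 0 ≤ ∑ n ∈ T, G n := fun T => sum_nonneg fun n _ => hG0 n
        exact mul_le_mul (ZZ_sum_le hδ _) (mul_le_mul (ZZ_sum_le hδ _) (ZZ_sum_le hδ _) (hs _) h0) (mul_nonneg (hs _) (hs _)) h0
    _ = _ := by ring

end QT

namespace QT
open Finset Filter Topology MeasureTheory NumberTheorySymbols

/-- punctured weight -/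
noncomputable def om' (M : ℝ) (k : ℤ) : ℝ := if k = 0 then 0 else om M k

lemma om'_nonneg (M : ℝ) (k : ℤ) : 0 ≤ om' M k := by
  unfold om'; split_ifs; exacts [le_rfl, om_nonneg M k]

lemma om'_le (M : ℝ) (k : ℤ) : om' M k ≤ om M k := by
  unfold om'; split_ifs; exacts [om_nonneg M k, le_rfl]

lemma om'_summable (M : ℝ) (hM : 0 < M) : Summable (om' M) :=
  Summable.of_nonneg_of_le (om'_nonneg M) (om'_le M) (om_summable M hM)

lemma om'_tsum (M : ℝ) (hM : 0 < M) : ∑' k, om' M k ≤ Real.pi * M := om_tsum_ne M hM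

lemma om'_sum (M : ℝ) (hM : 0 < M) (F : Finset ℤ) : ∑ k ∈ F, om' M k ≤ Real.pi * M :=
  ((om'_summable M hM).sum_le_tsum F (fun k _ => om'_nonneg M k)).trans (om'_tsum M hM)

lemma om'_scale (M : ℝ) (p : ℕ) (hp : 0 < p) (k : ℤ) : om' M (p * k) = om' (M / p) k := by
  unfold om'
  rw [om_scale M p hp]
  simp [hp.ne']

lemma om'_mul_summable (M : ℝ) (hM : 0 < M) (a : ℤ → ℝ) (h1 : ∀ x, |a x| ≤ 1) :
    Summable (fun k => a k * om' M k) := by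
  refine Summable.of_norm_bounded (om'_summable M hM) (fun k => ?_)
  rw [Real.norm_eq_abs, abs_mul, abs_of_nonneg (om'_nonneg M k)]
  exact mul_le_of_le_one_left (om'_nonneg M k) (h1 k)

lemma abs_jac_le_real (k : ℤ) (n : ℕ) : |(J(k | n) : ℝ)| ≤ 1 := by exact_mod_cast abs_jac_le k n

open Classical in
lemma sieve_T (M : ℝ) (hM : 0 < M) (x y : ℕ) (hx : Odd x) (hy : Odd y) :
    |∑' k : ℤ, (J(k | x * y) : ℝ) * om' M k| ≤
      (if IsSquare (x * y) then Real.pi * M else 0) + Real.sqrt x * Real.sqrt y := by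
  by_cases h : IsSquare (x * y)
  · rw [if_pos h]
    have h0 : 0 ≤ Real.sqrt x * Real.sqrt y := by positivity
    have h1 : ‖∑' k : ℤ, (J(k | x * y) : ℝ) * om' M k‖ ≤ ∑' k, om' M k := by
      refine tsum_of_norm_bounded (om'_summable M hM).hasSum fun k => ?_
      rw [Real.norm_eq_abs, abs_mul, abs_of_nonneg (om'_nonneg M k)]
      exact mul_le_of_le_one_left (om'_nonneg M k) (abs_jac_le_real k _)
    rw [Real.norm_eq_abs] at h1
    have := om'_tsum M hM
    linarith
  · rw [if_neg h, zero_add]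
    have h1 := sieve_char (x * y) (hx.mul hy) h M hM
    push_cast at h1
    rw [Real.sqrt_mul (by positivity)] at h1
    refine le_of_eq_of_le ?_ h1
    congr 1
    refine tsum_congr fun k => ?_
    unfold om'
    split_ifs with hk
    · have h2 : 1 < x * y := by
        have : x * y ≠ 1 := fun h1 => h (h1 ▸ IsSquare.one)
        have := hx.pos
        have := hy.pos
        have : 0 < x * y := by positivity
        omega
      rw [hk, jacobiSym.zero_left h2]; simp
    · rfl

open Classical in
lemma second_moment (M : ℝ) (hM : 0 < M) (S : Finset ℕ) (hS : ∀ κ ∈ S, Odd κ) (c : ℕ → ℂ) (F : Finset ℤ) :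
    ∑ k ∈ F, om' M k * ‖∑ κ ∈ S, c κ * (J(k | κ) : ℂ)‖ ^ 2 ≤
      ∑ x ∈ S, ∑ y ∈ S, ‖c x‖ * ‖c y‖ *
        ((if IsSquare (x * y) then Real.pi * M else 0) + Real.sqrt x * Real.sqrt y) := by
  set g : ℤ → ℝ := fun k => om' M k * ‖∑ κ ∈ S, c κ * (J(k | κ) : ℂ)‖ ^ 2 with hg
  have hg0 : ∀ k, 0 ≤ g k := fun k => mul_nonneg (om'_nonneg M k) (by positivity)
  have hS0 : ∀ κ ∈ S, κ ≠ 0 := fun κ h => (hS κ h).pos.ne'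
  have e1 : ∀ k, ((g k : ℝ) : ℂ) = ∑ x ∈ S, ∑ y ∈ S, (c x * (starRingEnd ℂ) (c y)) * (((J(k | x * y) : ℝ) * om' M k : ℝ) : ℂ) := by
    intro k
    simp only [hg]
    push_cast
    rw [← Complex.mul_conj', map_sum, sum_mul_sum, mul_sum]
    refine sum_congr rfl fun x hx => ?_
    rw [mul_sum]
    refine sum_congr rfl fun y hy => ?_
    have : NeZero x := ⟨hS0 x hx⟩
    have : NeZero y := ⟨hS0 y hy⟩
    rw [jacobiSym.mul_right]
    simp only [map_mul, map_intCast]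
    push_cast; ring
  have hs : ∀ x y : ℕ, HasSum (fun k : ℤ => (c x * (starRingEnd ℂ) (c y)) * (((J(k | x * y) : ℝ) * om' M k : ℝ) : ℂ))
      ((c x * (starRingEnd ℂ) (c y)) * ((∑' k : ℤ, (J(k | x * y) : ℝ) * om' M k : ℝ) : ℂ)) := by
    intro x y
    refine HasSum.mul_left _ ?_
    exact_mod_cast (Complex.hasSum_ofReal.mpr (om'_mul_summable M hM _ (fun k => abs_jac_le_real k (x * y))).hasSum)
  have h2 : HasSum (fun k => ((g k : ℝ) : ℂ)) (∑ x ∈ S, ∑ y ∈ S, (c x * (starRingEnd ℂ) (c y)) * ((∑' k : ℤ, (J(k | x * y) : ℝ) * om' M k : ℝ) : ℂ)) := by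
    simp_rw [e1]
    exact hasSum_sum fun x _ => hasSum_sum fun y _ => hs x y
  have h3 : Summable g := by
    have := h2.summable
    exact Complex.summable_ofReal.mp this
  have h4 : ‖∑' k, ((g k : ℝ) : ℂ)‖ ≤ ∑ x ∈ S, ∑ y ∈ S, ‖c x‖ * ‖c y‖ *
        ((if IsSquare (x * y) then Real.pi * M else 0) + Real.sqrt x * Real.sqrt y) := by
    rw [h2.tsum_eq]
    refine (norm_sum_le _ _).trans (sum_le_sum fun x hx => (norm_sum_le _ _).trans (sum_le_sum fun y hy => ?_))
    rw [norm_mul, norm_mul, RCLike.norm_conj, Complex.norm_real]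
    exact mul_le_mul_of_nonneg_left (sieve_T M hM x y (hS x hx) (hS y hy)) (by positivity)
  rw [← Complex.ofReal_tsum, Complex.norm_real, Real.norm_of_nonneg (tsum_nonneg hg0)] at h4
  exact (h3.sum_le_tsum F (fun k _ => hg0 k)).trans h4

noncomputable def CS (δ : ℝ) : ℝ := Real.pi * (1 + ZZ δ) ^ 2

lemma sieve_S3 {δ : ℝ} (hδ : 0 < δ) (M : ℝ) (hM : 0 < M) (S : Finset ℕ) (hS : ∀ κ ∈ S, Odd κ) (c : ℕ → ℂ)
    (F : Finset ℤ) (A B : ℝ) (hA : 0 ≤ A) (hB : 0 ≤ B)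
    (h1 : ∀ κ ∈ S, ‖c κ‖ ≤ A * (κ : ℝ) ^ (-(1/2 + δ))) (h3 : ∀ κ ∈ S, ‖c κ‖ ≤ B * (κ : ℝ) ^ (-(3/2 + δ))) :
    ∑ k ∈ F, om' M k * ‖∑ κ ∈ S, c κ * (J(k | κ) : ℂ)‖ ≤ CS δ * (M * A + Real.sqrt M * B) := by
  classical
  have hZ := ZZ_nonneg δ
  have hpi := Real.pi_gt_three
  set Z := ZZ δ with hZd
  have hS0 : ∀ κ ∈ S, 0 < κ := fun κ h => (hS κ h).pos
  have hsm : ∑ k ∈ F, om' M k * ‖∑ κ ∈ S, c κ * (J(k | κ) : ℂ)‖ ^ 2 ≤ Real.pi * M * A ^ 2 * Z ^ 3 + B ^ 2 * Z ^ 2 := by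
    refine (second_moment M hM S hS c F).trans ?_
    simp_rw [mul_add, sum_add_distrib]
    refine add_le_add ?_ ?_
    · have := diag_sum hδ S hS0
      rw [sum_filter, sum_product] at this
      calc _ ≤ ∑ x ∈ S, ∑ y ∈ S, Real.pi * M * A ^ 2 * (if IsSquare (x * y) then (x : ℝ) ^ (-(1/2 + δ)) * (y : ℝ) ^ (-(1/2 + δ)) else 0) := by
            refine sum_le_sum fun x hx => sum_le_sum fun y hy => ?_
            split_ifs
            · have := mul_le_mul (h1 x hx) (h1 y hy) (norm_nonneg _) (by positivity)
              calc _ ≤ _ := mul_le_mul_of_nonneg_right this (by positivity)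
                _ = _ := by ring
            · simp
        _ = Real.pi * M * A ^ 2 * ∑ x ∈ S, ∑ y ∈ S, (if IsSquare (x * y) then (x : ℝ) ^ (-(1/2 + δ)) * (y : ℝ) ^ (-(1/2 + δ)) else 0) := by
            simp_rw [mul_sum]
        _ ≤ _ := mul_le_mul_of_nonneg_left this (by positivity)
    · have h4 : ∑ x ∈ S, ‖c x‖ * Real.sqrt x ≤ B * Z := by
        calc _ ≤ ∑ x ∈ S, B * (x : ℝ) ^ (-(1 + δ)) := by
              refine sum_le_sum fun x hx => ?_
              have hx0 : (0 : ℝ) < x := by exact_mod_cast hS0 x hx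
              calc _ ≤ B * (x : ℝ) ^ (-(3/2 + δ)) * Real.sqrt x := mul_le_mul_of_nonneg_right (h3 x hx) (Real.sqrt_nonneg _)
                _ = _ := by
                  rw [Real.sqrt_eq_rpow, mul_assoc, ← Real.rpow_add hx0]
                  congr 2; ring
          _ = B * ∑ x ∈ S, (x : ℝ) ^ (-(1 + δ)) := by rw [mul_sum]
          _ ≤ _ := mul_le_mul_of_nonneg_left (ZZ_sum_le hδ S) hB
      calc _ = (∑ x ∈ S, ‖c x‖ * Real.sqrt x) * (∑ x ∈ S, ‖c x‖ * Real.sqrt x) := by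
            rw [sum_mul_sum]
            refine sum_congr rfl fun x hx => sum_congr rfl fun y hy => ?_
            ring
        _ ≤ (B * Z) * (B * Z) := by
            have : 0 ≤ ∑ x ∈ S, ‖c x‖ * Real.sqrt x := sum_nonneg fun x _ => by positivity
            exact mul_le_mul h4 h4 this (by positivity)
        _ = _ := by ring
  have hcs : (∑ k ∈ F, om' M k * ‖∑ κ ∈ S, c κ * (J(k | κ) : ℂ)‖) ^ 2 ≤
      (∑ k ∈ F, om' M k) * ∑ k ∈ F, om' M k * ‖∑ κ ∈ S, c κ * (J(k | κ) : ℂ)‖ ^ 2 := by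
    refine sum_sq_le_sum_mul_sum_of_sq_le_mul F (fun k _ => om'_nonneg M k)
      (fun k _ => mul_nonneg (om'_nonneg M k) (by positivity)) (fun k _ => le_of_eq (by ring))
  have hsqM : Real.sqrt M ^ 2 = M := Real.sq_sqrt hM.le
  have hs0 := Real.sqrt_nonneg M
  refine le_of_sq_le_sq ?_ (by unfold CS; positivity)
  have hbd := mul_le_mul (om'_sum M hM F) hsm (sum_nonneg fun k _ => mul_nonneg (om'_nonneg M k) (by positivity)) (by positivity)
  refine hcs.trans (hbd.trans ?_)
  unfold CS
  rw [← hZd]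
  have hz3 : Z ^ 3 ≤ (1 + Z) ^ 4 := by nlinarith [pow_nonneg hZ 2, pow_nonneg hZ 3, pow_nonneg hZ 4]
  have hz2 : Z ^ 2 ≤ (1 + Z) ^ 4 := by nlinarith [pow_nonneg hZ 2, pow_nonneg hZ 3, pow_nonneg hZ 4]
  have hpp : Real.pi ≤ Real.pi ^ 2 := by nlinarith
  calc Real.pi * M * (Real.pi * M * A ^ 2 * Z ^ 3 + B ^ 2 * Z ^ 2) = Real.pi ^ 2 * (M * A) ^ 2 * Z ^ 3 + Real.pi * (M * B ^ 2) * Z ^ 2 := by ring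
    _ ≤ Real.pi ^ 2 * (M * A) ^ 2 * (1 + Z) ^ 4 + Real.pi ^ 2 * (M * B ^ 2) * (1 + Z) ^ 4 := by gcongr
    _ = Real.pi ^ 2 * (1 + Z) ^ 4 * ((M * A) ^ 2 + (Real.sqrt M * B) ^ 2) := by rw [mul_pow (Real.sqrt M), hsqM]; ring
    _ ≤ Real.pi ^ 2 * (1 + Z) ^ 4 * (M * A + Real.sqrt M * B) ^ 2 := by
        gcongr
        nlinarith [mul_nonneg (mul_nonneg hM.le hA) (mul_nonneg hs0 hB)]
    _ = _ := by ring

end QT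

namespace QT
open Finset Filter Topology MeasureTheory NumberTheorySymbols

open Classical in
lemma bb_eq_Icc {n : ℕ} (hn : 0 < n) (G : ℕ) (hG : n ≤ G) (x : ℤ) :
    bb x n = ∑ g ∈ Icc 1 G, if g ^ 2 ∣ n ∧ ((g : ℤ) ^ 2 ∣ x) then (g : ℤ) * J(x / g ^ 2 | n / g ^ 2) else 0 := by
  unfold bb
  have h1 : ∀ g : ℕ, (if g ^ 2 ∣ n ∧ ((g : ℤ) ^ 2 ∣ x) then (g : ℤ) * J(x / g ^ 2 | n / g ^ 2) else 0) =
      if g ^ 2 ∣ n then (if ((g : ℤ) ^ 2 ∣ x) then (g : ℤ) * J(x / g ^ 2 | n / g ^ 2) else 0) else 0 := by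
    intro g
    rw [ite_and]
  simp_rw [h1]
  have h2 : sqd n = (Icc 1 G).filter (fun g => g ^ 2 ∣ n) := ?_
  · rw [h2, sum_filter]
  ext g
  rw [mem_sqd hn, mem_filter, mem_Icc]
  refine ⟨fun h => ⟨?_, h⟩, fun h => h.2⟩
  have hg : 0 < g := Nat.pos_of_ne_zero (by rintro rfl; simp at h; omega)
  have := Nat.le_of_dvd hn h
  exact ⟨hg, by nlinarith⟩

lemma sqdvd_param {N g : ℕ} (hN : Squarefree N) (hg : 0 < g) :
    ∃ l N' : ℕ, g ≤ l ∧ 0 < N' ∧ (∀ κ, g ^ 2 ∣ N * κ → l ∣ κ) ∧ ∀ κ', N * (l * κ') = g ^ 2 * (N' * κ') := by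
  obtain ⟨h, N', hc, hgh, hNN⟩ := Nat.exists_coprime g N
  set g1 := Nat.gcd g N with hg1
  have hg10 : 0 < g1 := Nat.gcd_pos_of_pos_left _ hg
  have hN0 : 0 < N := Nat.pos_of_ne_zero hN.ne_zero
  have hh : 0 < h := Nat.pos_of_ne_zero (by rintro rfl; simp at hgh; omega)
  have hN' : 0 < N' := Nat.pos_of_ne_zero (by rintro rfl; simp at hNN; omega)
  have hc1 : Nat.Coprime N' g1 := by
    rw [hNN] at hN
    exact Nat.coprime_of_squarefree_mul hN
  refine ⟨g1 * h ^ 2, N', ?_, hN', ?_, ?_⟩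
  · rw [hgh]; nlinarith [Nat.mul_le_mul hg10 (Nat.mul_le_mul hh hh)]
  · intro κ hd
    have h1 : g1 * h ^ 2 ∣ N' * κ := by
      have : g1 * (g1 * h ^ 2) ∣ g1 * (N' * κ) := by
        convert hd using 1
        · rw [hgh]; ring
        · rw [hNN]; ring
      exact Nat.dvd_of_mul_dvd_mul_left hg10 this
    refine Nat.Coprime.dvd_of_dvd_mul_left ?_ h1
    exact Nat.Coprime.mul_left hc1.symm (Nat.Coprime.pow_left 2 hc)
  · intro κ'
    rw [hgh]; nth_rewrite 1 [hNN]; ring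

lemma sieve_g {δ : ℝ} (hδ : 0 < δ) {N : ℕ} (hN : Squarefree N) (g : ℕ) (hg : 0 < g) (M : ℝ) (hM : 0 < M)
    (S : Finset ℕ) (hS : ∀ κ ∈ S, Odd κ) (c : ℕ → ℂ)
    (F : Finset ℤ) (A B : ℝ) (hA : 0 ≤ A) (hB : 0 ≤ B)
    (h1 : ∀ κ ∈ S, ‖c κ‖ ≤ A * (κ : ℝ) ^ (-(1/2 + δ))) (h3 : ∀ κ ∈ S, ‖c κ‖ ≤ B * (κ : ℝ) ^ (-(3/2 + δ))) :
    ∑ m ∈ F, (if (g : ℤ) ^ 2 ∣ m then om' M m * (g * ‖∑ κ ∈ S.filter (fun κ => g ^ 2 ∣ N * κ), c κ * (J(m / g ^ 2 | N * κ / g ^ 2) : ℂ)‖) else 0)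
      ≤ CS δ * (M * A + Real.sqrt M * B) * (g : ℝ) ^ (-(1 + δ)) := by
  classical
  obtain ⟨l, N', hl, hN', hdv, heq⟩ := sqdvd_param hN hg
  have hl0 : 0 < l := by omega
  have hg2 : (0 : ℤ) < (g : ℤ) ^ 2 := by positivity
  have hgr : (1 : ℝ) ≤ g := by exact_mod_cast hg
  have hg0 : (0 : ℝ) < g := by positivity
  set S1 := (S.filter (fun κ => g ^ 2 ∣ N * κ)) with hS1
  set S' := S1.image (fun κ => κ / l) with hS'
  have hS1m : ∀ κ ∈ S1, κ ∈ S ∧ l * (κ / l) = κ := by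
    intro κ hκ
    rw [hS1, mem_filter] at hκ
    exact ⟨hκ.1, Nat.mul_div_cancel' (hdv κ hκ.2)⟩
  have hinj : Set.InjOn (fun κ => κ / l) (S1 : Set ℕ) := by
    intro a ha b hb hab
    rw [← (hS1m a ha).2, ← (hS1m b hb).2]
    simp only at hab
    rw [hab]
  have hS'm : ∀ κ' ∈ S', l * κ' ∈ S := by
    intro κ' hκ
    rw [hS', mem_image] at hκ
    obtain ⟨κ, hκ, rfl⟩ := hκ
    rw [(hS1m κ hκ).2]; exact (hS1m κ hκ).1
  have hS'odd : ∀ κ' ∈ S', Odd κ' := fun κ' h => by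
    have := hS _ (hS'm κ' h)
    rw [Nat.odd_mul] at this
    exact this.2
  set F' := (F.filter (fun m => (g : ℤ) ^ 2 ∣ m)).image (fun m => m / (g : ℤ) ^ 2) with hF'
  have hinjF : Set.InjOn (fun m : ℤ => m / (g : ℤ) ^ 2) ((F.filter (fun m => (g : ℤ) ^ 2 ∣ m)) : Set ℤ) := by
    intro a ha b hb hab
    have ha' := (mem_filter.mp (mem_coe.mp ha)).2
    have hb' := (mem_filter.mp (mem_coe.mp hb)).2
    simp only at hab
    rw [← Int.mul_ediv_cancel' ha', ← Int.mul_ediv_cancel' hb', hab]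
  have hM' : 0 < M / ((g ^ 2 : ℕ) : ℝ) := by positivity
  have inner : ∀ μ : ℤ, ‖∑ κ ∈ S1, c κ * (J(μ | N * κ / g ^ 2) : ℂ)‖ ≤
      ‖∑ κ' ∈ S', c (l * κ') * (J(μ | κ') : ℂ)‖ := by
    intro μ
    have e : ∑ κ ∈ S1, c κ * (J(μ | N * κ / g ^ 2) : ℂ) = (J(μ | N') : ℂ) * ∑ κ' ∈ S', c (l * κ') * (J(μ | κ') : ℂ) := by
      rw [hS', sum_image hinj, mul_sum]
      refine sum_congr rfl fun κ hκ => ?_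
      rw [(hS1m κ hκ).2]
      have h4 : N * κ / g ^ 2 = N' * (κ / l) := by
        conv_lhs => rw [← (hS1m κ hκ).2]
        rw [heq, Nat.mul_div_cancel_left _ (by positivity)]
      rw [h4]
      have : NeZero N' := ⟨hN'.ne'⟩
      have : NeZero (κ / l) := ⟨fun h0 => by
        have h5 := (hS1m κ hκ).2
        rw [h0] at h5
        have := (hS κ (hS1m κ hκ).1).pos
        omega⟩
      rw [jacobiSym.mul_right]; push_cast; ring
    rw [e, norm_mul]
    refine mul_le_of_le_one_left (norm_nonneg _) ?_
    rw [Complex.norm_intCast]; exact abs_jac_le_real μ N'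
  have hscale : ∀ (σ : ℝ) (κ' : ℕ), 0 ≤ σ → ((l * κ' : ℕ) : ℝ) ^ (-σ) ≤ (g : ℝ) ^ (-σ) * (κ' : ℝ) ^ (-σ) := by
    intro σ κ' hσ
    push_cast
    rw [Real.mul_rpow (by positivity) (by positivity)]
    refine mul_le_mul_of_nonneg_right ?_ (by positivity)
    exact Real.rpow_le_rpow_of_nonpos hg0 (by exact_mod_cast hl) (by linarith)
  have main := sieve_S3 hδ (M / ((g ^ 2 : ℕ) : ℝ)) hM' S' hS'odd (fun κ' => c (l * κ')) F'
    (A * (g : ℝ) ^ (-(1/2 + δ))) (B * (g : ℝ) ^ (-(3/2 + δ))) (by positivity) (by positivity)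
    (fun κ' hκ => by
      refine (h1 _ (hS'm κ' hκ)).trans ?_
      rw [mul_assoc]
      exact mul_le_mul_of_nonneg_left (hscale _ _ (by linarith)) hA)
    (fun κ' hκ => by
      refine (h3 _ (hS'm κ' hκ)).trans ?_
      rw [mul_assoc]
      exact mul_le_mul_of_nonneg_left (hscale _ _ (by linarith)) hB)
  have e2 : ∑ m ∈ F, (if (g : ℤ) ^ 2 ∣ m then om' M m * (g * ‖∑ κ ∈ S1, c κ * (J(m / g ^ 2 | N * κ / g ^ 2) : ℂ)‖) else 0)
      ≤ g * ∑ μ ∈ F', om' (M / ((g ^ 2 : ℕ) : ℝ)) μ * ‖∑ κ' ∈ S', c (l * κ') * (J(μ | κ') : ℂ)‖ := by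
    rw [← sum_filter, hF', sum_image hinjF, mul_sum]
    refine sum_le_sum fun m hm => ?_
    have hm' := (mem_filter.mp hm).2
    rw [← om'_scale M (g ^ 2) (by positivity)]
    rw [show (((g ^ 2 : ℕ) : ℤ)) = (g : ℤ) ^ 2 by push_cast; rfl, Int.mul_ediv_cancel' hm']
    have := mul_le_mul_of_nonneg_left (mul_le_mul_of_nonneg_left (inner (m / (g : ℤ) ^ 2)) (Nat.cast_nonneg g)) (om'_nonneg M m)
    refine this.trans (le_of_eq ?_)
    ring
  refine e2.trans ((mul_le_mul_of_nonneg_left main hg0.le).trans ?_)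
  have hCS : 0 ≤ CS δ := by unfold CS; positivity
  have q1 : (g : ℝ) * (M / ((g ^ 2 : ℕ) : ℝ) * (A * (g : ℝ) ^ (-(1/2 + δ)))) ≤ M * A * (g : ℝ) ^ (-(1 + δ)) := by
    have : (g : ℝ) * (M / ((g ^ 2 : ℕ) : ℝ) * (A * (g : ℝ) ^ (-(1/2 + δ)))) = M * A * ((g : ℝ) ^ (-1 : ℝ) * (g : ℝ) ^ (-(1/2 + δ))) := by
      rw [Real.rpow_neg_one]; push_cast; field_simp
    rw [this, ← Real.rpow_add hg0]
    refine mul_le_mul_of_nonneg_left ?_ (by positivity)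
    exact Real.rpow_le_rpow_of_exponent_le hgr (by linarith)
  have q2 : (g : ℝ) * (Real.sqrt (M / ((g ^ 2 : ℕ) : ℝ)) * (B * (g : ℝ) ^ (-(3/2 + δ)))) ≤ Real.sqrt M * B * (g : ℝ) ^ (-(1 + δ)) := by
    have : (g : ℝ) * (Real.sqrt (M / ((g ^ 2 : ℕ) : ℝ)) * (B * (g : ℝ) ^ (-(3/2 + δ)))) = Real.sqrt M * B * (g : ℝ) ^ (-(3/2 + δ)) := by
      rw [Real.sqrt_div hM.le]; push_cast
      rw [Real.sqrt_sq hg0.le]; field_simp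
    rw [this]
    refine mul_le_mul_of_nonneg_left ?_ (by positivity)
    exact Real.rpow_le_rpow_of_exponent_le hgr (by linarith)
  calc _ = CS δ * ((g : ℝ) * (M / ((g ^ 2 : ℕ) : ℝ) * (A * (g : ℝ) ^ (-(1/2 + δ)))) + (g : ℝ) * (Real.sqrt (M / ((g ^ 2 : ℕ) : ℝ)) * (B * (g : ℝ) ^ (-(3/2 + δ))))) := by ring
    _ ≤ CS δ * (M * A * (g : ℝ) ^ (-(1 + δ)) + Real.sqrt M * B * (g : ℝ) ^ (-(1 + δ))) :=
        mul_le_mul_of_nonneg_left (add_le_add q1 q2) hCS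
    _ = _ := by ring

lemma sieve_S4 {δ : ℝ} (hδ : 0 < δ) {N : ℕ} (hN : Squarefree N) (M : ℝ) (hM : 0 < M)
    (S : Finset ℕ) (hS : ∀ κ ∈ S, Odd κ) (c : ℕ → ℂ)
    (F : Finset ℤ) (A B : ℝ) (hA : 0 ≤ A) (hB : 0 ≤ B)
    (h1 : ∀ κ ∈ S, ‖c κ‖ ≤ A * (κ : ℝ) ^ (-(1/2 + δ))) (h3 : ∀ κ ∈ S, ‖c κ‖ ≤ B * (κ : ℝ) ^ (-(3/2 + δ))) :
    ∑ m ∈ F, om' M m * ‖∑ κ ∈ S, c κ * (bb m (N * κ) : ℂ)‖ ≤ CS δ * ZZ δ * (M * A + Real.sqrt M * B) := by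
  classical
  have hN0 : 0 < N := Nat.pos_of_ne_zero hN.ne_zero
  set G := N * ∑ κ ∈ S, κ with hG
  have hGκ : ∀ κ ∈ S, N * κ ≤ G := fun κ hκ =>
    Nat.mul_le_mul_left N (single_le_sum (f := fun κ => κ) (fun _ _ => Nat.zero_le _) hκ)
  have e1 : ∀ m : ℤ, om' M m * ‖∑ κ ∈ S, c κ * (bb m (N * κ) : ℂ)‖ ≤ ∑ g ∈ Icc 1 G,
      (if (g : ℤ) ^ 2 ∣ m then om' M m * (g * ‖∑ κ ∈ S.filter (fun κ => g ^ 2 ∣ N * κ), c κ * (J(m / g ^ 2 | N * κ / g ^ 2) : ℂ)‖) else 0) := by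
    intro m
    have e2 : ∑ κ ∈ S, c κ * (bb m (N * κ) : ℂ) = ∑ g ∈ Icc 1 G,
        (if (g : ℤ) ^ 2 ∣ m then (g : ℂ) * ∑ κ ∈ S.filter (fun κ => g ^ 2 ∣ N * κ), c κ * (J(m / g ^ 2 | N * κ / g ^ 2) : ℂ) else 0) := by
      calc _ = ∑ κ ∈ S, ∑ g ∈ Icc 1 G, c κ * (if g ^ 2 ∣ N * κ ∧ ((g : ℤ) ^ 2 ∣ m) then (g : ℂ) * (J(m / g ^ 2 | N * κ / g ^ 2) : ℂ) else 0) := by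
            refine sum_congr rfl fun κ hκ => ?_
            have := (hS κ hκ).pos
            rw [bb_eq_Icc (by positivity) G (hGκ κ hκ), Int.cast_sum, mul_sum]
            refine sum_congr rfl fun g _ => ?_
            push_cast; rfl
        _ = _ := by
            rw [sum_comm]
            refine sum_congr rfl fun g _ => ?_
            by_cases hd : (g : ℤ) ^ 2 ∣ m
            · simp only [hd, and_true, if_true]
              rw [sum_filter, mul_sum]
              refine sum_congr rfl fun κ _ => ?_
              split_ifs
              · ring
              · simp
            · simp [hd]
    rw [e2]
    calc _ ≤ om' M m * ∑ g ∈ Icc 1 G, (if (g : ℤ) ^ 2 ∣ m then (g * ‖∑ κ ∈ S.filter (fun κ => g ^ 2 ∣ N * κ), c κ * (J(m / g ^ 2 | N * κ / g ^ 2) : ℂ)‖) else 0) := by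
          refine mul_le_mul_of_nonneg_left ((norm_sum_le _ _).trans (sum_le_sum fun g _ => ?_)) (om'_nonneg M m)
          split_ifs
          · rw [norm_mul, Complex.norm_natCast]
          · simp
      _ = _ := by
          rw [mul_sum]
          refine sum_congr rfl fun g _ => ?_
          split_ifs <;> simp
  have hCS : 0 ≤ CS δ := by unfold CS; positivity
  calc _ ≤ _ := sum_le_sum fun m _ => e1 m
    _ = _ := sum_comm
    _ ≤ ∑ g ∈ Icc 1 G, CS δ * (M * A + Real.sqrt M * B) * (g : ℝ) ^ (-(1 + δ)) :=
        sum_le_sum fun g hg => sieve_g hδ hN g (mem_Icc.mp hg).1 M hM S hS c F A B hA hB h1 h3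
    _ = CS δ * (M * A + Real.sqrt M * B) * ∑ g ∈ Icc 1 G, (g : ℝ) ^ (-(1 + δ)) := by rw [mul_sum]
    _ ≤ CS δ * (M * A + Real.sqrt M * B) * ZZ δ := mul_le_mul_of_nonneg_left (ZZ_sum_le hδ _) (by positivity)
    _ = _ := by ring

lemma sieve_S5 {δ : ℝ} (hδ : 0 < δ) {N : ℕ} (hN : Squarefree N)
    (S : Finset ℕ) (hS : ∀ κ ∈ S, Odd κ) (c : ℕ → ℂ) (B : ℝ) (hB : 0 ≤ B)
    (h3 : ∀ κ ∈ S, ‖c κ‖ ≤ B * (κ : ℝ) ^ (-(3/2 + δ))) :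
    ‖∑ κ ∈ S, c κ * (bb 0 (N * κ) : ℂ)‖ ≤ ZZ δ * B := by
  classical
  have hN0 : 0 < N := Nat.pos_of_ne_zero hN.ne_zero
  have hN1 : (1 : ℝ) ≤ N := by exact_mod_cast hN0
  set S1 := S.filter (fun κ => IsSquare (N * κ)) with hS1
  have hr : ∀ κ : ℕ, ∃ r : ℕ, κ ∈ S1 → κ = N * r ^ 2 ∧ 0 < r := by
    intro κ
    by_cases h : κ ∈ S1
    · rw [hS1, mem_filter] at h
      obtain ⟨hκ, s, hs⟩ := h
      have hNs : N ∣ s := by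
        refine (hN.dvd_pow_iff_dvd (n := 2) (by norm_num)).mp ⟨κ, ?_⟩
        rw [sq, hs]
      obtain ⟨r, rfl⟩ := hNs
      have h5 : κ = N * r ^ 2 := Nat.eq_of_mul_eq_mul_left hN0 (by rw [hs]; ring)
      refine ⟨r, fun _ => ⟨h5, Nat.pos_of_ne_zero ?_⟩⟩
      rintro rfl
      have := (hS κ hκ).pos
      simp at h5; omega
    · exact ⟨0, fun h' => absurd h' h⟩
  choose r hr using hr
  have hinj : Set.InjOn r (S1 : Set ℕ) := by
    intro a ha b hb hab
    rw [(hr a ha).1, (hr b hb).1, hab]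
  have e1 : ∑ κ ∈ S, c κ * (bb 0 (N * κ) : ℂ) = ∑ κ ∈ S1, c κ * (bb 0 (N * κ) : ℂ) := by
    rw [hS1, sum_filter]
    refine sum_congr rfl fun κ hκ => ?_
    split_ifs with h
    · rfl
    · have := (hS κ hκ).pos
      rw [bb_zero_nonsq (by positivity) h]; simp
  rw [e1]
  calc _ ≤ ∑ κ ∈ S1, B * (r κ : ℝ) ^ (-(1 + δ)) := by
        refine (norm_sum_le _ _).trans (sum_le_sum fun κ hκ => ?_)
        obtain ⟨h5, h6⟩ := hr κ hκ
        have hr0 : (0 : ℝ) < r κ := by exact_mod_cast h6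
        have hr1 : (1 : ℝ) ≤ r κ := by exact_mod_cast h6
        have hκS := (mem_filter.mp hκ).1
        have h7 : N * κ = (N * r κ) ^ 2 := by nth_rewrite 1 [h5]; ring
        rw [norm_mul, h7, bb_zero_sq (by positivity)]
        have h8 : ‖(((N * r κ : ℕ) : ℤ) : ℂ)‖ = N * r κ := by
          rw [Complex.norm_intCast]; push_cast
          exact abs_of_nonneg (by positivity)
        rw [h8]
        calc _ ≤ B * (κ : ℝ) ^ (-(3/2 + δ)) * (N * r κ) := mul_le_mul_of_nonneg_right (h3 κ hκS) (by positivity)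
          _ = B * ((N : ℝ) ^ (-(1/2 + δ)) * (r κ : ℝ) ^ (-(2 + 2 * δ))) := by
              have : (κ : ℝ) = N * (r κ : ℝ) ^ 2 := by exact_mod_cast h5
              rw [this, Real.mul_rpow (by positivity) (by positivity), ← Real.rpow_natCast, ← Real.rpow_mul hr0.le]
              have hNp : (0 : ℝ) < N := by positivity
              have a1 : (N : ℝ) ^ (-(1/2 + δ)) = (N : ℝ) ^ (-(3/2 + δ)) * N := by
                nth_rewrite 3 [← Real.rpow_one (N : ℝ)]
                rw [← Real.rpow_add hNp]; congr 1; ring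
              have a2 : (r κ : ℝ) ^ (-(2 + 2 * δ)) = (r κ : ℝ) ^ (((2 : ℕ) : ℝ) * -(3/2 + δ)) * r κ := by
                nth_rewrite 3 [← Real.rpow_one (r κ : ℝ)]
                rw [← Real.rpow_add hr0]; congr 1; push_cast; ring
              rw [a1, a2]; ring
          _ ≤ B * (1 * (r κ : ℝ) ^ (-(1 + δ))) := by
              refine mul_le_mul_of_nonneg_left ?_ hB
              refine mul_le_mul ?_ ?_ (by positivity) (by norm_num)
              · exact Real.rpow_le_one_of_one_le_of_nonpos hN1 (by linarith)
              · exact Real.rpow_le_rpow_of_exponent_le hr1 (by linarith)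
          _ = _ := by ring
    _ = B * ∑ n ∈ S1.image r, (n : ℝ) ^ (-(1 + δ)) := by rw [sum_image hinj, mul_sum]
    _ ≤ B * ZZ δ := mul_le_mul_of_nonneg_left (ZZ_sum_le hδ _) hB
    _ = _ := by ring

noncomputable def CT (δ : ℝ) : ℝ := CS δ * ZZ δ + ZZ δ

lemma CT_nonneg (δ : ℝ) : 0 ≤ CT δ := by
  have := ZZ_nonneg δ
  have : 0 ≤ CS δ := by unfold CS; positivity
  unfold CT; positivity

lemma sieve_main {δ : ℝ} (hδ : 0 < δ) {N : ℕ} (hN : Squarefree N) (M : ℝ) (hM : 1 ≤ M)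
    (S : Finset ℕ) (hS : ∀ κ ∈ S, Odd κ) (c : ℕ → ℂ)
    (F : Finset ℤ) (A B : ℝ) (hA : 0 ≤ A) (hB : 0 ≤ B)
    (h1 : ∀ κ ∈ S, ‖c κ‖ ≤ A * (κ : ℝ) ^ (-(1/2 + δ))) (h3 : ∀ κ ∈ S, ‖c κ‖ ≤ B * (κ : ℝ) ^ (-(3/2 + δ))) :
    ∑ m ∈ F, om M m * ‖∑ κ ∈ S, c κ * (bb m (N * κ) : ℂ)‖ ≤ CT δ * (M * A + Real.sqrt M * B) := by
  have hM0 : 0 < M := by linarith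
  have h4 := sieve_S4 hδ hN M hM0 S hS c F A B hA hB h1 h3
  have h5 := sieve_S5 hδ hN S hS c B hB h3
  have hs : 1 ≤ Real.sqrt M := Real.one_le_sqrt.mpr hM
  have hom : ∀ m : ℤ, om M m * ‖∑ κ ∈ S, c κ * (bb m (N * κ) : ℂ)‖ = om' M m * ‖∑ κ ∈ S, c κ * (bb m (N * κ) : ℂ)‖
      + if m = 0 then ‖∑ κ ∈ S, c κ * (bb 0 (N * κ) : ℂ)‖ else 0 := by
    intro m
    unfold om'
    split_ifs with h
    · rw [h]; unfold om; simp
    · simp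
  simp_rw [hom, sum_add_distrib, sum_ite_eq']
  have hZ := ZZ_nonneg δ
  have h6 : (if (0 : ℤ) ∈ F then ‖∑ κ ∈ S, c κ * (bb 0 (N * κ) : ℂ)‖ else 0) ≤ ZZ δ * B := by
    split_ifs
    · exact h5
    · positivity
  have h7 : ZZ δ * B ≤ ZZ δ * (M * A + Real.sqrt M * B) := by
    refine mul_le_mul_of_nonneg_left ?_ hZ
    nlinarith [mul_nonneg hM0.le hA]
  unfold CT
  linarith

end QT

namespace QT
open Finset Filter Topology MeasureTheory FourierTransform NumberTheorySymbols

/-- units times powers of two -/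
def uu (s : Bool) (a : ℕ) : ℤ := (if s then 1 else -1) * 2 ^ a

lemma jac_two_mod (n : ℕ) (hn : Odd n) : J(2 | n) = J(2 | n % 8) := by
  have h2 : Odd (n % 8) := by rw [Nat.odd_iff] at *; omega
  rw [jacobiSym.at_two hn, jacobiSym.at_two h2, ZMod.χ₈_nat_mod_eight]

lemma jac_neg_one_mod (n : ℕ) (hn : Odd n) : J(-1 | n) = J(-1 | n % 8) := by
  have h2 : Odd (n % 8) := by rw [Nat.odd_iff] at *; omega
  rw [jacobiSym.at_neg_one hn, jacobiSym.at_neg_one h2, ZMod.χ₄_nat_mod_four, ZMod.χ₄_nat_mod_four (n % 8)]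
  congr 2
  omega

lemma jac_uu_mod (s : Bool) (a n : ℕ) (hn : Odd n) : J(uu s a | n) = J(uu s a | n % 8) := by
  unfold uu
  rw [jacobiSym.mul_left, jacobiSym.mul_left, jacobiSym.pow_left, jacobiSym.pow_left, ← jac_two_mod n hn]
  congr 1
  split_ifs
  · rw [jacobiSym.one_left, jacobiSym.one_left]
  · exact jac_neg_one_mod n hn

lemma uu_coprime (s : Bool) (a n : ℕ) (hn : Odd n) : IsCoprime (uu s a) (n : ℤ) := by
  have h2 : IsCoprime (2 : ℤ) (n : ℤ) := by
    have := Nat.Coprime.symm (Nat.coprime_two_right.mpr hn)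
    exact_mod_cast Nat.isCoprime_iff_coprime.mpr this
  unfold uu
  refine IsCoprime.mul_left ?_ (h2.pow_left)
  split_ifs
  · exact isCoprime_one_left
  · exact isCoprime_one_left.neg_left

lemma uu_ne (s : Bool) (a : ℕ) : uu s a ≠ 0 := by unfold uu; split_ifs <;> simp

lemma uu_abs (s : Bool) (a : ℕ) : |(uu s a : ℝ)| = 2 ^ a := by unfold uu; split_ifs <;> simp

def iot (p : (Bool × ℕ) × ℕ) : ℤ := uu p.1.1 p.1.2 * (2 * p.2 + 1 : ℕ)

lemma iot_inj : Function.Injective iot := by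
  rintro ⟨⟨s, a⟩, j⟩ ⟨⟨s', a'⟩, j'⟩ h
  have hs : s = s' := by
    have p1 : (0 : ℤ) < 2 ^ a * (2 * j + 1 : ℕ) := by positivity
    have p2 : (0 : ℤ) < 2 ^ a' * (2 * j' + 1 : ℕ) := by positivity
    simp only [iot, uu] at h
    cases s <;> cases s' <;> simp only [if_true, Bool.false_eq_true, if_false] at h ⊢ <;> exfalso <;> linarith
  subst hs
  have h1 : 2 ^ a * (2 * j + 1) = 2 ^ a' * (2 * j' + 1) := by
    have : (2 : ℤ) ^ a * (2 * j + 1 : ℕ) = 2 ^ a' * (2 * j' + 1 : ℕ) := by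
      simp only [iot, uu] at h
      cases s <;> simp only [if_true, Bool.false_eq_true, if_false] at h <;> linarith
    exact_mod_cast this
  have key : ∀ a j a' j' : ℕ, 2 ^ a * (2 * j + 1) = 2 ^ a' * (2 * j' + 1) → a ≤ a' := by
    intro a j a' j' h
    by_contra hlt
    obtain ⟨d, hd⟩ := Nat.exists_eq_add_of_lt (not_le.mp hlt)
    rw [hd, pow_add, pow_add, mul_assoc, mul_assoc] at h
    have h5 := Nat.eq_of_mul_eq_mul_left (by positivity) h
    have h6 : 2 * (2 ^ d * (2 * j + 1)) = 2 * j' + 1 := by rw [← h5]; ring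
    omega
  have haa : a = a' := le_antisymm (key _ _ _ _ h1) (key _ _ _ _ h1.symm)
  subst haa
  have := Nat.eq_of_mul_eq_mul_left (by positivity) h1
  have : j = j' := by omega
  rw [this]

lemma iot_surj (k : ℤ) (hk : k ≠ 0) : ∃ p, iot p = k := by
  obtain ⟨a, m, hm, h⟩ := Nat.exists_eq_two_pow_mul_odd (n := k.natAbs) (by omega)
  obtain ⟨j, hj⟩ := hm
  have h' : (k.natAbs : ℤ) = 2 ^ a * (2 * j + 1 : ℕ) := by rw [h, hj]; push_cast; ring
  rcases le_total 0 k with h0 | h0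
  · refine ⟨((true, a), j), ?_⟩
    simp only [iot, uu, if_true, one_mul]
    rw [← h']; omega
  · refine ⟨((false, a), j), ?_⟩
    simp only [iot, uu, Bool.false_eq_true, if_false]
    rw [neg_one_mul, neg_mul, ← h']; omega

lemma iot_ne (p) : iot p ≠ 0 := by
  unfold iot
  refine mul_ne_zero (uu_ne _ _) (by positivity)

noncomputable def cN (N : ℕ) (x : ℤ) : ℂ := if (8 : ℤ) ∣ x - N then 1 else 0

lemma cN_per (N : ℕ) (x y : ℤ) (h : (8 : ℤ) ∣ x - y) : cN N x = cN N y := by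
  unfold cN
  congr 1
  rw [eq_iff_iff]
  omega

lemma cN_norm (N : ℕ) (x : ℤ) : ‖cN N x‖ ≤ 1 := by unfold cN; split_ifs <;> simp

noncomputable def gam (N n : ℕ) (k : ℤ) : ℂ :=
  (∑ j ∈ range 8, cN N (n * j) * ee (k * j / 8)) * (J(8 | n) * eps n)

lemma eps_norm (n : ℕ) : ‖eps n‖ = 1 := by unfold eps; split_ifs <;> simp

lemma jac_norm (a : ℤ) (n : ℕ) : ‖(J(a | n) : ℂ)‖ ≤ 1 := by
  rw [Complex.norm_intCast]; exact abs_jac_le_real a n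

lemma sum8_norm (c : ℤ → ℂ) (B : ℝ) (hB : ∀ x, ‖c x‖ ≤ B) (n : ℕ) (k : ℤ) :
    ‖∑ j ∈ range 8, c (n * j) * ee (k * j / 8)‖ ≤ 8 * B := by
  refine (norm_sum_le _ _).trans ((sum_le_sum (g := fun _ => B) fun j _ => ?_).trans (by simp))
  rw [norm_mul]
  have : ‖ee (k * j / 8)‖ = 1 := norm_ee _
  rw [this, mul_one]; exact hB _

lemma gam_norm (N n : ℕ) (k : ℤ) : ‖gam N n k‖ ≤ 8 := by
  unfold gam
  rw [norm_mul, norm_mul, eps_norm, mul_one]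
  have h1 := sum8_norm (cN N) 1 (cN_norm N) n k
  have h2 := jac_norm 8 n
  calc _ ≤ (8 * 1) * 1 := mul_le_mul h1 h2 (norm_nonneg _) (by norm_num)
    _ = 8 := by norm_num

lemma gam_mod (N n : ℕ) (hn : Odd n) (k : ℤ) : gam N n k = gam N (n % 8) k := by
  unfold gam
  have e1 : ∀ j : ℕ, cN N (n * j) = cN N ((n % 8 : ℕ) * j) := by
    intro j
    refine cN_per N _ _ ?_
    rw [← sub_mul]
    refine Dvd.dvd.mul_right ?_ _
    push_cast; omega
  have e2 : eps n = eps (n % 8) := by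
    unfold eps
    have : n % 8 % 4 = n % 4 := by omega
    rw [this]
  have e3 := jac_uu_mod true 3 n hn
  have e4 : uu true 3 = 8 := by simp [uu]
  rw [e4] at e3
  rw [e2, e3]
  simp_rw [e1]

/-- terms of the double sum -/
noncomputable def st (w : ℝ → ℝ) (N : ℕ) (X α : ℝ) (n : ℕ) (k : ℤ) : ℂ :=
  if Odd n then ((X / 8 : ℝ) : ℂ) * (gam N n k * (bb (N * k) n : ℂ) * EE w α (k * X / 8) 0 0 n) else 0

lemma jac8_coprime (n : ℕ) (hn : Odd n) : IsCoprime (8 : ℤ) (n : ℤ) := by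
  have := uu_coprime true 3 n hn
  simpa [uu] using this

lemma first_poisson {w : ℝ → ℝ} (hw : TF w) {N : ℕ} (hN : Squarefree N) (X α : ℝ) (hX : 0 < X) (hα : 0 < α)
    (n : ℕ) (hn : Odd n) :
    ∑' d : ℤ, (cN N d * (bb (N * d) n : ℂ)) * ((w (d / X) * Real.exp (-(α * X * n ^ 2) / d) : ℝ) : ℂ) =
      ∑' k : ℤ, st w N X α n k := by
  have hn0 : (0 : ℝ) < n := by exact_mod_cast hn.pos
  have h := poisson8 (fn_nice hw X (α * X * n ^ 2) hX (by positivity)) (fun d => bb (N * d) n) (cN N) n hn (J(8 | n))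
    (fun x y hxy => bb_period hn.pos (by rw [← mul_sub]; exact hxy.mul_left _)) (cN_per N)
    (fun x => by
      rw [← bb_unit hn.pos 8 _ (jac8_coprime n hn)]
      congr 1; ring)
  rw [h, ← tsum_mul_left]
  refine tsum_congr fun k => ?_
  rw [ft_main hN n hn k, fn_fourier w X _ _ hX]
  unfold st gam EE
  rw [if_pos hn, if_pos hn0]
  have e1 : α * X * (n : ℝ) ^ 2 / X = α * n ^ 2 := by field_simp
  have e2 : (k : ℝ) / (n * 8) * X = k * X / 8 / n := by field_simp
  have e3 : (n : ℝ) ^ (-(1/2 : ℝ) - (0 : ℕ)) = Real.sqrt n / n := by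
    rw [Nat.cast_zero, sub_zero, Real.rpow_neg hn0.le, ← Real.sqrt_eq_rpow, Real.sqrt_div_self]
  rw [e1, e2, e3]
  have hn' : (n : ℂ) ≠ 0 := by exact_mod_cast hn0.ne'
  push_cast
  field_simp

lemma st_norm {w : ℝ → ℝ} (hw : TF w) : ∃ C : ℝ, 0 ≤ C ∧ ∀ (N : ℕ) (X α : ℝ), 0 < X → 0 < α →
    ∀ n k, ‖st w N X α n k‖ ≤ C * X * ((n : ℝ) ^ 3 * Real.exp (-(α * n ^ 2))) * (1 / (1 + (X / 8 * k) ^ 2)) := by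
  obtain ⟨C, hC, hb⟩ := EE_bound hw 2 0 0
  refine ⟨C, hC, fun N X α hX hα n k => ?_⟩
  unfold st
  split_ifs with hn
  · have hn1 : (1 : ℝ) ≤ n := by exact_mod_cast hn.pos
    have hn0 : (0 : ℝ) < n := by linarith
    have h1 := hb α (k * X / 8) n hα.le hn0
    rw [norm_mul, norm_mul, norm_mul, Complex.norm_real, Real.norm_of_nonneg (by positivity)]
    have h2 : ‖(bb (N * k) n : ℂ)‖ ≤ n := by
      rw [Complex.norm_intCast]; exact_mod_cast bb_abs_le hn.pos _
    have h3 : (n : ℝ) ^ (-(1/2 : ℝ) - (0 : ℕ)) ≤ 1 := Real.rpow_le_one_of_one_le_of_nonpos hn1 (by norm_num)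
    have h4 : ((1 + |k * X / 8| / (n : ℝ)) ^ 2)⁻¹ ≤ (n : ℝ) ^ 2 * (1 / (1 + (X / 8 * k) ^ 2)) := by
      have h5 : 1 + (X / 8 * k) ^ 2 ≤ (n : ℝ) ^ 2 * (1 + |k * X / 8| / (n : ℝ)) ^ 2 := by
        rw [← mul_pow, mul_add, mul_div_cancel₀ _ hn0.ne', mul_one]
        have : (X / 8 * k) ^ 2 = |k * X / 8| ^ 2 := by rw [sq_abs]; ring
        rw [this]
        nlinarith [abs_nonneg (k * X / 8)]
      have p1 : 0 < (1 + |k * X / 8| / (n : ℝ)) ^ 2 := by positivity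
      rw [mul_one_div, inv_eq_one_div, div_le_div_iff₀ p1 (by positivity)]
      linarith
    calc _ ≤ X / 8 * (8 * n * (C * (1 * ((n : ℝ) ^ 2 * (1 / (1 + (X / 8 * k) ^ 2))) * Real.exp (-(α * n ^ 2))))) := by
          refine mul_le_mul_of_nonneg_left ?_ (by positivity)
          refine mul_le_mul (mul_le_mul (gam_norm N n k) h2 (norm_nonneg _) (by norm_num)) ?_ (norm_nonneg _) (by positivity)
          refine h1.trans (mul_le_mul_of_nonneg_left ?_ hC)
          refine mul_le_mul_of_nonneg_right ?_ (Real.exp_pos _).le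
          exact mul_le_mul h3 h4 (by positivity) (by norm_num)
      _ = _ := by ring
  · rw [norm_zero]; positivity

lemma exp_poly_summable (α : ℝ) (hα : 0 < α) (p : ℕ) : Summable (fun n : ℕ => (n : ℝ) ^ p * Real.exp (-(α * n ^ 2))) := by
  refine Summable.of_nonneg_of_le (fun n => by positivity) (fun n => ?_) (Real.summable_pow_mul_exp_neg_nat_mul p hα)
  refine mul_le_mul_of_nonneg_left (Real.exp_le_exp.mpr ?_) (by positivity)
  have : (n : ℝ) ≤ n ^ 2 := by
    rcases Nat.eq_zero_or_pos n with h | h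
    · simp [h]
    · have : (1 : ℝ) ≤ n := by exact_mod_cast h
      nlinarith
  nlinarith

lemma st_summable {w : ℝ → ℝ} (hw : TF w) (N : ℕ) (X α : ℝ) (hX : 0 < X) (hα : 0 < α) :
    Summable (fun p : ℕ × ℤ => st w N X α p.1 p.2) := by
  obtain ⟨C, hC, hb⟩ := st_norm hw
  have h1 := exp_poly_summable α hα 3
  have h2 := summable_inv_sq_int (X / 8) (by positivity)
  have h3 := Summable.mul_of_nonneg (h1.mul_left (C * X)) h2 (fun n => by positivity) (fun n => by positivity)
  refine Summable.of_norm_bounded h3 (fun p => hb N X α hX hα p.1 p.2)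

end QT

namespace QT
open Finset Filter Topology MeasureTheory FourierTransform NumberTheorySymbols

noncomputable def ck (N : ℕ) (s : Bool) (a κ : ℕ) (x : ℤ) : ℂ :=
  if Odd x then gam N (x % 8).toNat (uu s a * κ) * ((J(uu s a | (x % 8).toNat) : ℂ) *
    (-1) ^ (N * κ / 2 * ((x % 8).toNat / 2))) else 0

lemma ck_per (N : ℕ) (s : Bool) (a κ : ℕ) (x y : ℤ) (h : (8 : ℤ) ∣ x - y) : ck N s a κ x = ck N s a κ y := by
  have h1 : x % 8 = y % 8 := by omega
  have h2 : Odd x ↔ Odd y := by rw [Int.odd_iff, Int.odd_iff]; omega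
  unfold ck
  simp only [h1, h2]

lemma ck_norm (N : ℕ) (s : Bool) (a κ : ℕ) (x : ℤ) : ‖ck N s a κ x‖ ≤ 8 := by
  unfold ck
  split_ifs
  · rw [norm_mul, norm_mul, norm_pow, norm_neg, norm_one, one_pow, mul_one]
    calc _ ≤ (8 : ℝ) * 1 := mul_le_mul (gam_norm _ _ _) (jac_norm _ _) (norm_nonneg _) (by norm_num)
      _ = 8 := by norm_num
  · simp

lemma ck_eq (N : ℕ) (hN : Odd N) (s : Bool) (a κ : ℕ) (hκ : Odd κ) (n : ℕ) (hn : Odd n) :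
    gam N n (uu s a * κ) * (bb (N * (uu s a * κ)) n : ℂ) = ck N s a κ n * (bb n (N * κ) : ℂ) := by
  have e0 : ((n : ℤ) % 8).toNat = n % 8 := by omega
  have e1 : bb (N * (uu s a * κ)) n = J(uu s a | n) * ((-1) ^ (N * κ / 2 * (n / 2)) * bb n (N * κ)) := by
    rw [← bb_recip (hN.mul hκ) hn, ← bb_unit hn.pos _ _ (uu_coprime s a n hn)]
    congr 1; push_cast; ring
  have e2 : ((-1 : ℂ)) ^ (N * κ / 2 * (n / 2)) = (-1) ^ (N * κ / 2 * (n % 8 / 2)) := by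
    rw [pow_mul', pow_mul']
    congr 1
    rw [neg_one_pow_eq_pow_mod_two, neg_one_pow_eq_pow_mod_two (n % 8 / 2)]
    congr 1
    omega
  unfold ck
  rw [if_pos (by exact_mod_cast hn), e0, ← gam_mod N n hn, ← jac_uu_mod s a n hn, e1]
  push_cast
  rw [e2]
  ring

noncomputable def C1 (N : ℕ) (s : Bool) (a κ : ℕ) (m : ℤ) : ℂ :=
  (∑ j ∈ range 8, ck N s a κ ((N * κ : ℕ) * j) * ee (m * j / 8)) * (J(8 | N * κ) * eps (N * κ))

lemma C1_norm (N : ℕ) (s : Bool) (a κ : ℕ) (m : ℤ) : ‖C1 N s a κ m‖ ≤ 64 := by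
  unfold C1
  rw [norm_mul, norm_mul, eps_norm, mul_one]
  have h1 := sum8_norm (ck N s a κ) 8 (ck_norm N s a κ) (N * κ) m
  calc _ ≤ (8 * 8 : ℝ) * 1 := mul_le_mul h1 (jac_norm _ _) (norm_nonneg _) (by norm_num)
    _ = 64 := by norm_num

lemma C1_mod (N : ℕ) (s : Bool) (a κ : ℕ) (m : ℤ) : C1 N s a κ m = C1 N s a κ (m % 8) := by
  unfold C1
  congr 1
  refine sum_congr rfl fun j _ => ?_
  congr 1
  have h := Int.emod_add_mul_ediv m 8
  have : (m : ℝ) * j / 8 = ((m % 8 : ℤ) : ℝ) * j / 8 + ((m / 8 * j : ℤ) : ℝ) := by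
    nth_rewrite 1 [← h]
    push_cast; ring
  rw [this, ee_add_int]

lemma EE_rescale (w : ℝ → ℝ) (α β : ℝ) (κ : ℕ) (hκ : 0 < κ) (ξ : ℝ) :
    𝓕 (EE w α (κ * β) 0 0) (ξ / κ) = (Real.sqrt κ : ℂ) * 𝓕 (EE w (α * κ ^ 2) β 0 0) ξ := by
  have hκ0 : (0 : ℝ) < κ := by exact_mod_cast hκ
  have h := fourier_scale (EE w α (κ * β) 0 0) κ hκ0 ξ
  have e : (fun x => EE w α (κ * β) 0 0 (κ * x)) = fun x => (((Real.sqrt κ)⁻¹ : ℝ) : ℂ) • EE w (α * κ ^ 2) β 0 0 x := by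
    funext x
    unfold EE
    by_cases hx : 0 < x
    · rw [if_pos (by positivity), if_pos hx, smul_eq_mul, ← mul_assoc]
      have a1 : α * (κ * x) ^ 2 = α * κ ^ 2 * x ^ 2 := by ring
      have a2 : κ * β / (κ * x) = β / x := by field_simp
      rw [a1, a2]
      congr 1
      rw [← Complex.ofReal_mul]
      congr 1
      rw [Nat.cast_zero, sub_zero, pow_zero, mul_one, mul_one, Real.mul_rpow hκ0.le hx.le, Real.rpow_neg hκ0.le, ← Real.sqrt_eq_rpow]
    · have h1 : ¬ 0 < (κ : ℝ) * x := fun h => hx (pos_of_mul_pos_right h hκ0.le)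
      rw [if_neg h1, if_neg hx, smul_zero]
  rw [e] at h
  have h2 : 𝓕 (fun x => (((Real.sqrt κ)⁻¹ : ℝ) : ℂ) • EE w (α * κ ^ 2) β 0 0 x) ξ = (((Real.sqrt κ)⁻¹ : ℝ) : ℂ) * 𝓕 (EE w (α * κ ^ 2) β 0 0) ξ := by
    rw [fourier_ee, fourier_ee, ← integral_const_mul]
    congr 1; funext v; rw [smul_eq_mul]; ring
  rw [h2] at h
  have hs : (Real.sqrt κ : ℂ) ≠ 0 := by exact_mod_cast (Real.sqrt_pos.mpr hκ0).ne'
  have hk : (κ : ℂ) = (Real.sqrt κ : ℂ) * (Real.sqrt κ : ℂ) := by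
    rw [← Complex.ofReal_mul, Real.mul_self_sqrt hκ0.le]; simp
  have hkr : ((κ : ℝ) : ℂ) = (Real.sqrt κ : ℂ) * (Real.sqrt κ : ℂ) := by rw [← hk]; simp
  rw [hkr] at h
  push_cast at h
  field_simp at h
  rw [h]

noncomputable def gg (w : ℝ → ℝ) (N : ℕ) (X α : ℝ) (p : (Bool × ℕ) × ℕ) (m : ℤ) : ℂ :=
  C1 N p.1.1 p.1.2 (2 * p.2 + 1) m * (bb m (N * (2 * p.2 + 1)) : ℂ) *
    𝓕 (EE w (α * ((2 * p.2 + 1 : ℕ) : ℝ) ^ 2) (uu p.1.1 p.1.2 * X / 8) 0 0) (m / (8 * N))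

lemma gg_summable {w : ℝ → ℝ} (hw : TF w) {N : ℕ} (hN : 0 < N) (X α : ℝ) (hX : 0 < X) (hα : 0 < α)
    (p : (Bool × ℕ) × ℕ) : Summable (gg w N X α p) := by
  have hu : (uu p.1.1 p.1.2 : ℝ) * X / 8 ≠ 0 := by
    have : (uu p.1.1 p.1.2 : ℝ) ≠ 0 := by exact_mod_cast uu_ne _ _
    positivity
  have hn := EE_nice hw (α * ((2 * p.2 + 1 : ℕ) : ℝ) ^ 2) _ (by positivity) hu
  have hs := (hn.summable_ft (8 * N) (by positivity)).norm
  refine Summable.of_norm_bounded (hs.mul_left (64 * ((N * (2 * p.2 + 1) : ℕ) : ℝ))) (fun m => ?_)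
  unfold gg
  rw [norm_mul, norm_mul]
  refine mul_le_mul_of_nonneg_right ?_ (norm_nonneg _)
  refine mul_le_mul (C1_norm _ _ _ _ _) ?_ (norm_nonneg _) (by norm_num)
  rw [Complex.norm_intCast]
  exact_mod_cast bb_abs_le (by positivity) m

lemma second_poisson {w : ℝ → ℝ} (hw : TF w) {N : ℕ} (hN : Odd N) (X α : ℝ) (hX : 0 < X) (hα : 0 < α)
    (p : (Bool × ℕ) × ℕ) :
    ∑' n : ℕ, st w N X α n (iot p) = ((X / (64 * Real.sqrt N) : ℝ) : ℂ) * ∑' m : ℤ, gg w N X α p m := by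
  obtain ⟨⟨s, a⟩, j⟩ := p
  set κ := 2 * j + 1 with hκd
  have hκ : Odd κ := ⟨j, hκd⟩
  have hκ0 : (0 : ℝ) < κ := by exact_mod_cast hκ.pos
  have hN0 : (0 : ℝ) < N := by exact_mod_cast hN.pos
  have hu0 : (uu s a : ℝ) ≠ 0 := by exact_mod_cast uu_ne s a
  have hβ : (κ : ℝ) * (uu s a * X / 8) ≠ 0 := by positivity
  set f := EE w α (κ * (uu s a * X / 8)) 0 0 with hf
  have hnice : Nice f := EE_nice hw _ _ hα hβ
  have hodd : Odd (N * κ) := hN.mul hκ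
  have h := poisson8 hnice (fun x => bb x (N * κ)) (ck N s a κ) (N * κ) hodd (J(8 | N * κ))
    (fun x y hxy => bb_period hodd.pos hxy) (ck_per N s a κ)
    (fun x => bb_unit hodd.pos 8 _ (jac8_coprime _ hodd))
  have hL : ∑' n : ℕ, st w N X α n (iot ((s, a), j)) = ((X / 8 : ℝ) : ℂ) * ∑' d : ℤ, (ck N s a κ d * (bb d (N * κ) : ℂ)) * f d := by
    rw [← tsum_mul_left]
    rw [← (Nat.cast_injective (R := ℤ)).tsum_eq (f := fun d : ℤ => ((X / 8 : ℝ) : ℂ) * ((ck N s a κ d * (bb d (N * κ) : ℂ)) * f d))]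
    · refine tsum_congr fun n => ?_
      unfold st
      have hi : iot ((s, a), j) = uu s a * κ := rfl
      rw [hi]
      split_ifs with hn
      · rw [ck_eq N hN s a κ hκ n hn, hf]
        congr 3
        · push_cast; ring
      · have : ck N s a κ n = 0 := by
          unfold ck
          rw [if_neg (by exact_mod_cast hn)]
        simp [this]
    · intro d hd
      rw [Function.mem_support] at hd
      by_contra hd'
      have : d ≤ 0 := by
        by_contra h0
        exact hd' ⟨d.toNat, by omega⟩
      apply hd
      rw [hf, EE_nonpos w _ _ _ _ (by exact_mod_cast this)]
      simp
  rw [hL, h, ← tsum_mul_left, ← tsum_mul_left, ← tsum_mul_left]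
  refine tsum_congr fun m => ?_
  have hft := ft_main (N := 1) squarefree_one (N * κ) hodd m
  simp only [Nat.cast_one, one_mul] at hft
  rw [hft]
  have e1 : (m : ℝ) / ((N * κ : ℕ) * 8) = (m / (8 * N)) / κ := by push_cast; field_simp
  rw [e1, hf, EE_rescale w α _ κ hκ.pos]
  unfold gg C1
  simp only
  rw [← hκd]
  have e2 : Real.sqrt ((N * κ : ℕ) : ℝ) = Real.sqrt N * Real.sqrt κ := by
    push_cast; rw [Real.sqrt_mul hN0.le]
  rw [e2]
  have hsN : (Real.sqrt N : ℂ) ≠ 0 := by exact_mod_cast (Real.sqrt_pos.mpr hN0).ne'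
  have hsκ : (Real.sqrt κ : ℂ) ≠ 0 := by exact_mod_cast (Real.sqrt_pos.mpr hκ0).ne'
  have hNc : (N : ℂ) = (Real.sqrt N : ℂ) ^ 2 := by
    rw [← Complex.ofReal_pow, Real.sq_sqrt hN0.le]; simp
  have hκc : (κ : ℂ) = (Real.sqrt κ : ℂ) ^ 2 := by
    rw [← Complex.ofReal_pow, Real.sq_sqrt hκ0.le]; simp
  have e3 : (1 / (((N * κ : ℕ) : ℂ) * 8)) = 1 / ((Real.sqrt N : ℂ) ^ 2 * (Real.sqrt κ : ℂ) ^ 2 * 8) := by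
    rw [← hNc, ← hκc]; push_cast; rfl
  rw [e3]
  push_cast
  field_simp
  ring

end QT

namespace QT
open Finset Filter Topology MeasureTheory FourierTransform NumberTheorySymbols

noncomputable def kf (s b v : ℝ) : ℝ := v ^ (-s) * ((1 + b / v) ^ 4)⁻¹

lemma kf_nonneg (s : ℝ) {b v : ℝ} (hv : 0 < v) : 0 ≤ kf s b v := by
  unfold kf; positivity

lemma kf_int {s : ℝ} (hs : 1 < s) (hs4 : s ≤ 4) : IntegrableOn (kf s 1) (Set.Ioi 0) := by
  have hm : ContinuousOn (kf s 1) (Set.Ioi 0) := by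
    intro v hv
    have hv : 0 < v := hv
    unfold kf
    refine ContinuousAt.continuousWithinAt ?_
    refine ContinuousAt.mul (Real.continuousAt_rpow_const _ _ (Or.inl hv.ne')) (ContinuousAt.inv₀ ?_ (by positivity))
    exact ContinuousAt.pow (continuousAt_const.add (continuousAt_const.div continuousAt_id hv.ne')) 4
  have hu : Set.Ioi (0:ℝ) = Set.Ioc 0 1 ∪ Set.Ioi 1 := by
    rw [Set.Ioc_union_Ioi_eq_Ioi zero_le_one]
  rw [hu]
  refine IntegrableOn.union ?_ ?_
  · refine Integrable.mono' (g := fun _ => (1 : ℝ)) (integrableOn_const (by simp)) ?_ ?_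
    · exact (hm.mono (Set.Ioc_subset_Ioi_self)).aestronglyMeasurable measurableSet_Ioc
    · refine (ae_restrict_iff' measurableSet_Ioc).mpr (Eventually.of_forall fun v hv => ?_)
      have hv0 : 0 < v := hv.1
      rw [Real.norm_of_nonneg (kf_nonneg s hv0)]
      unfold kf
      have h1 : v ^ (-s) ≤ v ^ (-4 : ℝ) := Real.rpow_le_rpow_of_exponent_ge hv0 hv.2 (by linarith)
      have h2 : v ^ (-4 : ℝ) = (v ^ 4)⁻¹ := by
        rw [Real.rpow_neg hv0.le]; norm_cast
      have h3 : ((1 + 1 / v) ^ 4)⁻¹ ≤ v ^ 4 := by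
        rw [inv_le_comm₀ (by positivity) (by positivity), ← inv_pow]
        refine pow_le_pow_left₀ (by positivity) ?_ 4
        rw [one_div]; linarith
      calc _ ≤ (v ^ 4)⁻¹ * v ^ 4 := mul_le_mul (h1.trans_eq h2) h3 (by positivity) (by positivity)
        _ = 1 := by field_simp
  · refine Integrable.mono' (integrableOn_Ioi_rpow_of_lt (a := -s) (by linarith) zero_lt_one) ?_ ?_
    · exact (hm.mono (Set.Ioi_subset_Ioi zero_le_one)).aestronglyMeasurable measurableSet_Ioi
    · refine (ae_restrict_iff' measurableSet_Ioi).mpr (Eventually.of_forall fun v hv => ?_)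
      have hv0 : 0 < v := zero_lt_one.trans hv
      rw [Real.norm_of_nonneg (kf_nonneg s hv0)]
      unfold kf
      refine mul_le_of_le_one_right (by positivity) ?_
      apply inv_le_one_of_one_le₀
      refine one_le_pow₀ ?_
      have : 0 < 1 / v := by positivity
      linarith

noncomputable def KK (s : ℝ) : ℝ := ∫ v in Set.Ioi 0, kf s 1 v

lemma KK_nonneg (s : ℝ) : 0 ≤ KK s :=
  setIntegral_nonneg measurableSet_Ioi fun _ hv => kf_nonneg s hv

lemma kf_mul {s b x : ℝ} (hb : 0 < b) (hx : 0 < x) : kf s b (b * x) = b ^ (-s) * kf s 1 x := by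
  unfold kf
  rw [Real.mul_rpow hb.le hx.le, show b / (b * x) = 1 / x by field_simp]
  ring

lemma kf_scale_int {s : ℝ} (hs : 1 < s) (hs4 : s ≤ 4) {b : ℝ} (hb : 0 < b) :
    IntegrableOn (kf s b) (Set.Ioi 0) := by
  have h := integrableOn_Ioi_comp_mul_left_iff (kf s b) 0 hb
  rw [mul_zero] at h
  rw [← h]
  refine ((kf_int hs hs4).const_mul (b ^ (-s))).congr ?_
  refine (ae_restrict_iff' measurableSet_Ioi).mpr (Eventually.of_forall fun v hv => ?_)
  exact (kf_mul hb hv).symm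

lemma kf_scale {s : ℝ} {b : ℝ} (hb : 0 < b) :
    ∫ v in Set.Ioi 0, kf s b v = b ^ (1 - s) * KK s := by
  have h := integral_comp_mul_left_Ioi (kf s b) 0 hb
  rw [mul_zero, smul_eq_mul] at h
  have h2 : ∫ x in Set.Ioi 0, kf s b (b * x) = b ^ (-s) * KK s := by
    unfold KK
    rw [← integral_const_mul]
    exact setIntegral_congr_fun measurableSet_Ioi fun v hv => kf_mul hb hv
  rw [h2] at h
  have h3 : b ^ (1 - s) = b * b ^ (-s) := by
    rw [sub_eq_add_neg, Real.rpow_add hb, Real.rpow_one]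
  rw [h3, mul_assoc, h]
  field_simp

lemma exp_sq_le {p σ : ℝ} (hp : 0 < p) (h0 : 0 ≤ σ) (h2 : σ ≤ 2) : Real.exp (-p ^ 2) ≤ p ^ (-σ) := by
  rcases le_total p 1 with h | h
  · calc _ ≤ (1 : ℝ) := Real.exp_le_one_iff.mpr (by nlinarith)
      _ = p ^ (0 : ℝ) := by simp
      _ ≤ _ := Real.rpow_le_rpow_of_exponent_ge hp h (by linarith)
  · calc _ ≤ (p ^ 2)⁻¹ := by
          rw [Real.exp_neg]
          refine inv_anti₀ (by positivity) ?_
          have := Real.add_one_le_exp (p ^ 2)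
          linarith
      _ = p ^ (-2 : ℝ) := by rw [Real.rpow_neg hp.le]; norm_cast
      _ ≤ _ := Real.rpow_le_rpow_of_exponent_le h (by linarith)

lemma exp_bd {α κ v σ : ℝ} (hα : 0 < α) (hκ : 0 < κ) (hv : 0 < v) (h0 : 0 ≤ σ) (h2 : σ ≤ 2) :
    Real.exp (-(α * κ ^ 2 * v ^ 2)) ≤ α ^ (-(σ / 2)) * κ ^ (-σ) * v ^ (-σ) := by
  have h := exp_sq_le (p := Real.sqrt α * κ * v) (by positivity) h0 h2
  have e1 : (Real.sqrt α * κ * v) ^ 2 = α * κ ^ 2 * v ^ 2 := by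
    rw [mul_pow, mul_pow, Real.sq_sqrt hα.le]
  have e2 : (Real.sqrt α * κ * v) ^ (-σ) = α ^ (-(σ / 2)) * κ ^ (-σ) * v ^ (-σ) := by
    rw [Real.mul_rpow (by positivity) hv.le, Real.mul_rpow (by positivity) hκ.le, Real.sqrt_eq_rpow,
      ← Real.rpow_mul hα.le]
    congr 3; ring
  rwa [e1, e2] at h

lemma box_point {δ : ℝ} (hδ : 0 < δ) (hδ2 : δ ≤ 1 / 2) {C : ℝ} (hC : 0 ≤ C) {N : ℕ} (hN : Squarefree N)
    {α M β : ℝ} (hα : 0 < α) (hM : 1 ≤ M) (hβ : 0 < β) (s : Bool) (a : ℕ) (S : Finset ℕ) (F : Finset ℤ)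
    (D : ℕ → ℂ) {v : ℝ} (hv : 0 < v) (hD : ∀ j, ‖D j‖ ≤ C * (v ^ (-(1/2 : ℝ)) * ((1 + β / v) ^ 4)⁻¹ *
      Real.exp (-(α * ((2 * j + 1 : ℕ) : ℝ) ^ 2 * v ^ 2)))) :
    ∑ m ∈ F, om M m * ‖∑ j ∈ S, C1 N s a (2 * j + 1) m * (bb m (N * (2 * j + 1)) : ℂ) * D j‖ ≤
      8 * CT δ * (64 * C) * (M * α ^ (-(1/4 + δ/2)) * kf (1 + δ) β v + Real.sqrt M * α ^ (-(3/4 + δ/2)) * kf (2 + δ) β v) := by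
  have hbd : ∀ σ : ℝ, 0 ≤ σ → σ ≤ 2 → ∀ r : ℤ, ∀ j, ‖C1 N s a (2 * j + 1) r * D j‖ ≤
      (64 * C * α ^ (-(σ / 2)) * kf (1/2 + σ) β v) * ((2 * j + 1 : ℕ) : ℝ) ^ (-σ) := by
    intro σ h0 h2 r j
    rw [norm_mul]
    calc _ ≤ 64 * (C * (v ^ (-(1/2 : ℝ)) * ((1 + β / v) ^ 4)⁻¹ * (α ^ (-(σ / 2)) * ((2 * j + 1 : ℕ) : ℝ) ^ (-σ) * v ^ (-σ)))) := by
          refine mul_le_mul (C1_norm _ _ _ _ _) ((hD j).trans ?_) (norm_nonneg _) (by norm_num)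
          have := exp_bd hα (κ := ((2 * j + 1 : ℕ) : ℝ)) (by positivity) hv h0 h2
          gcongr
      _ = _ := by
          unfold kf
          rw [neg_add, Real.rpow_add hv]
          ring
  have key : ∀ r ∈ range 8, ∑ m ∈ F with m % 8 = (r : ℤ), om M m * ‖∑ j ∈ S, C1 N s a (2 * j + 1) m * (bb m (N * (2 * j + 1)) : ℂ) * D j‖
      ≤ CT δ * (64 * C) * (M * α ^ (-(1/4 + δ/2)) * kf (1 + δ) β v + Real.sqrt M * α ^ (-(3/4 + δ/2)) * kf (2 + δ) β v) := by
    intro r _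
    have hinj : Set.InjOn (fun j : ℕ => 2 * j + 1) S := fun x _ y _ h => by
      have : 2 * x + 1 = 2 * y + 1 := h
      omega
    have h := sieve_main hδ hN M hM (S.image (fun j => 2 * j + 1)) (by
        intro κ hκ
        obtain ⟨j, _, rfl⟩ := mem_image.mp hκ
        exact ⟨j, rfl⟩) (fun κ => C1 N s a κ r * D (κ / 2)) (F.filter (fun m => m % 8 = r))
        (64 * C * α ^ (-((1/2 + δ) / 2)) * kf (1/2 + (1/2 + δ)) β v)
        (64 * C * α ^ (-((3/2 + δ) / 2)) * kf (1/2 + (3/2 + δ)) β v)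
        (by have := kf_nonneg (1/2 + (1/2 + δ)) (b := β) hv; unfold kf; positivity)
        (by unfold kf; positivity)
        (by
          intro κ hκ
          obtain ⟨j, _, rfl⟩ := mem_image.mp hκ
          have := hbd (1/2 + δ) (by linarith) (by linarith) r j
          rwa [show (2 * j + 1) / 2 = j by omega])
        (by
          intro κ hκ
          obtain ⟨j, _, rfl⟩ := mem_image.mp hκ
          have := hbd (3/2 + δ) (by linarith) (by linarith) r j
          rwa [show (2 * j + 1) / 2 = j by omega])
    calc _ = ∑ m ∈ F with m % 8 = (r : ℤ), om M m * ‖∑ κ ∈ S.image (fun j => 2 * j + 1), (C1 N s a κ r * D (κ / 2)) * (bb m (N * κ) : ℂ)‖ := by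
          refine sum_congr rfl fun m hm => ?_
          rw [sum_image hinj]
          congr 2
          refine sum_congr rfl fun j _ => ?_
          rw [C1_mod N s a _ m, (mem_filter.mp hm).2, show (2 * j + 1) / 2 = j by omega]
          ring
      _ ≤ _ := h
      _ = _ := by
          rw [show (1/2 + (1/2 + δ)) = 1 + δ by ring, show (1/2 + (3/2 + δ)) = 2 + δ by ring,
            show (1/2 + δ)/2 = 1/4 + δ/2 by ring, show (3/2 + δ)/2 = 3/4 + δ/2 by ring]
          ring
  have hsplit : ∑ m ∈ F, om M m * ‖∑ j ∈ S, C1 N s a (2 * j + 1) m * (bb m (N * (2 * j + 1)) : ℂ) * D j‖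
      = ∑ r ∈ range 8, ∑ m ∈ F with m % 8 = (r : ℤ), om M m * ‖∑ j ∈ S, C1 N s a (2 * j + 1) m * (bb m (N * (2 * j + 1)) : ℂ) * D j‖ := by
    rw [← sum_fiberwise_of_maps_to (s := F) (t := range 8) (g := fun m : ℤ => (m % 8).toNat) (by
      intro m _; rw [mem_range]; omega)]
    refine sum_congr rfl fun r hr => sum_congr ?_ fun _ _ => rfl
    ext m; simp only [mem_filter]
    have := mem_range.mp hr
    constructor <;> rintro ⟨h1, h2⟩ <;> exact ⟨h1, by omega⟩
  rw [hsplit]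
  refine (sum_le_sum key).trans_eq ?_
  rw [sum_const, card_range, nsmul_eq_mul]
  push_cast
  ring

lemma box_bound {w : ℝ → ℝ} (hw : TF w) {δ : ℝ} (hδ : 0 < δ) (hδ2 : δ ≤ 1 / 2) : ∃ C : ℝ, 0 ≤ C ∧
    ∀ (N : ℕ), Squarefree N → ∀ X α : ℝ, 0 < X → X ≤ 8 * N → 0 < α → ∀ (s : Bool) (a : ℕ) (S : Finset ℕ) (F : Finset ℤ),
    ‖∑ m ∈ F, ∑ j ∈ S, gg w N X α ((s, a), j) m‖ ≤ C *
      ((8 * N / X) * α ^ (-(1/4 + δ/2)) * (2 ^ a * X / 8) ^ (-δ) +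
        Real.sqrt (8 * N / X) * α ^ (-(3/4 + δ/2)) * (2 ^ a * X / 8) ^ (-(1 + δ))) := by
  obtain ⟨C, hC, hW⟩ := W_main hw 4
  refine ⟨8 * CT δ * (64 * C) * (KK (1 + δ) + KK (2 + δ)), ?_, ?_⟩
  · have := CT_nonneg δ
    have := KK_nonneg (1 + δ)
    have := KK_nonneg (2 + δ)
    positivity
  intro N hN X α hX hXN hα s a S F
  set M := 8 * N / X with hM
  have hN0 : (0 : ℝ) < N := by exact_mod_cast Nat.pos_of_ne_zero hN.ne_zero
  have hM1 : 1 ≤ M := by rw [hM, le_div_iff₀ hX]; linarith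
  set β := 2 ^ a * X / 8 with hβd
  have hβ : 0 < β := by positivity
  have hu : |(uu s a : ℝ) * X / 8| = β := by
    rw [abs_div, abs_mul, uu_abs, abs_of_pos hX, hβd]; norm_num
  have hu0 : (uu s a : ℝ) * X / 8 ≠ 0 := by
    intro h; rw [h, abs_zero] at hu; exact hβ.ne hu
  have hXβ : X ≤ 8 * |(uu s a : ℝ) * X / 8| := by
    rw [hu, hβd]
    have : (1 : ℝ) ≤ 2 ^ a := one_le_pow₀ (by norm_num)
    nlinarith
  choose D hDc hDi hD0 hDb hDF using fun j : ℕ => hW (α * ((2 * j + 1 : ℕ) : ℝ) ^ 2) _ X (by positivity) hu0 hX hXβ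
  have hom : ∀ m : ℤ, (1 / (1 + X ^ 2 * ((m : ℝ) / (8 * N)) ^ 2) : ℝ) = om M m := by
    intro m; unfold om; rw [hM]; congr 2; field_simp
  have hintg : ∀ m : ℤ, ∀ j, Integrable (fun v => D j v * ee (-((m : ℝ) / (8 * N) * v))) := by
    intro m j
    refine (hDi j).mul_bdd (c := 1) ?_ ?_
    · refine Continuous.aestronglyMeasurable ?_
      unfold ee; fun_prop
    · exact Eventually.of_forall fun v => by rw [norm_ee]
  have hrep : ∑ m ∈ F, ∑ j ∈ S, gg w N X α ((s, a), j) m = ∫ v, ∑ m ∈ F, ∑ j ∈ S,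
      ((om M m : ℝ) : ℂ) * (C1 N s a (2 * j + 1) m * (bb m (N * (2 * j + 1)) : ℂ)) * (D j v * ee (-((m : ℝ) / (8 * N) * v))) := by
    rw [integral_finsetSum]
    · refine sum_congr rfl fun m _ => ?_
      rw [integral_finsetSum]
      · refine sum_congr rfl fun j _ => ?_
        rw [integral_const_mul]
        unfold gg
        simp only
        rw [hDF j, hom]
        ring
      · exact fun j _ => (hintg m j).const_mul _
    · exact fun m _ => integrable_finsetSum _ fun j _ => (hintg m j).const_mul _
  rw [hrep]
  set G : ℝ → ℝ := fun v => 8 * CT δ * (64 * C) * (M * α ^ (-(1/4 + δ/2)) * kf (1 + δ) β v + Real.sqrt M * α ^ (-(3/4 + δ/2)) * kf (2 + δ) β v) with hG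
  have hGi : IntegrableOn G (Set.Ioi 0) :=
    (((kf_scale_int (by linarith) (by linarith) hβ).const_mul _).add ((kf_scale_int (by linarith) (by linarith) hβ).const_mul _)).const_mul _
  have hb := norm_integral_le_of_norm_le (μ := volume) (f := fun v => ∑ m ∈ F, ∑ j ∈ S,
      ((om M m : ℝ) : ℂ) * (C1 N s a (2 * j + 1) m * (bb m (N * (2 * j + 1)) : ℂ)) * (D j v * ee (-((m : ℝ) / (8 * N) * v))))
      (g := (Set.Ioi 0).indicator G) (hGi.integrable_indicator measurableSet_Ioi) (Eventually.of_forall fun v => by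
        by_cases hv : 0 < v
        · rw [Set.indicator_of_mem (show v ∈ Set.Ioi 0 from hv)]
          have h := box_point hδ hδ2 hC hN hα hM1 hβ s a S F (fun j => D j v) hv (fun j => by
            have := hDb j v hv
            rwa [hu] at this)
          refine le_trans ?_ h
          refine (norm_sum_le _ _).trans (sum_le_sum fun m _ => ?_)
          have : ∑ j ∈ S, ((om M m : ℝ) : ℂ) * (C1 N s a (2 * j + 1) m * (bb m (N * (2 * j + 1)) : ℂ)) * (D j v * ee (-((m : ℝ) / (8 * N) * v)))
            = ((om M m : ℝ) : ℂ) * (∑ j ∈ S, C1 N s a (2 * j + 1) m * (bb m (N * (2 * j + 1)) : ℂ) * D j v) * ee (-((m : ℝ) / (8 * N) * v)) := by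
            rw [mul_sum, sum_mul]
            exact sum_congr rfl fun j _ => by ring
          rw [this, norm_mul, norm_mul, norm_ee, mul_one, Complex.norm_real, Real.norm_of_nonneg (om_nonneg _ _)]
        · rw [Set.indicator_of_notMem (by simpa using hv)]
          simp [hD0 _ v (not_lt.mp hv)])
  refine hb.trans ?_
  rw [integral_indicator measurableSet_Ioi, hG, integral_const_mul, integral_add
    ((kf_scale_int (by linarith) (by linarith) hβ).const_mul _) ((kf_scale_int (by linarith) (by linarith) hβ).const_mul _),
    integral_const_mul, integral_const_mul, kf_scale hβ, kf_scale hβ, show 1 - (1 + δ) = -δ by ring, show 1 - (2 + δ) = -(1 + δ) by ring]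
  have h1 := KK_nonneg (1 + δ)
  have h2 := KK_nonneg (2 + δ)
  have h0 := CT_nonneg δ
  rw [mul_assoc (8 * CT δ * (64 * C)) (KK (1 + δ) + KK (2 + δ))]
  refine mul_le_mul_of_nonneg_left ?_ (by positivity)
  have p1 : 0 ≤ M * α ^ (-(1/4 + δ/2)) * β ^ (-δ) := by positivity
  have p2 : 0 ≤ Real.sqrt M * α ^ (-(3/4 + δ/2)) * β ^ (-(1 + δ)) := by positivity
  nlinarith [mul_nonneg p1 h2, mul_nonneg p2 h1]

end QT

namespace QT
open Finset Filter Topology MeasureTheory FourierTransform NumberTheorySymbols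

noncomputable def Err (w : ℝ → ℝ) (N : ℕ) (X α : ℝ) : ℂ := ∑' p, ∑' n : ℕ, st w N X α n (iot p)

noncomputable def Mn (w : ℝ → ℝ) (N : ℕ) (X α : ℝ) : ℂ := ∑' n : ℕ, st w N X α n 0

lemma st_col {w : ℝ → ℝ} (hw : TF w) (N : ℕ) (X α : ℝ) (hX : 0 < X) (hα : 0 < α) :
    Summable (fun k : ℤ => ∑' n : ℕ, st w N X α n k) :=
  (st_summable hw N X α hX hα).prod_symm.prod

lemma main_err {w : ℝ → ℝ} (hw : TF w) (N : ℕ) (X α : ℝ) (hX : 0 < X) (hα : 0 < α) :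
    ∑' n : ℕ, ∑' k : ℤ, st w N X α n k = Mn w N X α + Err w N X α := by
  have h := st_summable hw N X α hX hα
  rw [← Summable.tsum_comm (f := fun (n : ℕ) (k : ℤ) => st w N X α n k) h,
    (st_col hw N X α hX hα).tsum_eq_add_tsum_ite 0]
  unfold Mn Err
  congr 1
  rw [← iot_inj.tsum_eq (f := fun k : ℤ => if k = 0 then 0 else ∑' n : ℕ, st w N X α n k)]
  · refine tsum_congr fun p => ?_
    rw [if_neg (iot_ne p)]
  · intro k hk
    rw [Function.mem_support] at hk
    have : k ≠ 0 := by rintro rfl; simp at hk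
    obtain ⟨p, hp⟩ := iot_surj k this
    exact ⟨p, hp⟩

lemma rpow_pow_aux (δ : ℝ) (a : ℕ) : ((2 : ℝ) ^ a) ^ (-δ) = ((2 : ℝ) ^ (-δ)) ^ a := by
  rw [← Real.rpow_natCast, ← Real.rpow_natCast, ← Real.rpow_mul (by norm_num), ← Real.rpow_mul (by norm_num), mul_comm]

lemma geo_summable {δ : ℝ} (hδ : 0 < δ) : Summable (fun u : Bool × ℕ => ((2 : ℝ) ^ (-δ)) ^ u.2) := by
  have h1 : Summable (fun _ : Bool => (1 : ℝ)) := (hasSum_fintype _).summable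
  have h2 : Summable (fun a : ℕ => ((2 : ℝ) ^ (-δ)) ^ a) := by
    apply summable_geometric_of_lt_one (by positivity)
    exact Real.rpow_lt_one_of_one_lt_of_neg (by norm_num) (by linarith)
  have := h1.mul_of_nonneg h2 (fun _ => zero_le_one) (fun _ => by positivity)
  simpa using this

lemma Err_bound1 {w : ℝ → ℝ} (hw : TF w) {δ : ℝ} (hδ : 0 < δ) (hδ2 : δ ≤ 1 / 2) : ∃ C : ℝ, 0 ≤ C ∧
    ∀ (N : ℕ), Odd N → Squarefree N → ∀ X α : ℝ, 0 < X → X ≤ 8 * N → 0 < α →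
    ‖Err w N X α‖ ≤ C * ((X / (64 * Real.sqrt N)) * ((8 * N / X) * α ^ (-(1/4 + δ/2)) * (X / 8) ^ (-δ) +
        Real.sqrt (8 * N / X) * α ^ (-(3/4 + δ/2)) * (X / 8) ^ (-(1 + δ)))) := by
  obtain ⟨C, hC, hB⟩ := box_bound hw hδ hδ2
  set G := ∑' u : Bool × ℕ, ((2 : ℝ) ^ (-δ)) ^ u.2 with hG
  have hG0 : 0 ≤ G := tsum_nonneg fun _ => by positivity
  refine ⟨G * C, by positivity, ?_⟩
  intro N hNo hN X α hX hXN hα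
  have hN0 : (0 : ℝ) < N := by exact_mod_cast hNo.pos
  set R := (8 * N / X) * α ^ (-(1/4 + δ/2)) * (X / 8) ^ (-δ) +
        Real.sqrt (8 * N / X) * α ^ (-(3/4 + δ/2)) * (X / 8) ^ (-(1 + δ)) with hR
  have hs : Summable (fun p => ∑' n : ℕ, st w N X α n (iot p)) := (st_col hw N X α hX hα).comp_injective iot_inj
  unfold Err
  rw [hs.tsum_prod]
  have key : ∀ u : Bool × ℕ, ‖∑' j, ∑' n : ℕ, st w N X α n (iot (u, j))‖ ≤
      ((2 : ℝ) ^ (-δ)) ^ u.2 * (C * ((X / (64 * Real.sqrt N)) * R)) := by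
    rintro ⟨s, a⟩
    have hj : Summable (fun j => ∑' n : ℕ, st w N X α n (iot ((s, a), j))) := hs.prod_factor (s, a)
    refine le_of_tendsto hj.hasSum.norm (Eventually.of_forall fun S => ?_)
    have e1 : ∑ j ∈ S, ∑' n : ℕ, st w N X α n (iot ((s, a), j)) =
        ((X / (64 * Real.sqrt N) : ℝ) : ℂ) * ∑' m : ℤ, ∑ j ∈ S, gg w N X α ((s, a), j) m := by
      rw [Summable.tsum_finsetSum (fun j _ => gg_summable hw hNo.pos X α hX hα _), mul_sum]
      exact sum_congr rfl fun j _ => second_poisson hw hNo X α hX hα _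
    have hsm : Summable (fun m : ℤ => ∑ j ∈ S, gg w N X α ((s, a), j) m) :=
      summable_sum fun j _ => gg_summable hw hNo.pos X α hX hα _
    have hb : ‖∑' m : ℤ, ∑ j ∈ S, gg w N X α ((s, a), j) m‖ ≤ C * (((2 : ℝ) ^ (-δ)) ^ a * R) := by
      refine le_of_tendsto hsm.hasSum.norm (Eventually.of_forall fun F => ?_)
      refine (hB N hN X α hX hXN hα s a S F).trans (mul_le_mul_of_nonneg_left ?_ hC)
      have h2a : (1 : ℝ) ≤ 2 ^ a := one_le_pow₀ (by norm_num)
      have f1 : ((2 : ℝ) ^ a * X / 8) ^ (-δ) = (2 ^ (-δ)) ^ a * (X / 8) ^ (-δ) := by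
        rw [mul_div_assoc, Real.mul_rpow (by positivity) (by positivity), rpow_pow_aux]
      have f2 : ((2 : ℝ) ^ a * X / 8) ^ (-(1 + δ)) ≤ (2 ^ (-δ)) ^ a * (X / 8) ^ (-(1 + δ)) := by
        rw [mul_div_assoc, Real.mul_rpow (by positivity) (by positivity), ← rpow_pow_aux]
        gcongr
        linarith
      rw [f1, hR]
      calc _ ≤ (8 * N / X) * α ^ (-(1/4 + δ/2)) * ((2 ^ (-δ)) ^ a * (X / 8) ^ (-δ)) +
        Real.sqrt (8 * N / X) * α ^ (-(3/4 + δ/2)) * ((2 ^ (-δ)) ^ a * (X / 8) ^ (-(1 + δ))) := by gcongr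
        _ = _ := by ring
    simp only
    rw [e1, norm_mul, Complex.norm_real, Real.norm_of_nonneg (by positivity)]
    calc _ ≤ (X / (64 * Real.sqrt N)) * (C * (((2 : ℝ) ^ (-δ)) ^ a * R)) := by gcongr
      _ = _ := by ring
  refine (tsum_of_norm_bounded ((geo_summable hδ).hasSum.mul_right _) key).trans_eq ?_
  rw [← hG]; ring

lemma Err_bound {w : ℝ → ℝ} (hw : TF w) {δ : ℝ} (hδ : 0 < δ) (hδ2 : δ ≤ 1 / 2) : ∃ C : ℝ, 0 ≤ C ∧
    ∀ (N : ℕ), Odd N → Squarefree N → ∀ X α : ℝ, 0 < X → X ≤ 8 * N → 0 < α → 1 / (N * X) ≤ α →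
    ‖Err w N X α‖ ≤ C * (Real.sqrt N * α ^ (-(1/4 + δ/2)) * X ^ (-δ)) := by
  obtain ⟨C, hC, hB⟩ := Err_bound1 hw hδ hδ2
  refine ⟨C * (8 ^ (-1 + (1:ℝ) + δ) * 8 / 64 + 8 ^ (1 + δ) * Real.sqrt 8 / 64), by positivity, ?_⟩
  intro N hNo hN X α hX hXN hα hαl
  have hN0 : (0 : ℝ) < N := by exact_mod_cast hNo.pos
  refine (hB N hNo hN X α hX hXN hα).trans ?_
  rw [mul_assoc C]
  refine mul_le_mul_of_nonneg_left ?_ hC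
  have hsN : 0 < Real.sqrt N := Real.sqrt_pos.mpr hN0
  have hsX : 0 < Real.sqrt X := Real.sqrt_pos.mpr hX
  have qN : Real.sqrt N * Real.sqrt N = N := Real.mul_self_sqrt hN0.le
  have qX : Real.sqrt X * Real.sqrt X = X := Real.mul_self_sqrt hX.le
  have e1 : (X / 8) ^ (-δ) = 8 ^ (-1 + (1:ℝ) + δ) * X ^ (-δ) := by
    rw [Real.div_rpow hX.le (by norm_num), Real.rpow_neg (by norm_num : (0:ℝ) ≤ 8)]
    rw [show (-1 + (1:ℝ) + δ) = δ by ring]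
    field_simp
  have e2 : (X / 8) ^ (-(1 + δ)) = 8 ^ (1 + δ) * (X ^ (-δ) / X) := by
    rw [Real.div_rpow hX.le (by norm_num), Real.rpow_neg (by norm_num : (0:ℝ) ≤ 8), neg_add, Real.rpow_add hX,
      Real.rpow_neg_one]
    field_simp
  have e3 : α ^ (-(3/4 + δ/2)) ≤ α ^ (-(1/4 + δ/2)) * (Real.sqrt N * Real.sqrt X) := by
    rw [show -(3/4 + δ/2) = -(1/4 + δ/2) + -(1/2 : ℝ) by ring, Real.rpow_add hα]
    refine mul_le_mul_of_nonneg_left ?_ (by positivity)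
    rw [Real.rpow_neg hα.le, ← Real.sqrt_eq_rpow, ← Real.sqrt_mul hN0.le, ← Real.sqrt_inv]
    refine Real.sqrt_le_sqrt ?_
    rw [inv_le_comm₀ hα (by positivity)]
    rwa [one_div] at hαl
  have e4 : Real.sqrt (8 * N / X) = Real.sqrt 8 * Real.sqrt N / Real.sqrt X := by
    rw [Real.sqrt_div (by positivity), Real.sqrt_mul (by norm_num)]
  rw [e1, e2, e4]
  calc _ ≤ X / (64 * Real.sqrt N) * (8 * N / X * α ^ (-(1/4 + δ/2)) * (8 ^ (-1 + (1:ℝ) + δ) * X ^ (-δ)) +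
        Real.sqrt 8 * Real.sqrt N / Real.sqrt X * (α ^ (-(1/4 + δ/2)) * (Real.sqrt N * Real.sqrt X)) * (8 ^ (1 + δ) * (X ^ (-δ) / X))) := by
        gcongr
    _ = _ := by
        generalize α ^ (-(1/4 + δ/2)) = P
        generalize X ^ (-δ) = Q
        generalize (8:ℝ) ^ (-1 + (1:ℝ) + δ) = R1
        generalize (8:ℝ) ^ (1 + δ) = R2
        rw [← qN]
        rw [Real.sqrt_mul_self hsN.le]
        field_simp

lemma II_zero (w : ℝ → ℝ) (P : ℝ) : II w P 0 = ((∫ u, w u * Real.exp (-P / u) : ℝ) : ℂ) := by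
  unfold II
  rw [← integral_complex_ofReal]
  simp [ee_zero]

lemma II_lower {w : ℝ → ℝ} (hw : TF w) (hw0 : ∀ u, 0 ≤ w u) {P : ℝ} (hP : 0 ≤ P) :
    Real.exp (-(4 * P)) * ∫ u, w u ≤ ∫ u, w u * Real.exp (-P / u) := by
  have hc : HasCompactSupport w := HasCompactSupport.intro isCompact_Icc (fun u hu => hw.2 u hu)
  have hi : Integrable w := hw.1.continuous.integrable_of_hasCompactSupport hc
  rw [← integral_const_mul]
  refine integral_mono (hi.const_mul _) ?_ ?_
  · refine Integrable.mono' hi ?_ ?_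
    · refine hw.1.continuous.aestronglyMeasurable.mul ?_
      exact (Real.measurable_exp.comp (measurable_const.div measurable_id)).aestronglyMeasurable
    · refine Eventually.of_forall fun u => ?_
      rw [norm_mul, Real.norm_of_nonneg (hw0 u), Real.norm_of_nonneg (Real.exp_pos _).le]
      by_cases hu : u ∈ Set.Icc (1/4 : ℝ) (3/4)
      · refine mul_le_of_le_one_right (hw0 u) (Real.exp_le_one_iff.mpr ?_)
        exact div_nonpos_of_nonpos_of_nonneg (by linarith) (by linarith [hu.1])
      · simp [hw.2 u hu]
  · intro u
    simp only
    by_cases hu : u ∈ Set.Icc (1/4 : ℝ) (3/4)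
    · rw [mul_comm]
      refine mul_le_mul_of_nonneg_left (Real.exp_le_exp.mpr ?_) (hw0 u)
      rw [neg_div, neg_le_neg_iff, div_le_iff₀ (by linarith [hu.1])]
      nlinarith [hu.1]
    · simp [hw.2 u hu]

lemma st_zero_form {w : ℝ → ℝ} (hw : TF w) (hw0 : ∀ u, 0 ≤ w u) {N : ℕ} (X α : ℝ) (hX : 0 < X) (hα : 0 < α) (n : ℕ) :
    0 ≤ (st w N X α n 0).re := by
  unfold st
  split_ifs with hn
  swap
  · simp
  by_cases hsq : ∃ s, n = s ^ 2
  · obtain ⟨s, rfl⟩ := hsq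
    have hs : Odd s := by
      by_contra h
      rw [Nat.not_odd_iff_even] at h
      exact (Nat.not_odd_iff_even.mpr (h.pow_of_ne_zero two_ne_zero)) hn
    have hs0 : 0 < s := hs.pos
    have h4 : s ^ 2 % 4 = 1 := by
      obtain ⟨r, rfl⟩ := hs
      ring_nf; omega
    have hJ : J(8 | s ^ 2) = 1 := by
      rw [jacobiSym.pow_right]
      apply jacobiSym.sq_one
      exact Int.isCoprime_iff_gcd_eq_one.mp (jac8_coprime s hs)
    have hg : ∃ c : ℕ, gam N (s ^ 2) 0 = c := by
      refine ⟨∑ j ∈ range 8, if (8 : ℤ) ∣ ((s ^ 2 : ℕ) : ℤ) * (j : ℤ) - N then 1 else 0, ?_⟩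
      unfold gam
      rw [hJ]
      unfold eps cN
      rw [if_pos h4]
      simp [ee_zero]
    obtain ⟨c, hc⟩ := hg
    have hE : EE w α (((0 : ℤ) : ℝ) * X / 8) 0 0 ((s ^ 2 : ℕ) : ℝ) =
        ((((s ^ 2 : ℕ) : ℝ) ^ (-(1/2 : ℝ) - (0:ℕ)) * (α * ((s ^ 2 : ℕ) : ℝ) ^ 2) ^ 0 * ∫ u, w u * Real.exp (-(α * ((s ^ 2 : ℕ) : ℝ) ^ 2) / u) : ℝ) : ℂ) := by
      unfold EE
      rw [if_pos (by positivity)]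
      rw [show (((0 : ℤ) : ℝ) * X / 8) / ((s ^ 2 : ℕ) : ℝ) = 0 by simp, II_zero, ← Complex.ofReal_mul]
    rw [hc, mul_zero, bb_zero_sq hs0, hE]
    have : 0 ≤ ∫ u, w u * Real.exp (-(α * ((s ^ 2 : ℕ) : ℝ) ^ 2) / u) :=
      integral_nonneg fun u => mul_nonneg (hw0 u) (Real.exp_pos _).le
    have e : ∀ r : ℝ, ((X / 8 : ℝ) : ℂ) * ((c : ℂ) * (((s : ℕ) : ℤ) : ℂ) * (r : ℂ)) = ((X / 8 * (c * s * r) : ℝ) : ℂ) := by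
      intro r; push_cast; ring
    rw [e, Complex.ofReal_re]
    positivity
  · push Not at hsq
    rw [mul_zero, bb_zero_nonsq hn.pos (fun ⟨s, h⟩ => hsq s (by rw [h, sq]))]
    simp

lemma st_one {w : ℝ → ℝ} {N : ℕ} (X α : ℝ) :
    (st w N X α 1 0).re = X / 8 * ∫ u, w u * Real.exp (-α / u) := by
  unfold st
  have hg : gam N 1 0 = 1 := by
    have : gam N 1 0 = ((∑ j ∈ range 8, if (8 : ℤ) ∣ (j : ℤ) - N then 1 else 0 : ℕ) : ℂ) := by
      unfold gam
      unfold eps cN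
      simp [ee_zero]
    rw [this]
    have h2 : (∑ j ∈ range 8, if (8 : ℤ) ∣ (j : ℤ) - N then 1 else 0 : ℕ) = 1 := by
      rw [sum_eq_single_of_mem (N % 8) (mem_range.mpr (by omega))]
      · rw [if_pos (by omega)]
      · intro b hb hne
        rw [if_neg]
        have := mem_range.mp hb
        omega
    rw [h2]; simp
  have hE : EE w α (((0 : ℤ) : ℝ) * X / 8) 0 0 ((1 : ℕ) : ℝ) = ((∫ u, w u * Real.exp (-α / u) : ℝ) : ℂ) := by
    unfold EE
    rw [if_pos (by norm_num)]
    rw [show (((0 : ℤ) : ℝ) * X / 8) / ((1 : ℕ) : ℝ) = 0 by simp, II_zero]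
    simp
  rw [if_pos odd_one, hg, hE, bb_one, Int.cast_one, mul_one, one_mul, ← Complex.ofReal_mul, Complex.ofReal_re]

lemma Mn_lower {w : ℝ → ℝ} (hw : TF w) (hw0 : ∀ u, 0 ≤ w u) {N : ℕ} (X α : ℝ) (hX : 0 < X) (hα : 0 < α) :
    X / 8 * (Real.exp (-(4 * α)) * ∫ u, w u) ≤ (Mn w N X α).re := by
  have hs : Summable (fun n : ℕ => st w N X α n 0) := (st_summable hw N X α hX hα).prod_symm.prod_factor 0
  have h1 : HasSum (fun n : ℕ => (st w N X α n 0).re) (Mn w N X α).re := Complex.hasSum_re hs.hasSum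
  have h2 := le_hasSum h1 1 (fun n _ => st_zero_form hw hw0 X α hX hα n)
  refine le_trans ?_ h2
  rw [st_one]
  exact mul_le_mul_of_nonneg_left (II_lower hw hw0 hα.le) (by positivity)

end QT

namespace QT
open Finset Filter Topology MeasureTheory FourierTransform NumberTheorySymbols

noncomputable def th (Q : ℕ) (y : ℝ) : ℂ := ∑' n : ℕ, (bb n Q : ℂ) * ((Real.exp (-(Real.pi * y / Q * n ^ 2)) : ℝ) : ℂ)

lemma bb_norm {Q : ℕ} (hQ : 0 < Q) (x : ℤ) : ‖(bb x Q : ℂ)‖ ≤ Q := by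
  rw [Complex.norm_intCast]
  exact_mod_cast bb_abs_le hQ x

lemma gauss_nat {c : ℝ} (hc : 0 < c) : Summable (fun n : ℕ => Real.exp (-(c * n ^ 2))) := by
  simpa using exp_poly_summable c hc 0

lemma th_summable {Q : ℕ} (hQ : 0 < Q) {y : ℝ} (hy : 0 < y) (c : ℕ → ℂ) (hc : ∀ n, ‖c n‖ ≤ Q) :
    Summable (fun n : ℕ => c n * ((Real.exp (-(Real.pi * y / Q * n ^ 2)) : ℝ) : ℂ)) := by
  have hQ' : (0 : ℝ) < Q := by exact_mod_cast hQ
  refine Summable.of_norm_bounded ((gauss_nat (c := Real.pi * y / Q) (by positivity)).mul_left (Q : ℝ)) fun n => ?_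
  rw [norm_mul, Complex.norm_real, Real.norm_of_nonneg (Real.exp_pos _).le]
  exact mul_le_mul_of_nonneg_right (hc n) (Real.exp_pos _).le

lemma bb_even {Q : ℕ} (hQ : Q % 4 = 1) (x : ℤ) : bb (-x) Q = bb x Q := by
  have h := bb_unit (n := Q) (by omega) (-1) x (by
    exact isCoprime_one_left.neg_left)
  rw [neg_one_mul] at h
  rw [h, jacobiSym.at_neg_one (Nat.odd_iff.mpr (by omega)), ZMod.χ₄_nat_one_mod_four hQ, one_mul]

lemma thZ {Q : ℕ} (hQ : Q % 4 = 1) (hns : ¬ IsSquare Q) {y : ℝ} (hy : 0 < y) :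
    HasSum (fun x : ℤ => (bb x Q : ℂ) * ((Real.exp (-(Real.pi * y / Q * x ^ 2)) : ℝ) : ℂ)) (2 * th Q y) := by
  have hQ0 : 0 < Q := by omega
  have h1 := (th_summable hQ0 hy (fun n => (bb n Q : ℂ)) (fun n => bb_norm hQ0 n)).hasSum
  have h2 := HasSum.of_nat_of_neg (f := fun x : ℤ => (bb x Q : ℂ) * ((Real.exp (-(Real.pi * y / Q * x ^ 2)) : ℝ) : ℂ))
    (g := th Q y) (g' := th Q y) (by simpa [th] using h1) (by
      have : (fun n : ℕ => (bb (-(n : ℤ)) Q : ℂ) * ((Real.exp (-(Real.pi * y / Q * ((-(n : ℤ) : ℤ) : ℝ) ^ 2)) : ℝ) : ℂ)) =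
        fun n : ℕ => (bb n Q : ℂ) * ((Real.exp (-(Real.pi * y / Q * n ^ 2)) : ℝ) : ℂ) := by
        funext n; rw [bb_even hQ]; simp
      rw [this]; exact h1)
  simpa [bb_zero_nonsq hQ0 hns, two_mul] using h2

lemma th_fe {Q : ℕ} (hQ : Q % 4 = 1) (hns : ¬ IsSquare Q) {y : ℝ} (hy : 0 < y) :
    th Q (1 / y) = ((y ^ (1/2 : ℝ) : ℝ) : ℂ) * th Q y := by
  have hQ0 : 0 < Q := by omega
  have hQ' : (0 : ℝ) < Q := by exact_mod_cast hQ0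
  have hQc : (Q : ℂ) ≠ 0 := by exact_mod_cast hQ0.ne'
  have hyc : (y : ℂ) ≠ 0 := by exact_mod_cast hy.ne'
  have h := tsum_exp_twist hQ0 (z := ((y / Q : ℝ) : ℂ)) (by rw [Complex.ofReal_re]; positivity) (fun x => (bb x Q : ℂ)) Q
    (fun x => bb_norm hQ0 x) (fun r j => by rw [bb_period hQ0 (y := r)]; exact ⟨j, by ring⟩)
  have e1 : ∑' x : ℤ, (bb x Q : ℂ) * Complex.exp (-Real.pi * ((y / Q : ℝ) : ℂ) * (x : ℂ) ^ 2) = 2 * th Q y := by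
    rw [← (thZ hQ hns hy).tsum_eq]
    refine tsum_congr fun x => ?_
    rw [Complex.ofReal_exp]
    congr 2
    push_cast; ring
  have e2 : ((((y / Q : ℝ) : ℂ) * (Q : ℂ) ^ 2) ^ (1 / 2 : ℂ)) = ((y ^ (1/2 : ℝ) * Real.sqrt Q : ℝ) : ℂ) := by
    rw [show (((y / Q : ℝ) : ℂ) * (Q : ℂ) ^ 2) = ((y * Q : ℝ) : ℂ) by push_cast; field_simp,
      show (1 / 2 : ℂ) = ((1/2 : ℝ) : ℂ) by push_cast; rfl, ← Complex.ofReal_cpow (by positivity),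
      Real.mul_rpow hy.le hQ'.le, Real.sqrt_eq_rpow (Q : ℝ)]
  have e3 : ∑ r ∈ range Q, (bb r Q : ℂ) * ∑' k : ℤ, ee (k * r / Q) * Complex.exp (-(Real.pi / (((y / Q : ℝ) : ℂ) * (Q : ℂ) ^ 2)) * (k : ℂ) ^ 2)
      = (Real.sqrt Q : ℂ) * (2 * th Q (1 / y)) := by
    have hy1 : 0 < 1 / y := by positivity
    rw [← (thZ hQ hns hy1).tsum_eq, ← tsum_mul_left]
    have hse : Summable (fun k : ℤ => Real.exp (-(Real.pi * (1 / y) / Q * (k : ℝ) ^ 2))) := by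
      have g := (gauss_nat (c := Real.pi * (1 / y) / Q) (by positivity))
      exact Summable.of_nat_of_neg (by simpa using g) (by simpa using g)
    have hs : ∀ r ∈ range Q, Summable (fun k : ℤ => (bb r Q : ℂ) * (ee (k * r / Q) * Complex.exp (-(Real.pi / (((y / Q : ℝ) : ℂ) * (Q : ℂ) ^ 2)) * (k : ℂ) ^ 2))) := by
      intro r _
      refine Summable.mul_left _ ?_
      refine Summable.of_norm_bounded hse fun k => ?_
      rw [norm_mul, norm_ee, one_mul, Complex.norm_exp]
      refine le_of_eq (congrArg _ ?_)
      rw [show (-(Real.pi / (((y / Q : ℝ) : ℂ) * (Q : ℂ) ^ 2)) * (k : ℂ) ^ 2) = ((-(Real.pi * (1 / y) / Q * (k : ℝ) ^ 2) : ℝ) : ℂ) by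
        push_cast; field_simp, Complex.ofReal_re]
    simp_rw [← tsum_mul_left]
    rw [← Summable.tsum_finsetSum hs]
    refine tsum_congr fun k => ?_
    have hft := ft_main (N := 1) squarefree_one Q (Nat.odd_iff.mpr (by omega)) k
    simp only [Nat.cast_one, one_mul] at hft
    unfold ft eps at hft
    rw [if_pos hQ, one_mul] at hft
    rw [← mul_assoc, ← hft, sum_mul]
    refine sum_congr rfl fun r _ => ?_
    rw [← mul_assoc, Complex.ofReal_exp]
    congr 2
    push_cast; field_simp
  rw [e1, e2, e3] at h
  have hsq : (Real.sqrt Q : ℂ) ≠ 0 := by exact_mod_cast (Real.sqrt_pos.mpr hQ').ne'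
  have hyp : ((y ^ (1/2 : ℝ) : ℝ) : ℂ) ≠ 0 := by exact_mod_cast (Real.rpow_pos_of_pos hy _).ne'
  rw [Complex.ofReal_mul] at h
  have h2 : (2 : ℂ) * (((y ^ (1/2 : ℝ) : ℝ) : ℂ) * th Q y) = 2 * th Q (1 / y) := by
    rw [mul_left_comm, h]; field_simp
  exact (mul_left_cancel₀ two_ne_zero h2).symm

lemma th_cont {Q : ℕ} (hQ : 0 < Q) : ContinuousOn (th Q) (Set.Ioi 0) := by
  have hQ' : (0 : ℝ) < Q := by exact_mod_cast hQ
  intro y hy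
  have hy : 0 < y := hy
  refine ContinuousAt.continuousWithinAt ?_
  have : ContinuousOn (th Q) (Set.Ioi (y / 2)) := by
    unfold th
    refine continuousOn_tsum (u := fun n : ℕ => (Q : ℝ) * Real.exp (-(Real.pi * (y / 2) / Q * n ^ 2))) (fun n => ?_) ?_ ?_
    · fun_prop
    · exact (gauss_nat (by positivity)).mul_left _
    · intro n x hx
      have hx : y / 2 < x := hx
      rw [norm_mul, Complex.norm_real, Real.norm_of_nonneg (Real.exp_pos _).le]
      refine mul_le_mul (bb_norm hQ n) ?_ (Real.exp_pos _).le hQ'.le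
      refine Real.exp_le_exp.mpr (neg_le_neg ?_)
      gcongr
  exact this.continuousAt (Ioi_mem_nhds (by linarith))

lemma th_decay {Q : ℕ} (hQ : 0 < Q) (hns : ¬ IsSquare Q) :
    ∃ K : ℝ, ∀ y, 1 ≤ y → ‖th Q y‖ ≤ K * Real.exp (-(Real.pi / Q) * y) := by
  have hQ' : (0 : ℝ) < Q := by exact_mod_cast hQ
  set G := ∑' n : ℕ, (Q : ℝ) * Real.exp (-(Real.pi * 1 / Q * n ^ 2))
  refine ⟨G * Real.exp (Real.pi / Q), fun y hy => ?_⟩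
  have hs := ((gauss_nat (c := Real.pi * 1 / Q) (by positivity)).mul_left (Q : ℝ))
  have := tsum_of_norm_bounded (f := fun n : ℕ => (bb n Q : ℂ) * ((Real.exp (-(Real.pi * y / Q * n ^ 2)) : ℝ) : ℂ))
    (hs.hasSum.mul_right (Real.exp (Real.pi / Q) * Real.exp (-(Real.pi / Q) * y))) (fun n => by
      rw [norm_mul, Complex.norm_real, Real.norm_of_nonneg (Real.exp_pos _).le]
      rcases Nat.eq_zero_or_pos n with rfl | hn
      · simp only [Nat.cast_zero, bb_zero_nonsq hQ hns]
        simp only [Int.cast_zero, norm_zero, zero_mul]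
        positivity
      · rw [mul_assoc]
        refine mul_le_mul (bb_norm hQ n) ?_ (Real.exp_pos _).le hQ'.le
        rw [← Real.exp_add, ← Real.exp_add]
        refine Real.exp_le_exp.mpr ?_
        have hn1 : (1 : ℝ) ≤ (n : ℝ) ^ 2 := one_le_pow₀ (by exact_mod_cast hn)
        have : 0 ≤ Real.pi / Q * ((y - 1) * ((n : ℝ) ^ 2 - 1)) := by
          have := sub_nonneg.mpr hy
          have := sub_nonneg.mpr hn1
          positivity
        have e : Real.pi / Q * ((y - 1) * ((n : ℝ) ^ 2 - 1)) = Real.pi * y / Q * n ^ 2 - Real.pi * 1 / Q * n ^ 2 + Real.pi / Q - Real.pi / Q * y := by ring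
        linarith)
  unfold th
  refine this.trans_eq ?_
  ring

lemma th_top {Q : ℕ} (hQ : 0 < Q) (hns : ¬ IsSquare Q) (r : ℝ) : th Q =O[atTop] (fun y : ℝ => y ^ r) := by
  obtain ⟨K, hK⟩ := th_decay hQ hns
  have hQ' : (0 : ℝ) < Q := by exact_mod_cast hQ
  have h1 : th Q =O[atTop] (fun y => Real.exp (-(Real.pi / Q) * y)) := by
    refine Asymptotics.IsBigO.of_bound K ?_
    filter_upwards [eventually_ge_atTop 1] with y hy
    rw [Real.norm_of_nonneg (Real.exp_pos _).le]
    exact hK y hy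
  exact h1.trans (isLittleO_exp_neg_mul_rpow_atTop (by positivity) r).isBigO

noncomputable def thPair (Q : ℕ) (hQ : Q % 4 = 1) (hns : ¬ IsSquare Q) : WeakFEPair ℂ where
  f := th Q
  g := th Q
  k := 1/2
  ε := 1
  f₀ := 0
  g₀ := 0
  hf_int := (th_cont (by omega)).locallyIntegrableOn measurableSet_Ioi
  hg_int := (th_cont (by omega)).locallyIntegrableOn measurableSet_Ioi
  hk := by norm_num
  hε := one_ne_zero
  h_feq := fun x hx => by rw [one_mul, smul_eq_mul]; exact th_fe hQ hns hx
  hf_top := fun r => by simpa using th_top (by omega) hns r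
  hg_top := fun r => by simpa using th_top (by omega) hns r

lemma thPair_strong (Q : ℕ) (hQ : Q % 4 = 1) (hns : ¬ IsSquare Q) : IsStrongFEPair (thPair Q hQ hns) := ⟨rfl, rfl⟩

lemma th_mellin_conv {Q : ℕ} (hQ : Q % 4 = 1) (hns : ¬ IsSquare Q) (s : ℂ) : MellinConvergent (th Q) s :=
  ((thPair_strong Q hQ hns).hasMellin s).1

lemma th_mellin_diff {Q : ℕ} (hQ : Q % 4 = 1) (hns : ¬ IsSquare Q) : Differentiable ℂ (mellin (th Q)) := by
  have h := (thPair_strong Q hQ hns).differentiable_Λ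
  have e : (thPair Q hQ hns).Λ = mellin (th Q) := funext fun s => ((thPair_strong Q hQ hns).hasMellin s).2.symm
  rwa [e] at h

end QT

namespace QT
open Finset Filter Topology MeasureTheory FourierTransform NumberTheorySymbols

noncomputable def jc (n : ℕ) [NeZero n] : DirichletCharacter ℂ n where
  toFun a := (J((a.val : ℤ) | n) : ℂ)
  map_one' := by
    have h : J((((1 : ZMod n)).val : ℤ) | n) = J(1 | n) := by
      apply jacobiSym.mod_left'
      have := ZMod.val_natCast n 1
      rw [Nat.cast_one] at this
      rw [this]; simp
    rw [h, jacobiSym.one_left]; simp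
  map_mul' a b := by
    have h : J(((a * b).val : ℤ) | n) = J((a.val : ℤ) * (b.val : ℤ) | n) := by
      apply jacobiSym.mod_left'
      rw [ZMod.val_mul]; push_cast; simp
    rw [h, jacobiSym.mul_left]; simp
  map_nonunit' a ha := by
    have h : J((a.val : ℤ) | n) = 0 := by
      rw [jacobiSym.eq_zero_iff_not_coprime]
      intro h
      apply ha
      rw [Int.gcd_natCast_natCast] at h
      have := (ZMod.isUnit_iff_coprime a.val n).mpr h
      rwa [ZMod.natCast_zmod_val] at this
    simp only [h]; simp

lemma jc_nat (n : ℕ) [NeZero n] (x : ℕ) : jc n (x : ZMod n) = (J((x : ℤ) | n) : ℂ) := by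
  change (J((((x : ZMod n)).val : ℤ) | n) : ℂ) = _
  congr 1
  apply jacobiSym.mod_left'
  rw [ZMod.val_natCast]; simp

lemma euler_ne {M : ℕ} (χ : DirichletCharacter ℂ M) (c : ℕ) :
    ∏ p ∈ c.primeFactors, (1 - χ p * (p : ℂ) ^ (-(1 / 2 : ℂ))) ≠ 0 := by
  rw [prod_ne_zero_iff]
  intro p hp h
  have hp' : p.Prime := Nat.prime_of_mem_primeFactors hp
  have h1 : ‖χ p * (p : ℂ) ^ (-(1 / 2 : ℂ))‖ < 1 := by
    rw [norm_mul]
    have h2 : ‖(p : ℂ) ^ (-(1 / 2 : ℂ))‖ < 1 := by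
      rw [Complex.norm_natCast_cpow_of_pos hp'.pos]
      apply Real.rpow_lt_one_of_one_lt_of_neg
      · exact_mod_cast hp'.one_lt
      · norm_num
    calc _ ≤ 1 * ‖(p : ℂ) ^ (-(1 / 2 : ℂ))‖ := mul_le_mul_of_nonneg_right (χ.norm_le_one _) (norm_nonneg _)
      _ < 1 := by rwa [one_mul]
  rw [← sub_eq_zero.mp h, norm_one] at h1
  exact lt_irrefl _ h1

lemma LF_level {a c : ℕ} [NeZero a] [NeZero c] (ha : a ∣ c) (χ : DirichletCharacter ℂ a) :
    DirichletCharacter.LFunction (DirichletCharacter.changeLevel ha χ) (1/2) = 0 ↔ DirichletCharacter.LFunction χ (1/2) = 0 := by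
  rw [DirichletCharacter.LFunction_changeLevel ha χ (Or.inr (by norm_num)), mul_eq_zero, or_iff_left (euler_ne χ c)]

lemma LF_equiv {a b c : ℕ} [NeZero a] [NeZero b] [NeZero c] (ha : a ∣ c) (hb : b ∣ c)
    (χ : DirichletCharacter ℂ a) (ψ : DirichletCharacter ℂ b) (h : ∀ x : ℕ, x.Coprime c → χ x = ψ x) :
    DirichletCharacter.LFunction χ (1/2) = 0 ↔ DirichletCharacter.LFunction ψ (1/2) = 0 := by
  rw [← LF_level ha, ← LF_level hb]
  have : DirichletCharacter.changeLevel ha χ = DirichletCharacter.changeLevel hb ψ := by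
    apply MulChar.ext
    intro u
    have hx : (ZMod.val (u : ZMod c)).Coprime c := ZMod.val_coe_unit_coprime u
    rw [DirichletCharacter.changeLevel_eq_cast_of_dvd, DirichletCharacter.changeLevel_eq_cast_of_dvd,
      ZMod.cast_eq_val, ZMod.cast_eq_val, h _ hx]
  rw [this]

noncomputable def LJ (m : ℕ) (s : ℂ) : ℂ :=
  if h : m ≠ 0 then haveI : NeZero m := ⟨h⟩; DirichletCharacter.LFunction (jc m) s else 0

lemma LJ_eq (m : ℕ) [NeZero m] (s : ℂ) : LJ m s = DirichletCharacter.LFunction (jc m) s := by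
  unfold LJ; rw [dif_pos (NeZero.ne m)]

lemma LJ_diff (m : ℕ) {s : ℂ} (hs : s ≠ 1) : DifferentiableAt ℂ (LJ m) s := by
  rcases eq_or_ne m 0 with rfl | h
  · have : LJ 0 = fun _ => 0 := by funext s; simp [LJ]
    rw [this]; exact differentiableAt_const _
  · haveI : NeZero m := ⟨h⟩
    have : LJ m = DirichletCharacter.LFunction (jc m) := funext fun s => LJ_eq m s
    rw [this]
    exact DirichletCharacter.differentiableAt_LFunction _ _ (Or.inl hs)

lemma LJ_sq {Q g : ℕ} (hQ : 0 < Q) (hg : g ^ 2 ∣ Q) (h0 : LJ Q (1/2) = 0) : LJ (Q / g ^ 2) (1/2) = 0 := by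
  obtain ⟨m, rfl⟩ := hg
  have hg0 : 0 < g := by
    rcases Nat.eq_zero_or_pos g with rfl | h
    · simp at hQ
    · exact h
  have hm0 : 0 < m := Nat.pos_of_mul_pos_left hQ
  rw [Nat.mul_div_cancel_left _ (by positivity)]
  haveI : NeZero m := ⟨hm0.ne'⟩
  haveI : NeZero g := ⟨hg0.ne'⟩
  haveI : NeZero (g ^ 2 * m) := ⟨hQ.ne'⟩
  rw [LJ_eq] at h0 ⊢
  rw [LF_equiv (dvd_mul_left m (g ^ 2)) dvd_rfl (jc m) (jc (g ^ 2 * m))]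
  · exact h0
  · intro x hx
    rw [jc_nat, jc_nat, jacobiSym.mul_right, jacobiSym.pow_right, jacobiSym.sq_one, one_mul]
    rw [Int.gcd_natCast_natCast]
    exact Nat.Coprime.coprime_dvd_right (Dvd.dvd.mul_right (dvd_pow_self g two_ne_zero) m) hx

lemma bb_series {Q : ℕ} (hQ : 0 < Q) {s : ℂ} (hs : 1 < s.re) :
    HasSum (fun n : ℕ => (bb n Q : ℂ) / (n : ℂ) ^ s)
      (∑ g ∈ sqd Q, ((g : ℂ) / ((g ^ 2 : ℕ) : ℂ) ^ s) * LJ (Q / g ^ 2) s) := by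
  have hs0 : s ≠ 0 := by rintro rfl; norm_num at hs
  have e : (fun n : ℕ => (bb n Q : ℂ) / (n : ℂ) ^ s) = fun n : ℕ => ∑ g ∈ sqd Q,
      (if (g : ℤ) ^ 2 ∣ (n : ℤ) then ((g : ℤ) * J((n : ℤ) / (g : ℤ) ^ 2 | Q / g ^ 2) : ℂ) else 0) / (n : ℂ) ^ s := by
    funext n
    unfold bb
    push_cast
    rw [sum_div]
  rw [e]
  refine hasSum_sum fun g hg => ?_
  have hg0 := sqd_pos hQ hg
  rw [mem_sqd hQ] at hg
  obtain ⟨m, hm⟩ := hg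
  have hm0 : 0 < m := by
    rcases Nat.eq_zero_or_pos m with rfl | h
    · omega
    · exact h
  haveI : NeZero m := ⟨hm0.ne'⟩
  have hQm : Q / g ^ 2 = m := by rw [hm]; exact Nat.mul_div_cancel_left _ (by positivity)
  rw [hQm, LJ_eq, DirichletCharacter.LFunction_eq_LSeries _ hs]
  have hinj : Function.Injective (fun k : ℕ => g ^ 2 * k) := fun x y h => Nat.eq_of_mul_eq_mul_left (by positivity) h
  rw [← hinj.hasSum_iff]
  · have hL : LSeriesHasSum (fun n : ℕ => jc m n) s (LSeries (fun n : ℕ => jc m n) s) :=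
      (DirichletCharacter.LSeriesSummable_of_one_lt_re (jc m) hs).LSeriesHasSum
    have hL' := (HasSum.mul_left ((g : ℂ) / ((g ^ 2 : ℕ) : ℂ) ^ s) hL)
    refine hL'.congr_fun ?_
    intro k
    simp only [Function.comp_apply]
    rcases Nat.eq_zero_or_pos k with rfl | hk
    · simp [LSeries.term, Complex.zero_cpow hs0]
    · rw [LSeries.term_of_ne_zero hk.ne', if_pos ⟨(k : ℤ), by push_cast; ring⟩, jc_nat]
      have e1 : ((g ^ 2 * k : ℕ) : ℤ) / (g : ℤ) ^ 2 = k := by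
        push_cast
        exact Int.mul_ediv_cancel_left _ (by positivity)
      rw [e1]
      have e2 : (((g ^ 2 * k : ℕ) : ℂ)) ^ s = ((g ^ 2 : ℕ) : ℂ) ^ s * (k : ℂ) ^ s := by
        rw [Nat.cast_mul, Complex.natCast_mul_natCast_cpow]
      rw [e2]
      simp only [Int.cast_natCast]
      ring
  · intro n hn
    rw [if_neg, zero_div]
    rintro ⟨k, hk⟩
    apply hn
    have : (g : ℤ) ^ 2 * k ≥ 0 := by rw [← hk]; positivity
    have hk0 : 0 ≤ k := by
      by_contra hc
      push Not at hc
      have : (0 : ℤ) < (g : ℤ) ^ 2 := by positivity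
      nlinarith
    refine ⟨k.toNat, ?_⟩
    simp only
    zify
    rw [Int.toNat_of_nonneg hk0, hk]

noncomputable def HQ (Q : ℕ) (s : ℂ) : ℂ := ∑ g ∈ sqd Q, ((g : ℂ) / ((g ^ 2 : ℕ) : ℂ) ^ s) * LJ (Q / g ^ 2) s

lemma HQ_diff {Q : ℕ} (hQ : 0 < Q) {s : ℂ} (hs : s ≠ 1) : DifferentiableAt ℂ (HQ Q) s := by
  unfold HQ
  refine DifferentiableAt.fun_sum fun g hg => ?_
  have hg0 := sqd_pos hQ hg
  have hgc : ((g ^ 2 : ℕ) : ℂ) ≠ 0 := by exact_mod_cast (by positivity : g ^ 2 ≠ 0)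
  refine DifferentiableAt.mul (DifferentiableAt.div (differentiableAt_const _) ?_ ?_) (LJ_diff _ hs)
  · exact DifferentiableAt.const_cpow differentiableAt_id (Or.inl hgc)
  · simp [Complex.cpow_eq_zero_iff, hg0.ne']

lemma mellin_big {Q : ℕ} (hQ : Q % 4 = 1) (hns : ¬ IsSquare Q) {s : ℂ} (hs : 1 < s.re) :
    (Complex.Gammaℝ s)⁻¹ * mellin (th Q) (s / 2) = (1 / (((Real.sqrt Q)⁻¹ : ℝ) : ℂ) ^ s) * HQ Q s := by
  have hQ0 : 0 < Q := by omega
  have hQ' : (0 : ℝ) < Q := by exact_mod_cast hQ0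
  have hs0 : 0 < s.re := by linarith
  have hsq : 0 < (Real.sqrt Q)⁻¹ := inv_pos.mpr (Real.sqrt_pos.mpr hQ')
  have h := hasSum_mellin_pi_mul_sq (a := fun n : ℕ => (bb n Q : ℂ)) (r := fun n : ℕ => (n : ℝ) * (Real.sqrt Q)⁻¹) (F := th Q) (s := s) hs0
    (by
      intro t ht
      have ht : 0 < t := ht
      have h1 := (th_summable hQ0 ht (fun n => (bb n Q : ℂ)) (fun n => bb_norm hQ0 n)).hasSum
      refine h1.congr_fun fun n => ?_
      rcases Nat.eq_zero_or_pos n with rfl | hn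
      · simp [bb_zero_nonsq hQ0 hns]
      · rw [if_neg (by positivity)]
        congr 3
        rw [mul_pow, inv_pow, Real.sq_sqrt hQ'.le]
        ring)
    (by
      have h1 : Summable (fun n : ℕ => (Q : ℝ) * ((Real.sqrt Q)⁻¹ ^ s.re)⁻¹ * (1 / (n : ℝ) ^ s.re)) :=
        (Real.summable_one_div_nat_rpow.mpr hs).mul_left _
      refine Summable.of_nonneg_of_le (fun n => by positivity) (fun n => ?_) h1
      rw [abs_of_nonneg (by positivity), Real.mul_rpow (by positivity) hsq.le]
      have := bb_norm hQ0 n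
      calc _ ≤ (Q : ℝ) / ((n : ℝ) ^ s.re * (Real.sqrt Q)⁻¹ ^ s.re) := by gcongr
        _ = _ := by ring)
  have h2 := (bb_series hQ0 hs).mul_left (Complex.Gammaℝ s / (((Real.sqrt Q)⁻¹ : ℝ) : ℂ) ^ s)
  have h3 := h.unique (h2.congr_fun fun n => by
    rw [abs_of_nonneg (by positivity), Complex.ofReal_mul, Complex.mul_cpow_ofReal_nonneg (by positivity) hsq.le]
    push_cast
    ring)
  rw [h3]
  have hG := Complex.Gammaℝ_ne_zero_of_re_pos hs0
  unfold HQ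
  field_simp

lemma mellin_all {Q : ℕ} (hQ : Q % 4 = 1) (hns : ¬ IsSquare Q) {s : ℂ} (hs : s ≠ 1) :
    (Complex.Gammaℝ s)⁻¹ * mellin (th Q) (s / 2) = (1 / (((Real.sqrt Q)⁻¹ : ℝ) : ℂ) ^ s) * HQ Q s := by
  have hQ0 : 0 < Q := by omega
  have hQ' : (0 : ℝ) < Q := by exact_mod_cast hQ0
  have hsq : 0 < (Real.sqrt Q)⁻¹ := inv_pos.mpr (Real.sqrt_pos.mpr hQ')
  have hqc : (((Real.sqrt Q)⁻¹ : ℝ) : ℂ) ≠ 0 := by exact_mod_cast hsq.ne'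
  have hpc : IsPreconnected ({1}ᶜ : Set ℂ) :=
    (isConnected_compl_singleton_of_one_lt_rank (by simp) _).isPreconnected
  have h1 : AnalyticOnNhd ℂ (fun s => (Complex.Gammaℝ s)⁻¹ * mellin (th Q) (s / 2)) ({1}ᶜ : Set ℂ) := by
    refine DifferentiableOn.analyticOnNhd (fun z _ => ?_) isOpen_compl_singleton
    refine (DifferentiableAt.mul Complex.differentiable_Gammaℝ_inv.differentiableAt ?_).differentiableWithinAt
    exact ((th_mellin_diff hQ hns) _).comp z (by fun_prop)
  have h2 : AnalyticOnNhd ℂ (fun s => (1 / (((Real.sqrt Q)⁻¹ : ℝ) : ℂ) ^ s) * HQ Q s) ({1}ᶜ : Set ℂ) := by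
    refine DifferentiableOn.analyticOnNhd (fun z hz => ?_) isOpen_compl_singleton
    refine (DifferentiableAt.mul (DifferentiableAt.div (differentiableAt_const _) ?_ ?_) (HQ_diff hQ0 hz)).differentiableWithinAt
    · exact DifferentiableAt.const_cpow differentiableAt_id (Or.inl hqc)
    · rw [Ne, Complex.cpow_eq_zero_iff]; tauto
  refine h1.eqOn_of_preconnected_of_eventuallyEq h2 hpc (z₀ := 2) (by simp) ?_ hs
  refine eventually_of_mem ?_ (fun t (ht : 1 < t.re) => mellin_big hQ hns ht)
  exact (Complex.continuous_re.isOpen_preimage _ isOpen_Ioi).mem_nhds (by simp : 1 < (2 : ℂ).re)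

lemma mellin_zero {Q : ℕ} (hQ : Q % 4 = 1) (hns : ¬ IsSquare Q) (h0 : LJ Q (1/2) = 0) : mellin (th Q) (1/4) = 0 := by
  have h := mellin_all hQ hns (s := 1/2) (by norm_num)
  have hH : HQ Q (1/2) = 0 := by
    unfold HQ
    refine sum_eq_zero fun g hg => ?_
    rw [LJ_sq (by omega) ((mem_sqd (by omega)).mp hg) h0, mul_zero]
  rw [hH, mul_zero, mul_eq_zero, show (1/2 : ℂ)/2 = 1/4 by norm_num] at h
  refine h.resolve_left (inv_ne_zero (Complex.Gammaℝ_ne_zero_of_re_pos (by norm_num)))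

lemma th_int_on {Q : ℕ} (hQ : Q % 4 = 1) (hns : ¬ IsSquare Q) :
    IntegrableOn (fun y : ℝ => ((y ^ (-(3/4) : ℝ) : ℝ) : ℂ) * th Q y) (Set.Ioi 1) := by
  have h := (th_mellin_conv hQ hns (1/4)).mono_set (Set.Ioi_subset_Ioi zero_le_one)
  refine h.congr ?_
  refine (ae_restrict_iff' measurableSet_Ioi).mpr (Eventually.of_forall fun y hy => ?_)
  have hy : (1 : ℝ) < y := hy
  simp only [smul_eq_mul]
  rw [Complex.ofReal_cpow (by linarith)]
  congr 2
  push_cast; norm_num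

lemma th_int_zero {Q : ℕ} (hQ : Q % 4 = 1) (hns : ¬ IsSquare Q) (h0 : LJ Q (1/2) = 0) :
    ∫ y in Set.Ioi (1 : ℝ), ((y ^ (-(3/4) : ℝ) : ℝ) : ℂ) * th Q y = 0 := by
  set h : ℝ → ℂ := (Set.Ioi 1).indicator (th Q) with hh
  have hc : MellinConvergent h (1/4) := by
    have := (th_mellin_conv hQ hns (1/4)).indicator (measurableSet_Ioi (a := (1:ℝ)))
    unfold MellinConvergent
    refine IntegrableOn.congr_fun this (fun t _ => ?_) measurableSet_Ioi
    rw [hh]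
    by_cases ht : t ∈ Set.Ioi (1 : ℝ)
    · simp only [Set.indicator_of_mem ht]
    · simp only [Set.indicator_of_notMem ht, smul_zero]
  set h' : ℝ → ℂ := fun t => (t : ℂ) ^ (-(1/2) : ℂ) • h t⁻¹ with hh'
  have hm' : mellin h' (1/4) = mellin h (1/4) := by
    rw [hh', mellin_cpow_smul (fun t => h t⁻¹), mellin_comp_inv]
    norm_num
  have hc' : MellinConvergent h' (1/4) := by
    rw [hh', MellinConvergent.cpow_smul]
    have := (MellinConvergent.comp_rpow (f := h) (s := 1/4 + -(1/2)) (a := -1) (by norm_num)).mpr (by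
      convert hc using 1; push_cast; norm_num)
    simpa [Real.rpow_neg_one] using this
  have hsum : mellin (th Q) (1/4) = mellin h (1/4) + mellin h' (1/4) := by
    rw [← (hasMellin_add hc hc').2]
    unfold mellin
    refine integral_congr_ae ?_
    refine (ae_restrict_iff' measurableSet_Ioi).mpr ?_
    filter_upwards [Measure.ae_ne volume (1 : ℝ)] with t ht1 ht
    have ht : 0 < t := ht
    congr 1
    rw [hh', hh]
    simp only
    rcases lt_or_gt_of_ne ht1 with hlt | hgt
    · have h1 : 1 < t⁻¹ := (one_lt_inv₀ ht).mpr hlt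
      rw [Set.indicator_of_notMem (by simpa using hlt.le), Set.indicator_of_mem (by simpa using h1), zero_add]
      have := th_fe hQ hns (y := t⁻¹) (by positivity)
      rw [one_div, inv_inv] at this
      rw [this, smul_eq_mul, Real.inv_rpow ht.le, ← Real.rpow_neg ht.le, Complex.ofReal_cpow ht.le]
      push_cast; rfl
    · have h1 : t⁻¹ < 1 := inv_lt_one_of_one_lt₀ hgt
      rw [Set.indicator_of_mem (by simpa using hgt), Set.indicator_of_notMem (by simpa using h1.le), smul_zero, add_zero]
  rw [hm', mellin_zero hQ hns h0, ← two_mul] at hsum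
  have hz : mellin h (1/4) = 0 := by
    have := hsum.symm
    simpa using this
  unfold mellin at hz
  rw [← hz, ← Set.inter_eq_left.mpr (Set.Ioi_subset_Ioi (zero_le_one' ℝ)), Set.inter_comm, ← setIntegral_indicator measurableSet_Ioi]
  refine setIntegral_congr_fun measurableSet_Ioi fun t ht => ?_
  have ht : 0 < t := ht
  rw [hh]
  by_cases ht1 : t ∈ Set.Ioi (1 : ℝ)
  · rw [Set.indicator_of_mem ht1, Set.indicator_of_mem ht1, smul_eq_mul, Complex.ofReal_cpow ht.le]
    congr 2
    push_cast; norm_num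
  · rw [Set.indicator_of_notMem ht1, Set.indicator_of_notMem ht1, smul_zero]

end QT

namespace QT
open Finset Filter Topology MeasureTheory FourierTransform NumberTheorySymbols

/-- The odd part of the theta series. -/
noncomputable def tho (Q : ℕ) (y : ℝ) : ℂ :=
  ∑' n : ℕ, (if Odd n then (bb n Q : ℂ) else 0) * ((Real.exp (-(Real.pi * y / Q * n ^ 2)) : ℝ) : ℂ)

lemma tho_summable {Q : ℕ} (hQ : 0 < Q) {y : ℝ} (hy : 0 < y) :
    Summable (fun n : ℕ => (if Odd n then (bb n Q : ℂ) else 0) * ((Real.exp (-(Real.pi * y / Q * n ^ 2)) : ℝ) : ℂ)) := by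
  refine th_summable hQ hy (fun n => if Odd n then (bb n Q : ℂ) else 0) fun n => ?_
  split_ifs
  · exact bb_norm hQ n
  · simp

lemma bb_two {Q : ℕ} (hQ : Q % 8 = 1) (k : ℕ) : bb ((2 * k : ℕ) : ℤ) Q = bb (k : ℤ) Q := by
  have hQ0 : 0 < Q := by omega
  have hodd : Odd Q := Nat.odd_iff.mpr (by omega)
  have h2 : IsCoprime (2 : ℤ) (Q : ℤ) := (jac8_coprime Q hodd).of_isCoprime_of_dvd_left (by norm_num)
  have h := bb_unit hQ0 2 (k : ℤ) h2
  have hj : J(2 | Q) = 1 := by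
    rw [jac_two_mod _ hodd, hQ, jacobiSym.one_right]
  rw [hj, one_mul] at h
  rw [Nat.cast_mul, Nat.cast_ofNat, h]

lemma th_rec {Q : ℕ} (hQ : Q % 8 = 1) {y : ℝ} (hy : 0 < y) : th Q y = tho Q y + th Q (4 * y) := by
  have hQ0 : 0 < Q := by omega
  have h1 := th_summable hQ0 hy (fun n => (bb n Q : ℂ)) (fun n => bb_norm hQ0 n)
  have h2 := tho_summable hQ0 hy
  have i2 : Function.Injective (fun k : ℕ => 2 * k) := fun a b h => by simpa using h
  have i3 : Function.Injective (fun k : ℕ => 2 * k + 1) := fun a b h => by simpa using h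
  have e1 := tsum_even_add_odd (f := fun n : ℕ => (bb n Q : ℂ) * ((Real.exp (-(Real.pi * y / Q * n ^ 2)) : ℝ) : ℂ)) (h1.comp_injective i2) (h1.comp_injective i3)
  have e2 := tsum_even_add_odd (f := fun n : ℕ => (if Odd n then (bb n Q : ℂ) else 0) * ((Real.exp (-(Real.pi * y / Q * n ^ 2)) : ℝ) : ℂ)) (h2.comp_injective i2) (h2.comp_injective i3)
  unfold th tho
  rw [← e1, ← e2, add_comm]
  have z : ∑' k : ℕ, (if Odd (2 * k) then (bb ((2 * k : ℕ) : ℤ) Q : ℂ) else 0) *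
      ((Real.exp (-(Real.pi * y / Q * ((2 * k : ℕ) : ℝ) ^ 2)) : ℝ) : ℂ) = 0 := by
    have : ∀ k : ℕ, (if Odd (2 * k) then (bb ((2 * k : ℕ) : ℤ) Q : ℂ) else 0) *
      ((Real.exp (-(Real.pi * y / Q * ((2 * k : ℕ) : ℝ) ^ 2)) : ℝ) : ℂ) = 0 := fun k => by
      rw [if_neg (by simp), zero_mul]
    rw [tsum_congr this, tsum_zero]
  rw [z, zero_add]
  congr 1
  · refine tsum_congr fun k => ?_
    rw [if_pos ⟨k, rfl⟩]
  · refine tsum_congr fun k => ?_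
    have he : -(Real.pi * y / Q * ((2 * k : ℕ) : ℝ) ^ 2) = -(Real.pi * (4 * y) / Q * (k : ℝ) ^ 2) := by
      push_cast
      ring
    rw [bb_two hQ, he]

lemma A_eq {w : ℝ → ℝ} (hw : TF w) {N : ℕ} (hNo : Odd N) (hN : Squarefree N) {X t : ℝ} (hX : 0 < X) (ht : 0 < t)
    (D : Finset ℕ) (hD : ∀ d : ℕ, d ∈ D ↔ 0 < d ∧ (d : ℝ) ≤ 3 / 4 * X ∧ (8 : ℤ) ∣ (d : ℤ) - N) :
    ∑ d ∈ D, (w (d / X) : ℂ) * tho (N * d) t =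
      Mn w N X (Real.pi * t / (N * X)) + Err w N X (Real.pi * t / (N * X)) := by
  have hN0 : (0 : ℝ) < N := by exact_mod_cast hNo.pos
  set α := Real.pi * t / (N * X) with hαd
  have hα : 0 < α := by positivity
  rw [← main_err hw N X α hX hα]
  unfold tho
  simp_rw [← tsum_mul_left]
  rw [← Summable.tsum_finsetSum]
  swap
  · intro d hd
    exact (tho_summable (Nat.mul_pos hNo.pos ((hD d).mp hd).1) ht).mul_left _
  refine tsum_congr fun n => ?_
  by_cases hn : Odd n
  swap
  · simp [hn, st]
  rw [← first_poisson hw hN X α hX hα n hn]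
  rw [tsum_eq_sum (s := D.map Nat.castEmbedding)]
  · rw [sum_map]
    refine sum_congr rfl fun d hd => ?_
    obtain ⟨h1, h2, h3⟩ := (hD d).mp hd
    have hd0 : (0 : ℝ) < d := by exact_mod_cast h1
    have hQ : (N * d) % 4 = 1 := by
      obtain ⟨c, hc⟩ := h3
      have h8 : d % 8 = N % 8 := by omega
      have hN2 := Nat.odd_iff.mp hNo
      have : N % 8 = 1 ∨ N % 8 = 3 ∨ N % 8 = 5 ∨ N % 8 = 7 := by omega
      have h4 : d % 4 = N % 4 := by omega
      have : N % 4 = 1 ∨ N % 4 = 3 := by omega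
      rw [Nat.mul_mod, h4]
      rcases this with h | h <;> rw [h]
    have hcN : cN N (d : ℤ) = 1 := if_pos h3
    have hbb : bb ((N : ℤ) * (d : ℤ)) n = bb (n : ℤ) (N * d) := by
      rw [← bb_recip_one hQ hn]; push_cast; rfl
    simp only [Nat.castEmbedding_apply, hcN, hbb, if_pos hn]
    have he : -(Real.pi * t / ((N * d : ℕ) : ℝ) * n ^ 2) = -(α * X * n ^ 2) / ((d : ℤ) : ℝ) := by
      rw [hαd]; push_cast; field_simp
    rw [he]
    push_cast
    ring
  · intro d hd
    by_cases h8 : (8 : ℤ) ∣ d - N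
    swap
    · simp [cN, h8]
    have : w ((d : ℝ) / X) = 0 := by
      apply hw.2
      rintro ⟨ha, hb⟩
      rw [div_le_iff₀ hX] at hb
      rw [le_div_iff₀ hX] at ha
      have hd0 : (0 : ℝ) < d := by nlinarith
      have hd0' : 0 < d := by exact_mod_cast hd0
      lift d to ℕ using hd0'.le
      apply hd
      rw [Finset.mem_map]
      exact ⟨d, (hD d).mpr ⟨by exact_mod_cast hd0', by exact_mod_cast hb, h8⟩, rfl⟩
    rw [this]; simp

end QT

namespace QT
open Finset Filter Topology MeasureTheory FourierTransform NumberTheorySymbols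

lemma nonsq_mul {N d : ℕ} (hN : Squarefree N) (hd : 0 < d) (hdN : d < N) : ¬ IsSquare (N * d) := by
  rintro ⟨m, hm⟩
  have h1 : N ∣ m ^ 2 := by rw [sq, ← hm]; exact dvd_mul_right _ _
  rw [hN.dvd_pow_iff_dvd two_ne_zero] at h1
  obtain ⟨c, rfl⟩ := h1
  have hN0 : 0 < N := by omega
  have h2 : d = N * c * c := Nat.eq_of_mul_eq_mul_left hN0 (by rw [hm]; ring)
  have hc : 0 < c := by
    rcases Nat.eq_zero_or_pos c with rfl | h
    · simp at h2; omega
    · exact h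
  have : N ≤ N * c * c := by nlinarith [Nat.mul_pos hc hc, Nat.mul_le_mul_left N (Nat.mul_pos hc hc)]
  omega

lemma rec_lower (T A M : ℝ → ℝ) {K β : ℝ} (hK : 0 ≤ K) (hβ : 1/4 ≤ β) (hrec : ∀ t, 1 ≤ t → T t = A t + T (4 * t))
    (hA : ∀ t, 1 ≤ t → M t - K * t ^ (-β) ≤ A t) (hM : ∀ t, 0 ≤ M t) (hT : Tendsto T atTop (𝓝 0)) {t : ℝ} (ht : 1 ≤ t) :
    M t - 4 * K * t ^ (-β) ≤ T t := by
  set U : ℝ → ℝ := fun t => T t + 4 * K * t ^ (-β) with hU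
  have h4 : (4 : ℝ) ^ (-β) ≤ 3 / 4 := by
    calc (4 : ℝ) ^ (-β) ≤ 4 ^ (-(1/4) : ℝ) := Real.rpow_le_rpow_of_exponent_le (by norm_num) (by linarith)
      _ ≤ 3 / 4 := by
        rw [Real.rpow_neg (by norm_num), inv_le_comm₀ (by positivity) (by norm_num)]
        refine le_of_pow_le_pow_left₀ (n := 4) (by norm_num) (by positivity) ?_
        rw [← Real.rpow_natCast (4 ^ (1/4 : ℝ)), ← Real.rpow_mul (by norm_num)]
        norm_num
  have hstep : ∀ t, 1 ≤ t → U (4 * t) + M t ≤ U t := by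
    intro t ht
    have h1 := hrec t ht
    have h2 := hA t ht
    have h3 : (4 * t) ^ (-β) = 4 ^ (-β) * t ^ (-β) := Real.mul_rpow (by norm_num) (by linarith)
    simp only [hU]
    rw [h3, h1]
    have h5 : 0 ≤ K * t ^ (-β) := by positivity
    nlinarith
  have hiter : ∀ (J : ℕ) t, 1 ≤ t → U (4 ^ J * t) ≤ U t := by
    intro J
    induction J with
    | zero => intro t _; simp
    | succ J ih =>
      intro t ht
      have h1 := ih (4 * t) (by linarith)
      have h2 := hstep t ht
      have h3 := hM t
      rw [show (4 : ℝ) ^ (J + 1) * t = 4 ^ J * (4 * t) by ring]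
      linarith
  have hUlim : Tendsto U atTop (𝓝 0) := by
    have := (tendsto_rpow_neg_atTop (y := β) (by linarith)).const_mul (4 * K)
    simpa [hU] using hT.add this
  have hnn : ∀ t, 1 ≤ t → 0 ≤ U t := by
    intro t ht
    have hl : Tendsto (fun J : ℕ => (4 : ℝ) ^ J * t) atTop atTop :=
      (tendsto_pow_atTop_atTop_of_one_lt (by norm_num)).atTop_mul_const (by linarith)
    exact le_of_tendsto' (hUlim.comp hl) (fun J => hiter J t ht)
  have h1 := hstep t ht
  have h2 := hnn (4 * t) (by linarith)
  simp only [hU] at h1 h2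
  linarith

lemma int_lower (f g : ℝ → ℝ) (hf : IntegrableOn f (Set.Ioi 1)) (hg : IntegrableOn g (Set.Ioi 1))
    (h0 : ∫ t in Set.Ioi (1 : ℝ), f t = 0) (hfg : ∀ t, 1 < t → 0 ≤ f t + g t) {m Y : ℝ} (hY : 1 ≤ Y)
    (hm : ∀ t, 1 < t → t ≤ Y → m ≤ f t + g t) : m * (Y - 1) ≤ ∫ t in Set.Ioi (1 : ℝ), g t := by
  have h1 : ∫ t in Set.Ioi (1 : ℝ), (f t + g t) = ∫ t in Set.Ioi (1 : ℝ), g t := by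
    rw [integral_add hf hg, h0, zero_add]
  rw [← h1]
  have hs : Set.Ioc 1 Y ⊆ Set.Ioi (1 : ℝ) := fun x hx => hx.1
  have h2 : ∫ t in Set.Ioc 1 Y, (f t + g t) ≤ ∫ t in Set.Ioi (1 : ℝ), (f t + g t) := by
    refine setIntegral_mono_set (hf.add hg) ?_ (LE.le.eventuallyLE hs)
    exact (ae_restrict_iff' measurableSet_Ioi).mpr (Eventually.of_forall fun t ht => hfg t ht)
  have h3 : ∫ t in Set.Ioc 1 Y, m ≤ ∫ t in Set.Ioc 1 Y, (f t + g t) := by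
    refine setIntegral_mono_on ?_ ((hf.add hg).mono_set hs) measurableSet_Ioc (fun t ht => hm t ht.1 ht.2)
    exact integrableOn_const (by simp)
  have h4 : ∫ t in Set.Ioc 1 Y, m = m * (Y - 1) := by
    simp [Measure.real, hY]
    ring
  linarith

lemma bump_exists : ∃ w : ℝ → ℝ, TF w ∧ (∀ u, 0 ≤ w u) ∧ 0 < ∫ u, w u := by
  let b : ContDiffBump (1/2 : ℝ) := ⟨1/8, 1/4, by norm_num, by norm_num⟩
  refine ⟨b, ⟨b.contDiff, fun u hu => ?_⟩, fun u => b.nonneg, b.integral_pos⟩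
  apply b.zero_of_le_dist
  rw [Set.mem_Icc, not_and_or, not_le, not_le] at hu
  rw [Real.dist_eq]
  change 1/4 ≤ _
  rcases hu with h | h
  · rw [abs_of_neg (by linarith)]; linarith
  · rw [abs_of_pos (by linarith)]; linarith

end QT

namespace QT
open Finset Filter Topology MeasureTheory FourierTransform NumberTheorySymbols

lemma mod_eight {N d : ℕ} (hNo : Odd N) (h : (8 : ℤ) ∣ (d : ℤ) - N) : (N * d) % 8 = 1 := by
  have h8 : d % 8 = N % 8 := by omega
  have hN2 := Nat.odd_iff.mp hNo
  have : N % 8 = 1 ∨ N % 8 = 3 ∨ N % 8 = 5 ∨ N % 8 = 7 := by omega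
  rw [Nat.mul_mod, h8]
  rcases this with h | h | h | h <;> rw [h]

lemma CT_ineq {w : ℝ → ℝ} (hw : TF w) (hw0 : ∀ u, 0 ≤ w u) {δ : ℝ} (hδ : 0 < δ) (hδ2 : δ ≤ 1/2) :
    ∃ C : ℝ, 0 ≤ C ∧ ∀ N : ℕ, Odd N → Squarefree N → ∀ X : ℝ, 0 < X → X ≤ N → 2 ≤ N * X →
    (∀ d : ℕ, 0 < d → (d : ℝ) ≤ 3 / 4 * X → (8 : ℤ) ∣ (d : ℤ) - N → LJ (N * d) (1/2) = 0) →
    X * (∫ u, w u) * (N * X) ^ (1/4 : ℝ) ≤ C * (Real.sqrt N * (N * X) ^ (1/4 + δ/2) * X ^ (-δ)) := by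
  obtain ⟨C, hC, hB⟩ := Err_bound hw hδ hδ2
  refine ⟨16 * Real.exp (4 * Real.pi) * (4 * C * (2 / δ)), by positivity, ?_⟩
  intro N hNo hN X hX hXN hY2 hL
  have hN0 : (0 : ℝ) < N := by exact_mod_cast hNo.pos
  set Y : ℝ := N * X with hYd
  have hY : 0 < Y := by positivity
  set β : ℝ := 1/4 + δ/2 with hβ
  set K : ℝ := C * (Real.sqrt N * Y ^ β * X ^ (-δ)) with hKd
  have hK : 0 ≤ K := by positivity
  set I := ∫ u, w u with hI
  have hI0 : 0 ≤ I := integral_nonneg hw0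
  classical
  set D : Finset ℕ := (range (⌈X⌉₊ + 1)).filter (fun d => 0 < d ∧ (d : ℝ) ≤ 3 / 4 * X ∧ (8 : ℤ) ∣ (d : ℤ) - N) with hDd
  have hD : ∀ d : ℕ, d ∈ D ↔ 0 < d ∧ (d : ℝ) ≤ 3 / 4 * X ∧ (8 : ℤ) ∣ (d : ℤ) - N := by
    intro d
    rw [hDd, mem_filter, and_iff_right_iff_imp]
    rintro ⟨_, h, _⟩
    rw [mem_range, Nat.lt_succ_iff]
    have : (d : ℝ) ≤ ⌈X⌉₊ := by linarith [Nat.le_ceil X]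
    exact_mod_cast this
  have hQ8 : ∀ d ∈ D, (N * d) % 8 = 1 := fun d hd => mod_eight hNo ((hD d).mp hd).2.2
  have hQ4 : ∀ d ∈ D, (N * d) % 4 = 1 := fun d hd => by have := hQ8 d hd; omega
  have hns : ∀ d ∈ D, ¬ IsSquare (N * d) := fun d hd => by
    obtain ⟨h1, h2, h3⟩ := (hD d).mp hd
    refine nonsq_mul hN h1 ?_
    have : (d : ℝ) < N := by linarith
    exact_mod_cast this
  set T : ℝ → ℝ := fun t => (∑ d ∈ D, (w (d / X) : ℂ) * th (N * d) t).re with hT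
  set A : ℝ → ℝ := fun t => (∑ d ∈ D, (w (d / X) : ℂ) * tho (N * d) t).re with hA
  set M : ℝ → ℝ := fun t => X / 8 * (Real.exp (-(4 * (Real.pi * t / Y))) * I) with hM
  have hlow : ∀ t, 1 ≤ t → M t - 4 * K * t ^ (-β) ≤ T t := by
    intro t ht
    refine rec_lower T A M hK (by rw [hβ]; linarith) ?_ ?_ (fun t => by simp only [hM]; positivity) ?_ ht
    · intro t ht
      simp only [hT, hA]
      rw [← Complex.add_re, ← sum_add_distrib]
      congr 1
      refine sum_congr rfl fun d hd => ?_
      rw [th_rec (hQ8 d hd) (by linarith), mul_add]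
    · intro t ht
      have ht0 : 0 < t := by linarith
      simp only [hA]
      rw [A_eq hw hNo hN hX ht0 D hD, Complex.add_re, ← hYd]
      have hα : 0 < Real.pi * t / Y := by positivity
      have h1 := Mn_lower hw hw0 (N := N) X (Real.pi * t / Y) hX hα
      have h2 := hB N hNo hN X (Real.pi * t / Y) hX (by linarith) hα (by
        rw [← hYd]
        gcongr
        nlinarith [Real.pi_gt_three])
      have h3 := (abs_le.mp ((Complex.abs_re_le_norm (Err w N X (Real.pi * t / Y))).trans h2)).1
      have h4 : (Real.pi * t / Y) ^ (-β) ≤ Y ^ β * t ^ (-β) := by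
        rw [show Real.pi * t / Y = Real.pi * (t / Y) by ring, Real.mul_rpow Real.pi_pos.le (by positivity),
          Real.div_rpow ht0.le hY.le, Real.rpow_neg hY.le, div_inv_eq_mul]
        have : Real.pi ^ (-β) ≤ 1 := by
          apply Real.rpow_le_one_of_one_le_of_nonpos
          · linarith [Real.pi_gt_three]
          · rw [hβ]; linarith
        calc _ ≤ 1 * (t ^ (-β) * Y ^ β) := by gcongr
          _ = _ := by ring
      have h5 : C * (Real.sqrt N * (Real.pi * t / Y) ^ (-β) * X ^ (-δ)) ≤ K * t ^ (-β) := by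
        rw [hKd]
        calc _ ≤ C * (Real.sqrt N * (Y ^ β * t ^ (-β)) * X ^ (-δ)) := by gcongr
          _ = _ := by ring
      simp only [hM]
      linarith
    · have h1 : Tendsto (fun t => ∑ d ∈ D, (w (d / X) : ℂ) * th (N * d) t) atTop (𝓝 (∑ d ∈ D, (w (d / X) : ℂ) * 0)) := by
        refine tendsto_finsetSum _ fun d hd => Tendsto.const_mul _ ?_
        have := th_top (Q := N * d) (Nat.mul_pos hNo.pos ((hD d).mp hd).1) (hns d hd) (-1)
        exact this.trans_tendsto (tendsto_rpow_neg_atTop one_pos)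
      have h2 := (Complex.continuous_re.tendsto _).comp h1
      simpa [Function.comp_def, hT] using h2
  set F : ℝ → ℂ := fun t => ∑ d ∈ D, (w (d / X) : ℂ) * (((t ^ (-(3/4) : ℝ) : ℝ) : ℂ) * th (N * d) t) with hF
  have hFint : IntegrableOn F (Set.Ioi 1) :=
    integrable_finsetSum _ fun d hd => (th_int_on (hQ4 d hd) (hns d hd)).const_mul _
  have hF0 : ∫ t in Set.Ioi (1 : ℝ), F t = 0 := by
    simp only [hF]
    rw [integral_finsetSum _ fun d hd => (th_int_on (hQ4 d hd) (hns d hd)).const_mul _]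
    refine sum_eq_zero fun d hd => ?_
    obtain ⟨h1, h2, h3⟩ := (hD d).mp hd
    rw [integral_const_mul, th_int_zero (hQ4 d hd) (hns d hd) (hL d h1 h2 h3), mul_zero]
  have hFT : ∀ t, (F t).re = t ^ (-(3/4) : ℝ) * T t := by
    intro t
    simp only [hF, hT]
    rw [← Complex.re_ofReal_mul, mul_sum]
    congr 1
    refine sum_congr rfl fun d _ => by ring
  set g : ℝ → ℝ := fun t => 4 * K * t ^ (-1 - δ/2) with hg
  have hgi : IntegrableOn g (Set.Ioi 1) :=
    (integrableOn_Ioi_rpow_of_lt (a := -1 - δ/2) (by linarith) one_pos).const_mul _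
  have hgI : ∫ t in Set.Ioi (1 : ℝ), g t = 4 * K * (2 / δ) := by
    simp only [hg]
    rw [integral_const_mul, integral_Ioi_rpow_of_lt (by linarith) one_pos, Real.one_rpow]
    congr 1
    rw [show -1 - δ/2 + 1 = -(δ/2) by ring]
    field_simp
  have hsum : ∀ t, 1 < t → t ^ (-(3/4) : ℝ) * M t ≤ (F t).re + g t := by
    intro t ht
    rw [hFT]
    have h1 : t ^ (-1 - δ/2) = t ^ (-(3/4) : ℝ) * t ^ (-β) := by
      rw [← Real.rpow_add (by linarith)]
      congr 1
      rw [hβ]; ring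
    simp only [hg]
    rw [h1]
    have := mul_le_mul_of_nonneg_left (hlow t ht.le) (by positivity : 0 ≤ t ^ (-(3/4) : ℝ))
    nlinarith
  have hMnn : ∀ t, 0 ≤ M t := fun t => by simp only [hM]; positivity
  have hmain := int_lower (fun t => (F t).re) g hFint.re hgi (by
      have := integral_re hFint
      simp only [RCLike.re_eq_complex_re] at this
      rw [this, hF0]; simp)
    (fun t ht => (mul_nonneg (by positivity) (hMnn t)).trans (hsum t ht))
    (m := Y ^ (-(3/4) : ℝ) * (X / 8 * (Real.exp (-(4 * Real.pi)) * I))) (Y := Y) (by linarith) (by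
      intro t ht htY
      refine le_trans ?_ (hsum t ht)
      simp only [hM]
      have h1 : Y ^ (-(3/4) : ℝ) ≤ t ^ (-(3/4) : ℝ) :=
        Real.rpow_le_rpow_of_nonpos (by linarith) htY (by norm_num)
      have h2 : Real.exp (-(4 * Real.pi)) ≤ Real.exp (-(4 * (Real.pi * t / Y))) := by
        apply Real.exp_le_exp.mpr
        have : Real.pi * t / Y ≤ Real.pi := by
          rw [div_le_iff₀ hY]
          exact mul_le_mul_of_nonneg_left htY Real.pi_pos.le
        linarith
      gcongr)
  rw [hgI] at hmain
  have h1 : Y ^ (1/4 : ℝ) / 2 ≤ Y ^ (-(3/4) : ℝ) * (Y - 1) := by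
    have : Y ^ (1/4 : ℝ) = Y ^ (-(3/4) : ℝ) * Y := by
      conv_rhs => rw [← Real.rpow_one Y, ← Real.rpow_mul hY.le, ← Real.rpow_add hY]
      norm_num
    rw [this]
    have : 0 < Y ^ (-(3/4) : ℝ) := by positivity
    nlinarith
  have h2 : X / 8 * (Real.exp (-(4 * Real.pi)) * I) * (Y ^ (1/4 : ℝ) / 2) ≤ 4 * K * (2 / δ) := by
    refine le_trans ?_ hmain
    have := mul_le_mul_of_nonneg_left h1 (by positivity : 0 ≤ X / 8 * (Real.exp (-(4 * Real.pi)) * I))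
    linarith
  have h3 := mul_le_mul_of_nonneg_left h2 (by positivity : 0 ≤ 16 * Real.exp (4 * Real.pi))
  have h4 : Real.exp (4 * Real.pi) * Real.exp (-(4 * Real.pi)) = 1 := by rw [← Real.exp_add]; simp
  calc X * I * Y ^ (1/4 : ℝ) = (Real.exp (4 * Real.pi) * Real.exp (-(4 * Real.pi))) * (X * I * Y ^ (1/4 : ℝ)) := by rw [h4, one_mul]
    _ = 16 * Real.exp (4 * Real.pi) * (X / 8 * (Real.exp (-(4 * Real.pi)) * I) * (Y ^ (1/4 : ℝ) / 2)) := by ring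
    _ ≤ _ := h3
    _ = _ := by rw [hKd]; ring

theorem CT_main {ε : ℝ} (hε : 0 < ε) (hε2 : ε ≤ 1/4) : ∃ N0 : ℕ, ∀ N : ℕ, N0 ≤ N → Odd N → Squarefree N →
    ∃ d : ℕ, 0 < d ∧ (d : ℝ) ≤ (N : ℝ) ^ (1/2 + ε) ∧ (8 : ℤ) ∣ (d : ℤ) - N ∧ LJ (N * d) (1/2) ≠ 0 := by
  obtain ⟨w, hw, hw0, hwI⟩ := bump_exists
  obtain ⟨C, hC, hB⟩ := CT_ineq hw hw0 hε (by linarith)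
  set I := ∫ u, w u with hI
  have hlim : Tendsto (fun N : ℕ => (N : ℝ) ^ (3 * ε / 4)) atTop atTop :=
    (tendsto_rpow_atTop (by positivity)).comp tendsto_natCast_atTop_atTop
  obtain ⟨N1, hN1⟩ := (hlim.eventually_gt_atTop (C / I)).exists_forall_of_atTop
  refine ⟨max N1 2, fun N hNN hNo hN => ?_⟩
  have hgt := hN1 N (le_trans (le_max_left _ _) hNN)
  have hN2 : (2 : ℝ) ≤ N := by exact_mod_cast le_trans (le_max_right _ _) hNN
  have hN0 : (0 : ℝ) < N := by linarith
  by_contra! hcon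
  set X : ℝ := (N : ℝ) ^ (1/2 + ε) with hX
  have hX0 : 0 < X := by positivity
  have hX1 : 1 ≤ X := Real.one_le_rpow (by linarith) (by positivity)
  have hXN : X ≤ N := by
    conv_rhs => rw [← Real.rpow_one (N : ℝ)]
    exact Real.rpow_le_rpow_of_exponent_le (by linarith) (by linarith)
  have h := hB N hNo hN X hX0 hXN (by nlinarith) (fun d h1 h2 h3 => hcon d h1 (by linarith) h3)
  have hY : 0 < (N : ℝ) * X := by positivity
  have e1 : Real.sqrt N * (N * X) ^ (1/4 + ε/2) * X ^ (-ε) =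
      (N * X) ^ (1/4 : ℝ) * ((N : ℝ) ^ (1/2 : ℝ) * (N : ℝ) ^ (ε/2) * X ^ (-(ε/2))) := by
    rw [Real.rpow_add hY, Real.mul_rpow hN0.le hX0.le (z := ε/2), Real.sqrt_eq_rpow,
      show X ^ (-(ε/2)) = X ^ (ε/2) * X ^ (-ε) by rw [← Real.rpow_add hX0]; congr 1; ring]
    ring
  rw [e1] at h
  have e2 : (N : ℝ) ^ (1/2 : ℝ) * (N : ℝ) ^ (ε/2) * X ^ (-(ε/2)) ≤ (N : ℝ) ^ (1/2 + ε/4) := by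
    rw [hX, ← Real.rpow_mul hN0.le, ← Real.rpow_add hN0, ← Real.rpow_add hN0]
    apply Real.rpow_le_rpow_of_exponent_le (by linarith)
    nlinarith [sq_nonneg ε]
  have h4 : 0 < (N * X) ^ (1/4 : ℝ) := by positivity
  have h5 : X * I ≤ C * (N : ℝ) ^ (1/2 + ε/4) := by
    have : X * I ≤ C * ((N : ℝ) ^ (1/2 : ℝ) * (N : ℝ) ^ (ε/2) * X ^ (-(ε/2))) := by
      refine le_of_mul_le_mul_right ?_ h4
      linarith
    exact this.trans (mul_le_mul_of_nonneg_left e2 hC)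
  have e3 : X = (N : ℝ) ^ (3 * ε / 4) * (N : ℝ) ^ (1/2 + ε/4) := by
    rw [hX, ← Real.rpow_add hN0]; congr 1; ring
  rw [e3] at h5
  have h6 : 0 < (N : ℝ) ^ (1/2 + ε/4) := by positivity
  have h7 : (N : ℝ) ^ (3 * ε / 4) * I ≤ C := by
    refine le_of_mul_le_mul_right ?_ h6
    linarith
  rw [div_lt_iff₀ hwI] at hgt
  linarith

end QT

namespace QT
open Finset Filter Topology MeasureTheory FourierTransform NumberTheorySymbols

lemma cl_nat {a c : ℕ} (h : a ∣ c) (χ : DirichletCharacter ℂ a) {n : ℕ} (hn : n.Coprime c) :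
    DirichletCharacter.changeLevel h χ (n : ZMod c) = χ (n : ZMod a) := by
  have := DirichletCharacter.changeLevel_eq_cast_of_dvd' χ h (a := (n : ℤ)) (Nat.isCoprime_iff_coprime.mpr hn)
  simpa using this

lemma quad_level {a c : ℕ} [NeZero c] (h : a ∣ c) (χ : DirichletCharacter ℂ a) :
    MulChar.IsQuadratic (DirichletCharacter.changeLevel h χ) ↔ MulChar.IsQuadratic χ := by
  rw [MulChar.isQuadratic_iff_sq_eq_one, MulChar.isQuadratic_iff_sq_eq_one, ← map_pow,
    DirichletCharacter.changeLevel_eq_one_iff]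

lemma quad_mul {a : ℕ} {χ ψ : DirichletCharacter ℂ a} (h : MulChar.IsQuadratic χ) (h' : MulChar.IsQuadratic ψ) :
    MulChar.IsQuadratic (χ * ψ) := by
  rw [MulChar.isQuadratic_iff_sq_eq_one] at *
  rw [mul_pow, h, h', mul_one]

lemma quad_sq {a : ℕ} {χ : DirichletCharacter ℂ a} (h : MulChar.IsQuadratic χ) {n : ℕ} (hn : n.Coprime a) :
    χ (n : ZMod a) ^ 2 = 1 := by
  rw [MulChar.isQuadratic_iff_sq_eq_one] at h
  rw [← MulChar.pow_apply' _ two_ne_zero, h]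
  exact MulChar.one_apply ((ZMod.isUnit_iff_coprime n a).mpr hn)

lemma jc_quad (n : ℕ) [NeZero n] : MulChar.IsQuadratic (jc n) := by
  intro a
  obtain ⟨x, rfl⟩ := ZMod.natCast_zmod_surjective a
  rw [jc_nat]
  rcases jacobiSym.trichotomy x n with h | h | h <;> simp [h]

lemma odd_pow_one {z : ℂ} (h : z ^ 2 = 1) {k : ℕ} (hk : Odd k) (h1 : z ^ k = 1) : z = 1 := by
  obtain ⟨m, rfl⟩ := hk
  rwa [pow_succ, pow_mul, h, one_pow, one_mul] at h1

/-- Elements that are `1` modulo `m` and a square modulo `p` are killed by a real character mod `p^(k+1) m`. -/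
lemma kill_p {p k m : ℕ} (hp : p.Prime) (hp2 : p ≠ 2) (hm : p.Coprime m) {M : ℕ} (hM : M = p ^ (k + 1) * m)
    {χ : DirichletCharacter ℂ M} (hχ : MulChar.IsQuadratic χ) {n : ℕ} (hn : n.Coprime M) (hn1 : n ≡ 1 [MOD m])
    (hJ : J((n : ℤ) | p) = 1) : χ (n : ZMod M) = 1 := by
  haveI : Fact p.Prime := ⟨hp⟩
  have hnp : (n : ZMod p) ≠ 0 := by
    intro h
    rw [ZMod.natCast_eq_zero_iff] at h
    have := Nat.Coprime.coprime_dvd_left h (Nat.Coprime.coprime_dvd_right (by rw [hM]; exact (dvd_pow_self p (Nat.succ_ne_zero k)).mul_right m : p ∣ M) hn)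
    rw [Nat.coprime_self] at this
    exact hp.one_lt.ne' this
  rw [← jacobiSym.legendreSym.to_jacobiSym, legendreSym.eq_one_iff' p hnp] at hJ
  obtain ⟨r, hr⟩ := hJ
  obtain ⟨a, ha⟩ := ZMod.natCast_zmod_surjective r
  obtain ⟨b, hb1, hb2⟩ := Nat.chineseRemainder hm a 1
  have e1 : n ≡ b ^ 2 [MOD p] := by
    rw [← ZMod.natCast_eq_natCast_iff]
    push_cast
    rw [(ZMod.natCast_eq_natCast_iff b a p).mpr hb1, ha, hr, sq]
  have e2 : n ≡ b ^ 2 [MOD m] := hn1.trans (by simpa using (hb2.pow 2).symm)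
  have e3 : n ^ p ^ k ≡ (b ^ 2) ^ p ^ k [MOD p ^ (k + 1)] := by
    have h1 : ((p : ℕ) : ℤ) ∣ ((b ^ 2 : ℕ) : ℤ) - (n : ℤ) := (Nat.modEq_iff_dvd).mp e1
    have h2 := dvd_sub_pow_of_dvd_sub h1 k
    rw [Nat.modEq_iff_dvd]
    push_cast at h2 ⊢
    exact h2
  have e4 : n ^ p ^ k ≡ (b ^ 2) ^ p ^ k [MOD M] := by
    rw [hM]
    exact (Nat.modEq_and_modEq_iff_modEq_mul (Nat.Coprime.pow_left _ hm)).mp ⟨e3, e2.pow _⟩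
  have hbM : b.Coprime M := by
    have h1 : (n ^ p ^ k).Coprime M := Nat.Coprime.pow_left _ hn
    have h2 : ((b ^ 2) ^ p ^ k).Coprime M := by
      rw [Nat.Coprime, ← e4.gcd_eq]; exact h1
    refine Nat.Coprime.coprime_dvd_left ?_ h2
    exact (dvd_pow_self b two_ne_zero).trans (dvd_pow_self _ (pow_pos hp.pos k).ne')
  refine odd_pow_one (quad_sq hχ hn) ((hp.odd_of_ne_two hp2).pow (n := k)) ?_
  have h5 := congrArg χ ((ZMod.natCast_eq_natCast_iff _ _ M).mpr e4)
  push_cast at h5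
  rw [map_pow, map_pow, map_pow, quad_sq hχ hbM, one_pow] at h5
  exact h5

lemma two_sq {n : ℕ} (hn : n % 8 = 1) (k : ℕ) : ∃ x : ℕ, Odd x ∧ x ^ 2 ≡ n [MOD 2 ^ (k + 3)] := by
  induction k with
  | zero => exact ⟨1, odd_one, by simp [Nat.ModEq, hn]⟩
  | succ k ih =>
    obtain ⟨x, hx, h⟩ := ih
    rw [Nat.modEq_iff_dvd] at h
    obtain ⟨c, hc⟩ := h
    push_cast at hc
    rcases Int.even_or_odd c with ⟨e, he⟩ | ⟨e, he⟩
    · refine ⟨x, hx, ?_⟩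
      rw [Nat.modEq_iff_dvd]
      refine ⟨e, ?_⟩
      push_cast
      rw [hc, he]; ring
    · refine ⟨x + 2 ^ (k + 2), hx.add_even ⟨2 ^ (k + 1), by ring⟩, ?_⟩
      obtain ⟨f, hf⟩ := hx
      rw [Nat.modEq_iff_dvd]
      refine ⟨e - f - 2 ^ k, ?_⟩
      push_cast
      have : (n : ℤ) = (x : ℤ) ^ 2 + 2 ^ (k + 3) * c := by linarith
      have hf' : (x : ℤ) = 2 * f + 1 := by exact_mod_cast hf
      rw [this, he, hf']; ring

lemma factors_of {M m : ℕ} [NeZero M] (hd : m ∣ M) (χ : DirichletCharacter ℂ M)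
    (h : ∀ n : ℕ, n.Coprime M → n ≡ 1 [MOD m] → χ (n : ZMod M) = 1) :
    ∃ ψ : DirichletCharacter ℂ m, χ = DirichletCharacter.changeLevel hd ψ := by
  have hf : χ.FactorsThrough m := by
    rw [DirichletCharacter.factorsThrough_iff_ker_unitsMap hd]
    intro u hu
    rw [MonoidHom.mem_ker] at hu ⊢
    have h1 := h (u : ZMod M).val (ZMod.val_coe_unit_coprime u) (by
      rw [← ZMod.natCast_eq_natCast_iff]
      have := congrArg Units.val hu
      rw [ZMod.unitsMap_val] at this
      rw [← ZMod.cast_eq_val, this]; simp)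
    rw [ZMod.natCast_zmod_val] at h1
    apply Units.ext
    rw [MulChar.coe_toUnitHom, h1]; rfl
  exact ⟨hf.χ₀, hf.eq_changeLevel⟩

end QT

namespace QT
open Finset Filter Topology MeasureTheory FourierTransform NumberTheorySymbols

/-- Structure of real characters. -/
lemma real_struct : ∀ M : ℕ, 0 < M → ∀ χ : DirichletCharacter ℂ M, MulChar.IsQuadratic χ →
    ∃ N : ℕ, Odd N ∧ Squarefree N ∧ N ∣ M ∧ ∃ χ2 : DirichletCharacter ℂ 8, MulChar.IsQuadratic χ2 ∧
      ∀ n : ℕ, n.Coprime (2 * M) → χ (n : ZMod M) = χ2 (n : ZMod 8) * (J((n : ℤ) | N) : ℂ) := by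
  intro M
  induction M using Nat.strong_induction_on with
  | _ M ih =>
  intro hM0 χ hχ
  have : NeZero M := ⟨hM0.ne'⟩
  by_cases hodd : ∃ p : ℕ, p.Prime ∧ p ≠ 2 ∧ p ∣ M
  · obtain ⟨p, hp, hp2, hpM⟩ := hodd
    have : NeZero p := ⟨hp.ne_zero⟩
    obtain ⟨k', m, hpm, hM⟩ := Nat.exists_eq_pow_mul_and_not_dvd hM0.ne' p hp.ne_one
    obtain ⟨k, rfl⟩ : ∃ k, k' = k + 1 := by
      rcases k' with _ | k
      · rw [pow_zero, one_mul] at hM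
        exact absurd (hM ▸ hpM) hpm
      · exact ⟨k, rfl⟩
    have hcop : p.Coprime m := (Nat.Prime.coprime_iff_not_dvd hp).mpr hpm
    have hm0 : 0 < m := by
      rcases Nat.eq_zero_or_pos m with rfl | h
      · simp at hpm
      · exact h
    have hmM : m ∣ M := ⟨p ^ (k + 1), by rw [hM]; ring⟩
    have hlt : m < M := by
      rw [hM]
      have : 1 < p ^ (k + 1) := Nat.one_lt_pow (Nat.succ_ne_zero k) hp.one_lt
      nlinarith
    have hfac : ∃ (N' : ℕ) (ψ : DirichletCharacter ℂ m), (N' = 1 ∨ N' = p) ∧ MulChar.IsQuadratic ψ ∧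
        ∀ n : ℕ, n.Coprime M → χ (n : ZMod M) = ψ (n : ZMod m) * (J((n : ℤ) | N') : ℂ) := by
      by_cases hall : ∀ n : ℕ, n.Coprime M → n ≡ 1 [MOD m] → χ (n : ZMod M) = 1
      · obtain ⟨ψ, rfl⟩ := factors_of hmM χ hall
        refine ⟨1, ψ, Or.inl rfl, (quad_level hmM ψ).mp hχ, fun n hn => ?_⟩
        rw [cl_nat hmM ψ hn]; simp
      · push Not at hall
        obtain ⟨n0, hn0, hn1, hne⟩ := hall
        set ρ := DirichletCharacter.changeLevel hpM (jc p) with hρ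
        have hρq : MulChar.IsQuadratic ρ := (quad_level hpM _).mpr (jc_quad p)
        have hρv : ∀ n : ℕ, n.Coprime M → ρ (n : ZMod M) = (J((n : ℤ) | p) : ℂ) := fun n hn => by
          rw [hρ, cl_nat hpM _ hn, jc_nat]
        have hJv : ∀ n : ℕ, n.Coprime M → J((n : ℤ) | p) = 1 ∨ J((n : ℤ) | p) = -1 := fun n hn => by
          apply jacobiSym.eq_one_or_neg_one
          rw [Int.gcd_natCast_natCast]
          exact Nat.Coprime.coprime_dvd_right hpM hn
        have hχv : ∀ n : ℕ, n.Coprime M → χ (n : ZMod M) = 1 ∨ χ (n : ZMod M) = -1 := fun n hn =>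
          sq_eq_one_iff.mp (quad_sq hχ hn)
        have hn0J : J((n0 : ℤ) | p) = -1 := (hJv n0 hn0).resolve_left fun h =>
          hne (kill_p hp hp2 hcop hM hχ hn0 hn1 h)
        have hn0χ : χ (n0 : ZMod M) = -1 := (hχv n0 hn0).resolve_left hne
        obtain ⟨ψ, hψ⟩ := factors_of hmM (χ * ρ) (by
          intro n hn hnm
          rw [MulChar.mul_apply, hρv n hn]
          rcases hJv n hn with h | h
          · rw [h, kill_p hp hp2 hcop hM hχ hn hnm h]; simp
          · have h2 := kill_p hp hp2 hcop hM hχ (Nat.Coprime.mul_left hn hn0)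
              (by simpa using hnm.mul hn1) (by
                push_cast
                rw [jacobiSym.mul_left, h, hn0J]; norm_num)
            push_cast at h2
            rw [map_mul, hn0χ] at h2
            rw [h]; push_cast; exact h2)
        refine ⟨p, ψ, Or.inr rfl, (quad_level hmM ψ).mp (hψ ▸ quad_mul hχ hρq), fun n hn => ?_⟩
        rw [← cl_nat hmM ψ hn, ← hψ, MulChar.mul_apply, hρv n hn]
        have h3 : (J((n : ℤ) | p) : ℂ) * (J((n : ℤ) | p) : ℂ) = 1 := by
          rcases hJv n hn with h | h <;> rw [h] <;> norm_num
        rw [mul_assoc, h3, mul_one]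
    obtain ⟨N', ψ, hN', hψ, hv⟩ := hfac
    obtain ⟨N, hNo, hNs, hNm, χ2, hχ2, hv2⟩ := ih m hlt hm0 ψ hψ
    have hval : ∀ n : ℕ, n.Coprime (2 * M) → χ (n : ZMod M) = χ2 (n : ZMod 8) * (J((n : ℤ) | N * N') : ℂ) := by
      intro n hn
      have hN0 : NeZero N := ⟨hNo.pos.ne'⟩
      have hN0' : NeZero N' := ⟨by rcases hN' with rfl | rfl <;> [norm_num; exact hp.ne_zero]⟩
      rw [hv n (Nat.Coprime.coprime_dvd_right (dvd_mul_left M 2) hn),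
        hv2 n (Nat.Coprime.coprime_dvd_right (mul_dvd_mul_left 2 hmM) hn), jacobiSym.mul_right]
      push_cast; ring
    refine ⟨N * N', ?_, ?_, ?_, χ2, hχ2, hval⟩
    · rcases hN' with rfl | rfl
      · simpa using hNo
      · exact hNo.mul (hp.odd_of_ne_two hp2)
    · rcases hN' with rfl | rfl
      · simpa using hNs
      · rw [Nat.squarefree_mul (Nat.Coprime.coprime_dvd_left hNm hcop.symm)]
        exact ⟨hNs, hp.prime.squarefree⟩
    · rw [hM, mul_comm]
      refine mul_dvd_mul ?_ hNm
      rcases hN' with rfl | rfl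
      · exact one_dvd _
      · exact dvd_pow_self _ (Nat.succ_ne_zero k)
  · push Not at hodd
    obtain ⟨k, hk⟩ : ∃ k, M = 2 ^ k := by
      refine ⟨_, Nat.eq_prime_pow_of_unique_prime_dvd hM0.ne' (fun {d} hd hdM => ?_)⟩
      by_contra h
      exact hodd d hd h hdM
    have hM8 : M ∣ 2 ^ (k + 3) := by rw [hk]; exact pow_dvd_pow 2 (by omega)
    have h8 : (8 : ℕ) ∣ 2 ^ (k + 3) := ⟨2 ^ k, by ring⟩
    have : NeZero (2 ^ (k + 3)) := ⟨by positivity⟩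
    set χu := DirichletCharacter.changeLevel hM8 χ with hχu
    have hχuq : MulChar.IsQuadratic χu := (quad_level hM8 χ).mpr hχ
    obtain ⟨χ2, h2⟩ := factors_of h8 χu (by
      intro n hn hn8
      obtain ⟨x, hx, hxn⟩ := two_sq (n := n) (by simpa [Nat.ModEq] using hn8) k
      have := congrArg χu ((ZMod.natCast_eq_natCast_iff _ _ _).mpr hxn)
      push_cast at this
      rw [map_pow] at this
      rw [← this]
      exact quad_sq hχuq (Nat.Coprime.pow_right _ (Nat.coprime_two_right.mpr hx)))
    refine ⟨1, odd_one, squarefree_one, one_dvd _, χ2, (quad_level h8 χ2).mp (h2 ▸ hχuq), fun n hn => ?_⟩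
    have hn2 : n.Coprime (2 ^ (k + 3)) :=
      Nat.Coprime.pow_right _ (Nat.Coprime.coprime_dvd_right (dvd_mul_right 2 M) hn)
    rw [← cl_nat h8 χ2 hn2, ← h2, hχu, cl_nat hM8 χ hn2]; simp

lemma twist_lemma {N0 N e m : ℕ} (hN0 : 0 < N0) (he : 0 < e) (hm : 0 < m)
    {χ : DirichletCharacter ℂ N0} {χ2 : DirichletCharacter ℂ 8} (hχ2 : MulChar.IsQuadratic χ2)
    (hv : ∀ n : ℕ, n.Coprime (2 * N0) → χ (n : ZMod N0) = χ2 (n : ZMod 8) * (J((n : ℤ) | N) : ℂ))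
    (hJ : ∀ n : ℕ, n.Coprime N0 → J((n : ℤ) | N) * J((n : ℤ) | e) = J((n : ℤ) | m))
    (hL : LJ m (1/2) ≠ 0) :
    ∃ (q : ℕ) (χ' : DirichletCharacter ℂ q), 0 < q ∧ χ'.IsPrimitive ∧ MulChar.IsQuadratic χ' ∧ q ≤ 8 * e ∧
      twistedCentralValue χ χ' ≠ 0 := by
  have : NeZero e := ⟨he.ne'⟩
  have : NeZero m := ⟨hm.ne'⟩
  have : NeZero N0 := ⟨hN0.ne'⟩
  set η : DirichletCharacter ℂ (8 * e) := DirichletCharacter.changeLevel (dvd_mul_right 8 e) χ2 *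
    DirichletCharacter.changeLevel (dvd_mul_left e 8) (jc e) with hη
  have hηq : MulChar.IsQuadratic η := quad_mul ((quad_level _ _).mpr hχ2) ((quad_level _ _).mpr (jc_quad e))
  set q := η.conductor with hq
  have hq0 : q ≠ 0 := DirichletCharacter.conductor_ne_zero η
  have : NeZero q := ⟨hq0⟩
  have hqd : q ∣ 8 * e := DirichletCharacter.conductor_dvd_level η
  have hcl : DirichletCharacter.changeLevel hqd η.primitiveCharacter = η := η.changeLevel_primitiveCharacter
  refine ⟨q, η.primitiveCharacter, Nat.pos_of_ne_zero hq0, η.primitiveCharacter_isPrimitive, ?_,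
    Nat.le_of_dvd (by positivity) hqd, ?_⟩
  · rw [← quad_level hqd, hcl]; exact hηq
  · have hne : N0 * q ≠ 0 := mul_ne_zero hN0.ne' hq0
    have : NeZero (N0 * q) := ⟨hne⟩
    unfold twistedCentralValue
    rw [dif_pos hne]
    rw [LJ_eq] at hL
    have hcne : (N0 * q) * (8 * e) * m ≠ 0 := by positivity
    have : NeZero ((N0 * q) * (8 * e) * m) := ⟨hcne⟩
    intro h0
    apply hL
    refine (LF_equiv (c := (N0 * q) * (8 * e) * m) (by rw [mul_assoc]; exact dvd_mul_right _ _) (dvd_mul_left _ _) _ _ ?_).mp h0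
    intro n hn
    have hnq : n.Coprime (N0 * q) := Nat.Coprime.coprime_dvd_right (by rw [mul_assoc]; exact dvd_mul_right _ _) hn
    have hne8 : n.Coprime (8 * e) := Nat.Coprime.coprime_dvd_right (by rw [mul_right_comm]; exact dvd_mul_left _ _) hn
    have hn8 : n.Coprime 8 := Nat.Coprime.coprime_dvd_right (dvd_mul_right 8 e) hne8
    have hnN : n.Coprime N0 := Nat.Coprime.coprime_dvd_right (dvd_mul_right N0 q) hnq
    have hn2N : n.Coprime (2 * N0) := Nat.Coprime.mul_right (Nat.Coprime.coprime_dvd_right (by norm_num) hn8) hnN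
    rw [MulChar.mul_apply, cl_nat _ _ hnq, cl_nat _ _ hnq, hv n hn2N, ← cl_nat hqd _ hne8, hcl, hη, MulChar.mul_apply,
      cl_nat _ _ hne8, cl_nat _ _ hne8, jc_nat, jc_nat, ← hJ n hnN]
    have := quad_sq hχ2 hn8
    push_cast
    linear_combination (J((n : ℤ) | N) : ℂ) * (J((n : ℤ) | e) : ℂ) * this

theorem final_main : ∀ ε : ℝ, 0 < ε → ∃ C : ℝ, 0 < C ∧
      ∀ (N : ℕ), 1 ≤ N → ∀ χ : DirichletCharacter ℂ N, χ.IsPrimitive →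
        MulChar.IsQuadratic χ →
        ∃ (q : ℕ) (χ' : DirichletCharacter ℂ q), 0 < q ∧ χ'.IsPrimitive ∧
          MulChar.IsQuadratic χ' ∧ (q : ℝ) ≤ C * (N : ℝ) ^ ((1 : ℝ) / 2 + ε) ∧
          twistedCentralValue χ χ' ≠ 0 := by
  intro ε hε
  obtain ⟨Ns, hNs⟩ := CT_main (ε := min ε (1/4)) (lt_min hε (by norm_num)) (min_le_right _ _)
  obtain ⟨N1, hN1, hN1p⟩ := Nat.exists_infinite_primes (max Ns 3)
  obtain ⟨d1, hd1, -, -, hL1⟩ := hNs N1 (le_trans (le_max_left _ _) hN1)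
    (hN1p.odd_of_ne_two (by have := le_trans (le_max_right _ _) hN1; omega)) hN1p.prime.squarefree
  refine ⟨8 * (Ns * (N1 * d1) + 1), by positivity, ?_⟩
  intro N0 hN0 χ _ hχ
  obtain ⟨N, hNo, hNsq, hNd, χ2, hχ2, hv⟩ := real_struct N0 hN0 χ hχ
  have hNN : (N : ℝ) ≤ N0 := by exact_mod_cast Nat.le_of_dvd hN0 hNd
  have hN01 : (1 : ℝ) ≤ N0 := by exact_mod_cast hN0
  have hN1' : (1 : ℝ) ≤ N := by exact_mod_cast hNo.pos
  have hNz : NeZero N := ⟨hNo.pos.ne'⟩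
  by_cases hle : Ns ≤ N
  · obtain ⟨d, hd0, hd, -, hL⟩ := hNs N hle hNo hNsq
    have hdz : NeZero d := ⟨hd0.ne'⟩
    obtain ⟨q, χ', h1, h2, h3, h4, h5⟩ := twist_lemma hN0 hd0 (Nat.mul_pos hNo.pos hd0) hχ2 hv
      (fun n _ => (jacobiSym.mul_right _ _ _).symm) hL
    refine ⟨q, χ', h1, h2, h3, ?_, h5⟩
    have h6 : (q : ℝ) ≤ 8 * d := by exact_mod_cast h4
    have h7 : (N : ℝ) ^ (1/2 + min ε (1/4)) ≤ (N0 : ℝ) ^ (1/2 + ε) := by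
      calc _ ≤ (N : ℝ) ^ (1/2 + ε) := Real.rpow_le_rpow_of_exponent_le hN1' (by linarith [min_le_left ε (1/4)])
        _ ≤ _ := Real.rpow_le_rpow (by linarith) hNN (by linarith)
    have h8 : (0 : ℝ) ≤ (N0 : ℝ) ^ (1/2 + ε) := by positivity
    have h9 : (0 : ℝ) ≤ (Ns : ℝ) * (N1 * d1) := by positivity
    nlinarith
  · have hN1z : NeZero N1 := ⟨hN1p.ne_zero⟩
    have hd1z : NeZero d1 := ⟨hd1.ne'⟩
    have hmz : NeZero (N1 * d1) := ⟨(Nat.mul_pos hN1p.pos hd1).ne'⟩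
    obtain ⟨q, χ', h1, h2, h3, h4, h5⟩ := twist_lemma (e := N * (N1 * d1)) hN0
      (Nat.mul_pos hNo.pos (Nat.mul_pos hN1p.pos hd1)) (Nat.mul_pos hN1p.pos hd1) hχ2 hv
      (fun n hn => by
        rw [jacobiSym.mul_right _ N (N1 * d1), ← mul_assoc, ← sq, jacobiSym.sq_one, one_mul]
        rw [Int.gcd_natCast_natCast]
        exact Nat.Coprime.coprime_dvd_right hNd hn) hL1
    refine ⟨q, χ', h1, h2, h3, ?_, h5⟩
    have h6 : q ≤ 8 * (Ns * (N1 * d1)) := h4.trans (by gcongr; omega)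
    have h6' : (q : ℝ) ≤ 8 * (Ns * (N1 * d1)) := by exact_mod_cast h6
    have h7 : (1 : ℝ) ≤ (N0 : ℝ) ^ (1/2 + ε) := Real.one_le_rpow hN01 (by linarith)
    have h9 : (0 : ℝ) ≤ (Ns : ℝ) * (N1 * d1) := by positivity
    nlinarith

end QT

open DirichletCharacter

/-- Self-dual instance of the GL(1) case of Theorem 1: for every `ε > 0` there is `C > 0`
such that for every real (quadratic) primitive Dirichlet character `χ` of conductor `N ≥ 1`,
there is a real primitive Dirichlet character `χ'` of some conductor `q ≤ C · N^{1/2+ε}`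
with `L(1/2, χ·χ') ≠ 0`. -/
theorem first_nonvanishing_quadratic_twist_GL1_selfdual :
    ∀ ε : ℝ, 0 < ε → ∃ C : ℝ, 0 < C ∧
      ∀ (N : ℕ), 1 ≤ N → ∀ χ : DirichletCharacter ℂ N, χ.IsPrimitive →
        MulChar.IsQuadratic χ →
        ∃ (q : ℕ) (χ' : DirichletCharacter ℂ q), 0 < q ∧ χ'.IsPrimitive ∧
          MulChar.IsQuadratic χ' ∧ (q : ℝ) ≤ C * (N : ℝ) ^ ((1 : ℝ) / 2 + ε) ∧
          twistedCentralValue χ χ' ≠ 0 := by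
  exact QT.final_main
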